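/- Let f, g be holomorphic functions defined on neighborhoods of 0 ∈ ℂⁿ, not identically zero, vanishing at 0, and reduced at 0, with orders of vanishing m and m' at 0 respectively. Let P, Q ∈ ℂ[z₁,…,zₙ] be homogeneous polynomials of degrees m and m' whose evaluations coincide with the lowest-degree homogeneous terms f_m and g_{m'} of the Taylor expansions of f and g at 0 (so the tangent cones of V(f) and V(g) at 0 are V(P) and V(Q)). Assume that every irreducible factor p of P satisfies Sing V(p) ⊆ {0}. If there exists a bi-Lipschitz homeomorphism φ : (ℂⁿ, V(f), 0) → (ℂⁿ, V(g), 0), then every irreducible factor q of Q satisfies Sing V(q) ⊆ {0}, and m = m'. -/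

import Mathlib

open scoped Topology

noncomputable section

/-- `ℂⁿ` with the Euclidean metric. -/
abbrev En (n : ℕ) := EuclideanSpace ℂ (Fin n)

/-- The zero set `V(p) ⊆ ℂⁿ` of a polynomial `p ∈ ℂ[z₁,…,zₙ]`. -/
def pV {n : ℕ} (p : MvPolynomial (Fin n) ℂ) : Set (En n) :=
  {x | MvPolynomial.eval (x : Fin n → ℂ) p = 0}

/-- The singular set `Sing V(p) = {x ∈ V(p) : ∂p/∂z₁(x) = ⋯ = ∂p/∂zₙ(x) = 0}`. -/
def SingV {n : ℕ} (p : MvPolynomial (Fin n) ℂ) : Set (En n) :=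
  {x | MvPolynomial.eval (x : Fin n → ℂ) p = 0 ∧
       ∀ i, MvPolynomial.eval (x : Fin n → ℂ) (MvPolynomial.pderiv i p) = 0}

/-- A bi-Lipschitz homeomorphism of germs `φ : (ℂⁿ, X, 0) → (ℂⁿ, Y, 0)`. -/
def BiLipGermHomeo {n : ℕ} (X Y : Set (En n)) : Prop :=
  ∃ (U U' : Set (En n)) (φ ψ : En n → En n) (K : NNReal),
    IsOpen U ∧ IsOpen U' ∧ (0 : En n) ∈ U ∧ (0 : En n) ∈ U' ∧
    φ 0 = 0 ∧
    Set.MapsTo φ U U' ∧ Set.MapsTo ψ U' U ∧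
    Set.LeftInvOn ψ φ U ∧ Set.RightInvOn ψ φ U' ∧
    LipschitzOnWith K φ U ∧ LipschitzOnWith K ψ U' ∧
    φ '' (X ∩ U) = Y ∩ U'

/-- The order of vanishing of `f` at `0`. -/
def vanishingOrder {n : ℕ} (f : En n → ℂ) : ℕ :=
  sInf {k | iteratedFDeriv ℂ k f 0 ≠ 0}

open Metric Set Filter
/-! ### Logarithms of nonvanishing continuous functions and winding indices -/

/-- Lifting a homotopy of nonvanishing functions through the exponential. -/
lemma exists_log_homotopy {A : Type*} [TopologicalSpace A] (H : C(unitInterval × A, ℂ))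
    (hH : ∀ z, H z ≠ 0) (u₀ : C(A, ℂ)) (h₀ : ∀ a, H (0, a) = Complex.exp (u₀ a)) :
    ∃ U : C(unitInterval × A, ℂ), (∀ z, H z = Complex.exp (U z)) ∧ ∀ a, U (0, a) = u₀ a := by
  let H' : C(unitInterval × A, {z : ℂ // z ≠ 0}) := ⟨fun z => ⟨H z, hH z⟩, by fun_prop⟩
  refine ⟨Complex.isCoveringMap_exp.liftHomotopy H' u₀ (fun a => Subtype.ext (h₀ a)), ?_, ?_⟩
  · intro z
    have := congrFun (Complex.isCoveringMap_exp.liftHomotopy_lifts H' u₀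
      (fun a => Subtype.ext (h₀ a))) z
    exact (congrArg Subtype.val this).symm
  · intro a
    exact Complex.isCoveringMap_exp.liftHomotopy_zero H' u₀ (fun a => Subtype.ext (h₀ a)) a

/-- A continuous function on a subtype, as a function continuous on the set. -/
lemma exists_continuousOn_extension {X Y : Type*} [TopologicalSpace X] [TopologicalSpace Y]
    [Nonempty Y] {s : Set X} {U : s → Y} (hU : Continuous U) :
    ∃ v : X → Y, ContinuousOn v s ∧ ∀ z (hz : z ∈ s), v z = U ⟨z, hz⟩ := by
  classical
  refine ⟨fun x => if hx : x ∈ s then U ⟨x, hx⟩ else Classical.arbitrary Y, ?_, fun z hz => by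
    simp only [hz, dif_pos]⟩
  rw [continuousOn_iff_continuous_domRestrict]
  convert hU using 1
  ext x
  simp [Set.domRestrict]

lemma exists_log_of_convex {E : Type*} [NormedAddCommGroup E] [NormedSpace ℝ E] {s : Set E}
    (hs : Convex ℝ s) {F : E → ℂ} (hF : ContinuousOn F s) (h0 : ∀ x ∈ s, F x ≠ 0) :
    ∃ u : E → ℂ, ContinuousOn u s ∧ ∀ x ∈ s, F x = Complex.exp (u x) := by
  classical
  rcases s.eq_empty_or_nonempty with rfl | ⟨x₀, hx₀⟩
  · exact ⟨0, by simp, by simp⟩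
  have hmem : ∀ z : unitInterval × s, x₀ + (z.1 : ℝ) • ((z.2 : E) - x₀) ∈ s := fun z =>
    hs.add_smul_sub_mem hx₀ z.2.2 z.1.2
  let H : C(unitInterval × s, ℂ) := ⟨fun z => F (x₀ + (z.1 : ℝ) • ((z.2 : E) - x₀)),
    hF.comp_continuous (by fun_prop) hmem⟩
  obtain ⟨U, hU, -⟩ := exists_log_homotopy H (fun z => h0 _ (hmem z))
    (ContinuousMap.const _ (Complex.log (F x₀)))
    (fun a => by simp [H, Complex.exp_log (h0 _ hx₀)])
  obtain ⟨v, hv, hvU⟩ := exists_continuousOn_extension (s := s) (U := fun x => U (1, x))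
    (by fun_prop)
  refine ⟨v, hv, fun x hx => ?_⟩
  have := hU (1, ⟨x, hx⟩)
  rw [hvU x hx, ← this]
  simp [H]

/-- On a preconnected set two continuous logarithms differ by a constant multiple of `2πi`. -/
lemma log_sub_log_const {X : Type*} [TopologicalSpace X] {s : Set X} (hs : IsPreconnected s)
    {u v : X → ℂ} (hu : ContinuousOn u s) (hv : ContinuousOn v s)
    (h : ∀ x ∈ s, Complex.exp (u x) = Complex.exp (v x)) :
    ∃ k : ℤ, ∀ x ∈ s, u x = v x + k * (2 * Real.pi * Complex.I) := by
  rcases s.eq_empty_or_nonempty with rfl | ⟨x₀, hx₀⟩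
  · exact ⟨0, by simp⟩
  have hd : IsDiscrete (Set.range ((↑) : ℤ → ℂ)) := by
    have : Topology.IsClosedEmbedding ((↑) : ℤ → ℂ) := Complex.isClosedEmbedding_intCast
    exact this.isEmbedding.isDiscrete_range
  have hpi : (2 * Real.pi * Complex.I : ℂ) ≠ 0 := Complex.two_pi_I_ne_zero
  have hmt : MapsTo (fun x => (u x - v x) / (2 * Real.pi * Complex.I)) s
      (Set.range ((↑) : ℤ → ℂ)) := by
    intro x hx
    obtain ⟨n, hn⟩ := Complex.exp_eq_exp_iff_exists_int.1 (h x hx)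
    exact ⟨n, by simp only [hn]; field_simp; ring⟩
  obtain ⟨k, hk⟩ := hmt hx₀
  refine ⟨k, fun x hx => ?_⟩
  have := hs.constant_of_mapsTo hd ((hu.sub hv).div_const _) hmt hx hx₀
  have h2 : (u x - v x) / (2 * Real.pi * Complex.I) = k := by
    rw [hk]; exact this
  rw [div_eq_iff hpi] at h2
  rw [← h2]; ring

/-- `F` restricted to the circle `sphere c r` has winding number `a` around `0`. -/
def HasIdx (F : ℂ → ℂ) (c : ℂ) (r : ℝ) (a : ℤ) : Prop :=
  ∃ u : ℂ → ℂ, ContinuousOn u (sphere c r) ∧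
    ∀ z ∈ sphere c r, F z = (z - c) ^ a * Complex.exp (u z)

lemma sub_ne_zero_of_mem_sphere {c z : ℂ} {r : ℝ} (hr : 0 < r) (hz : z ∈ sphere c r) :
    z - c ≠ 0 := by
  intro h
  rw [mem_sphere_iff_norm, h, norm_zero] at hz
  exact hr.ne hz

lemma zpow_eq_exp_circle {r : ℝ} (hr : 0 < r) (θ : ℝ) (a : ℤ) :
    ((r : ℂ) * Complex.exp (θ * Complex.I)) ^ a =
      Complex.exp (a * (Real.log r + θ * Complex.I)) := by
  rw [Complex.exp_int_mul, Complex.exp_add, ← Complex.ofReal_exp, Real.exp_log hr]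

lemma HasIdx.unique {F : ℂ → ℂ} {c : ℂ} {r : ℝ} {a b : ℤ} (hr : 0 < r) (ha : HasIdx F c r a)
    (hb : HasIdx F c r b) : a = b := by
  obtain ⟨u, hu, hF⟩ := ha
  obtain ⟨v, hv, hF'⟩ := hb
  let γ : ℝ → ℂ := fun θ => c + r * Complex.exp (θ * Complex.I)
  have hγ : ∀ θ, γ θ ∈ sphere c r := by
    intro θ
    simp [γ, Complex.norm_exp_ofReal_mul_I, abs_of_pos hr]
  have hγc : Continuous γ := by fun_prop
  have key := log_sub_log_const (s := (Set.univ : Set ℝ)) isPreconnected_univ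
    (u := fun θ => a * (Real.log r + θ * Complex.I) + u (γ θ))
    (v := fun θ => b * (Real.log r + θ * Complex.I) + v (γ θ))
    (by
      have := hu.comp_continuous hγc hγ
      exact ((by fun_prop : Continuous fun θ : ℝ =>
        (a : ℂ) * (Real.log r + θ * Complex.I)).add this).continuousOn)
    (by
      have := hv.comp_continuous hγc hγ
      exact ((by fun_prop : Continuous fun θ : ℝ =>
        (b : ℂ) * (Real.log r + θ * Complex.I)).add this).continuousOn)
    (by
      intro θ _
      have h1 := hF _ (hγ θ)
      have h2 := hF' _ (hγ θ)
      have e : γ θ - c = r * Complex.exp (θ * Complex.I) := by simp [γ]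
      rw [e, zpow_eq_exp_circle hr] at h1 h2
      rw [Complex.exp_add, Complex.exp_add, ← h1, ← h2])
  obtain ⟨k, hk⟩ := key
  have h0 := hk 0 trivial
  have h1 := hk (2 * Real.pi) trivial
  have e : γ (2 * Real.pi) = γ 0 := by simp [γ, Complex.exp_two_pi_mul_I]
  simp only [e] at h1
  have h3 : ((a : ℂ) - b) * (2 * Real.pi * Complex.I) = 0 := by
    push_cast at h0 h1
    linear_combination h1 - h0
  have h4 := (mul_eq_zero.1 h3).resolve_right Complex.two_pi_I_ne_zero
  exact_mod_cast sub_eq_zero.1 h4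

lemma HasIdx.congr {F G : ℂ → ℂ} {c : ℂ} {r : ℝ} {a : ℤ} (h : HasIdx F c r a)
    (hFG : ∀ z ∈ sphere c r, G z = F z) : HasIdx G c r a := by
  obtain ⟨u, hu, hF⟩ := h
  exact ⟨u, hu, fun z hz => (hFG z hz).trans (hF z hz)⟩

lemma HasIdx.mul {F G : ℂ → ℂ} {c : ℂ} {r : ℝ} {a b : ℤ} (hr : 0 < r) (hF : HasIdx F c r a)
    (hG : HasIdx G c r b) : HasIdx (fun z => F z * G z) c r (a + b) := by
  obtain ⟨u, hu, hF⟩ := hF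
  obtain ⟨v, hv, hG⟩ := hG
  refine ⟨fun z => u z + v z, hu.add hv, fun z hz => ?_⟩
  simp only
  rw [hF z hz, hG z hz, zpow_add₀ (sub_ne_zero_of_mem_sphere hr hz), Complex.exp_add]
  ring

lemma HasIdx.zpow {F : ℂ → ℂ} {c : ℂ} {r : ℝ} {a : ℤ} (hF : HasIdx F c r a) (k : ℤ) :
    HasIdx (fun z => F z ^ k) c r (k * a) := by
  obtain ⟨u, hu, hF⟩ := hF
  refine ⟨fun z => k * u z, continuousOn_const.mul hu, fun z hz => ?_⟩
  simp only
  rw [hF z hz, mul_zpow, ← zpow_mul, Complex.exp_int_mul, mul_comm a k]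

lemma hasIdx_exp {u : ℂ → ℂ} {c : ℂ} {r : ℝ} (hu : ContinuousOn u (sphere c r)) :
    HasIdx (fun z => Complex.exp (u z)) c r 0 :=
  ⟨u, hu, by simp⟩

/-- Winding numbers do not change under perturbations smaller than the function. -/
lemma HasIdx.of_norm_sub_lt {F G : ℂ → ℂ} {c : ℂ} {r : ℝ} {a : ℤ} (hr : 0 < r)
    (h : HasIdx F c r a)
    (hG : ContinuousOn G (sphere c r)) (hFG : ∀ z ∈ sphere c r, ‖G z - F z‖ < ‖F z‖) :
    HasIdx G c r a := by
  obtain ⟨u, hu, hF⟩ := h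
  have hF0 : ∀ z ∈ sphere c r, F z ≠ 0 := fun z hz h0 => by
    have := hFG z hz
    rw [h0, norm_zero] at this
    exact absurd this (not_lt.2 (norm_nonneg _))
  have hFc : ContinuousOn F (sphere c r) := by
    have : ContinuousOn (fun z => (z - c) ^ a * Complex.exp (u z)) (sphere c r) := by
      refine ContinuousOn.mul (ContinuousOn.zpow₀ (by fun_prop) _ fun z hz =>
        Or.inl (sub_ne_zero_of_mem_sphere hr hz)) hu.cexp
    exact this.congr hF
  have hs : ∀ z ∈ sphere c r, G z / F z ∈ Complex.slitPlane := by
    intro z hz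
    have : G z / F z = 1 + (G z - F z) / F z := by
      field_simp [hF0 z hz]; ring
    rw [this]
    apply Complex.mem_slitPlane_of_norm_lt_one
    rw [norm_div, div_lt_one (norm_pos_iff.2 (hF0 z hz))]
    exact hFG z hz
  refine ⟨fun z => u z + Complex.log (G z / F z),
    hu.add ((hG.div hFc hF0).clog hs), fun z hz => ?_⟩
  have hG0 : G z / F z ≠ 0 := Complex.slitPlane_ne_zero (hs z hz)
  rw [Complex.exp_add, Complex.exp_log hG0, ← mul_assoc, ← hF z hz]
  field_simp [hF0 z hz]

lemma hasIdx_sub {c z : ℂ} {r : ℝ} (hz : z ∈ ball c r) :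
    HasIdx (fun l => l - z) c r 1 := by
  have hr : 0 < r := pos_of_mem_ball hz
  have h1 : HasIdx (fun l => l - c) c r 1 := ⟨0, continuousOn_const, by simp⟩
  refine h1.of_norm_sub_lt hr (by fun_prop) fun l hl => ?_
  rw [mem_sphere_iff_norm] at hl
  rw [mem_ball_iff_norm] at hz
  rw [hl]
  calc ‖l - z - (l - c)‖ = ‖z - c‖ := by rw [← norm_neg]; congr 1; ring
    _ < r := hz

/-- `F` is defined in a punctured neighbourhood of `z` and winds `a` times around it. -/
def LocIdx (F : ℂ → ℂ) (z : ℂ) (a : ℤ) : Prop :=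
  ∃ ε > 0, ∃ u : ℂ → ℂ, ContinuousOn u (ball z ε \ {z}) ∧
    ∀ l ∈ ball z ε \ {z}, F l = (l - z) ^ a * Complex.exp (u l)

lemma LocIdx.mul {F G : ℂ → ℂ} {z : ℂ} {a b : ℤ} (hF : LocIdx F z a) (hG : LocIdx G z b) :
    LocIdx (fun l => F l * G l) z (a + b) := by
  obtain ⟨ε, hε, u, hu, hF⟩ := hF
  obtain ⟨δ, hδ, v, hv, hG⟩ := hG
  have s1 : ball z (min ε δ) \ {z} ⊆ ball z ε \ {z} :=
    sdiff_subset_sdiff_left (ball_subset_ball (min_le_left _ _))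
  have s2 : ball z (min ε δ) \ {z} ⊆ ball z δ \ {z} :=
    sdiff_subset_sdiff_left (ball_subset_ball (min_le_right _ _))
  refine ⟨min ε δ, lt_min hε hδ, fun l => u l + v l, (hu.mono s1).add (hv.mono s2),
    fun l hl => ?_⟩
  simp only
  rw [hF l (s1 hl), hG l (s2 hl), zpow_add₀ (sub_ne_zero.2 hl.2), Complex.exp_add]
  ring

lemma LocIdx.zpow {F : ℂ → ℂ} {z : ℂ} {a : ℤ} (hF : LocIdx F z a) (k : ℤ) :
    LocIdx (fun l => F l ^ k) z (k * a) := by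
  obtain ⟨ε, hε, u, hu, hF⟩ := hF
  refine ⟨ε, hε, fun l => k * u l, continuousOn_const.mul hu, fun l hl => ?_⟩
  simp only
  rw [hF l hl, mul_zpow, ← zpow_mul, Complex.exp_int_mul, mul_comm a k]

lemma LocIdx.congr {F G : ℂ → ℂ} {z : ℂ} {a : ℤ} (hF : LocIdx F z a)
    (h : ∀ᶠ l in 𝓝[≠] z, G l = F l) : LocIdx G z a := by
  obtain ⟨ε, hε, u, hu, hF⟩ := hF
  rw [eventually_nhdsWithin_iff, Metric.eventually_nhds_iff_ball] at h
  obtain ⟨δ, hδ, h⟩ := h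
  have s1 : ball z (min ε δ) \ {z} ⊆ ball z ε \ {z} :=
    sdiff_subset_sdiff_left (ball_subset_ball (min_le_left _ _))
  refine ⟨min ε δ, lt_min hε hδ, u, hu.mono s1, fun l hl => ?_⟩
  rw [h l (ball_subset_ball (min_le_right _ _) hl.1) hl.2, hF l (s1 hl)]

lemma locIdx_zero_of_exp {F : ℂ → ℂ} {z : ℂ} {ε : ℝ} (hε : 0 < ε) {u : ℂ → ℂ}
    (hu : ContinuousOn u (ball z ε \ {z})) (h : ∀ l ∈ ball z ε \ {z}, F l = Complex.exp (u l)) :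
    LocIdx F z 0 := ⟨ε, hε, u, hu, by simpa using h⟩

lemma locIdx_zero_of_continuousOn {F : ℂ → ℂ} {z : ℂ} {s : Set ℂ} (hs : s ∈ 𝓝 z)
    (hF : ContinuousOn F s) (h0 : F z ≠ 0) : LocIdx F z 0 := by
  have hc : ContinuousAt F z := hF.continuousAt hs
  obtain ⟨ε, hε, hb⟩ := Metric.mem_nhds_iff.1 (Filter.inter_mem hs (hc.eventually_ne h0))
  obtain ⟨u, hu, h⟩ := exists_log_of_convex (convex_ball z ε) (hF.mono fun l hl => (hb hl).1)
    (fun l hl => (hb hl).2)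
  exact locIdx_zero_of_exp hε (hu.mono sdiff_subset) fun l hl => h l hl.1

lemma locIdx_of_analyticAt {F : ℂ → ℂ} {z : ℂ} (hF : AnalyticAt ℂ F z)
    (h : ¬ ∀ᶠ l in 𝓝 z, F l = 0) : ∃ m : ℕ, LocIdx F z m ∧ (F z = 0 → 1 ≤ m) := by
  obtain ⟨m, g, hg, hg0, hFg⟩ := hF.exists_eventuallyEq_pow_smul_nonzero_iff.2 h
  have h2 : LocIdx (fun l => (l - z) ^ (m : ℤ)) z m := ⟨1, one_pos, 0, continuousOn_const, by simp⟩
  obtain ⟨s, hs, hgs⟩ := hg.exists_mem_nhds_analyticOnNhd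
  have h3 := h2.mul (locIdx_zero_of_continuousOn hs hgs.continuousOn hg0)
  refine ⟨m, ?_, ?_⟩
  · rw [add_zero] at h3
    refine h3.congr (Filter.Eventually.filter_mono nhdsWithin_le_nhds (hFg.mono fun l hl => ?_))
    simp [hl]
  · intro h0
    by_contra hm
    have : m = 0 := by omega
    subst this
    have := hFg.self_of_nhds
    simp [h0] at this
    exact hg0 this.symm

/-- Additivity of the winding number: the index on the boundary of a disc is the sum of the
local indices inside. -/
lemma hasIdx_sum_locIdx {c : ℂ} {r : ℝ} (hr : 0 < r) (a : ℂ → ℤ) (Z : Finset ℂ)  :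
    ∀ (F : ℂ → ℂ) (_ : ∀ z ∈ Z, z ∈ ball c r)
    (_ : ContinuousOn F (closedBall c r \ Z)) (_ : ∀ l ∈ closedBall c r \ Z, F l ≠ 0)
    (_ : ∀ z ∈ Z, LocIdx F z (a z)), HasIdx F c r (∑ z ∈ Z, a z) := by
  classical
  induction Z using Finset.induction_on with
  | empty =>
    intro F _ hF h0 _
    simp only [Finset.coe_empty, sdiff_empty] at hF h0
    obtain ⟨u, hu, h⟩ := exists_log_of_convex (convex_closedBall c r) hF h0
    have := hasIdx_exp (hu.mono sphere_subset_closedBall)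
    simpa using this.congr fun z hz => h z (sphere_subset_closedBall hz)
  | insert z Z hzZ ih =>
    intro F hZ hF h0 hloc
    have hzb : z ∈ ball c r := hZ z (Finset.mem_insert_self _ _)
    obtain ⟨ε₀, hε₀, u, hu, hFu⟩ := hloc z (Finset.mem_insert_self _ _)
    have hopen : IsOpen (ball c r \ (Z : Set ℂ)) :=
      isOpen_ball.sdiff Z.finite_toSet.isClosed
    obtain ⟨ε₁, hε₁, hb₁⟩ := Metric.isOpen_iff.1 hopen z ⟨hzb, by simpa using hzZ⟩
    set ε := min ε₀ ε₁ with hε_def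
    have hε : 0 < ε := lt_min hε₀ hε₁
    have hb : ball z ε ⊆ ball c r \ (Z : Set ℂ) :=
      (ball_subset_ball (min_le_right _ _)).trans hb₁
    have hbu : ball z ε \ {z} ⊆ ball z ε₀ \ {z} :=
      sdiff_subset_sdiff_left (ball_subset_ball (min_le_left _ _))
    let τ : ℂ → ℝ := fun l => max 0 (min 1 (3 * ‖l - z‖ / ε - 1))
    have hτc : Continuous τ := by fun_prop
    have hτ0 : ∀ l ∈ ball z (ε / 3), τ l = 0 := by
      intro l hl
      rw [mem_ball_iff_norm] at hl
      apply max_eq_left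
      apply (min_le_right _ _).trans
      rw [sub_nonpos, div_le_one hε]
      linarith
    have hτ1 : ∀ l, 2 * ε / 3 < ‖l - z‖ → τ l = 1 := by
      intro l hl
      have : 1 ≤ 3 * ‖l - z‖ / ε - 1 := by
        rw [le_sub_iff_add_le, le_div_iff₀ hε]
        linarith
      simp [τ, min_eq_left this]
    let F₁ : ℂ → ℂ := fun l => if l ∈ ball z ε then Complex.exp (τ l * u l)
      else F l * (l - z) ^ (-a z)
    have hF₁out : ∀ l, 2 * ε / 3 < ‖l - z‖ → F₁ l = F l * (l - z) ^ (-a z) := by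
      intro l hl
      have hlz : l ≠ z := by
        rintro rfl
        simp at hl; linarith
      by_cases hlb : l ∈ ball z ε
      · simp only [F₁, hlb, if_true]
        rw [hτ1 l hl, hFu l (hbu ⟨hlb, hlz⟩), zpow_neg]
        have : (l - z) ^ a z ≠ 0 := zpow_ne_zero _ (sub_ne_zero.2 hlz)
        field_simp
        simp
      · simp only [F₁, hlb, if_false]
    have hF₁0 : ∀ l ∈ closedBall c r \ (Z : Set ℂ), F₁ l ≠ 0 := by
      intro l hl
      by_cases hlb : l ∈ ball z ε
      · simp only [F₁, hlb, if_true]; exact Complex.exp_ne_zero _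
      · simp only [F₁, hlb, if_false]
        have hlz : l ≠ z := by rintro rfl; exact hlb (mem_ball_self hε)
        refine mul_ne_zero (h0 l ⟨hl.1, ?_⟩) (zpow_ne_zero _ (sub_ne_zero.2 hlz))
        have := hl.2
        simp only [Finset.coe_insert, Set.mem_insert_iff, not_or]
        exact ⟨hlz, this⟩
    have hF₁c : ContinuousOn F₁ (closedBall c r \ (Z : Set ℂ)) := by
      intro l hl
      by_cases h1 : l ∈ ball z (ε / 3)
      · have : F₁ =ᶠ[𝓝 l] fun _ => 1 := by
          filter_upwards [isOpen_ball.mem_nhds h1] with l' hl'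
          have : l' ∈ ball z ε := ball_subset_ball (by linarith) hl'
          simp only [F₁, this, if_true, hτ0 l' hl']
          simp
        exact (continuousAt_const.congr this.symm).continuousWithinAt
      · have hlz : l ≠ z := by rintro rfl; exact h1 (mem_ball_self (by positivity))
        by_cases h2 : l ∈ ball z ε
        · have hopen2 : IsOpen (ball z ε \ {z}) := isOpen_ball.sdiff isClosed_singleton
          have hca : ContinuousAt u l := (hu.mono hbu).continuousAt (hopen2.mem_nhds ⟨h2, hlz⟩)
          have : F₁ =ᶠ[𝓝 l] fun l => Complex.exp (τ l * u l) := by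
            filter_upwards [isOpen_ball.mem_nhds h2] with l' hl'
            simp only [F₁, hl', if_true]
          refine (ContinuousAt.congr ?_ this.symm).continuousWithinAt
          have : ContinuousAt τ l := hτc.continuousAt
          fun_prop
        · have hgt : 2 * ε / 3 < ‖l - z‖ := by
            rw [mem_ball_iff_norm, not_lt] at h2; linarith
          have hlmem : l ∈ closedBall c r \ ((insert z Z : Finset ℂ) : Set ℂ) := by
            refine ⟨hl.1, ?_⟩
            simp only [Finset.coe_insert, Set.mem_insert_iff, not_or]
            exact ⟨hlz, hl.2⟩
          have hev : F₁ =ᶠ[𝓝 l] fun l => F l * (l - z) ^ (-a z) := by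
            have : Continuous fun l : ℂ => ‖l - z‖ := by fun_prop
            filter_upwards [this.continuousAt.eventually (lt_mem_nhds hgt)] with l' hl'
            exact hF₁out l' hl'
          have hcF : ContinuousWithinAt F (closedBall c r \ (Z : Set ℂ)) l := by
            refine (hF l hlmem).mono_of_mem_nhdsWithin ?_
            have : ({z}ᶜ : Set ℂ) ∈ 𝓝 l := isOpen_compl_singleton.mem_nhds hlz
            filter_upwards [self_mem_nhdsWithin, nhdsWithin_le_nhds this] with l' h1 h2
            refine ⟨h1.1, ?_⟩
            simp only [Finset.coe_insert, Set.mem_insert_iff, not_or]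
            exact ⟨h2, h1.2⟩
          refine ContinuousWithinAt.congr_of_eventuallyEq ?_
            (hev.filter_mono nhdsWithin_le_nhds) hev.self_of_nhds
          refine hcF.mul ?_
          exact ((continuousAt_id.sub continuousAt_const).zpow₀ _
            (Or.inl (sub_ne_zero.2 hlz))).continuousWithinAt
    have hloc₁ : ∀ z' ∈ Z, LocIdx F₁ z' (a z') := by
      intro z' hz'
      have hzz' : z' ≠ z := by rintro rfl; exact hzZ hz'
      have hz'b : z' ∉ ball z ε := fun h => (hb h).2 hz'
      have hgt : 2 * ε / 3 < ‖z' - z‖ := by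
        rw [mem_ball_iff_norm, not_lt] at hz'b; linarith
      have h1 : LocIdx (fun l => (l - z) ^ (-a z)) z' 0 :=
        locIdx_zero_of_continuousOn (s := {z}ᶜ) (isOpen_compl_singleton.mem_nhds hzz')
          (ContinuousOn.zpow₀ (by fun_prop) _ fun l hl => Or.inl (sub_ne_zero.2 hl))
          (zpow_ne_zero _ (sub_ne_zero.2 hzz'))
      have h2 := (hloc z' (Finset.mem_insert_of_mem hz')).mul h1
      rw [add_zero] at h2
      refine h2.congr (Filter.Eventually.filter_mono nhdsWithin_le_nhds ?_)
      have : Continuous fun l : ℂ => ‖l - z‖ := by fun_prop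
      filter_upwards [this.continuousAt.eventually (lt_mem_nhds hgt)] with l' hl'
      exact hF₁out l' hl'
    have hI := ih F₁ (fun z' hz' => hZ z' (Finset.mem_insert_of_mem hz')) hF₁c hF₁0 hloc₁
    have hI2 := hI.mul hr ((hasIdx_sub hzb).zpow (a z))
    rw [Finset.sum_insert hzZ, add_comm]
    rw [mul_one] at hI2
    refine hI2.congr fun l hl => ?_
    have hlb : l ∉ ball z ε := by
      intro h
      have := (hb h).1
      rw [mem_sphere] at hl
      rw [mem_ball, hl] at this
      exact lt_irrefl _ this
    have hlz : l ≠ z := by rintro rfl; exact hlb (mem_ball_self hε)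
    simp only [F₁, hlb, if_false]
    rw [mul_assoc, ← zpow_add₀ (sub_ne_zero.2 hlz)]
    simp

/-- Homotopy invariance of the winding number. -/
lemma HasIdx.of_homotopy {c : ℂ} {r : ℝ} {a : ℤ} (H : ℝ → ℂ → ℂ)
    (hc : ContinuousOn (fun z : ℝ × ℂ => H z.1 z.2) (Icc 0 1 ×ˢ sphere c r))
    (h0 : ∀ t ∈ Icc (0 : ℝ) 1, ∀ z ∈ sphere c r, H t z ≠ 0) (h : HasIdx (H 0) c r a) :
    HasIdx (H 1) c r a := by
  classical
  obtain ⟨u, hu, hF⟩ := h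
  have hmem : ∀ z : unitInterval × sphere c r, ((z.1 : ℝ), (z.2 : ℂ)) ∈
      Icc (0 : ℝ) 1 ×ˢ sphere c r := fun z => ⟨z.1.2, z.2.2⟩
  have c1 : Continuous fun z : unitInterval × sphere c r => H z.1 z.2 :=
    hc.comp_continuous (by fun_prop) hmem
  have c0 : Continuous fun z : unitInterval × sphere c r => H 0 z.2 :=
    hc.comp_continuous (f := fun z : unitInterval × sphere c r => ((0 : ℝ), (z.2 : ℂ)))
      (by fun_prop) (fun z => ⟨by simp, z.2.2⟩)
  let K : C(unitInterval × sphere c r, ℂ) := ⟨fun z => H z.1 z.2 / H 0 z.2,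
    c1.div c0 fun z => h0 0 (by simp) _ z.2.2⟩
  obtain ⟨U, hU, -⟩ := exists_log_homotopy K
    (fun z => div_ne_zero (h0 _ z.1.2 _ z.2.2) (h0 0 (by simp) _ z.2.2))
    (ContinuousMap.const _ 0) (fun z => by
      simp only [K, ContinuousMap.coe_mk, ContinuousMap.const_apply, Complex.exp_zero]
      exact div_self (h0 0 (by simp) _ z.2))
  obtain ⟨v, hv, hvU⟩ := exists_continuousOn_extension (s := sphere c r)
    (U := fun x => U (1, x)) (by fun_prop)
  refine ⟨fun z => u z + v z, hu.add hv, fun z hz => ?_⟩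
  have h1 := hU (1, ⟨z, hz⟩)
  simp only [K, ContinuousMap.coe_mk, Set.Icc.coe_one] at h1
  rw [Complex.exp_add, hvU z hz, ← h1, ← mul_assoc, ← hF z hz]
  field_simp [h0 0 (by simp) z hz]

/-! ### Local structure of the complement of a smooth hypersurface -/

/-- A nonvanishing function on `W × B`, where `W` is a punctured disc or the punctured plane and
`B` is convex, is a power of the first coordinate times an exponential. -/
lemma exists_zpow_mul_exp {K : Type*} [NormedAddCommGroup K] [NormedSpace ℝ K] {W : Set ℂ}
    (hW0 : (0 : ℂ) ∉ W) (hW : Convex ℝ (Complex.exp ⁻¹' W)) {B : Set K} (hB : Convex ℝ B)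
    {F : ℂ × K → ℂ} (hF : ContinuousOn F (W ×ˢ B)) (h0 : ∀ z ∈ W ×ˢ B, F z ≠ 0) :
    ∃ a : ℤ, ∃ u : ℂ × K → ℂ, ContinuousOn u (W ×ˢ B) ∧
      ∀ z ∈ W ×ˢ B, F z = z.1 ^ a * Complex.exp (u z) := by
  have hmt : MapsTo (fun z : ℂ × K => (Complex.exp z.1, z.2)) ((Complex.exp ⁻¹' W) ×ˢ B)
      (W ×ˢ B) := fun z hz => ⟨hz.1, hz.2⟩
  obtain ⟨ρ, hρ, hFρ⟩ := exists_log_of_convex (hW.prod hB)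
    (hF.comp (f := fun z : ℂ × K => (Complex.exp z.1, z.2)) (by fun_prop) hmt)
    (fun z hz => h0 _ (hmt hz))
  have hper : ∀ (k : ℤ) (z : ℂ × K), z ∈ (Complex.exp ⁻¹' W) ×ˢ B →
      (z.1 + k * (2 * Real.pi * Complex.I), z.2) ∈ (Complex.exp ⁻¹' W) ×ˢ B := by
    intro k z hz
    refine ⟨?_, hz.2⟩
    have := hz.1
    simp only [mem_preimage] at this ⊢
    rwa [Complex.exp_add, Complex.exp_int_mul_two_pi_mul_I, mul_one]
  have hper1 : ∀ (z : ℂ × K), z ∈ (Complex.exp ⁻¹' W) ×ˢ B →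
      (z.1 + (2 * Real.pi * Complex.I), z.2) ∈ (Complex.exp ⁻¹' W) ×ˢ B := fun z hz => by
    simpa using hper 1 z hz
  obtain ⟨a, ha⟩ := log_sub_log_const (hW.prod hB).isPreconnected
    (u := fun z : ℂ × K => ρ (z.1 + (2 * Real.pi * Complex.I), z.2)) (v := ρ)
    (hρ.comp (f := fun z : ℂ × K => (z.1 + (2 * Real.pi * Complex.I), z.2)) (by fun_prop) hper1)
    hρ (by
      intro z hz
      rw [← hFρ _ hz, ← hFρ _ (hper1 z hz)]
      simp [Complex.exp_add])
  let w : ℂ × K → ℂ := fun z => ρ z - a * z.1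
  have hw : ContinuousOn w ((Complex.exp ⁻¹' W) ×ˢ B) := hρ.sub (by fun_prop)
  have hw1 : ∀ z ∈ (Complex.exp ⁻¹' W) ×ˢ B, w (z.1 + (2 * Real.pi * Complex.I), z.2) = w z := by
    intro z hz
    have := ha z hz
    simp only [w, this]
    ring
  have hwk : ∀ (k : ℕ) (z : ℂ × K), z ∈ (Complex.exp ⁻¹' W) ×ˢ B →
      w (z.1 + k * (2 * Real.pi * Complex.I), z.2) = w z := by
    intro k
    induction k with
    | zero => intro z _; simp
    | succ k ih =>
      intro z hz
      have h1 := hw1 (z.1 + k * (2 * Real.pi * Complex.I), z.2) (by simpa using hper k z hz)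
      rw [ih z hz] at h1
      rw [← h1]
      congr 2
      push_cast; ring
  have hinv : ∀ s s' : ℂ, ∀ k ∈ B, Complex.exp s ∈ W → Complex.exp s = Complex.exp s' →
      w (s, k) = w (s', k) := by
    intro s s' k hk hs hss
    obtain ⟨n, hn⟩ := Complex.exp_eq_exp_iff_exists_int.1 hss
    obtain ⟨m, rfl | rfl⟩ := n.eq_nat_or_neg
    · have := hwk m (s', k) ⟨by simpa [← hss] using hs, hk⟩
      simp only at this
      rw [← this, hn]
      simp
    · have := hwk m (s, k) ⟨hs, hk⟩
      simp only at this
      rw [← this, hn]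
      congr 2
      push_cast; ring
  refine ⟨a, fun z => w (Complex.log z.1, z.2), ?_, ?_⟩
  · intro z hz
    have hz0 : z.1 ≠ 0 := fun h => hW0 (h ▸ hz.1)
    have hlog : ∀ y ∈ W ×ˢ B, (Complex.log y.1, y.2) ∈ (Complex.exp ⁻¹' W) ×ˢ B := by
      intro y hy
      have hy0 : y.1 ≠ 0 := fun h => hW0 (h ▸ hy.1)
      exact ⟨by simpa [Complex.exp_log hy0] using hy.1, hy.2⟩
    by_cases hsl : z.1 ∈ Complex.slitPlane
    · refine ContinuousWithinAt.comp (f := fun y : ℂ × K => (Complex.log y.1, y.2))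
        (hw _ (hlog z hz)) ?_ hlog
      exact ((continuousAt_fst.clog hsl).prodMk continuousAt_snd).continuousWithinAt
    · have hneg : -z.1 ∈ Complex.slitPlane := by
        rw [Complex.mem_slitPlane_iff] at hsl ⊢
        push Not at hsl
        left
        simp only [Complex.neg_re, Left.neg_pos_iff]
        rcases hsl.1.lt_or_eq with h | h
        · exact h
        · exact absurd (Complex.ext h hsl.2) hz0
      have hexp : ∀ y ∈ W ×ˢ B, Complex.exp (Complex.log (-y.1) + Real.pi * Complex.I) = y.1 := by
        intro y hy
        have hy0 : -y.1 ≠ 0 := fun h => hW0 (neg_eq_zero.1 h ▸ hy.1)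
        rw [Complex.exp_add, Complex.exp_log hy0, Complex.exp_pi_mul_I]; ring
      have hmt2 : MapsTo (fun y : ℂ × K => (Complex.log (-y.1) + Real.pi * Complex.I, y.2))
          (W ×ˢ B) ((Complex.exp ⁻¹' W) ×ˢ B) := fun y hy =>
        ⟨by simp only [mem_preimage]; rw [hexp y hy]; exact hy.1, hy.2⟩
      have heq : ∀ y ∈ W ×ˢ B, w (Complex.log y.1, y.2) =
          w (Complex.log (-y.1) + Real.pi * Complex.I, y.2) := by
        intro y hy
        have hy0 : y.1 ≠ 0 := fun h => hW0 (h ▸ hy.1)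
        apply hinv _ _ _ hy.2
        · rw [Complex.exp_log hy0]; exact hy.1
        · rw [Complex.exp_log hy0, hexp y hy]
      refine ContinuousWithinAt.congr (f := fun y : ℂ × K =>
        w (Complex.log (-y.1) + Real.pi * Complex.I, y.2)) ?_ heq (heq z hz)
      refine ContinuousWithinAt.comp (f := fun y : ℂ × K =>
        (Complex.log (-y.1) + Real.pi * Complex.I, y.2)) (hw _ (hmt2 hz)) ?_ hmt2
      exact ((((continuousAt_fst.neg).clog hneg).add continuousAt_const).prodMk
        continuousAt_snd).continuousWithinAt
  · intro z hz
    have hz0 : z.1 ≠ 0 := fun h => hW0 (h ▸ hz.1)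
    have := hFρ (Complex.log z.1, z.2) ⟨by simpa [Complex.exp_log hz0] using hz.1, hz.2⟩
    simp only [Function.comp, Complex.exp_log hz0] at this
    rw [show F z = F (z.1, z.2) from rfl, this]
    simp only [w]
    rw [Complex.exp_sub, Complex.exp_int_mul, Complex.exp_log hz0]
    field_simp [zpow_ne_zero a hz0]

lemma convex_exp_preimage_punctured_ball {δ : ℝ} (hδ : 0 < δ) :
    Convex ℝ (Complex.exp ⁻¹' (ball (0 : ℂ) δ \ {0})) := by
  have : Complex.exp ⁻¹' (ball (0 : ℂ) δ \ {0}) = {s | s.re < Real.log δ} := by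
    ext s
    simp [Complex.norm_exp, Real.lt_log_iff_exp_lt hδ, Complex.exp_ne_zero]
  rw [this]
  exact convex_halfSpace_re_lt _

section
variable {E : Type*} [NormedAddCommGroup E] [NormedSpace ℂ E]

lemma HasStrictFDerivAt.eventually_continuousAt {E' : Type*} [NormedAddCommGroup E']
    [NormedSpace ℂ E'] {p : E → E'} {p' : E →L[ℂ] E'} {x : E} (hp : HasStrictFDerivAt p p' x) :
    ∀ᶠ z in 𝓝 x, ContinuousAt p z := by
  obtain ⟨s, hs, hL⟩ := hp.exists_lipschitzOnWith.choose_spec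
  filter_upwards [eventually_mem_nhds_iff.2 hs] with z hz
  exact hL.continuousOn.continuousAt hz

/-- A function with nonzero derivative winds once around its zero on small transversal circles. -/
lemma hasIdx_line {p : E → ℂ} {p' : E →L[ℂ] ℂ} {x b : E} (hp : HasStrictFDerivAt p p' x)
    (hpx : p x = 0) (hb : p' b ≠ 0) :
    ∀ᶠ r in 𝓝[>] (0 : ℝ), HasIdx (fun l : ℂ => p (x + l • b)) 0 r 1 := by
  have h1 : (fun z => p z - p' (z - x)) =o[𝓝 x] fun z => z - x := by
    have := hp.hasFDerivAt.isLittleO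
    simpa [hpx] using this
  have hb0 : 0 < ‖b‖ := norm_pos_iff.2 fun h => hb (by simp [h])
  have hc : 0 < ‖p' b‖ / (2 * ‖b‖) := div_pos (norm_pos_iff.2 hb) (by positivity)
  have h2 := (h1.def hc).and hp.eventually_continuousAt
  obtain ⟨ε, hε, hball⟩ := Metric.eventually_nhds_iff_ball.1 h2
  have hε' : 0 < ε / ‖b‖ := by positivity
  filter_upwards [Ioo_mem_nhdsGT hε'] with r hr
  have hmem : ∀ l ∈ sphere (0 : ℂ) r, x + l • b ∈ ball x ε := by
    intro l hl
    rw [mem_sphere_zero_iff_norm] at hl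
    rw [mem_ball_iff_norm, add_sub_cancel_left, norm_smul, hl]
    exact (lt_div_iff₀ hb0).1 hr.2
  have hI : HasIdx (fun l : ℂ => l * p' b) 0 r 1 :=
    ⟨fun _ => Complex.log (p' b), continuousOn_const, fun z _ => by
      simp [Complex.exp_log hb]⟩
  refine hI.of_norm_sub_lt hr.1 ?_ ?_
  · intro l hl
    have : ContinuousAt p (x + l • b) := (hball _ (hmem l hl)).2
    exact (ContinuousAt.comp (f := fun l : ℂ => x + l • b) this (by fun_prop)).continuousWithinAt
  · intro l hl
    have h3 := (hball _ (hmem l hl)).1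
    rw [mem_sphere_zero_iff_norm] at hl
    simp only [add_sub_cancel_left, map_smul, smul_eq_mul, norm_smul, hl] at h3
    rw [norm_mul, hl]
    have : r * ‖p' b‖ = 2 * (‖p' b‖ / (2 * ‖b‖) * (r * ‖b‖)) := by field_simp
    have hpos : 0 < ‖p' b‖ / (2 * ‖b‖) * (r * ‖b‖) := mul_pos hc (mul_pos hr.1 hb0)
    linarith

lemma exists_apply_ne_zero {p' : E →L[ℂ] ℂ} (h : p' ≠ 0) : ∃ b, p' b ≠ 0 := by
  by_contra! hh
  exact h (ContinuousLinearMap.ext hh)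

lemma eventually_nhdsGT_line_mem {x b : E} {Ω : Set E} (hΩ : Ω ∈ 𝓝 x) :
    ∀ᶠ r in 𝓝[>] (0 : ℝ), ∀ l ∈ closedBall (0 : ℂ) r, x + l • b ∈ Ω := by
  have : ContinuousAt (fun l : ℂ => x + l • b) 0 := by fun_prop
  have h2 := this.preimage_mem_nhds (t := Ω) (by simpa using hΩ)
  obtain ⟨ε, hε, hb⟩ := Metric.mem_nhds_iff.1 h2
  filter_upwards [Ioo_mem_nhdsGT hε] with r hr l hl
  exact hb (closedBall_subset_ball hr.2 hl)

lemma zpow_eq_exp_imp {p : E → ℂ} {p' : E →L[ℂ] ℂ} {x : E} (hp : HasStrictFDerivAt p p' x)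
    (hpx : p x = 0) (hp' : p' ≠ 0) {Ω : Set E} (hΩ : Ω ∈ 𝓝 x) {c : ℤ} {u : E → ℂ}
    (hu : ContinuousOn u (Ω \ {z | p z = 0}))
    (h : ∀ z ∈ Ω \ {z | p z = 0}, p z ^ c = Complex.exp (u z)) : c = 0 := by
  obtain ⟨b, hb⟩ := exists_apply_ne_zero hp'
  obtain ⟨r, ⟨h1, h2⟩, hr⟩ := (((hasIdx_line hp hpx hb).and
    (eventually_nhdsGT_line_mem (b := b) hΩ)).and self_mem_nhdsWithin).exists
  have hr : 0 < r := hr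
  have hmem : MapsTo (fun l : ℂ => x + l • b) (sphere (0 : ℂ) r) (Ω \ {z | p z = 0}) := by
    intro l hl
    refine ⟨h2 l (sphere_subset_closedBall hl), ?_⟩
    obtain ⟨v, hv, h3⟩ := h1
    have := h3 l hl
    simp only at this
    simp only [mem_setOf_eq, this]
    exact mul_ne_zero (zpow_ne_zero _ (sub_ne_zero_of_mem_sphere hr hl)) (Complex.exp_ne_zero _)
  have h3 := h1.zpow c
  have h4 := hasIdx_exp (hu.comp (f := fun l : ℂ => x + l • b) (by fun_prop) hmem)
  have := h3.unique hr (h4.congr fun l hl => h _ (hmem hl))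
  simpa using this

variable [CompleteSpace E]

/-- Off a smooth hypersurface `p = 0`, locally every nonvanishing function is `p ^ a * exp u`. -/
lemma exists_nhds_zpow_mul_exp {p : E → ℂ} {p' : E →L[ℂ] ℂ} {x : E}
    (hp : HasStrictFDerivAt p p' x) (hpx : p x = 0) (hp' : p' ≠ 0) {N : Set E} (hN : N ∈ 𝓝 x) :
    ∃ Ω ∈ 𝓝 x, Ω ⊆ N ∧ IsOpen Ω ∧ ∀ F : E → ℂ, ContinuousOn F (Ω \ {z | p z = 0}) →
      (∀ z ∈ Ω \ {z | p z = 0}, F z ≠ 0) → ∃ a : ℤ, ∃ u : E → ℂ,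
        ContinuousOn u (Ω \ {z | p z = 0}) ∧
        ∀ z ∈ Ω \ {z | p z = 0}, F z = p z ^ a * Complex.exp (u z) := by
  have hsurj : (p' : E →ₗ[ℂ] ℂ).range = ⊤ := by
    obtain ⟨b, hb⟩ := exists_apply_ne_zero hp'
    rw [LinearMap.range_eq_top]
    intro c
    exact ⟨(c / p' b) • b, by simp [hb]⟩
  set e := hp.implicitToOpenPartialHomeomorph p p' hsurj with he
  have hefst : ∀ z, (e z).1 = p z := fun z => hp.implicitToOpenPartialHomeomorph_fst hsurj z
  have hxs : x ∈ e.source := hp.mem_implicitToOpenPartialHomeomorph_source hsurj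
  have hex : e x = (0, (e x).2) := Prod.ext ((hefst x).trans hpx) rfl
  set k₀ := (e x).2
  have hT : e.target ∩ e.symm ⁻¹' N ∈ 𝓝 (e x) := by
    refine Filter.inter_mem (e.open_target.mem_nhds (e.map_source hxs)) ?_
    refine (e.symm.continuousAt (e.map_source hxs)).preimage_mem_nhds ?_
    rwa [e.left_inv hxs]
  obtain ⟨δ, hδ, hb⟩ := Metric.mem_nhds_iff.1 hT
  rw [hex, ← ball_prod_same] at hb
  have hopen : IsOpen (e.source ∩ e ⁻¹' (ball (0 : ℂ) δ ×ˢ ball k₀ δ)) :=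
    e.isOpen_inter_preimage (isOpen_ball.prod isOpen_ball)
  refine ⟨_, hopen.mem_nhds ⟨hxs, ?_⟩, ?_, hopen, ?_⟩
  · rw [mem_preimage, hex]; exact ⟨mem_ball_self hδ, mem_ball_self hδ⟩
  · intro z hz
    have := (hb hz.2).2
    rwa [mem_preimage, e.left_inv hz.1] at this
  intro F hF hF0
  have hmt : MapsTo e.symm ((ball (0 : ℂ) δ \ {0}) ×ˢ ball k₀ δ)
      ((e.source ∩ e ⁻¹' (ball (0 : ℂ) δ ×ˢ ball k₀ δ)) \ {z | p z = 0}) := by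
    intro y hy
    have hyt : y ∈ e.target := (hb ⟨hy.1.1, hy.2⟩).1
    refine ⟨⟨e.map_target hyt, ?_⟩, ?_⟩
    · rw [mem_preimage, e.right_inv hyt]; exact ⟨hy.1.1, hy.2⟩
    · rw [mem_setOf_eq, ← hefst, e.right_inv hyt]; exact hy.1.2
  have hsub : (ball (0 : ℂ) δ \ {0}) ×ˢ ball k₀ δ ⊆ e.target := fun y hy =>
    (hb ⟨hy.1.1, hy.2⟩).1
  obtain ⟨a, u, hu, h⟩ := exists_zpow_mul_exp (by simp) (convex_exp_preimage_punctured_ball hδ)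
    (convex_ball k₀ δ)
    (hF.comp (e.symm.continuousOn.mono hsub) hmt) (fun y hy => hF0 _ (hmt hy))
  have hmt2 : MapsTo e ((e.source ∩ e ⁻¹' (ball (0 : ℂ) δ ×ˢ ball k₀ δ)) \ {z | p z = 0})
      ((ball (0 : ℂ) δ \ {0}) ×ˢ ball k₀ δ) := by
    intro z hz
    refine ⟨⟨hz.1.2.1, ?_⟩, hz.1.2.2⟩
    have := hz.2
    rwa [mem_singleton_iff, hefst]
  refine ⟨a, u ∘ e, hu.comp (e.continuousOn.mono fun z hz => hz.1.1) hmt2, fun z hz => ?_⟩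
  have := h _ (hmt2 hz)
  rw [Function.comp, e.left_inv hz.1.1, hefst] at this
  exact this

/-- A local homeomorphism between pairs (ambient space, smooth hypersurface) preserves the
meridian up to sign. -/
lemma local_pair {E' : Type*} [NormedAddCommGroup E'] [NormedSpace ℂ E'] [CompleteSpace E']
    {p : E → ℂ} {p' : E →L[ℂ] ℂ} {x : E} {q : E' → ℂ} {q' : E' →L[ℂ] ℂ}
    {φ : E → E'} {ψ : E' → E} (hp : HasStrictFDerivAt p p' x) (hpx : p x = 0) (hp' : p' ≠ 0)
    (hq : HasStrictFDerivAt q q' (φ x)) (hqy : q (φ x) = 0) (hq' : q' ≠ 0)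
    (hφ : ∀ᶠ z in 𝓝 x, ContinuousAt φ z) (hψ : ∀ᶠ w in 𝓝 (φ x), ContinuousAt ψ w)
    (hψφ : ∀ᶠ z in 𝓝 x, ψ (φ z) = z)
    (hpq : ∀ᶠ z in 𝓝 x, (q (φ z) = 0 ↔ p z = 0))
    (hqp : ∀ᶠ w in 𝓝 (φ x), (p (ψ w) = 0 ↔ q w = 0)) :
    ∃ Ω ∈ 𝓝 x, IsOpen Ω ∧ ∃ a : ℤ, (a = 1 ∨ a = -1) ∧ ∃ u : E → ℂ,
      ContinuousOn u (Ω \ {z | p z = 0}) ∧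
      ∀ z ∈ Ω \ {z | p z = 0}, q (φ z) = p z ^ a * Complex.exp (u z) := by
  have hφx : ContinuousAt φ x := hφ.self_of_nhds
  have hψx : ContinuousAt ψ (φ x) := hψ.self_of_nhds
  have hxx : ψ (φ x) = x := hψφ.self_of_nhds
  have hcp : ∀ᶠ w in 𝓝 (φ x), ContinuousAt p (ψ w) := by
    have := hp.eventually_continuousAt
    rw [← hxx] at this
    exact hψx.eventually this
  obtain ⟨Ω', hΩ', hΩ'N, -, hlog'⟩ := exists_nhds_zpow_mul_exp hq hqy hq'
    (Filter.inter_mem hqp (Filter.inter_mem hψ hcp))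
  obtain ⟨b, v, hv, hpv⟩ := hlog' (fun w => p (ψ w))
    (fun w hw => by
      obtain ⟨_, h2, h3⟩ := hΩ'N hw.1
      exact (ContinuousAt.comp (f := ψ) h3 h2).continuousWithinAt)
    (fun w hw => fun h => hw.2 ((hΩ'N hw.1).1.1 h))
  obtain ⟨Ω, hΩ, hΩN, hΩo, hlog⟩ := exists_nhds_zpow_mul_exp hp hpx hp'
    (Filter.inter_mem (Filter.inter_mem hpq hψφ) (Filter.inter_mem hφ
      (Filter.inter_mem (hφx.eventually hq.eventually_continuousAt) (hφx hΩ'))))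
  have hcφ : ContinuousOn φ (Ω \ {z | p z = 0}) := fun z hz =>
    (ContinuousAt.continuousWithinAt (hΩN hz.1).2.1)
  obtain ⟨a, u, hu, hqu⟩ := hlog (fun z => q (φ z))
    (fun z hz => by
      obtain ⟨_, h2, h3, _⟩ := hΩN hz.1
      exact (ContinuousAt.comp (f := φ) h3 h2).continuousWithinAt)
    (fun z hz => fun h => hz.2 ((hΩN hz.1).1.1.1 h))
  refine ⟨Ω, hΩ, hΩo, a, ?_, u, hu, hqu⟩
  have hmt : MapsTo φ (Ω \ {z | p z = 0}) (Ω' \ {w | q w = 0}) := by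
    intro z hz
    exact ⟨(hΩN hz.1).2.2.2, fun h => hz.2 ((hΩN hz.1).1.1.1 h)⟩
  have hab : 1 - a * b = 0 := by
    refine zpow_eq_exp_imp hp hpx hp' hΩ (u := fun z => b * u z + v (φ z)) ?_ ?_
    · exact (continuousOn_const.mul hu).add (hv.comp hcφ hmt)
    · intro z hz
      have hz0 : p z ≠ 0 := hz.2
      have h1 := hpv _ (hmt hz)
      have h2 : ψ (φ z) = z := (hΩN hz.1).1.2
      simp only [h2, hqu z hz] at h1
      rw [mul_zpow, ← Complex.exp_int_mul, ← zpow_mul, mul_assoc, ← Complex.exp_add] at h1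
      rw [zpow_sub₀ hz0, zpow_one, div_eq_iff (zpow_ne_zero _ hz0), mul_comm]
      exact h1
  have : a * b = 1 := by linarith
  rcases Int.mul_eq_one_iff_eq_one_or_neg_one.1 this with h | h
  · exact Or.inl h.1
  · exact Or.inr h.1

end

/-! ### Evaluation of polynomials on `ℂⁿ` and initial forms -/

/-- Evaluation of a polynomial at a point of `ℂⁿ`. -/
def pev {n : ℕ} (P : MvPolynomial (Fin n) ℂ) (x : En n) : ℂ :=
  MvPolynomial.eval (x : Fin n → ℂ) P

section
variable {n : ℕ}

@[simp] lemma pev_mul (P Q : MvPolynomial (Fin n) ℂ) (x : En n) :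
    pev (P * Q) x = pev P x * pev Q x := by simp [pev]

@[simp] lemma pev_add (P Q : MvPolynomial (Fin n) ℂ) (x : En n) :
    pev (P + Q) x = pev P x + pev Q x := by simp [pev]

@[simp] lemma pev_pow (P : MvPolynomial (Fin n) ℂ) (k : ℕ) (x : En n) :
    pev (P ^ k) x = pev P x ^ k := by simp [pev]

@[simp] lemma pev_C (c : ℂ) (x : En n) : pev (MvPolynomial.C c) x = c := by simp [pev]

@[simp] lemma pev_zero (x : En n) : pev 0 x = 0 := by simp [pev]

@[simp] lemma pev_X (i : Fin n) (x : En n) : pev (MvPolynomial.X i) x = x i := by simp [pev]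

lemma pev_ext {P Q : MvPolynomial (Fin n) ℂ} (h : ∀ x, pev P x = pev Q x) : P = Q :=
  MvPolynomial.funext fun x => h (WithLp.toLp 2 x)

lemma exists_pev_ne_zero {P : MvPolynomial (Fin n) ℂ} (h : P ≠ 0) : ∃ x, pev P x ≠ 0 := by
  by_contra! hh
  exact h (pev_ext fun x => by simp [hh x])

lemma contDiff_pev (P : MvPolynomial (Fin n) ℂ) {k : WithTop ℕ∞} :
    ContDiff ℂ k (pev P) := by
  induction P using MvPolynomial.induction_on with
  | C a => simpa [funext (pev_C (n := n) a)] using contDiff_const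
  | add p q hp hq => simpa [funext (pev_add p q)] using hp.add hq
  | mul_X p i hp =>
    have : ContDiff ℂ k fun x : En n => x i := (EuclideanSpace.proj (𝕜 := ℂ) i).contDiff
    have h2 := hp.mul this
    have e : pev (p * MvPolynomial.X i) = fun x : En n => pev p x * x i := by
      ext x; simp
    rw [e]; exact h2

lemma continuous_pev (P : MvPolynomial (Fin n) ℂ) : Continuous (pev P) :=
  (contDiff_pev P (k := 1)).continuous

lemma differentiable_pev (P : MvPolynomial (Fin n) ℂ) : Differentiable ℂ (pev P) :=
  (contDiff_pev P (k := 1)).differentiable one_ne_zero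

lemma analyticAt_pev (P : MvPolynomial (Fin n) ℂ) (x : En n) : AnalyticAt ℂ (pev P) x :=
  (contDiff_pev P (k := ⊤)).contDiffAt.analyticAt

lemma hasStrictFDerivAt_pev (P : MvPolynomial (Fin n) ℂ) (x : En n) :
    HasStrictFDerivAt (pev P) (fderiv ℂ (pev P) x) x :=
  (analyticAt_pev P x).hasStrictFDerivAt

lemma MvPolynomial.IsHomogeneous.pev_smul {P : MvPolynomial (Fin n) ℂ} {m : ℕ}
    (hP : P.IsHomogeneous m) (c : ℂ) (x : En n) : pev P (c • x) = c ^ m * pev P x := by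
  simp only [pev]
  rw [MvPolynomial.eval_eq, MvPolynomial.eval_eq, Finset.mul_sum]
  refine Finset.sum_congr rfl fun d hd => ?_
  have hdeg : ∑ i ∈ d.support, d i = m := by
    have := hP (MvPolynomial.mem_support_iff.1 hd)
    rw [Finsupp.weight_apply, Finsupp.sum] at this
    simpa using this
  have h2 : ∏ i ∈ d.support, (c * x i) ^ d i = c ^ m * ∏ i ∈ d.support, x i ^ d i := by
    simp only [mul_pow, Finset.prod_mul_distrib]
    rw [Finset.prod_pow_eq_pow_sum, hdeg]
  simp only [PiLp.smul_apply, smul_eq_mul]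
  rw [h2]; ring

/-- On a line with direction off the cone `P = 0`, zeros of `P` are isolated. -/
lemma eventually_pev_line_ne_zero {P : MvPolynomial (Fin n) ℂ} {m : ℕ}
    (hP : P.IsHomogeneous m) {b : En n} (hb : pev P b ≠ 0) (x : En n) (c : ℂ) :
    ∀ᶠ l in 𝓝[≠] c, pev P (x + l • b) ≠ 0 := by
  have han : AnalyticOnNhd ℂ (fun l : ℂ => pev P (x + l • b)) univ := fun l _ =>
    (analyticAt_pev P _).comp (by fun_prop)
  rcases (han c trivial).eventually_eq_zero_or_eventually_ne_zero with h | h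
  · exfalso
    have h0 : ∀ l : ℂ, pev P (x + l • b) = 0 := fun l =>
      han.eqOn_zero_of_preconnected_of_eventuallyEq_zero isPreconnected_univ trivial h trivial
    have h1 : ∀ μ : ℂ, μ ≠ 0 → pev P (μ • x + b) = 0 := by
      intro μ hμ
      have := hP.pev_smul μ (x + μ⁻¹ • b)
      rw [h0, mul_zero, smul_add, smul_smul, mul_inv_cancel₀ hμ, one_smul] at this
      exact this
    have hc : Continuous fun μ : ℂ => pev P (μ • x + b) :=
      (continuous_pev P).comp (by fun_prop)
    have h2 : (fun μ : ℂ => pev P (μ • x + b)) =ᶠ[𝓝[≠] 0] fun _ => 0 :=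
      eventually_nhdsWithin_of_forall h1
    have h3 := tendsto_nhds_unique (tendsto_const_nhds.congr' h2.symm)
      (hc.continuousAt (x := 0).mono_left nhdsWithin_le_nhds)
    simp at h3
    exact hb h3.symm
  · exact h

/-- `P` is the initial form, of degree `m`, of `f` at the origin. -/
structure IsInit (f : En n → ℂ) (m : ℕ) (P : MvPolynomial (Fin n) ℂ) : Prop where
  hom : P.IsHomogeneous m
  ne : P ≠ 0
  bound : ∃ C ≥ 0, ∃ ρ > 0, ∀ x : En n, ‖x‖ < ρ → ‖f x - pev P x‖ ≤ C * ‖x‖ ^ (m + 1)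

lemma IsInit.rescale {f : En n → ℂ} {m : ℕ} {P : MvPolynomial (Fin n) ℂ} (h : IsInit f m P)
    (R : ℝ) {ε : ℝ} (hε : 0 < ε) :
    ∀ᶠ t : ℝ in 𝓝[>] (0 : ℝ), ∀ x : En n, ‖x‖ ≤ R →
      ‖f ((t : ℂ) • x) - (t : ℂ) ^ m * pev P x‖ ≤ ε * t ^ m := by
  obtain ⟨C, hC, ρ, hρ, hb⟩ := h.bound
  have hR : 0 < max R 1 := lt_max_of_lt_right one_pos
  have e1 : 0 < ρ / max R 1 := by positivity
  have e2 : 0 < ε / ((C + 1) * max R 1 ^ (m + 1)) := by positivity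
  filter_upwards [Ioo_mem_nhdsGT e1, Ioo_mem_nhdsGT e2] with t h1 h2 x hx
  have ht : 0 < t := h1.1
  have hx' : ‖x‖ ≤ max R 1 := hx.trans (le_max_left _ _)
  have hn : ‖(t : ℂ) • x‖ = t * ‖x‖ := by
    rw [norm_smul, Complex.norm_real, Real.norm_of_nonneg ht.le]
  have := hb ((t : ℂ) • x) (by
    rw [hn]
    calc t * ‖x‖ ≤ t * max R 1 := by gcongr
      _ < ρ := (lt_div_iff₀ hR).1 h1.2)
  rw [h.hom.pev_smul] at this
  refine this.trans ?_
  rw [hn, mul_pow, pow_succ t]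
  have h3 : t * ((C + 1) * max R 1 ^ (m + 1)) ≤ ε := ((lt_div_iff₀ (by positivity)).1 h2.2).le
  calc C * (t ^ m * t * ‖x‖ ^ (m + 1)) ≤ (C + 1) * (t ^ m * t * max R 1 ^ (m + 1)) := by
        gcongr; linarith
    _ = (t * ((C + 1) * max R 1 ^ (m + 1))) * t ^ m := by ring
    _ ≤ ε * t ^ m := by gcongr

/-- Minimum modulus principle: a holomorphic function smaller at the centre than on the circle has
a zero in the disc. -/
lemma exists_zero_of_norm_lt {F : ℂ → ℂ} {c : ℂ} {r : ℝ} (hr : 0 < r)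
    (hF : DifferentiableOn ℂ F (closedBall c r)) (h : ∀ z ∈ sphere c r, ‖F c‖ < ‖F z‖) :
    ∃ z ∈ ball c r, F z = 0 := by
  by_contra! hne
  have hne' : ∀ z ∈ closedBall c r, F z ≠ 0 := by
    intro z hz
    rcases (mem_closedBall.1 hz).lt_or_eq with h1 | h1
    · exact hne z h1
    · intro h0
      have := h z h1
      rw [h0, norm_zero] at this
      exact absurd this (not_lt.2 (norm_nonneg _))
  have hd : DiffContOnCl ℂ (fun z => (F z)⁻¹) (ball c r) := by
    apply DifferentiableOn.diffContOnCl
    rw [closure_ball c hr.ne']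
    exact hF.inv hne'
  have hcomp : IsCompact (sphere c r) := isCompact_sphere c r
  obtain ⟨z₁, hz₁, hmin⟩ := hcomp.exists_isMinOn (NormedSpace.sphere_nonempty.2 hr.le)
    (hF.continuousOn.mono sphere_subset_closedBall).norm
  have hc0 := hne' c (mem_closedBall_self hr.le)
  have := Complex.norm_le_of_forall_mem_frontier_norm_le isBounded_ball hd (C := ‖F z₁‖⁻¹)
    (fun z hz => by
      rw [frontier_ball c hr.ne'] at hz
      rw [norm_inv]
      have h1 : ‖F z₁‖ ≤ ‖F z‖ := hmin hz
      have h2 : 0 < ‖F z₁‖ := norm_pos_iff.2 (hne' _ (sphere_subset_closedBall hz₁))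
      gcongr) (subset_closure (mem_ball_self hr))
  rw [norm_inv] at this
  have h3 := h z₁ hz₁
  have h4 := inv_strictAnti₀ (norm_pos_iff.2 hc0) h3
  linarith

/-- Points of the tangent cone are limits of rescaled points of the zero set. -/
lemma IsInit.exists_zero_near {f : En n → ℂ} {m : ℕ} {P : MvPolynomial (Fin n) ℂ}
    (h : IsInit f m P) (hf : AnalyticAt ℂ f 0) {x : En n} (hx : pev P x = 0) {ε : ℝ}
    (hε : 0 < ε) :
    ∀ᶠ t : ℝ in 𝓝[>] (0 : ℝ), ∃ x' : En n, ‖x' - x‖ < ε ∧ f ((t : ℂ) • x') = 0 := by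
  obtain ⟨b, hb⟩ := exists_pev_ne_zero h.ne
  have hev : ∀ᶠ r in 𝓝[>] (0 : ℝ), ∀ l ∈ sphere (0 : ℂ) r, pev P (x + l • b) ≠ 0 := by
    have := eventually_pev_line_ne_zero h.hom hb x 0
    rw [eventually_nhdsWithin_iff, Metric.eventually_nhds_iff_ball] at this
    obtain ⟨δ, hδ, h1⟩ := this
    filter_upwards [Ioo_mem_nhdsGT hδ] with r hr l hl
    exact h1 l (sphere_subset_ball hr.2 hl) (by simpa using sub_ne_zero_of_mem_sphere hr.1 hl)
  obtain ⟨r, ⟨hr1, hr2⟩, hr⟩ := ((hev.and (eventually_nhdsGT_line_mem (b := b)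
    (ball_mem_nhds x hε))).and self_mem_nhdsWithin).exists
  have hr : 0 < r := hr
  obtain ⟨z₁, hz₁, hmin⟩ := (isCompact_sphere (0 : ℂ) r).exists_isMinOn
    (NormedSpace.sphere_nonempty.2 hr.le)
    ((continuous_pev P).comp (by fun_prop : Continuous fun l : ℂ => x + l • b)).norm.continuousOn
  set μ := ‖pev P (x + z₁ • b)‖ with hμ
  have hμ0 : 0 < μ := norm_pos_iff.2 (hr1 z₁ hz₁)
  obtain ⟨ρ, hρ, hfρ⟩ := Metric.eventually_nhds_iff_ball.1 hf.eventually_analyticAt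
  set R := ‖x‖ + ε with hR
  have hRpos : 0 < R := by positivity
  have hρR : 0 < ρ / R := by positivity
  filter_upwards [h.rescale R (show 0 < μ / 4 by positivity), Ioo_mem_nhdsGT hρR] with t ht htρ
  have ht0 : 0 < t := htρ.1
  have hnorm : ∀ l ∈ closedBall (0 : ℂ) r, ‖x + l • b‖ ≤ R := by
    intro l hl
    have := hr2 l hl
    rw [mem_ball_iff_norm] at this
    calc ‖x + l • b‖ = ‖x + (x + l • b - x)‖ := by congr 1; abel
      _ ≤ ‖x‖ + ‖x + l • b - x‖ := norm_add_le _ _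
      _ ≤ R := by rw [hR]; gcongr
  have hdiff : DifferentiableOn ℂ (fun l : ℂ => f ((t : ℂ) • (x + l • b))) (closedBall 0 r) := by
    intro l hl
    have hmem : (t : ℂ) • (x + l • b) ∈ ball (0 : En n) ρ := by
      rw [mem_ball_zero_iff, norm_smul, Complex.norm_real, Real.norm_of_nonneg ht0.le]
      calc t * ‖x + l • b‖ ≤ t * R := by gcongr; exact hnorm l hl
        _ < ρ := (lt_div_iff₀ hRpos).1 htρ.2
    refine DifferentiableAt.differentiableWithinAt ?_
    exact DifferentiableAt.comp l (f := fun l : ℂ => (t : ℂ) • (x + l • b))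
      (hfρ _ hmem).differentiableAt (by fun_prop)
  have htm : 0 < t ^ m := by positivity
  obtain ⟨l, hl, hl0⟩ := exists_zero_of_norm_lt hr hdiff (by
    intro l hl
    have h1 := ht x (by rw [hR]; linarith)
    have h2 := ht (x + l • b) (hnorm l (sphere_subset_closedBall hl))
    rw [hx, mul_zero, sub_zero] at h1
    have h3 : μ ≤ ‖pev P (x + l • b)‖ := hmin hl
    have h4 : ‖(t : ℂ) ^ m * pev P (x + l • b)‖ = t ^ m * ‖pev P (x + l • b)‖ := by
      rw [norm_mul, norm_pow, Complex.norm_real, Real.norm_of_nonneg ht0.le]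
    have h5 : ‖(t : ℂ) ^ m * pev P (x + l • b)‖ - ‖f ((t : ℂ) • (x + l • b))‖ ≤
        ‖f ((t : ℂ) • (x + l • b)) - (t : ℂ) ^ m * pev P (x + l • b)‖ := by
      rw [norm_sub_rev]; exact norm_sub_norm_le _ _
    have h6 : t ^ m * μ ≤ t ^ m * ‖pev P (x + l • b)‖ := by gcongr
    simp only [zero_smul, add_zero]
    have h7 : 0 < t ^ m * μ := by positivity
    rw [h4] at h5
    nlinarith)
  exact ⟨x + l • b, by simpa [mem_ball_iff_norm] using hr2 l (ball_subset_closedBall hl), hl0⟩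

/-! ### Blow-ups of bi-Lipschitz germs -/

/-- A germ of a bi-Lipschitz homeomorphism at the origin, taking `f = 0` to `g = 0`. -/
structure LipGerm (f g : En n → ℂ) (φ ψ : En n → En n) (K r : ℝ) : Prop where
  hK : 1 ≤ K
  hr : 0 < r
  φ0 : φ 0 = 0
  ψ0 : ψ 0 = 0
  lipφ : ∀ x ∈ ball (0 : En n) r, ∀ y ∈ ball (0 : En n) r, ‖φ x - φ y‖ ≤ K * ‖x - y‖
  lipψ : ∀ x ∈ ball (0 : En n) r, ∀ y ∈ ball (0 : En n) r, ‖ψ x - ψ y‖ ≤ K * ‖x - y‖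
  left : ∀ x ∈ ball (0 : En n) r, ψ (φ x) = x
  right : ∀ y ∈ ball (0 : En n) r, φ (ψ y) = y
  memφ : ∀ x ∈ ball (0 : En n) r, g (φ x) = 0 ↔ f x = 0
  memψ : ∀ y ∈ ball (0 : En n) r, f (ψ y) = 0 ↔ g y = 0

lemma LipGerm.symm {f g : En n → ℂ} {φ ψ : En n → En n} {K r : ℝ} (H : LipGerm f g φ ψ K r) :
    LipGerm g f ψ φ K r :=
  ⟨H.hK, H.hr, H.ψ0, H.φ0, H.lipψ, H.lipφ, H.right, H.left, H.memψ, H.memφ⟩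

/-- A pair of mutually inverse bi-Lipschitz maps of `ℂⁿ` fixing the origin. -/
structure LipPair (h h' : En n → En n) (K : ℝ) : Prop where
  zero : h 0 = 0
  zero' : h' 0 = 0
  lip : ∀ x y, ‖h x - h y‖ ≤ K * ‖x - y‖
  lip' : ∀ x y, ‖h' x - h' y‖ ≤ K * ‖x - y‖
  left : ∀ x, h' (h x) = x
  right : ∀ y, h (h' y) = y

lemma LipPair.symm {h h' : En n → En n} {K : ℝ} (H : LipPair h h' K) : LipPair h' h K :=
  ⟨H.zero', H.zero, H.lip', H.lip, H.right, H.left⟩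

lemma continuous_of_lip {h : En n → En n} {K : ℝ} (H : ∀ x y, ‖h x - h y‖ ≤ K * ‖x - y‖) :
    Continuous h := by
  have : LipschitzWith K.toNNReal h := LipschitzWith.of_dist_le' fun x y => by
    simpa [dist_eq_norm] using H x y
  exact this.continuous

lemma LipPair.continuous {h h' : En n → En n} {K : ℝ} (H : LipPair h h' K) : Continuous h :=
  continuous_of_lip H.lip

/-- The map `x ↦ t⁻¹ φ(t x)`. -/
def rescaled (φ : En n → En n) (t : ℝ) (x : En n) : En n := (t : ℂ)⁻¹ • φ ((t : ℂ) • x)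

lemma smul_rescaled {φ : En n → En n} {t : ℝ} (ht : 0 < t) (x : En n) :
    (t : ℂ) • rescaled φ t x = φ ((t : ℂ) • x) := by
  rw [rescaled, smul_smul, mul_inv_cancel₀ (by exact_mod_cast ht.ne'), one_smul]

lemma norm_rescaled_sub {φ : En n → En n} {K r : ℝ}
    (hφ : ∀ x ∈ ball (0 : En n) r, ∀ y ∈ ball (0 : En n) r, ‖φ x - φ y‖ ≤ K * ‖x - y‖)
    {t : ℝ} (ht : 0 < t) {x y : En n} (hx : (t : ℂ) • x ∈ ball (0 : En n) r)
    (hy : (t : ℂ) • y ∈ ball (0 : En n) r) :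
    ‖rescaled φ t x - rescaled φ t y‖ ≤ K * ‖x - y‖ := by
  have := hφ _ hx _ hy
  rw [rescaled, rescaled, ← smul_sub, norm_smul, norm_inv, Complex.norm_real,
    Real.norm_of_nonneg ht.le]
  rw [← smul_sub, norm_smul, Complex.norm_real, Real.norm_of_nonneg ht.le] at this
  rw [inv_mul_le_iff₀ ht]
  linarith

lemma eventually_smul_mem_ball {r : ℝ} (hr : 0 < r) (R : ℝ) :
    ∀ᶠ t : ℝ in 𝓝[>] (0 : ℝ), ∀ x : En n, ‖x‖ ≤ R → (t : ℂ) • x ∈ ball (0 : En n) r := by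
  have hR : 0 < max R 1 := lt_max_of_lt_right one_pos
  have e1 : 0 < r / max R 1 := by positivity
  filter_upwards [Ioo_mem_nhdsGT e1] with t ht x hx
  rw [mem_ball_zero_iff, norm_smul, Complex.norm_real, Real.norm_of_nonneg ht.1.le]
  calc t * ‖x‖ ≤ t * max R 1 := by
        have := ht.1
        gcongr; exact hx.trans (le_max_left _ _)
    _ < r := (lt_div_iff₀ hR).1 ht.2

/-- `h` is a blow-up of the germ `φ` along the ultrafilter `𝒰` of scales. -/
structure IsBlowup (φ ψ : En n → En n) (𝒰 : Ultrafilter ℝ) (h h' : En n → En n) : Prop where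
  le : (𝒰 : Filter ℝ) ≤ 𝓝[>] 0
  tendsto : ∀ x, Tendsto (fun t => rescaled φ t x) 𝒰 (𝓝 (h x))
  tendsto' : ∀ x, Tendsto (fun t => rescaled ψ t x) 𝒰 (𝓝 (h' x))

lemma exists_tendsto_rescaled {φ : En n → En n} {K r : ℝ} (hr : 0 < r) (h0 : φ 0 = 0)
    (hφ : ∀ x ∈ ball (0 : En n) r, ∀ y ∈ ball (0 : En n) r, ‖φ x - φ y‖ ≤ K * ‖x - y‖)
    {𝒰 : Ultrafilter ℝ} (h𝒰 : (𝒰 : Filter ℝ) ≤ 𝓝[>] 0) :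
    ∃ h : En n → En n, (∀ x, Tendsto (fun t => rescaled φ t x) 𝒰 (𝓝 (h x))) ∧
      ∀ x y, ‖h x - h y‖ ≤ K * ‖x - y‖ := by
  have hex : ∀ x, ∃ y, Tendsto (fun t => rescaled φ t x) 𝒰 (𝓝 y) := by
    intro x
    have hmem : ∀ᶠ t : ℝ in (𝒰 : Filter ℝ), rescaled φ t x ∈ closedBall (0 : En n) (K * ‖x‖) := by
      filter_upwards [h𝒰 (eventually_smul_mem_ball hr ‖x‖), h𝒰 self_mem_nhdsWithin] with t h1 h2
      have := norm_rescaled_sub hφ h2 (h1 x le_rfl) (y := 0) (by simpa using hr)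
      simpa [rescaled, h0] using this
    obtain ⟨y, -, hy⟩ := (isCompact_closedBall (0 : En n) (K * ‖x‖)).ultrafilter_le_nhds
      (𝒰.map fun t => rescaled φ t x) (by
        rw [le_principal_iff]; exact hmem)
    exact ⟨y, hy⟩
  choose h hh using hex
  refine ⟨h, hh, fun x y => ?_⟩
  refine le_of_tendsto ((hh x).sub (hh y)).norm ?_
  filter_upwards [h𝒰 (eventually_smul_mem_ball hr ‖x‖), h𝒰 (eventually_smul_mem_ball hr ‖y‖),
    h𝒰 self_mem_nhdsWithin] with t h1 h2 h3
  exact norm_rescaled_sub hφ h3 (h1 x le_rfl) (h2 y le_rfl)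

lemma blowup_left_inv {φ ψ h h' : En n → En n} {K r : ℝ} (hr : 0 < r)
    (hψ : ∀ x ∈ ball (0 : En n) r, ∀ y ∈ ball (0 : En n) r, ‖ψ x - ψ y‖ ≤ K * ‖x - y‖)
    (hl : ∀ x ∈ ball (0 : En n) r, ψ (φ x) = x) {𝒰 : Ultrafilter ℝ}
    (h𝒰 : (𝒰 : Filter ℝ) ≤ 𝓝[>] 0) (hh : ∀ x, Tendsto (fun t => rescaled φ t x) 𝒰 (𝓝 (h x)))
    (hh' : ∀ x, Tendsto (fun t => rescaled ψ t x) 𝒰 (𝓝 (h' x))) (x : En n) : h' (h x) = x := by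
  have h1 : Tendsto (fun t => rescaled ψ t (rescaled φ t x) - rescaled ψ t (h x)) 𝒰 (𝓝 0) := by
    have h2 : Tendsto (fun t => K * ‖rescaled φ t x - h x‖) 𝒰 (𝓝 0) := by
      have := (((hh x).sub_const (h x)).norm).const_mul K
      simpa using this
    refine squeeze_zero_norm' ?_ h2
    have hb : ∀ᶠ t : ℝ in (𝒰 : Filter ℝ), ‖rescaled φ t x‖ ≤ ‖h x‖ + 1 :=
      ((hh x).norm.eventually (gt_mem_nhds (lt_add_one _))).mono fun t ht => ht.le
    filter_upwards [h𝒰 (eventually_smul_mem_ball hr (‖h x‖ + 1)), h𝒰 self_mem_nhdsWithin, hb]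
      with t e1 e2 e3
    exact norm_rescaled_sub hψ e2 (e1 _ e3) (e1 _ (by linarith))
  have h3 : (fun t => rescaled ψ t (rescaled φ t x)) =ᶠ[(𝒰 : Filter ℝ)] fun _ => x := by
    filter_upwards [h𝒰 (eventually_smul_mem_ball hr ‖x‖), h𝒰 self_mem_nhdsWithin] with t e1 e2
    have ht : (0 : ℝ) < t := e2
    have hne : (t : ℂ) ≠ 0 := by exact_mod_cast ht.ne'
    rw [rescaled, smul_rescaled ht, hl _ (e1 x le_rfl), smul_smul, inv_mul_cancel₀ hne, one_smul]
  have h4 : Tendsto (fun t => rescaled ψ t (h x)) 𝒰 (𝓝 x) := by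
    have := (tendsto_const_nhds (x := x).congr' h3.symm).sub h1
    simpa using this
  exact tendsto_nhds_unique (hh' (h x)) h4

lemma LipGerm.exists_blowup {f g : En n → ℂ} {φ ψ : En n → En n} {K r : ℝ}
    (H : LipGerm f g φ ψ K r) :
    ∃ (𝒰 : Ultrafilter ℝ) (h h' : En n → En n), IsBlowup φ ψ 𝒰 h h' ∧ LipPair h h' K := by
  have h𝒰 : ((Ultrafilter.of (𝓝[>] (0 : ℝ)) : Ultrafilter ℝ) : Filter ℝ) ≤ 𝓝[>] 0 :=
    Ultrafilter.of_le _
  set 𝒰 := Ultrafilter.of (𝓝[>] (0 : ℝ))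
  obtain ⟨h, hh, hl⟩ := exists_tendsto_rescaled H.hr H.φ0 H.lipφ h𝒰
  obtain ⟨h', hh', hl'⟩ := exists_tendsto_rescaled H.hr H.ψ0 H.lipψ h𝒰
  have e1 : h 0 = 0 := by
    refine tendsto_nhds_unique (hh 0) ?_
    simp [rescaled, H.φ0]
  have e2 : h' 0 = 0 := by
    refine tendsto_nhds_unique (hh' 0) ?_
    simp [rescaled, H.ψ0]
  exact ⟨𝒰, h, h', ⟨h𝒰, hh, hh'⟩, e1, e2, hl, hl',
    blowup_left_inv H.hr H.lipψ H.left h𝒰 hh hh', blowup_left_inv H.hr H.lipφ H.right h𝒰 hh' hh⟩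

lemma IsBlowup.symm {φ ψ h h' : En n → En n} {𝒰 : Ultrafilter ℝ} (B : IsBlowup φ ψ 𝒰 h h') :
    IsBlowup ψ φ 𝒰 h' h := ⟨B.le, B.tendsto', B.tendsto⟩

/-- The blow-up maps the tangent cone of `f = 0` into the tangent cone of `g = 0`. -/
lemma IsBlowup.pev_eq_zero {f g : En n → ℂ} {φ ψ h h' : En n → En n} {K r : ℝ}
    {𝒰 : Ultrafilter ℝ} (B : IsBlowup φ ψ 𝒰 h h') (H : LipGerm f g φ ψ K r)
    {m m' : ℕ} {P Q : MvPolynomial (Fin n) ℂ} (hf : AnalyticAt ℂ f 0) (hP : IsInit f m P)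
    (hQ : IsInit g m' Q) {x : En n} (hx : pev P x = 0) : pev Q (h x) = 0 := by
  have hKpos : 0 < K := lt_of_lt_of_le one_pos H.hK
  have hclose : ∀ ε > 0, ∀ᶠ t : ℝ in (𝒰 : Filter ℝ), ∃ y : En n, ‖y - h x‖ < ε ∧
      g ((t : ℂ) • y) = 0 := by
    intro ε hε
    filter_upwards [B.le (hP.exists_zero_near hf hx (show 0 < min 1 (ε / (2 * K)) by positivity)),
      B.le (eventually_smul_mem_ball H.hr (‖x‖ + 1)), B.le self_mem_nhdsWithin,
      (B.tendsto x).eventually (ball_mem_nhds _ (half_pos hε))] with t e1 e2 e3 e4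
    obtain ⟨x', hx', hfx'⟩ := e1
    have hx'n : ‖x'‖ ≤ ‖x‖ + 1 := by
      have := norm_sub_norm_le x' x
      have := hx'.trans_le (min_le_left _ _)
      linarith
    refine ⟨rescaled φ t x', ?_, ?_⟩
    · have h1 := norm_rescaled_sub H.lipφ e3 (e2 x' hx'n) (e2 x (by linarith))
      have h2 : K * ‖x' - x‖ < ε / 2 := by
        have := hx'.trans_le (min_le_right _ _)
        rw [lt_div_iff₀ (by positivity)] at this
        linarith
      rw [dist_eq_norm] at e4
      calc ‖rescaled φ t x' - h x‖ ≤ ‖rescaled φ t x' - rescaled φ t x‖ +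
            ‖rescaled φ t x - h x‖ := norm_sub_le_norm_sub_add_norm_sub _ _ _
        _ < ε := by linarith
    · rw [smul_rescaled e3, H.memφ _ (e2 x' hx'n), hfx']
  by_contra hne
  obtain ⟨ε, hε, hball⟩ := Metric.mem_nhds_iff.1
    ((continuous_pev Q).norm.continuousAt.eventually (lt_mem_nhds
      (half_lt_self (norm_pos_iff.2 hne))))
  have h1 := (hQ.rescale (‖h x‖ + ε) (show 0 < ‖pev Q (h x)‖ / 4 by
    have := norm_pos_iff.2 hne
    positivity)).filter_mono B.le
  obtain ⟨t, ⟨y, hy, hgy⟩, e2, e3⟩ := ((hclose ε hε).and (h1.and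
    (Eventually.filter_mono B.le self_mem_nhdsWithin))).exists
  have ht : (0 : ℝ) < t := e3
  have hyn : ‖y‖ ≤ ‖h x‖ + ε := by
    have := norm_sub_norm_le y (h x); linarith
  have h4 : ‖pev Q (h x)‖ / 2 < ‖pev Q y‖ := hball (mem_ball_iff_norm.2 hy)
  have h5 := e2 y hyn
  rw [hgy, zero_sub, norm_neg, norm_mul, norm_pow, Complex.norm_real,
    Real.norm_of_nonneg ht.le] at h5
  have htm : 0 < t ^ m' := by positivity
  have := norm_pos_iff.2 hne
  nlinarith

lemma IsBlowup.pev_eq_zero_iff {f g : En n → ℂ} {φ ψ h h' : En n → En n} {K r : ℝ}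
    {𝒰 : Ultrafilter ℝ} (B : IsBlowup φ ψ 𝒰 h h') (H : LipGerm f g φ ψ K r)
    (L : LipPair h h' K)
    {m m' : ℕ} {P Q : MvPolynomial (Fin n) ℂ} (hf : AnalyticAt ℂ f 0) (hg : AnalyticAt ℂ g 0)
    (hP : IsInit f m P) (hQ : IsInit g m' Q) (x : En n) : pev Q (h x) = 0 ↔ pev P x = 0 := by
  refine ⟨fun hx => ?_, B.pev_eq_zero H hf hP hQ⟩
  have := B.symm.pev_eq_zero H.symm hg hQ hP hx
  rwa [L.left] at this

/-- Rescalings converge to the blow-up uniformly on bounded sets. -/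
lemma IsBlowup.uniform {φ ψ h h' : En n → En n} {K r : ℝ} {𝒰 : Ultrafilter ℝ}
    (B : IsBlowup φ ψ 𝒰 h h') (hr : 0 < r) (hK : 0 < K)
    (hφ : ∀ x ∈ ball (0 : En n) r, ∀ y ∈ ball (0 : En n) r, ‖φ x - φ y‖ ≤ K * ‖x - y‖)
    (hh : ∀ x y, ‖h x - h y‖ ≤ K * ‖x - y‖) (R : ℝ) {ε : ℝ} (hε : 0 < ε) :
    ∀ᶠ t : ℝ in (𝒰 : Filter ℝ), ∀ x : En n, ‖x‖ ≤ R → ‖rescaled φ t x - h x‖ < ε := by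
  have hδ : 0 < ε / (4 * K) := by positivity
  obtain ⟨T, hTs, hTf, hT⟩ := (isCompact_closedBall (0 : En n) R).finite_cover_balls hδ
  have h1 : ∀ᶠ t : ℝ in (𝒰 : Filter ℝ), ∀ y ∈ T, ‖rescaled φ t y - h y‖ < ε / 4 := by
    rw [hTf.eventually_all]
    intro y _
    filter_upwards [(B.tendsto y).eventually (ball_mem_nhds _ (by positivity : 0 < ε / 4))]
      with t ht
    rwa [← dist_eq_norm]
  filter_upwards [h1, B.le (eventually_smul_mem_ball hr R), B.le self_mem_nhdsWithin]
    with t e1 e2 e3 x hx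
  obtain ⟨y, hy, hxy⟩ := mem_iUnion₂.1 (hT (mem_closedBall_zero_iff.2 hx))
  have hyR : ‖y‖ ≤ R := mem_closedBall_zero_iff.1 (hTs hy)
  rw [mem_ball_iff_norm, lt_div_iff₀ (by positivity)] at hxy
  have a1 := norm_rescaled_sub hφ e3 (e2 x hx) (e2 y hyR)
  have a2 := hh y x
  rw [norm_sub_rev y x] at a2
  have a3 := e1 y hy
  have : rescaled φ t x - h x = (rescaled φ t x - rescaled φ t y) + (rescaled φ t y - h y) +
    (h y - h x) := by abel
  rw [this]
  have := norm_add₃_le (a := rescaled φ t x - rescaled φ t y) (b := rescaled φ t y - h y)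
    (c := h y - h x)
  linarith

end

/-! ### Zeros of holomorphic functions on slices -/

/-- Zeros of a holomorphic function in a disc, counted by the index on the boundary. -/
lemma exists_zeros_finset {F : ℂ → ℂ} {c : ℂ} {r : ℝ} (hr : 0 < r)
    (hF : AnalyticOnNhd ℂ F (closedBall c r)) (h0 : ∀ l ∈ sphere c r, F l ≠ 0) :
    ∃ (Z : Finset ℂ) (m : ℂ → ℕ), (∀ l, l ∈ Z ↔ l ∈ ball c r ∧ F l = 0) ∧
      (∀ l ∈ Z, LocIdx F l (m l) ∧ 1 ≤ m l) ∧ HasIdx F c r (∑ l ∈ Z, (m l : ℤ)) := by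
  classical
  have hiso : ∀ l ∈ closedBall c r, ∀ᶠ l' in 𝓝[≠] l, F l' ≠ 0 := by
    intro l hl
    rcases (hF l hl).eventually_eq_zero_or_eventually_ne_zero with h | h
    · exfalso
      obtain ⟨l', hl'⟩ := NormedSpace.sphere_nonempty (x := c).2 hr.le
      exact h0 l' hl' (hF.eqOn_zero_of_preconnected_of_eventuallyEq_zero
        (convex_closedBall c r).isPreconnected hl h (sphere_subset_closedBall hl'))
    · exact h
  have hfin : {l | l ∈ ball c r ∧ F l = 0}.Finite := by
    by_contra hinf
    obtain ⟨l, hl, hacc⟩ := Set.Infinite.exists_accPt_of_subset_isCompact hinf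
      (isCompact_closedBall c r) (fun l hl => ball_subset_closedBall hl.1)
    rw [accPt_iff_frequently_nhdsNE] at hacc
    obtain ⟨l', h1, h2⟩ := (hacc.and_eventually (hiso l hl)).exists
    exact h2 h1.2
  have hm : ∀ l, ∃ m : ℕ, l ∈ hfin.toFinset → (LocIdx F l m ∧ 1 ≤ m) := by
    intro l
    by_cases hl : l ∈ hfin.toFinset
    · have hl' := hfin.mem_toFinset.1 hl
      obtain ⟨m, h1, h2⟩ := locIdx_of_analyticAt (hF l (ball_subset_closedBall hl'.1)) (by
        intro h
        obtain ⟨l', h1, h2⟩ := ((h.filter_mono nhdsWithin_le_nhds).and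
          (hiso l (ball_subset_closedBall hl'.1))).exists
        exact h2 h1)
      exact ⟨m, fun _ => ⟨h1, h2 hl'.2⟩⟩
    · exact ⟨0, fun h => absurd h hl⟩
  choose m hm using hm
  refine ⟨hfin.toFinset, m, fun l => hfin.mem_toFinset, hm, ?_⟩
  refine hasIdx_sum_locIdx hr (fun l => (m l : ℤ)) hfin.toFinset F
    (fun l hl => (hfin.mem_toFinset.1 hl).1) (hF.continuousOn.mono sdiff_subset) ?_
    (fun l hl => (hm l hl).1)
  intro l hl hF0
  rcases (mem_closedBall.1 hl.1).lt_or_eq with h | h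
  · exact hl.2 (by simpa using ⟨h, hF0⟩)
  · exact h0 l h hF0

section
variable {n : ℕ}

lemma continuous_slice (z b : En n) : Continuous fun y : En n × ℂ => z + y.1 + y.2 • b := by
  fun_prop

lemma analyticAt_slice {f : En n → ℂ} {z b : En n} {l : ℂ} (h : AnalyticAt ℂ f (z + l • b)) :
    AnalyticAt ℂ (fun l : ℂ => f (z + l • b)) l :=
  AnalyticAt.comp (f := fun l : ℂ => z + l • b) h (by fun_prop)

/-- A disc can be moved slightly so that it meets the zero set of a holomorphic function only in a
given relatively open dense subset. -/
lemma exists_good_slice {f : En n → ℂ} {Ω : Set (En n)} (hΩ : IsOpen Ω)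
    (hf : AnalyticOnNhd ℂ f Ω) {z b : En n} {r : ℝ} (hr : 0 < r)
    (hD : ∀ l ∈ closedBall (0 : ℂ) r, z + l • b ∈ Ω)
    (hS : ∀ l ∈ sphere (0 : ℂ) r, f (z + l • b) ≠ 0) {G : Set (En n)}
    (hGo : ∀ x ∈ G, ∀ᶠ y in 𝓝 x, f y = 0 → y ∈ G) (hGV : ∀ x ∈ G, f x = 0)
    (hGd : ∀ x ∈ Ω, f x = 0 → x ∈ closure G) {δ₀ : ℝ} (hδ₀ : 0 < δ₀) :
    ∃ w : En n, ‖w‖ < δ₀ ∧ (∀ l ∈ closedBall (0 : ℂ) r, z + w + l • b ∈ Ω) ∧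
      (∀ l ∈ sphere (0 : ℂ) r, ‖f (z + w + l • b) - f (z + l • b)‖ < ‖f (z + l • b)‖) ∧
      ∀ l ∈ ball (0 : ℂ) r, f (z + w + l • b) = 0 → z + w + l • b ∈ G := by
  classical
  have hcont : ∀ y : En n × ℂ, z + y.1 + y.2 • b ∈ Ω →
      ContinuousAt (fun y : En n × ℂ => f (z + y.1 + y.2 • b)) y := fun y hy =>
    ContinuousAt.comp (f := fun y : En n × ℂ => z + y.1 + y.2 • b)
      (hf _ hy).continuousAt (continuous_slice z b).continuousAt
  have t1 : ∀ᶠ w in 𝓝 (0 : En n), ∀ l ∈ closedBall (0 : ℂ) r, z + w + l • b ∈ Ω := by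
    refine (isCompact_closedBall (0 : ℂ) r).eventually_forall_of_forall_eventually ?_
    intro l hl
    exact (continuous_slice z b).continuousAt.preimage_mem_nhds
      (hΩ.mem_nhds (by simpa using hD l hl))
  have t2 : ∀ᶠ w in 𝓝 (0 : En n), ∀ l ∈ sphere (0 : ℂ) r,
      ‖f (z + w + l • b) - f (z + l • b)‖ < ‖f (z + l • b)‖ := by
    refine (isCompact_sphere (0 : ℂ) r).eventually_forall_of_forall_eventually ?_
    intro l hl
    have hl' := hD l (sphere_subset_closedBall hl)
    have c1 := hcont (0, l) (by simpa using hl')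
    have c2 : ContinuousAt (fun y : En n × ℂ => f (z + y.2 • b)) (0, l) :=
      ContinuousAt.comp (f := fun y : En n × ℂ => z + y.2 • b) (hf _ hl').continuousAt
        (by fun_prop)
    have := (c1.sub c2).norm.eventually_lt c2.norm (by simpa using hS l hl)
    exact this
  obtain ⟨δ₁, hδ₁, ht⟩ := Metric.eventually_nhds_iff_ball.1 (t1.and t2)
  set δ := min δ₀ δ₁ with hδdef
  have hδ : 0 < δ := lt_min hδ₀ hδ₁
  have hsubδ : ball (0 : En n) δ ⊆ ball 0 δ₁ := ball_subset_ball (min_le_right _ _)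
  have han : ∀ w ∈ ball (0 : En n) δ,
      AnalyticOnNhd ℂ (fun l : ℂ => f (z + w + l • b)) (closedBall 0 r) := fun w hw l hl =>
    analyticAt_slice (hf _ ((ht w (hsubδ hw)).1 l hl))
  have hne : ∀ w ∈ ball (0 : En n) δ, ∀ l ∈ sphere (0 : ℂ) r, f (z + w + l • b) ≠ 0 := by
    intro w hw l hl h0
    have := (ht w (hsubδ hw)).2 l hl
    rw [h0, zero_sub, norm_neg] at this
    exact lt_irrefl _ this
  have h0mem : (0 : En n) ∈ ball (0 : En n) δ := mem_ball_self hδ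
  obtain ⟨Z₀, m₀, -, -, hidx⟩ := exists_zeros_finset hr (han 0 h0mem) (hne 0 h0mem)
  simp only [add_zero] at hidx
  set k : ℕ := ∑ l ∈ Z₀, m₀ l with hk
  have hidx0 : HasIdx (fun l : ℂ => f (z + l • b)) 0 r (k : ℤ) := by
    rw [hk]; push_cast; exact hidx
  have hex : ∀ w : En n, ∃ Z : Finset ℂ, w ∈ ball (0 : En n) δ →
      ((∀ l, l ∈ Z ↔ l ∈ ball (0 : ℂ) r ∧ f (z + w + l • b) = 0) ∧ Z.card ≤ k) := by
    intro w
    by_cases hw : w ∈ ball (0 : En n) δ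
    · obtain ⟨Z, m, hZ, hm, hI⟩ := exists_zeros_finset hr (han w hw) (hne w hw)
      refine ⟨Z, fun _ => ⟨hZ, ?_⟩⟩
      have hI' := hidx0.of_norm_sub_lt hr (han w hw |>.continuousOn.mono sphere_subset_closedBall)
        (ht w (hsubδ hw)).2
      have heq := hI.unique hr hI'
      have hle : Z.card ≤ ∑ l ∈ Z, m l := by
        rw [Finset.card_eq_sum_ones]
        exact Finset.sum_le_sum fun l hl => (hm l hl).2
      have : (∑ l ∈ Z, m l : ℕ) = k := by exact_mod_cast heq
      omega
    · exact ⟨∅, fun h => absurd h hw⟩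
  choose Z hZ using hex
  let bad : En n → Finset ℂ := fun w => (Z w).filter fun l => z + w + l • b ∉ G
  let μ : En n → ℕ := fun w => (k - (Z w).card) * (k + 1) + (bad w).card
  have hmin : ∃ w₀ ∈ ball (0 : En n) δ, ∀ w ∈ ball (0 : En n) δ, μ w₀ ≤ μ w := by
    have hnon : (μ '' ball (0 : En n) δ).Nonempty := ⟨_, mem_image_of_mem _ h0mem⟩
    obtain ⟨w₀, hw₀, hμ⟩ := Nat.sInf_mem hnon
    exact ⟨w₀, hw₀, fun w hw => hμ ▸ Nat.sInf_le (mem_image_of_mem _ hw)⟩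
  obtain ⟨w₀, hw₀, hmin⟩ := hmin
  refine ⟨w₀, (mem_ball_zero_iff.1 hw₀).trans_le (min_le_left _ _), (ht w₀ (hsubδ hw₀)).1,
    (ht w₀ (hsubδ hw₀)).2, ?_⟩
  by_contra! hbad
  obtain ⟨l₁, hl₁, hfl₁, hGl₁⟩ := hbad
  have hl₁Z : l₁ ∈ Z w₀ := ((hZ w₀ hw₀).1 l₁).2 ⟨hl₁, hfl₁⟩
  have hl₁bad : l₁ ∈ bad w₀ := Finset.mem_filter.2 ⟨hl₁Z, hGl₁⟩
  -- a common radius for the zeros of the minimal slice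
  have hpair : ∀ᶠ ε in 𝓝[>] (0 : ℝ), ∀ i ∈ Z w₀, ∀ j ∈ Z w₀, i ≠ j → 2 * ε < dist i j := by
    rw [Filter.eventually_all_finset]
    intro i _
    rw [Filter.eventually_all_finset]
    intro j _
    by_cases hij : i = j
    · exact Eventually.of_forall fun _ h => absurd hij h
    · have : 0 < dist i j / 2 := half_pos (dist_pos.2 hij)
      filter_upwards [Ioo_mem_nhdsGT this] with ε hε _
      have := hε.2
      linarith
  have hsub : ∀ᶠ ε in 𝓝[>] (0 : ℝ), ∀ i ∈ Z w₀, closedBall i ε ⊆ ball (0 : ℂ) r := by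
    rw [Filter.eventually_all_finset]
    intro i hi
    have := isOpen_ball.mem_nhds (((hZ w₀ hw₀).1 i).1 hi).1
    obtain ⟨ε, hε, h⟩ := Metric.mem_nhds_iff.1 this
    filter_upwards [Ioo_mem_nhdsGT hε] with ε' hε'
    exact (closedBall_subset_ball hε'.2).trans h
  have hgood : ∀ᶠ ε in 𝓝[>] (0 : ℝ), ∀ i ∈ Z w₀, z + w₀ + i • b ∈ G →
      ∀ w ∈ ball w₀ ε, ∀ l ∈ ball i ε, f (z + w + l • b) = 0 → z + w + l • b ∈ G := by
    rw [Filter.eventually_all_finset]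
    intro i hi
    by_cases hiG : z + w₀ + i • b ∈ G
    · have : ∀ᶠ y : En n × ℂ in 𝓝 (w₀, i), f (z + y.1 + y.2 • b) = 0 → z + y.1 + y.2 • b ∈ G :=
        (continuous_slice z b).continuousAt.eventually (hGo _ hiG)
      obtain ⟨ε, hε, h⟩ := Metric.eventually_nhds_iff_ball.1 this
      filter_upwards [Ioo_mem_nhdsGT hε] with ε' hε' _ w hw l hl
      refine h (w, l) ?_
      rw [← ball_prod_same]
      exact ⟨ball_subset_ball hε'.2.le hw, ball_subset_ball hε'.2.le hl⟩
    · exact Eventually.of_forall fun _ h => absurd h hiG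
  obtain ⟨ε, ⟨⟨e1, e2⟩, e3⟩, hε⟩ := (((hpair.and hsub).and hgood).and self_mem_nhdsWithin).exists
  have hε : 0 < ε := hε
  have hzer : ∀ᶠ w in 𝓝 w₀, ∀ i ∈ Z w₀, ∃ l ∈ ball i ε, f (z + w + l • b) = 0 := by
    rw [Filter.eventually_all_finset]
    intro i hi
    have hiZ := ((hZ w₀ hw₀).1 i).1 hi
    have hcl : closedBall i ε ⊆ closedBall 0 r := (e2 i hi).trans ball_subset_closedBall
    have h1 : ∀ l ∈ sphere i ε, f (z + w₀ + l • b) ≠ 0 := by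
      intro l hl hl0
      have hlr := e2 i hi (sphere_subset_closedBall hl)
      have hlZ : l ∈ Z w₀ := ((hZ w₀ hw₀).1 l).2 ⟨hlr, hl0⟩
      have hne' : i ≠ l := by
        rintro rfl
        rw [mem_sphere, dist_self] at hl
        exact hε.ne hl
      have := e1 i hi l hlZ hne'
      rw [dist_comm, mem_sphere.1 hl] at this
      linarith
    have h2 : ∀ᶠ w in 𝓝 w₀, ∀ l ∈ sphere i ε,
        ‖f (z + w + i • b)‖ < ‖f (z + w + l • b)‖ := by
      refine (isCompact_sphere i ε).eventually_forall_of_forall_eventually ?_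
      intro l hl
      have m1 := (ht w₀ (hsubδ hw₀)).1 l (hcl (sphere_subset_closedBall hl))
      have m2 := (ht w₀ (hsubδ hw₀)).1 i (ball_subset_closedBall hiZ.1)
      have c1 := hcont (w₀, l) m1
      have c2 : ContinuousAt (fun y : En n × ℂ => f (z + y.1 + i • b)) (w₀, l) :=
        ContinuousAt.comp (f := fun y : En n × ℂ => z + y.1 + i • b) (hf _ m2).continuousAt
          (by fun_prop)
      exact c2.norm.eventually_lt c1.norm (by
        simp only [hiZ.2, norm_zero]
        exact norm_pos_iff.2 (h1 l hl))
    filter_upwards [h2, isOpen_ball.mem_nhds hw₀] with w hw hwδ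
    exact exists_zero_of_norm_lt hε ((han w hwδ).differentiableOn.mono hcl) hw
  have ev1 : ∀ᶠ w in 𝓝 w₀, w ∈ ball (0 : En n) δ := isOpen_ball.mem_nhds hw₀
  have ev2 : ∀ᶠ w in 𝓝 w₀, w ∈ ball w₀ ε := ball_mem_nhds w₀ hε
  obtain ⟨η, hη, hηz⟩ := Metric.eventually_nhds_iff_ball.1 (hzer.and (ev1.and ev2))
  have hx' : z + w₀ + l₁ • b ∈ Ω := (ht w₀ (hsubδ hw₀)).1 l₁ (ball_subset_closedBall hl₁)
  obtain ⟨x'', hx''G, hx''d⟩ := Metric.mem_closure_iff.1 (hGd _ hx' hfl₁) η hη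
  set w₁ := w₀ + (x'' - (z + w₀ + l₁ • b)) with hw₁
  have hw₁η : w₁ ∈ ball w₀ η := by
    rw [mem_ball_iff_norm, hw₁, add_sub_cancel_left, ← dist_eq_norm, dist_comm]
    exact hx''d
  obtain ⟨hz1, hw₁δ, hw₁ε⟩ := hηz w₁ hw₁η
  have hpt : z + w₁ + l₁ • b = x'' := by rw [hw₁]; abel
  have hex2 : ∀ i, ∃ l, i ∈ Z w₀ → l ∈ ball i ε ∧ f (z + w₁ + l • b) = 0 := by
    intro i
    by_cases hi : i ∈ Z w₀
    · obtain ⟨l, h1, h2⟩ := hz1 i hi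
      exact ⟨l, fun _ => ⟨h1, h2⟩⟩
    · exact ⟨0, fun h => absurd h hi⟩
  choose g hg using hex2
  have hgZ : ∀ i ∈ Z w₀, g i ∈ Z w₁ := fun i hi =>
    ((hZ w₁ hw₁δ).1 _).2 ⟨e2 i hi (ball_subset_closedBall (hg i hi).1), (hg i hi).2⟩
  have hdisj : ∀ i ∈ Z w₀, ∀ j ∈ Z w₀, ∀ l, l ∈ ball i ε → l ∈ ball j ε → i = j := by
    intro i hi j hj l h1 h2
    by_contra hij
    have h3 := e1 i hi j hj hij
    have h4 := dist_triangle_left i j l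
    rw [mem_ball] at h1 h2
    linarith
  have hginj : Set.InjOn g (Z w₀) := fun i hi j hj hij =>
    hdisj i hi j hj (g i) (hg i hi).1 (hij ▸ (hg j hj).1)
  have hcard : (Z w₀).card ≤ (Z w₁).card := Finset.card_le_card_of_injOn g hgZ hginj
  have hbk : (bad w₁).card ≤ k := (Finset.card_filter_le _ _).trans (hZ w₁ hw₁δ).2
  have hμ := hmin w₁ hw₁δ
  rcases hcard.lt_or_eq with hlt | heq
  · have hk1 := (hZ w₁ hw₁δ).2
    have : (k - (Z w₁).card) + 1 ≤ k - (Z w₀).card := by omega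
    have h5 : ((k - (Z w₁).card) + 1) * (k + 1) ≤ (k - (Z w₀).card) * (k + 1) :=
      Nat.mul_le_mul_right _ this
    simp only [μ] at hμ
    nlinarith
  · have himg : (Z w₀).image g = Z w₁ := by
      apply Finset.eq_of_subset_of_card_le
      · intro l hl
        obtain ⟨i, hi, rfl⟩ := Finset.mem_image.1 hl
        exact hgZ i hi
      · rw [Finset.card_image_of_injOn hginj, heq]
    have hl₁1 : l₁ ∈ Z w₁ := ((hZ w₁ hw₁δ).1 _).2 ⟨hl₁, by rw [hpt]; exact hGV _ hx''G⟩
    have hgl₁ : g l₁ = l₁ := by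
      rw [← himg, Finset.mem_image] at hl₁1
      obtain ⟨j, hj, hjl⟩ := hl₁1
      have : l₁ = j := hdisj l₁ hl₁Z j hj l₁ (mem_ball_self hε) (hjl ▸ (hg j hj).1)
      rw [← this] at hjl
      exact hjl
    have hsubset : bad w₁ ⊆ ((bad w₀).erase l₁).image g := by
      intro l hl
      obtain ⟨hlZ, hlG⟩ := Finset.mem_filter.1 hl
      rw [← himg, Finset.mem_image] at hlZ
      obtain ⟨i, hi, rfl⟩ := hlZ
      refine Finset.mem_image_of_mem g (Finset.mem_erase.2 ⟨?_, Finset.mem_filter.2 ⟨hi, ?_⟩⟩)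
      · rintro rfl
        rw [hgl₁, hpt] at hlG
        exact hlG hx''G
      · intro hiG
        exact hlG (e3 i hi hiG w₁ hw₁ε _ (hg i hi).1 (hg i hi).2)
    have h6 : (bad w₁).card < (bad w₀).card := by
      calc (bad w₁).card ≤ (((bad w₀).erase l₁).image g).card := Finset.card_le_card hsubset
        _ ≤ ((bad w₀).erase l₁).card := Finset.card_image_le
        _ < (bad w₀).card := Finset.card_erase_lt_of_mem hl₁bad
    simp only [μ, heq] at hμ
    omega

/-- `f` is reduced at the origin. -/
def RedAt (f : En n → ℂ) : Prop :=
  ∀ᶠ x in 𝓝 (0 : En n), f x = 0 → x ∈ closure {z | f z = 0 ∧ fderiv ℂ f z ≠ 0}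

lemma LipGerm.continuousAt {f g : En n → ℂ} {φ ψ : En n → En n} {K r : ℝ}
    (H : LipGerm f g φ ψ K r) {y : En n} (hy : y ∈ ball (0 : En n) r) : ContinuousAt φ y := by
  have : LipschitzOnWith K.toNNReal φ (ball 0 r) := LipschitzOnWith.of_dist_le_mul
    fun x hx y hy => by
      rw [dist_eq_norm, dist_eq_norm, Real.coe_toNNReal _ (by linarith [H.hK])]
      exact H.lipφ x hx y hy
  exact this.continuousOn.continuousAt (isOpen_ball.mem_nhds hy)

lemma LipGerm.map_mem_ball {f g : En n → ℂ} {φ ψ : En n → En n} {K r : ℝ}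
    (H : LipGerm f g φ ψ K r) {s : ℝ} (hs : s ≤ r) {y : En n}
    (hy : y ∈ ball (0 : En n) (s / K)) : φ y ∈ ball (0 : En n) s := by
  have hK : 0 < K := lt_of_lt_of_le one_pos H.hK
  rw [mem_ball_zero_iff, lt_div_iff₀ hK] at hy
  have hyr : y ∈ ball (0 : En n) r := by
    rw [mem_ball_zero_iff]
    nlinarith [norm_nonneg y, H.hK]
  have := H.lipφ y hyr 0 (mem_ball_self H.hr)
  rw [H.φ0, sub_zero, sub_zero] at this
  rw [mem_ball_zero_iff]
  linarith

lemma LipGerm.ball_subset {f g : En n → ℂ} {φ ψ : En n → En n} {K r : ℝ}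
    (H : LipGerm f g φ ψ K r) {s : ℝ} (hs : 0 < s) : ball (0 : En n) (s / K) ⊆ ball 0 s :=
  ball_subset_ball (div_le_self hs.le H.hK)

lemma LipGerm.local_pair {f g : En n → ℂ} {φ ψ : En n → En n} {K r : ℝ}
    (H : LipGerm f g φ ψ K r) {y : En n} (hy : y ∈ ball (0 : En n) (r / K)) (hfy : f y = 0)
    (hf : AnalyticAt ℂ f y) (hg : AnalyticAt ℂ g (φ y)) (hf' : fderiv ℂ f y ≠ 0)
    (hg' : fderiv ℂ g (φ y) ≠ 0) :
    ∃ Ω ∈ 𝓝 y, IsOpen Ω ∧ ∃ a : ℤ, (a = 1 ∨ a = -1) ∧ ∃ u : En n → ℂ,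
      ContinuousOn u (Ω \ {z | f z = 0}) ∧
      ∀ z ∈ Ω \ {z | f z = 0}, g (φ z) = f z ^ a * Complex.exp (u z) := by
  have hyr : y ∈ ball (0 : En n) r := H.ball_subset H.hr hy
  have hφy : φ y ∈ ball (0 : En n) r := H.map_mem_ball le_rfl hy
  have e1 : ∀ᶠ z in 𝓝 y, z ∈ ball (0 : En n) r := isOpen_ball.mem_nhds hyr
  have e2 : ∀ᶠ z in 𝓝 (φ y), z ∈ ball (0 : En n) r := isOpen_ball.mem_nhds hφy
  exact _root_.local_pair hf.hasStrictFDerivAt hfy hf' hg.hasStrictFDerivAt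
    ((H.memφ y hyr).2 hfy) hg' (e1.mono fun z hz => H.continuousAt hz)
    (e2.mono fun z hz => H.symm.continuousAt hz) (e1.mono fun z hz => H.left z hz)
    (e1.mono fun z hz => H.memφ z hz) (e2.mono fun z hz => H.memψ z hz)

/-- Points where both hypersurfaces are smooth are dense. -/
lemma LipGerm.dense_good {f g : En n → ℂ} {φ ψ : En n → En n} {K r : ℝ}
    (H : LipGerm f g φ ψ K r) (hf : AnalyticAt ℂ f 0) (hg : AnalyticAt ℂ g 0) (hfr : RedAt f)
    (hgr : RedAt g) : ∃ s > 0, s ≤ r / K ∧ AnalyticOnNhd ℂ f (ball 0 s) ∧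
      (∀ z ∈ ball (0 : En n) s, AnalyticAt ℂ g (φ z)) ∧
      ∃ G : Set (En n), (∀ x ∈ G, f x = 0 ∧ fderiv ℂ f x ≠ 0 ∧ fderiv ℂ g (φ x) ≠ 0) ∧
        (∀ x ∈ G, ∀ᶠ y in 𝓝 x, f y = 0 → y ∈ G) ∧
        ∀ x ∈ ball (0 : En n) s, f x = 0 → x ∈ closure G := by
  have hK : 0 < K := lt_of_lt_of_le one_pos H.hK
  obtain ⟨ρ₁, hρ₁, h1⟩ := Metric.eventually_nhds_iff_ball.1 (hf.eventually_analyticAt.and hfr)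
  obtain ⟨ρ₂, hρ₂, h2⟩ := Metric.eventually_nhds_iff_ball.1 (hg.eventually_analyticAt.and hgr)
  set s₂ := min ρ₂ r with hs₂
  have hs₂p : 0 < s₂ := lt_min hρ₂ H.hr
  set s := min ρ₁ (s₂ / K) with hs
  have hsp : 0 < s := by positivity
  have hs1 : ball (0 : En n) s ⊆ ball 0 ρ₁ := ball_subset_ball (min_le_left _ _)
  have hs2 : ball (0 : En n) s ⊆ ball 0 (s₂ / K) := ball_subset_ball (min_le_right _ _)
  have hsr : ball (0 : En n) s ⊆ ball 0 r :=
    (hs2.trans (H.ball_subset hs₂p)).trans (ball_subset_ball (min_le_right _ _))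
  have hφs : ∀ z ∈ ball (0 : En n) s, φ z ∈ ball (0 : En n) s₂ := fun z hz =>
    H.map_mem_ball (min_le_right _ _) (hs2 hz)
  have hgφ : ∀ z ∈ ball (0 : En n) s, AnalyticAt ℂ g (φ z) := fun z hz =>
    (h2 _ (ball_subset_ball (min_le_left _ _) (hφs z hz))).1
  have evf : ∀ x ∈ ball (0 : En n) s, fderiv ℂ f x ≠ 0 → ∀ᶠ y in 𝓝 x, fderiv ℂ f y ≠ 0 :=
    fun x hx h => (h1 x (hs1 hx)).1.fderiv.continuousAt.eventually_ne h
  have evg : ∀ x ∈ ball (0 : En n) s, fderiv ℂ g (φ x) ≠ 0 →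
      ∀ᶠ y in 𝓝 x, fderiv ℂ g (φ y) ≠ 0 := fun x hx h =>
    (H.continuousAt (hsr hx)).eventually ((hgφ x hx).fderiv.continuousAt.eventually_ne h)
  refine ⟨s, hsp, ?_, fun z hz => (h1 z (hs1 hz)).1, hgφ,
    {x | x ∈ ball (0 : En n) s ∧ f x = 0 ∧ fderiv ℂ f x ≠ 0 ∧ fderiv ℂ g (φ x) ≠ 0},
    fun x hx => hx.2, ?_, ?_⟩
  · exact (min_le_right _ _).trans (by gcongr; exact min_le_right _ _)
  · rintro x ⟨hx, hx0, hxf, hxg⟩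
    filter_upwards [evf x hx hxf, evg x hx hxg, isOpen_ball.mem_nhds hx] with y a1 a2 a3 a4
    exact ⟨a3, a4, a1, a2⟩
  · intro x hx hx0
    rw [mem_closure_iff_nhds]
    intro t ht
    have hnt : t ∩ ball 0 s ∈ 𝓝 x := inter_mem ht (isOpen_ball.mem_nhds hx)
    obtain ⟨x', hx't, hx'0, hx'f⟩ := mem_closure_iff_nhds.1
      ((h1 x (hs1 hx)).2 hx0) (interior (t ∩ ball 0 s)) (isOpen_interior.mem_nhds
        (mem_interior_iff_mem_nhds.2 hnt))
    have hx'U := interior_subset hx't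
    have hx's : x' ∈ ball (0 : En n) s := hx'U.2
    have hgx' : g (φ x') = 0 := (H.memφ x' (hsr hx's)).2 hx'0
    have hφx'r : φ x' ∈ ball (0 : En n) r :=
      ball_subset_ball (min_le_right _ _) (hφs x' hx's)
    have hψc : ContinuousAt ψ (φ x') := H.symm.continuousAt hφx'r
    have hnb : ∀ᶠ y in 𝓝 (φ x'), ψ y ∈ interior (t ∩ ball 0 s) ∧ fderiv ℂ f (ψ y) ≠ 0 ∧
        y ∈ ball (0 : En n) r := by
      have hxx : ψ (φ x') = x' := H.left x' (hsr hx's)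
      have a1 : ∀ᶠ z in 𝓝 (ψ (φ x')), z ∈ interior (t ∩ ball 0 s) ∧ fderiv ℂ f z ≠ 0 := by
        rw [hxx]
        have ev0 : ∀ᶠ z in 𝓝 x', z ∈ interior (t ∩ ball 0 s) := isOpen_interior.mem_nhds hx't
        exact ev0.and (evf x' hx's hx'f)
      filter_upwards [hψc.eventually a1, isOpen_ball.mem_nhds hφx'r] with y a1 a2
      exact ⟨a1.1, a1.2, a2⟩
    obtain ⟨y, ⟨hy1, hy2, hy3⟩, hy0, hyg⟩ := mem_closure_iff_nhds.1
      ((h2 _ (ball_subset_ball (min_le_left _ _) (hφs x' hx's))).2 hgx') _ hnb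
    refine ⟨ψ y, (interior_subset hy1).1, (interior_subset hy1).2, (H.memψ y hy3).2 hy0, hy2, ?_⟩
    rwa [H.right y hy3]

end

section
variable {n : ℕ}

lemma HasIdx.const_mul {F : ℂ → ℂ} {c : ℂ} {r : ℝ} {a : ℤ} (h : HasIdx F c r a) {d : ℂ}
    (hd : d ≠ 0) : HasIdx (fun z => d * F z) c r a := by
  obtain ⟨u, hu, hF⟩ := h
  refine ⟨fun z => Complex.log d + u z, continuousOn_const.add hu, fun z hz => ?_⟩
  simp only
  rw [Complex.exp_add, Complex.exp_log hd, hF z hz]; ring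

lemma HasIdx.ne_zero {F : ℂ → ℂ} {c : ℂ} {r : ℝ} {a : ℤ} (hr : 0 < r) (h : HasIdx F c r a) {z : ℂ}
    (hz : z ∈ sphere c r) : F z ≠ 0 := by
  obtain ⟨u, hu, hF⟩ := h
  rw [hF z hz]
  exact mul_ne_zero (zpow_ne_zero _ (sub_ne_zero_of_mem_sphere hr hz)) (Complex.exp_ne_zero _)

lemma hasIdx_zero_of_closedBall {F : ℂ → ℂ} {c : ℂ} {r : ℝ} (hF : ContinuousOn F (closedBall c r))
    (h : ∀ z ∈ closedBall c r, F z ≠ 0) : HasIdx F c r 0 := by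
  obtain ⟨u, hu, h1⟩ := exists_log_of_convex (convex_closedBall c r) hF h
  exact (hasIdx_exp (hu.mono sphere_subset_closedBall)).congr fun z hz =>
    h1 z (sphere_subset_closedBall hz)

/-- The local index of `g ∘ φ` along a line at a point where both hypersurfaces are smooth is, up
to sign, that of `f`. -/
lemma locIdx_of_local_pair {f : En n → ℂ} {F : En n → ℂ} {y b : En n} {l₀ : ℂ} {m : ℤ}
    (hm : LocIdx (fun l : ℂ => f (y + l • b)) l₀ m) {Ω : Set (En n)} (hΩ : Ω ∈ 𝓝 (y + l₀ • b))
    {a : ℤ} {u : En n → ℂ} (hu : ContinuousOn u (Ω \ {z | f z = 0}))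
    (h : ∀ z ∈ Ω \ {z | f z = 0}, F z = f z ^ a * Complex.exp (u z)) :
    LocIdx (fun l : ℂ => F (y + l • b)) l₀ (a * m) := by
  have hc : ContinuousAt (fun l : ℂ => y + l • b) l₀ := by fun_prop
  obtain ⟨ε₁, hε₁, hb⟩ := Metric.mem_nhds_iff.1 (hc.preimage_mem_nhds hΩ)
  obtain ⟨ε₂, hε₂, v, hv, hfv⟩ := hm
  have hmt : MapsTo (fun l : ℂ => y + l • b) (ball l₀ (min ε₁ ε₂) \ {l₀})
      (Ω \ {z | f z = 0}) := by
    intro l hl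
    refine ⟨hb (ball_subset_ball (min_le_left _ _) hl.1), ?_⟩
    have := hfv l ⟨ball_subset_ball (min_le_right _ _) hl.1, hl.2⟩
    simp only [mem_ofPred_eq, this]
    exact mul_ne_zero (zpow_ne_zero _ (sub_ne_zero.2 hl.2)) (Complex.exp_ne_zero _)
  have h1 : LocIdx (fun l : ℂ => Complex.exp (u (y + l • b))) l₀ 0 :=
    locIdx_zero_of_exp (lt_min hε₁ hε₂) (hu.comp (by fun_prop) hmt) (fun l _ => rfl)
  have h2 := (LocIdx.zpow ⟨ε₂, hε₂, v, hv, hfv⟩ a).mul h1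
  rw [add_zero] at h2
  refine h2.congr ?_
  rw [eventually_nhdsWithin_iff, Metric.eventually_nhds_iff_ball]
  exact ⟨_, lt_min hε₁ hε₂, fun l hl hne => h _ (hmt ⟨hl, hne⟩)⟩

/-- Sum of local indices of `g ∘ φ` on a disc all of whose zeros are good. -/
lemma LipGerm.natAbs_index_le {f g : En n → ℂ} {φ ψ : En n → En n} {K r₀ : ℝ}
    (H : LipGerm f g φ ψ K r₀) (hf : AnalyticAt ℂ f 0) (hg : AnalyticAt ℂ g 0) (hfr : RedAt f)
    (hgr : RedAt g) : ∃ s > 0, ContinuousOn f (ball 0 s) ∧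
      ContinuousOn (fun y => g (φ y)) (ball 0 s) ∧ ∀ (z b : En n) (r : ℝ) (k : ℕ) (c : ℤ), 0 < r →
      (∀ l ∈ closedBall (0 : ℂ) r, z + l • b ∈ ball (0 : En n) s) →
      HasIdx (fun l : ℂ => f (z + l • b)) 0 r k →
      HasIdx (fun l : ℂ => g (φ (z + l • b))) 0 r c → c.natAbs ≤ k := by
  obtain ⟨s, hs, hsr, hfs, hgs, G, hG, hGo, hGd⟩ := H.dense_good hf hg hfr hgr
  have hsub : ball (0 : En n) s ⊆ ball 0 (r₀ / K) := ball_subset_ball hsr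
  have hsr₀ : ball (0 : En n) s ⊆ ball 0 r₀ := hsub.trans (H.ball_subset H.hr)
  have hcg : ∀ y ∈ ball (0 : En n) s, ContinuousAt (fun y => g (φ y)) y := fun y hy =>
    ContinuousAt.comp (f := φ) (hgs y hy).continuousAt (H.continuousAt (hsr₀ hy))
  refine ⟨s, hs, hfs.continuousOn, fun y hy => (hcg y hy).continuousWithinAt,
    fun z b r k c hr hD hIf hIg => ?_⟩
  have t2 : ∀ᶠ w in 𝓝 (0 : En n), ∀ l ∈ sphere (0 : ℂ) r,
      ‖g (φ (z + w + l • b)) - g (φ (z + l • b))‖ < ‖g (φ (z + l • b))‖ := by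
    refine (isCompact_sphere (0 : ℂ) r).eventually_forall_of_forall_eventually ?_
    intro l hl
    have hl' := hD l (sphere_subset_closedBall hl)
    have c1 : ContinuousAt (fun y : En n × ℂ => g (φ (z + y.1 + y.2 • b))) (0, l) :=
      ContinuousAt.comp (g := fun y => g (φ y)) (f := fun y : En n × ℂ => z + y.1 + y.2 • b)
        (hcg _ (by rw [add_zero]; exact hl')) (continuous_slice z b).continuousAt
    have c2 : ContinuousAt (fun y : En n × ℂ => g (φ (z + y.2 • b))) (0, l) :=
      ContinuousAt.comp (g := fun y => g (φ y)) (f := fun y : En n × ℂ => z + y.2 • b)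
        (hcg _ hl') (by fun_prop)
    have hne : g (φ (z + l • b)) ≠ 0 := hIg.ne_zero hr hl
    have hlt : ‖g (φ (z + (0 : En n) + l • b)) - g (φ (z + l • b))‖ < ‖g (φ (z + l • b))‖ := by
      rw [add_zero, sub_self, norm_zero]
      exact norm_pos_iff.2 hne
    exact (c1.sub c2).norm.eventually_lt c2.norm hlt
  obtain ⟨δ, hδ, hδt⟩ := Metric.eventually_nhds_iff_ball.1 t2
  obtain ⟨w, hw, hwD, hwS, hwG⟩ := exists_good_slice isOpen_ball hfs hr hD
    (fun l hl => hIf.ne_zero hr hl) hGo (fun x hx => (hG x hx).1) hGd hδ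
  have han : AnalyticOnNhd ℂ (fun l : ℂ => f (z + w + l • b)) (closedBall 0 r) := fun l hl =>
    analyticAt_slice (hfs _ (hwD l hl))
  have hIf' := hIf.of_norm_sub_lt hr (han.continuousOn.mono sphere_subset_closedBall) hwS
  have hcont : ContinuousOn (fun l : ℂ => g (φ (z + w + l • b))) (closedBall 0 r) := fun l hl =>
    (ContinuousAt.comp (g := fun y => g (φ y)) (f := fun l : ℂ => z + w + l • b) (hcg _ (hwD l hl))
      (by fun_prop)).continuousWithinAt
  have hIg' := hIg.of_norm_sub_lt hr (hcont.mono sphere_subset_closedBall)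
    (hδt w (mem_ball_zero_iff.2 hw))
  obtain ⟨Z, m, hZ, hm, hI⟩ := exists_zeros_finset hr han (fun l hl => hIf'.ne_zero hr hl)
  have hkm : (∑ l ∈ Z, m l : ℕ) = k := by exact_mod_cast hI.unique hr hIf'
  have hloc : ∀ l, ∃ a : ℤ, l ∈ Z → ((a = 1 ∨ a = -1) ∧
      LocIdx (fun l : ℂ => g (φ (z + w + l • b))) l (a * m l)) := by
    intro l
    by_cases hl : l ∈ Z
    · obtain ⟨hlb, hl0⟩ := (hZ l).1 hl
      obtain ⟨h1, h2, h3⟩ := hG _ (hwG l hlb hl0)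
      have hys := hwD l (ball_subset_closedBall hlb)
      obtain ⟨Ω, hΩ, -, a, ha, u, hu, hgu⟩ := H.local_pair (hsub hys) h1 (hfs _ hys)
        (hgs _ hys) h2 h3
      exact ⟨a, fun _ => ⟨ha, locIdx_of_local_pair (F := fun y => g (φ y)) (hm l hl).1 hΩ hu hgu⟩⟩
    · exact ⟨0, fun h => absurd h hl⟩
  choose a ha using hloc
  have hsum := hasIdx_sum_locIdx hr (fun l => a l * m l) Z
    (fun l : ℂ => g (φ (z + w + l • b))) (fun l hl => ((hZ l).1 hl).1)
    (hcont.mono sdiff_subset) (by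
      intro l hl h0
      have hys := hwD l hl.1
      rw [H.memφ _ (hsr₀ hys)] at h0
      rcases (mem_closedBall.1 hl.1).lt_or_eq with h | h
      · exact hl.2 (Finset.mem_coe.2 ((hZ l).2 ⟨h, h0⟩))
      · exact hIf'.ne_zero hr h h0) (fun l hl => (ha l hl).2)
  have hc := hIg'.unique hr hsum
  rw [hc, ← hkm]
  refine (Int.natAbs_sum_le _ _).trans (Finset.sum_le_sum fun l hl => ?_)
  rcases (ha l hl).1 with h | h <;> simp [h]

/-- Relative multiplicities of the tangent cones at corresponding smooth points do not
increase. -/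
theorem rel_mult_le {f g : En n → ℂ} {φ ψ h h' : En n → En n} {K r₀ : ℝ} {𝒰 : Ultrafilter ℝ}
    (H : LipGerm f g φ ψ K r₀) (B : IsBlowup φ ψ 𝒰 h h') (L : LipPair h h' K)
    (hf : AnalyticAt ℂ f 0) (hg : AnalyticAt ℂ g 0) (hfr : RedAt f) (hgr : RedAt g)
    {m m' : ℕ} {P Q : MvPolynomial (Fin n) ℂ} (hP : IsInit f m P) (hQ : IsInit g m' Q)
    {p u q v : MvPolynomial (Fin n) ℂ} {k l : ℕ} (hk : 1 ≤ k) (hl : 1 ≤ l)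
    (hPp : P = p ^ k * u) (hQq : Q = q ^ l * v) {x : En n}
    (hpx : pev p x = 0) (hp' : fderiv ℂ (pev p) x ≠ 0) (hux : pev u x ≠ 0)
    (hqx : pev q (h x) = 0) (hq' : fderiv ℂ (pev q) (h x) ≠ 0) (hvx : pev v (h x) ≠ 0) :
    l ≤ k := by
  have hKpos : 0 < K := lt_of_lt_of_le one_pos H.hK
  have hhc : Continuous h := L.continuous
  have hh'c : Continuous h' := L.symm.continuous
  have hk0 : k ≠ 0 := by omega
  have hl0 : l ≠ 0 := by omega
  have hPz : ∀ z, pev P z = pev p z ^ k * pev u z := fun z => by simp [hPp]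
  have hQz : ∀ z, pev Q z = pev q z ^ l * pev v z := fun z => by simp [hQq]
  have hiff : ∀ z, pev u z ≠ 0 → pev v (h z) ≠ 0 → (pev q (h z) = 0 ↔ pev p z = 0) := by
    intro z h1 h2
    have := B.pev_eq_zero_iff H L hf hg hP hQ z
    simpa [hPz, hQz, h1, h2, hk0, hl0] using this
  have evu : ∀ᶠ z in 𝓝 x, pev u z ≠ 0 := (continuous_pev u).continuousAt.eventually_ne hux
  have evv : ∀ᶠ z in 𝓝 x, pev v (h z) ≠ 0 :=
    ((continuous_pev v).comp hhc).continuousAt.eventually_ne hvx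
  have hxx : h' (h x) = x := L.left x
  obtain ⟨Ω, hΩ, -, a, ha, e, he, hqe⟩ := local_pair (φ := h) (ψ := h')
    (hasStrictFDerivAt_pev p x) hpx hp' (hasStrictFDerivAt_pev q (h x)) hqx hq'
    (Eventually.of_forall fun z => hhc.continuousAt)
    (Eventually.of_forall fun z => hh'c.continuousAt) (Eventually.of_forall L.left)
    (by filter_upwards [evu, evv] with z h1 h2 using hiff z h1 h2)
    (by
      have t : Tendsto h' (𝓝 (h x)) (𝓝 x) := by
        have := hh'c.tendsto (h x); rwa [hxx] at this
      filter_upwards [t.eventually evu, t.eventually evv] with w h1 h2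
      have := hiff (h' w) h1 h2
      rw [L.right] at this
      exact this.symm)
  obtain ⟨b, hb⟩ := exists_apply_ne_zero hp'
  have hN : Ω ∩ ({z | pev u z ≠ 0} ∩ {z | pev v (h z) ≠ 0}) ∈ 𝓝 x :=
    inter_mem hΩ (inter_mem evu evv)
  obtain ⟨R, ⟨hI1, hR2⟩, hR⟩ := (((hasIdx_line (hasStrictFDerivAt_pev p x) hpx hb).and
    (eventually_nhdsGT_line_mem (b := b) hN)).and self_mem_nhdsWithin).exists
  have hR : 0 < R := hR
  have hlc : Continuous fun c : ℂ => x + c • b := by fun_prop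
  have hIP : HasIdx (fun c : ℂ => pev P (x + c • b)) 0 R k := by
    have h1 := (hI1.zpow k).mul hR (hasIdx_zero_of_closedBall (F := fun c : ℂ => pev u (x + c • b))
      ((continuous_pev u).comp hlc).continuousOn (fun c hc => (hR2 c hc).2.1))
    rw [mul_one, add_zero] at h1
    exact h1.congr fun c _ => by simp [hPz]
  have hmt : MapsTo (fun c : ℂ => x + c • b) (sphere 0 R) (Ω \ {z | pev p z = 0}) := fun c hc =>
    ⟨(hR2 c (sphere_subset_closedBall hc)).1, hI1.ne_zero hR hc⟩
  have hIq : HasIdx (fun c : ℂ => pev q (h (x + c • b))) 0 R a := by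
    have h1 := (hI1.zpow a).mul hR (hasIdx_exp (he.comp hlc.continuousOn hmt))
    rw [mul_one, add_zero] at h1
    exact h1.congr fun c hc => hqe _ (hmt hc)
  have hIQ : HasIdx (fun c : ℂ => pev Q (h (x + c • b))) 0 R (l * a) := by
    have h1 := (hIq.zpow l).mul hR (hasIdx_zero_of_closedBall
      (F := fun c : ℂ => pev v (h (x + c • b)))
      ((continuous_pev v).comp (hhc.comp hlc)).continuousOn (fun c hc => (hR2 c hc).2.2))
    rw [add_zero] at h1
    exact h1.congr fun c _ => by simp [hQz]
  obtain ⟨s, hs, hcf, hcg, hidx⟩ := H.natAbs_index_le hf hg hfr hgr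
  obtain ⟨c₁, hc₁, hmin₁⟩ := (isCompact_sphere (0 : ℂ) R).exists_isMinOn
    (NormedSpace.sphere_nonempty.2 hR.le) ((continuous_pev P).comp hlc).norm.continuousOn
  obtain ⟨c₂, hc₂, hmin₂⟩ := (isCompact_sphere (0 : ℂ) R).exists_isMinOn
    (NormedSpace.sphere_nonempty.2 hR.le)
    ((continuous_pev Q).comp (hhc.comp hlc)).norm.continuousOn
  set μ₁ := ‖pev P (x + c₁ • b)‖ with hμ₁
  set μ₂ := ‖pev Q (h (x + c₂ • b))‖ with hμ₂
  have hμ₁0 : 0 < μ₁ := norm_pos_iff.2 (hIP.ne_zero hR hc₁)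
  have hμ₂0 : 0 < μ₂ := norm_pos_iff.2 (hIQ.ne_zero hR hc₂)
  set C := ‖x‖ + R * ‖b‖ with hC
  have hnorm : ∀ c ∈ closedBall (0 : ℂ) R, ‖x + c • b‖ ≤ C := by
    intro c hc
    rw [mem_closedBall_zero_iff] at hc
    calc ‖x + c • b‖ ≤ ‖x‖ + ‖c • b‖ := norm_add_le _ _
      _ ≤ C := by rw [norm_smul, hC]; gcongr
  have hhn : ∀ y : En n, ‖y‖ ≤ C → ‖h y‖ ≤ K * C := by
    intro y hy
    have := L.lip y 0
    rw [L.zero, sub_zero, sub_zero] at this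
    exact this.trans (by gcongr)
  have huc : UniformContinuousOn (pev Q) (closedBall 0 (K * C + 1)) :=
    (isCompact_closedBall _ _).uniformContinuousOn_of_continuous (continuous_pev Q).continuousOn
  rw [Metric.uniformContinuousOn_iff] at huc
  obtain ⟨η, hη, hηQ⟩ := huc (μ₂ / 4) (by positivity)
  have hη' : 0 < min η 1 := lt_min hη one_pos
  have ev : ∀ᶠ t : ℝ in (𝒰 : Filter ℝ), 0 < t := B.le self_mem_nhdsWithin
  have ev1 := (hP.rescale C (half_pos hμ₁0)).filter_mono B.le
  have ev2 := (hQ.rescale (K * C + 1) (show 0 < μ₂ / 4 by positivity)).filter_mono B.le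
  have ev3 := B.uniform H.hr hKpos H.lipφ L.lip C hη'
  have ev4 := (eventually_smul_mem_ball (n := n) hs C).filter_mono B.le
  obtain ⟨t, ht, e1, e2, e3, e4⟩ := (ev.and (ev1.and (ev2.and (ev3.and ev4)))).exists
  have ht0 : (t : ℂ) ≠ 0 := by exact_mod_cast ht.ne'
  have hpt : ∀ c : ℂ, (t : ℂ) • x + c • ((t : ℂ) • b) = (t : ℂ) • (x + c • b) := by
    intro c; rw [smul_add, smul_comm c]
  have hD : ∀ c ∈ closedBall (0 : ℂ) R, (t : ℂ) • x + c • ((t : ℂ) • b) ∈ ball (0 : En n) s := by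
    intro c hc
    rw [hpt]; exact e4 _ (hnorm c hc)
  have hlc' : Continuous fun c : ℂ => (t : ℂ) • x + c • ((t : ℂ) • b) := by fun_prop
  have hIf : HasIdx (fun c : ℂ => f ((t : ℂ) • x + c • ((t : ℂ) • b))) 0 R k := by
    refine (hIP.const_mul (pow_ne_zero m ht0)).of_norm_sub_lt hR
      (hcf.comp hlc'.continuousOn fun c hc => hD c (sphere_subset_closedBall hc)) ?_
    intro c hc
    rw [hpt]
    refine (e1 _ (hnorm c (sphere_subset_closedBall hc))).trans_lt ?_
    rw [norm_mul, norm_pow, Complex.norm_real, Real.norm_of_nonneg ht.le]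
    have h3 : μ₁ ≤ ‖pev P (x + c • b)‖ := hmin₁ hc
    have : 0 < t ^ m := by positivity
    nlinarith
  have hIg : HasIdx (fun c : ℂ => g (φ ((t : ℂ) • x + c • ((t : ℂ) • b)))) 0 R (l * a) := by
    refine (hIQ.const_mul (pow_ne_zero m' ht0)).of_norm_sub_lt hR
      (hcg.comp hlc'.continuousOn fun c hc => hD c (sphere_subset_closedBall hc)) ?_
    intro c hc
    have hy := hnorm c (sphere_subset_closedBall hc)
    set y := x + c • b with hydef
    have hd := e3 y hy
    have hyK := hhn y hy
    have hyn : ‖rescaled φ t y‖ ≤ K * C + 1 := by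
      have h1 := norm_sub_norm_le (rescaled φ t y) (h y)
      have h2 := hd.trans_le (min_le_right _ _)
      linarith
    have h4 := e2 _ hyn
    rw [smul_rescaled ht] at h4
    have h5 := hηQ _ (mem_closedBall_zero_iff.2 hyn) (h y)
      (mem_closedBall_zero_iff.2 (by linarith))
      (by rw [dist_eq_norm]; exact hd.trans_le (min_le_left _ _))
    rw [dist_eq_norm] at h5
    have h6 : μ₂ ≤ ‖pev Q (h y)‖ := hmin₂ hc
    have htm : 0 < t ^ m' := by positivity
    have hnt : ‖(t : ℂ) ^ m'‖ = t ^ m' := by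
      rw [norm_pow, Complex.norm_real, Real.norm_of_nonneg ht.le]
    rw [hpt, ← hydef]
    calc ‖g (φ ((t : ℂ) • y)) - (t : ℂ) ^ m' * pev Q (h y)‖
        = ‖(g (φ ((t : ℂ) • y)) - (t : ℂ) ^ m' * pev Q (rescaled φ t y)) +
          (t : ℂ) ^ m' * (pev Q (rescaled φ t y) - pev Q (h y))‖ := by congr 1; ring
      _ ≤ μ₂ / 4 * t ^ m' + t ^ m' * (μ₂ / 4) := by
        refine (norm_add_le _ _).trans (add_le_add h4 ?_)
        rw [norm_mul, hnt]
        gcongr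
      _ < t ^ m' * μ₂ := by nlinarith
      _ ≤ ‖(t : ℂ) ^ m' * pev Q (h y)‖ := by
        rw [norm_mul, hnt]; gcongr
  have := hidx _ _ R k _ hR hD hIf hIg
  rw [Int.natAbs_mul] at this
  rcases ha with h | h <;> simpa [h] using this

end

section
variable {E : Type*} [NormedAddCommGroup E] [NormedSpace ℝ E] [FiniteDimensional ℝ E]

lemma det_smul_id_add_pos {A : E →L[ℝ] E} {C s : ℝ} (hA : ∀ x, ‖A x‖ ≤ C * ‖x‖) (hs : C < s)
    (hs0 : 0 < s) : 0 < (s • ContinuousLinearMap.id ℝ E + A).det := by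
  have hne : ∀ τ ∈ Icc (0 : ℝ) 1, (s • ContinuousLinearMap.id ℝ E + τ • A).det ≠ 0 := by
    intro τ hτ h0
    have hk := LinearMap.bot_lt_ker_of_det_eq_zero (f := ((s • ContinuousLinearMap.id ℝ E + τ • A :
      E →L[ℝ] E) : E →ₗ[ℝ] E)) h0
    obtain ⟨x, hx, hx0⟩ := (Submodule.ne_bot_iff _).1 hk.ne'
    have hx' : s • x + τ • A x = 0 := by simpa using hx
    have h1 : s * ‖x‖ = τ * ‖A x‖ := by
      have : s • x = -(τ • A x) := eq_neg_of_add_eq_zero_left hx'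
      have := congrArg norm this
      rwa [norm_neg, norm_smul, norm_smul, Real.norm_of_nonneg hs0.le,
        Real.norm_of_nonneg hτ.1] at this
    have h2 : 0 < ‖x‖ := norm_pos_iff.2 hx0
    have h3 : τ * ‖A x‖ ≤ ‖A x‖ := mul_le_of_le_one_left (norm_nonneg _) hτ.2
    nlinarith [hA x]
  have hcont : Continuous fun τ : ℝ => (s • ContinuousLinearMap.id ℝ E + τ • A).det :=
    ContinuousLinearMap.continuous_det.comp (by fun_prop)
  have h0 : 0 < (s • ContinuousLinearMap.id ℝ E + (0 : ℝ) • A).det := by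
    have : (s • ContinuousLinearMap.id ℝ E + (0 : ℝ) • A).det = s ^ Module.finrank ℝ E := by
      rw [zero_smul, add_zero]
      simp [ContinuousLinearMap.det]
    rw [this]; positivity
  by_contra hneg
  have h1 : (s • ContinuousLinearMap.id ℝ E + (1 : ℝ) • A).det ≤ 0 := by simpa using hneg
  obtain ⟨τ, hτ, hτ0⟩ := intermediate_value_Icc' (zero_le_one (α := ℝ)) hcont.continuousOn
    (⟨h1, h0.le⟩ : (0 : ℝ) ∈ Icc _ _)
  exact hne τ hτ hτ0

lemma surjective_smul_add {Ψ : E → E} {C : NNReal} (hΨ : LipschitzWith C Ψ) {s : ℝ}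
    (hs : (C : ℝ) < s) : Function.Surjective fun x => s • x + Ψ x := by
  have hs0 : 0 < s := lt_of_le_of_lt C.2 hs
  have hl : ApproximatesLinearOn (fun x => x + s⁻¹ • Ψ x)
      ((ContinuousLinearEquiv.refl ℝ E : E ≃L[ℝ] E) : E →L[ℝ] E) univ (C / s.toNNReal) := by
    refine LipschitzOnWith.approximatesLinearOn ?_ |>.mono_num le_rfl
    refine LipschitzWith.lipschitzOnWith (LipschitzWith.of_dist_le_mul fun x y => ?_)
    have e : ∀ x, (((fun x => x + s⁻¹ • Ψ x) -
        ⇑((ContinuousLinearEquiv.refl ℝ E : E ≃L[ℝ] E) : E →L[ℝ] E)) x : E) = s⁻¹ • Ψ x := by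
      intro x; simp
    rw [e, e, dist_smul₀, Real.norm_of_nonneg (by positivity)]
    have := hΨ.dist_le_mul x y
    rw [NNReal.coe_div, Real.coe_toNNReal _ hs0.le, div_eq_inv_mul, mul_assoc]
    gcongr
  have hsur := hl.surjective (by
    by_cases hE : Subsingleton E
    · exact Or.inl hE
    · right
      have := not_subsingleton_iff_nontrivial.1 hE
      have h1 : ‖((ContinuousLinearEquiv.refl ℝ E).symm : E →L[ℝ] E)‖₊ = 1 := by
        rw [← NNReal.coe_inj]
        exact ContinuousLinearMap.norm_id
      rw [h1, inv_one, ← NNReal.coe_lt_coe, NNReal.coe_div, Real.coe_toNNReal _ hs0.le]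
      exact (div_lt_one hs0).2 hs)
  intro y
  obtain ⟨x, hx⟩ := hsur (s⁻¹ • y)
  refine ⟨x, ?_⟩
  have : s • (x + s⁻¹ • Ψ x) = y := by
    rw [show x + s⁻¹ • Ψ x = s⁻¹ • y from hx, smul_smul, mul_inv_cancel₀ hs0.ne', one_smul]
  rwa [smul_add, smul_smul, mul_inv_cancel₀ hs0.ne', one_smul] at this

lemma injective_smul_add {Ψ : E → E} {C : NNReal} (hΨ : LipschitzWith C Ψ) {s : ℝ}
    (hs : (C : ℝ) < s) : Function.Injective fun x => s • x + Ψ x := by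
  have hs0 : 0 < s := lt_of_le_of_lt C.2 hs
  intro x y hxy
  by_contra hne
  have h1 : s • (x - y) = Ψ y - Ψ x := by
    have : s • x + Ψ x = s • y + Ψ y := hxy
    rw [smul_sub, sub_eq_sub_iff_add_eq_add, this, add_comm]
  have h2 := congrArg norm h1
  rw [norm_smul, Real.norm_of_nonneg hs0.le] at h2
  have h3 := hΨ.dist_le_mul y x
  rw [dist_eq_norm, ← h2, dist_comm, dist_eq_norm] at h3
  have : 0 < ‖x - y‖ := norm_pos_iff.2 (sub_ne_zero.2 hne)
  nlinarith

variable [MeasurableSpace E] [BorelSpace E] (μ : MeasureTheory.Measure E) [μ.IsAddHaarMeasure]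

lemma image_eq_image_of_eqOn_compl {α β : Type*} {f g : α → β} {s : Set α}
    (hf : Function.Bijective f) (hg : Function.Bijective g) (h : EqOn f g sᶜ) :
    f '' s = g '' s := by
  have := h.image_eq
  rw [image_compl_eq hf, image_compl_eq hg] at this
  exact compl_injective this

lemma integral_det_smul_add_eq {Ψ₀ Ψ₁ : E → E} (h0 : ContDiff ℝ 1 Ψ₀) (h1 : ContDiff ℝ 1 Ψ₁)
    {C : NNReal} (hl0 : LipschitzWith C Ψ₀) (hl1 : LipschitzWith C Ψ₁) {R : ℝ}
    (heq : ∀ x, R ≤ ‖x‖ → Ψ₀ x = Ψ₁ x) {s : ℝ} (hs : (C : ℝ) < s) :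
    ∫ x in ball (0 : E) R, (s • ContinuousLinearMap.id ℝ E + fderiv ℝ Ψ₀ x).det ∂μ =
      ∫ x in ball (0 : E) R, (s • ContinuousLinearMap.id ℝ E + fderiv ℝ Ψ₁ x).det ∂μ := by
  have hs0 : 0 < s := lt_of_le_of_lt C.2 hs
  have key : ∀ Ψ : E → E, ContDiff ℝ 1 Ψ → LipschitzWith C Ψ →
      ∫ x in ball (0 : E) R, (s • ContinuousLinearMap.id ℝ E + fderiv ℝ Ψ x).det ∂μ =
      ∫ _ in (fun x => s • x + Ψ x) '' ball (0 : E) R, (1 : ℝ) ∂μ := by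
    intro Ψ hΨ hl
    rw [MeasureTheory.integral_image_eq_integral_abs_det_fderiv_smul μ measurableSet_ball
      (f := fun x => s • x + Ψ x) (f' := fun x => s • ContinuousLinearMap.id ℝ E + fderiv ℝ Ψ x)
      (fun x _ => ((((hasFDerivAt_id x).const_smul s).add
        (hΨ.differentiable one_ne_zero x).hasFDerivAt)).hasFDerivWithinAt)
      (injective_smul_add hl hs).injOn]
    refine MeasureTheory.setIntegral_congr_fun measurableSet_ball fun x _ => ?_
    have hb : ∀ v, ‖fderiv ℝ Ψ x v‖ ≤ C * ‖v‖ := fun v =>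
      (ContinuousLinearMap.le_opNorm _ v).trans
        (mul_le_mul_of_nonneg_right (norm_fderiv_le_of_lipschitz ℝ hl) (norm_nonneg _))
    simp only [smul_eq_mul, mul_one]
    exact (abs_of_pos (det_smul_id_add_pos hb hs hs0)).symm
  rw [key _ h0 hl0, key _ h1 hl1]
  rw [image_eq_image_of_eqOn_compl
    ⟨injective_smul_add hl0 hs, surjective_smul_add hl0 hs⟩
    ⟨injective_smul_add hl1 hs, surjective_smul_add hl1 hs⟩]
  intro x hx
  have : R ≤ ‖x‖ := by simpa using hx
  simp [heq x this]

lemma exists_interpolation_weights (N : ℕ) {s : ℝ} (hs : 0 < s) :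
    ∃ c : ℕ → ℝ, ∀ p : Polynomial ℝ, p.natDegree ≤ N →
      p.eval 0 = ∑ j ∈ Finset.range (N + 1), c j * p.eval (s * (j + 1)) := by
  have hinj : Set.InjOn (fun j : ℕ => s * ((j : ℝ) + 1)) (Finset.range (N + 1)) := by
    intro i _ j _ hij
    have := mul_left_cancel₀ hs.ne' hij
    exact_mod_cast add_right_cancel this
  refine ⟨fun j => (Lagrange.basis (Finset.range (N + 1)) (fun j : ℕ => s * ((j : ℝ) + 1)) j).eval 0,
    fun p hp => ?_⟩
  have hd : p.degree < (Finset.range (N + 1)).card := by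
    rw [Finset.card_range]
    exact lt_of_le_of_lt Polynomial.degree_le_natDegree (by exact_mod_cast Nat.lt_succ_of_le hp)
  have := congrArg (Polynomial.eval 0) (Lagrange.eq_interpolate hinj hd)
  rw [this, Lagrange.interpolate_apply, Polynomial.eval_finsetSum]
  refine Finset.sum_congr rfl fun j _ => ?_
  rw [Polynomial.eval_mul, Polynomial.eval_C, mul_comm]

lemma exists_polynomial_det (A : E →L[ℝ] E) : ∃ p : Polynomial ℝ,
    p.natDegree ≤ Module.finrank ℝ E ∧
      ∀ s : ℝ, p.eval s = (s • ContinuousLinearMap.id ℝ E + A).det := by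
  refine ⟨(-(A : E →ₗ[ℝ] E)).charpoly, (LinearMap.charpoly_natDegree _).le, fun s => ?_⟩
  rw [LinearMap.eval_charpoly, ContinuousLinearMap.det]
  congr 1
  ext x
  simp [Algebra.algebraMap_eq_smul_one]

lemma integrableOn_ball_of_continuous {u : E → ℝ} (hu : Continuous u) (R : ℝ) :
    MeasureTheory.IntegrableOn u (ball (0 : E) R) μ :=
  (hu.continuousOn.integrableOn_compact (isCompact_closedBall (0 : E) R)).mono_set
    ball_subset_closedBall

/-- The integral of the Jacobian over a ball depends only on the boundary behaviour. -/
lemma integral_det_fderiv_eq {Φ₀ Φ₁ : E → E} (h0 : ContDiff ℝ 1 Φ₀) (h1 : ContDiff ℝ 1 Φ₁) {R : ℝ}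
    (hR : 0 < R) (heq : ∀ x, R ≤ ‖x‖ → Φ₀ x = Φ₁ x) :
    ∫ x in ball (0 : E) R, (fderiv ℝ Φ₀ x).det ∂μ =
      ∫ x in ball (0 : E) R, (fderiv ℝ Φ₁ x).det ∂μ := by
  let χ : ContDiffBump (0 : E) := ⟨R, R + 1, hR, by linarith⟩
  have hc : ∀ Φ : E → E, ContDiff ℝ 1 Φ → ContDiff ℝ 1 (fun x => χ x • Φ x) := fun Φ h =>
    χ.contDiff.smul h
  have hsupp : ∀ Φ : E → E, HasCompactSupport (fun x => χ x • Φ x) := fun Φ =>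
    χ.hasCompactSupport.smul_right
  obtain ⟨C0, hC0⟩ := ContDiff.lipschitzWith_of_hasCompactSupport (hsupp Φ₀) (hc _ h0) one_ne_zero
  obtain ⟨C1, hC1⟩ := ContDiff.lipschitzWith_of_hasCompactSupport (hsupp Φ₁) (hc _ h1) one_ne_zero
  have hC0' := hC0.weaken (le_max_left C0 C1)
  have hC1' := hC1.weaken (le_max_right C0 C1)
  set C := max C0 C1
  obtain ⟨c, hcw⟩ := exists_interpolation_weights (Module.finrank ℝ E)
    (show (0 : ℝ) < C + 1 by positivity)
  have key : ∀ Φ : E → E, ContDiff ℝ 1 Φ → ∫ x in ball (0 : E) R, (fderiv ℝ Φ x).det ∂μ =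
      ∑ j ∈ Finset.range (Module.finrank ℝ E + 1), c j * ∫ x in ball (0 : E) R,
        ((((C : ℝ) + 1) * (j + 1)) • ContinuousLinearMap.id ℝ E +
          fderiv ℝ (fun x => χ x • Φ x) x).det ∂μ := by
    intro Φ hΦ
    simp_rw [← MeasureTheory.integral_const_mul]
    rw [← MeasureTheory.integral_finsetSum]
    · refine MeasureTheory.setIntegral_congr_fun measurableSet_ball fun x hx => ?_
      have e : fderiv ℝ (fun x => χ x • Φ x) x = fderiv ℝ Φ x := by
        refine Filter.EventuallyEq.fderiv_eq ?_
        filter_upwards [isOpen_ball.mem_nhds hx] with y hy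
        rw [χ.one_of_mem_closedBall (ball_subset_closedBall hy), one_smul]
      obtain ⟨p, hp, hpe⟩ := exists_polynomial_det (fderiv ℝ Φ x)
      have := hcw p hp
      simp only [hpe, zero_smul, zero_add] at this
      simp only [e]
      exact this
    · intro j _
      refine (integrableOn_ball_of_continuous μ ?_ R).const_mul (c j)
      exact ContinuousLinearMap.continuous_det.comp
        (continuous_const.add ((hc Φ hΦ).continuous_fderiv one_ne_zero))
  rw [key _ h0, key _ h1]
  refine Finset.sum_congr rfl fun j _ => ?_
  rw [integral_det_smul_add_eq μ (hc _ h0) (hc _ h1) hC0' hC1' (fun x hx => by rw [heq x hx])]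
  have : (0 : ℝ) ≤ C := C.2
  have hj : (0 : ℝ) ≤ j := j.cast_nonneg
  nlinarith
end

section
variable {E : Type*} [NormedAddCommGroup E] [NormedSpace ℝ E]

/-- `f` and `g` are homotopic on the unit sphere as maps into the complement of `0`. -/
def SphHom (f g : E → E) : Prop :=
  ∃ H : ℝ × E → E, ContinuousOn H (Icc 0 1 ×ˢ sphere 0 1) ∧
    (∀ z ∈ Icc (0 : ℝ) 1 ×ˢ sphere (0 : E) 1, H z ≠ 0) ∧
    (∀ x ∈ sphere (0 : E) 1, H (0, x) = f x) ∧ ∀ x ∈ sphere (0 : E) 1, H (1, x) = g x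

lemma SphHom.symm {f g : E → E} (h : SphHom f g) : SphHom g f := by
  obtain ⟨H, hc, hne, h0, h1⟩ := h
  have hm : MapsTo (fun z : ℝ × E => (1 - z.1, z.2)) (Icc (0 : ℝ) 1 ×ˢ sphere (0 : E) 1)
      (Icc (0 : ℝ) 1 ×ˢ sphere (0 : E) 1) := fun z hz =>
    ⟨⟨by linarith [hz.1.2], by linarith [hz.1.1]⟩, hz.2⟩
  refine ⟨fun z => H (1 - z.1, z.2), hc.comp (by fun_prop) hm, fun z hz => hne _ (hm hz),
    fun x hx => ?_, fun x hx => ?_⟩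
  · simpa using h1 x hx
  · simpa using h0 x hx

lemma SphHom.trans {f g k : E → E} (h : SphHom f g) (h' : SphHom g k) : SphHom f k := by
  obtain ⟨H, hc, hne, h0, h1⟩ := h
  obtain ⟨H', hc', hne', h0', h1'⟩ := h'
  have hm : MapsTo (fun z : ℝ × E => (2 * z.1, z.2)) (Icc (0 : ℝ) (1 / 2) ×ˢ sphere (0 : E) 1)
      (Icc (0 : ℝ) 1 ×ˢ sphere (0 : E) 1) := fun z hz =>
    ⟨⟨by linarith [hz.1.1], by linarith [hz.1.2]⟩, hz.2⟩
  have hm' : MapsTo (fun z : ℝ × E => (2 * z.1 - 1, z.2)) (Icc (1 / 2 : ℝ) 1 ×ˢ sphere (0 : E) 1)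
      (Icc (0 : ℝ) 1 ×ˢ sphere (0 : E) 1) := fun z hz =>
    ⟨⟨by linarith [hz.1.1], by linarith [hz.1.2]⟩, hz.2⟩
  set K : ℝ × E → E := fun z => if z.1 ≤ 1 / 2 then H (2 * z.1, z.2) else H' (2 * z.1 - 1, z.2)
    with hK
  have e1 : EqOn K (fun z => H (2 * z.1, z.2)) (Icc (0 : ℝ) (1 / 2) ×ˢ sphere (0 : E) 1) :=
    fun z hz => if_pos hz.1.2
  have e2 : EqOn K (fun z => H' (2 * z.1 - 1, z.2)) (Icc (1 / 2 : ℝ) 1 ×ˢ sphere (0 : E) 1) := by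
    intro z hz
    rcases hz.1.1.lt_or_eq with h | h
    · exact if_neg (not_le.2 h)
    · rw [hK]
      simp only [← h, le_refl, if_true]
      norm_num
      rw [h1 _ hz.2, h0' _ hz.2]
  have hu : Icc (0 : ℝ) 1 ×ˢ sphere (0 : E) 1 =
      Icc (0 : ℝ) (1 / 2) ×ˢ sphere (0 : E) 1 ∪ Icc (1 / 2 : ℝ) 1 ×ˢ sphere (0 : E) 1 := by
    rw [← union_prod, Icc_union_Icc_eq_Icc (by norm_num) (by norm_num)]
  refine ⟨K, ?_, ?_, fun x hx => ?_, fun x hx => ?_⟩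
  · rw [hu]
    exact ContinuousOn.union_of_isClosed ((hc.comp (by fun_prop) hm).congr e1)
      ((hc'.comp (by fun_prop) hm').congr e2) (isClosed_Icc.prod isClosed_sphere)
      (isClosed_Icc.prod isClosed_sphere)
  · intro z hz
    rw [hu] at hz
    rcases hz with hz | hz
    · rw [e1 hz]; exact hne _ (hm hz)
    · rw [e2 hz]; exact hne' _ (hm' hz)
  · have := e1 (x := (0, x)) ⟨⟨le_rfl, by norm_num⟩, hx⟩
    rw [this]; simpa using h0 x hx
  · have := e2 (x := (1, x)) ⟨⟨by norm_num, le_rfl⟩, hx⟩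
    rw [this]; norm_num; exact h1' x hx

lemma SphHom.of_segment {f g : E → E} (hf : ContinuousOn f (sphere 0 1))
    (hg : ContinuousOn g (sphere 0 1))
    (h : ∀ x ∈ sphere (0 : E) 1, ∀ t ∈ Icc (0 : ℝ) 1, f x + t • (g x - f x) ≠ 0) :
    SphHom f g := by
  have hm : MapsTo Prod.snd (Icc (0 : ℝ) 1 ×ˢ sphere (0 : E) 1) (sphere (0 : E) 1) :=
    fun z hz => hz.2
  have h1 := hf.comp continuousOn_snd hm
  have h2 := hg.comp continuousOn_snd hm
  exact ⟨fun z => f z.2 + z.1 • (g z.2 - f z.2),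
    h1.add (continuousOn_fst.smul (h2.sub h1)), fun z hz => h _ hz.2 _ hz.1, by simp, by simp⟩

lemma SphHom.map {f g : E → E} (h : SphHom f g) (L : E ≃L[ℝ] E) :
    SphHom (fun x => L (f x)) fun x => L (g x) := by
  obtain ⟨H, hc, hne, h0, h1⟩ := h
  exact ⟨fun z => L (H z), L.continuous.comp_continuousOn hc,
    fun z hz h => hne z hz (by simpa using h),
    fun x hx => by simp only [h0 x hx], fun x hx => by simp only [h1 x hx]⟩

lemma SphHom.congr {f g f' g' : E → E} (h : SphHom f g) (hf : EqOn f f' (sphere 0 1))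
    (hg : EqOn g g' (sphere 0 1)) : SphHom f' g' := by
  obtain ⟨H, hc, hne, h0, h1⟩ := h
  exact ⟨H, hc, hne, fun x hx => (h0 x hx).trans (hf hx), fun x hx => (h1 x hx).trans (hg hx)⟩

lemma SphHom.exists_extension {f g G κ : E → E} (h : SphHom f g) (hG : Continuous G)
    (hκ : Continuous κ) (hGf : ∀ x ∈ sphere (0 : E) 1, G x = f x)
    (hκg : ∀ x ∈ sphere (0 : E) 1, κ ((2 : ℝ) • x) = g x) :
    ∃ Φ : E → E, Continuous Φ ∧ (∀ x, ‖x‖ ≤ 1 → Φ x = G x) ∧ (∀ x, 2 ≤ ‖x‖ → Φ x = κ x) ∧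
      ∀ x, 1 ≤ ‖x‖ → ‖x‖ ≤ 2 → Φ x ≠ 0 := by
  obtain ⟨H, hc, hne, h0, h1⟩ := h
  set M : E → E := fun x => H (‖x‖ - 1, ‖x‖⁻¹ • x)
  have hm : MapsTo (fun x : E => (‖x‖ - 1, ‖x‖⁻¹ • x)) {x | 1 ≤ ‖x‖ ∧ ‖x‖ ≤ 2}
      (Icc (0 : ℝ) 1 ×ˢ sphere (0 : E) 1) := by
    intro x hx
    refine ⟨⟨by linarith [hx.1], by linarith [hx.2]⟩, ?_⟩
    have : ‖x‖ ≠ 0 := by linarith [hx.1]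
    simp [norm_smul, this]
  have hMc : ContinuousOn M {x | 1 ≤ ‖x‖ ∧ ‖x‖ ≤ 2} := by
    refine hc.comp ?_ hm
    refine (by fun_prop : ContinuousOn (fun x : E => ‖x‖ - 1) _).prodMk
      (ContinuousOn.smul (continuousOn_id.norm.inv₀ fun x hx => ?_) continuousOn_id)
    have := hx.1
    simp only [id]; linarith
  set Φ : E → E := fun x => if ‖x‖ ≤ 1 then G x else if ‖x‖ ≤ 2 then M x else κ x with hΦ
  have e1 : ∀ x, ‖x‖ ≤ 1 → Φ x = G x := fun x hx => if_pos hx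
  have e2 : ∀ x, 1 ≤ ‖x‖ ∧ ‖x‖ ≤ 2 → Φ x = M x := by
    intro x hx
    rcases hx.1.lt_or_eq with h | h
    · simp only [hΦ, not_le.2 h, hx.2, if_true, if_false]
    · rw [e1 x h.ge, hGf x (by simp [h])]
      simp only [M, ← h]
      simp [h0 x (by simp [h])]
  have e3 : ∀ x, 2 ≤ ‖x‖ → Φ x = κ x := by
    intro x hx
    rcases hx.lt_or_eq with h | h
    · simp only [hΦ, not_le.2 h, not_le.2 (by linarith : (1 : ℝ) < ‖x‖), if_false]
    · rw [e2 x ⟨by linarith, h.ge⟩]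
      have hs : (2 : ℝ)⁻¹ • x ∈ sphere (0 : E) 1 := by simp [norm_smul, ← h]
      simp only [M, ← h]
      rw [show (2 : ℝ) - 1 = 1 by norm_num, h1 _ hs, ← hκg _ hs, smul_smul]
      norm_num
  refine ⟨Φ, ?_, e1, e3, fun x h1 h2 => by rw [e2 x ⟨h1, h2⟩]; exact hne _ (hm ⟨h1, h2⟩)⟩
  rw [← continuousOn_univ]
  have hu : (univ : Set E) = {x | ‖x‖ ≤ 1} ∪ {x | 1 ≤ ‖x‖ ∧ ‖x‖ ≤ 2} ∪ {x | 2 ≤ ‖x‖} := by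
    ext x
    simp only [mem_univ, mem_union, mem_ofPred_eq, true_iff]
    rcases le_total ‖x‖ 1 with h | h <;> rcases le_total ‖x‖ 2 with h' | h' <;> tauto
  have c1 : IsClosed {x : E | ‖x‖ ≤ 1} := isClosed_le continuous_norm continuous_const
  have c2 : IsClosed {x : E | 1 ≤ ‖x‖ ∧ ‖x‖ ≤ 2} :=
    (isClosed_le continuous_const continuous_norm).inter
      (isClosed_le continuous_norm continuous_const)
  have c3 : IsClosed {x : E | 2 ≤ ‖x‖} := isClosed_le continuous_const continuous_norm
  rw [hu]
  exact ContinuousOn.union_of_isClosed (ContinuousOn.union_of_isClosed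
    (hG.continuousOn.congr e1) (hMc.congr e2) c1 c2) (hκ.continuousOn.congr e3) (c1.union c2) c3

variable [FiniteDimensional ℝ E]

lemma exists_contDiff_det_fderiv_eq_weight (y₀ : E) {N : Set E} (hN : N ∈ 𝓝 y₀) :
    ∃ (θ : E → E) (w : E → ℝ), ContDiff ℝ 1 θ ∧ Continuous w ∧
      (∀ y, (fderiv ℝ θ y).det = w y) ∧ (∀ y, 0 ≤ w y) ∧ 0 < w y₀ ∧ ∀ y ∉ N, w y = 0 := by
  let L := (Module.finBasis ℝ E).equivFunL
  have hN' : L.symm ⁻¹' N ∈ 𝓝 (L y₀) :=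
    L.symm.continuous.continuousAt.preimage_mem_nhds (by simpa using hN)
  obtain ⟨ρ, hρ, hb⟩ := Metric.mem_nhds_iff.1 hN'
  let β : ℝ → ℝ := fun s => max 0 (ρ - |s|)
  have hβ : Continuous β := by fun_prop
  let η : ℝ → ℝ := fun s => ∫ x in (0 : ℝ)..s, β x
  have hη : ∀ s, HasDerivAt η (β s) s := fun s => (hβ.integral_hasStrictDerivAt 0 s).hasDerivAt
  have hηc : ContDiff ℝ 1 η := contDiff_one_iff_deriv.2
    ⟨fun s => (hη s).differentiableAt, by rw [funext fun s => (hη s).deriv]; exact hβ⟩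
  let T : (Fin (Module.finrank ℝ E) → ℝ) → Fin (Module.finrank ℝ E) → ℝ :=
    fun z i => η (z i - L y₀ i)
  have hT : ContDiff ℝ 1 T := contDiff_pi.2 fun i => hηc.comp (by fun_prop)
  let D : (Fin (Module.finrank ℝ E) → ℝ) → Fin (Module.finrank ℝ E) → ℝ →L[ℝ] ℝ :=
    fun z i => ContinuousLinearMap.toSpanSingleton ℝ (β (z i - L y₀ i))
  have hTd : ∀ z, HasFDerivAt T (ContinuousLinearMap.pi fun i => (D z i).comp
      (ContinuousLinearMap.proj i)) z := by
    intro z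
    refine hasFDerivAt_pi.2 fun i => ?_
    have h1 : HasDerivAt (fun s => η (s - L y₀ i)) (β (z i - L y₀ i)) (z i) :=
      HasDerivAt.comp_sub_const (z i) (L y₀ i) (hη _)
    have h2 := h1.hasFDerivAt.comp z
      (ContinuousLinearMap.proj (R := ℝ) (φ := fun _ : Fin (Module.finrank ℝ E) => ℝ) i).hasFDerivAt
    exact h2
  refine ⟨fun y => L.symm (T (L y)), fun y => ∏ i, β (L y i - L y₀ i),
    L.symm.contDiff.comp (hT.comp L.contDiff), ?_, fun y => ?_, fun y => ?_, ?_, fun y hy => ?_⟩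
  · refine continuous_finsetProd _ fun i _ => hβ.comp ?_
    exact ((continuous_apply i).comp L.continuous).sub continuous_const
  · have h1 : HasFDerivAt (fun y => L.symm (T (L y))) ((L.symm : _ →L[ℝ] E).comp
        ((ContinuousLinearMap.pi fun i => (D (L y) i).comp (ContinuousLinearMap.proj i)).comp
          (L : E →L[ℝ] _))) y :=
      L.symm.hasFDerivAt.comp y ((hTd (L y)).comp y L.hasFDerivAt)
    rw [h1.fderiv]
    have h2 := LinearMap.det_conj ((ContinuousLinearMap.pi fun i => (D (L y) i).comp
      (ContinuousLinearMap.proj i) : _ →L[ℝ] _) : (Fin (Module.finrank ℝ E) → ℝ) →ₗ[ℝ] _)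
      L.symm.toLinearEquiv
    have h3 := ContinuousLinearMap.det_pi (D (L y))
    refine (h2.trans h3).trans ?_
    refine Finset.prod_congr rfl fun i _ => ?_
    simp [D, ContinuousLinearMap.det]
  · exact Finset.prod_nonneg fun i _ => le_max_left _ _
  · exact Finset.prod_pos fun i _ => by simp [β, hρ]
  · by_contra hne
    apply hy
    have : L y ∈ ball (L y₀) ρ := by
      rw [mem_ball, dist_pi_lt_iff hρ]
      intro i
      rw [Real.dist_eq]
      by_contra! hge
      exact hne (Finset.prod_eq_zero (Finset.mem_univ i) (max_eq_left (by linarith)))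
    simpa using hb this

variable [MeasurableSpace E] [BorelSpace E] (μ : MeasureTheory.Measure E) [μ.IsAddHaarMeasure]

lemma det_fderiv_comp {θ Φ : E → E} (hθ : Differentiable ℝ θ) (hΦ : Differentiable ℝ Φ) (x : E) :
    (fderiv ℝ (fun x => θ (Φ x)) x).det = (fderiv ℝ θ (Φ x)).det * (fderiv ℝ Φ x).det := by
  rw [show (fun x => θ (Φ x)) = θ ∘ Φ from rfl, fderiv_comp x (hθ _) (hΦ _)]
  exact LinearMap.det_comp _ _

/-- Comparison of the weighted degrees of `G` and `κ`. -/
lemma SphHom.integral_eq {f g G κ : E → E} (h : SphHom f g) (hG : ContDiff ℝ 1 G)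
    (hκ : ContDiff ℝ 1 κ) (hGf : ∀ x ∈ sphere (0 : E) 1, G x = f x)
    (hκg : ∀ x ∈ sphere (0 : E) 1, κ ((2 : ℝ) • x) = g x)
    (hG0 : ∀ x, 1 / 2 ≤ ‖x‖ → ‖x‖ ≤ 1 → G x ≠ 0) (hκ0 : ∀ x, 2 ≤ ‖x‖ → κ x ≠ 0) :
    ∃ c > 0, ∀ (θ : E → E) (w : E → ℝ), ContDiff ℝ 1 θ → (∀ y, (fderiv ℝ θ y).det = w y) →
      (∀ y ∉ ball (0 : E) c, w y = 0) →
      ∫ x in ball (0 : E) (1 / 2), w (G x) * (fderiv ℝ G x).det ∂μ =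
        ∫ x in ball (0 : E) 3, w (κ x) * (fderiv ℝ κ x).det ∂μ := by
  obtain ⟨Φ, hΦ, e1, e2, e3⟩ := h.exists_extension hG.continuous hκ.continuous hGf hκg
  have hΦ0 : ∀ x, 1 / 2 ≤ ‖x‖ → Φ x ≠ 0 := by
    intro x hx
    rcases le_total ‖x‖ 1 with h1 | h1
    · rw [e1 x h1]; exact hG0 x hx h1
    rcases le_total ‖x‖ 2 with h2 | h2
    · exact e3 x h1 h2
    · rw [e2 x h2]; exact hκ0 x h2
  have hcpt : IsCompact {x : E | 1 / 2 ≤ ‖x‖ ∧ ‖x‖ ≤ 3} := by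
    refine (isCompact_closedBall (0 : E) 3).of_isClosed_subset ?_ fun x hx => by simpa using hx.2
    exact (isClosed_le continuous_const continuous_norm).inter
      (isClosed_le continuous_norm continuous_const)
  obtain ⟨c, hc, hcb⟩ : ∃ c > 0, ∀ x, 1 / 2 ≤ ‖x‖ → ‖x‖ ≤ 3 → 2 * c ≤ ‖Φ x‖ := by
    rcases ({x : E | 1 / 2 ≤ ‖x‖ ∧ ‖x‖ ≤ 3}).eq_empty_or_nonempty with h | h
    · exact ⟨1, one_pos, fun x h1 h2 => absurd (show x ∈ {x : E | 1 / 2 ≤ ‖x‖ ∧ ‖x‖ ≤ 3} from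
        ⟨h1, h2⟩) (by rw [h]; exact notMem_empty _)⟩
    · obtain ⟨x, hx, hmin⟩ := hcpt.exists_isMinOn h hΦ.norm.continuousOn
      have hp : 0 < ‖Φ x‖ := norm_pos_iff.2 (hΦ0 x hx.1)
      refine ⟨‖Φ x‖ / 2, by positivity, fun y h1 h2 => ?_⟩
      have : ‖Φ x‖ ≤ ‖Φ y‖ := hmin (show y ∈ {x : E | 1 / 2 ≤ ‖x‖ ∧ ‖x‖ ≤ 3} from ⟨h1, h2⟩)
      linarith
  refine ⟨c, hc, fun θ w hθ hw hsupp => ?_⟩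
  have hU : (ball (0 : E) 1 ∪ {x | 2 < ‖x‖}) ∈ 𝓝ˢ ({x : E | ‖x‖ ≤ 1 / 2} ∪ {x | 3 ≤ ‖x‖}) := by
    refine (isOpen_ball.union (isOpen_lt continuous_const continuous_norm)).mem_nhdsSet.2 ?_
    rintro x (hx | hx)
    · left
      have : ‖x‖ ≤ 1 / 2 := hx
      simp only [mem_ball_zero_iff]; linarith
    · right
      have : 3 ≤ ‖x‖ := hx
      simp only [mem_ofPred_eq]; linarith
  have hUs : ContDiffOn ℝ 1 Φ (ball (0 : E) 1 ∪ {x | 2 < ‖x‖}) := by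
    rintro x (hx | hx)
    · refine ((hG.contDiffAt (x := x)).congr_of_eventuallyEq ?_).contDiffWithinAt
      filter_upwards [isOpen_ball.mem_nhds hx] with y hy using e1 y (mem_ball_zero_iff.1 hy).le
    · refine ((hκ.contDiffAt (x := x)).congr_of_eventuallyEq ?_).contDiffWithinAt
      filter_upwards [(isOpen_lt continuous_const continuous_norm).mem_nhds hx] with y hy
        using e2 y (le_of_lt hy)
  obtain ⟨Φ', hΦ', hd, hS, -⟩ := hΦ.exists_contDiff_approx_and_eqOn 1
    (continuous_const (y := c)) (fun _ => hc)
    ((isClosed_le continuous_norm continuous_const).union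
      (isClosed_le continuous_const continuous_norm)) hU hUs
  have hΦ'1 : ContDiff ℝ 1 Φ' := hΦ'
  have hθd := hθ.differentiable one_ne_zero
  have hvol := integral_det_fderiv_eq μ (Φ₀ := fun x => θ (Φ' x)) (Φ₁ := fun x => θ (κ x))
    (hθ.comp hΦ'1) (hθ.comp hκ) (R := 3) (by norm_num) (fun x hx => by
      show θ (Φ' x) = θ (κ x)
      rw [hS (Or.inr hx), e2 x (by linarith)])
  simp only [det_fderiv_comp hθd (hΦ'1.differentiable one_ne_zero),
    det_fderiv_comp hθd (hκ.differentiable one_ne_zero), hw] at hvol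
  rw [← hvol]
  rw [MeasureTheory.setIntegral_eq_of_subset_of_forall_sdiff_eq_zero measurableSet_ball
    (ball_subset_ball (by norm_num : (1 / 2 : ℝ) ≤ 3))]
  · refine MeasureTheory.setIntegral_congr_fun measurableSet_ball fun x hx => ?_
    have hev : Φ' =ᶠ[𝓝 x] G := by
      filter_upwards [isOpen_ball.mem_nhds hx] with y hy
      have hy' : ‖y‖ < 1 / 2 := mem_ball_zero_iff.1 hy
      rw [hS (Or.inl hy'.le), e1 y (by linarith)]
    simp only [hev.fderiv_eq, hev.eq_of_nhds]
  · rintro x ⟨hx, hx'⟩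
    have h1 : ‖x‖ < 3 := mem_ball_zero_iff.1 hx
    have h2 : 1 / 2 ≤ ‖x‖ := by simpa using hx'
    rw [hsupp, zero_mul]
    intro hlt
    have h3 := hd x
    have h4 := hcb x h2 h1.le
    rw [dist_comm, dist_eq_norm] at h3
    have h5 := norm_sub_norm_le (Φ x) (Φ' x)
    have h6 : ‖Φ' x‖ < c := mem_ball_zero_iff.1 hlt
    linarith

lemma setIntegral_pos_of_continuous {u : E → ℝ} (hu : Continuous u) (h0 : ∀ x, 0 ≤ u x) {R : ℝ}
    {x : E} (hx : x ∈ ball (0 : E) R) (hpos : 0 < u x) : 0 < ∫ y in ball (0 : E) R, u y ∂μ := by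
  rw [MeasureTheory.setIntegral_pos_iff_support_of_nonneg_ae (Eventually.of_forall h0)
    (integrableOn_ball_of_continuous μ hu R)]
  exact ((hu.isOpen_support).inter isOpen_ball).measure_pos μ ⟨x, hpos.ne', hx⟩

end

section
variable {N : ℕ}

lemma det_fderiv_real_eq {G : En N → En N} (hG : Differentiable ℂ G) (x : En N) :
    (fderiv ℝ G x).det = Complex.normSq (fderiv ℂ G x).det := by
  rw [(hG x).fderiv_restrictScalars ℝ]
  have := LinearMap.det_restrictScalars (R := ℝ) (f := (fderiv ℂ G x : En N →ₗ[ℂ] En N))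
  rw [Algebra.norm_complex_apply] at this
  exact this

/-- A holomorphic map vanishing only at the origin is essential on the unit sphere. -/
lemma not_sphHom_const {G : En N → En N} (hG : ContDiff ℂ 1 G) (hG0 : G 0 = 0)
    (hne : ∀ x, x ≠ 0 → G x ≠ 0) {v : En N} (hv : v ≠ 0) : ¬ SphHom G fun _ => v := by
  intro hS
  have : Nontrivial (En N) := ⟨⟨v, 0, hv⟩⟩
  have hcpt : IsCompact {x : En N | 1 / 2 ≤ ‖x‖ ∧ ‖x‖ ≤ 1} := by
    refine (isCompact_closedBall (0 : En N) 1).of_isClosed_subset ?_ fun x hx => by simpa using hx.2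
    exact (isClosed_le continuous_const continuous_norm).inter
      (isClosed_le continuous_norm continuous_const)
  obtain ⟨b, hb, hbb⟩ : ∃ b > 0, ∀ x : En N, 1 / 2 ≤ ‖x‖ → ‖x‖ ≤ 1 → b ≤ ‖G x‖ := by
    rcases ({x : En N | 1 / 2 ≤ ‖x‖ ∧ ‖x‖ ≤ 1}).eq_empty_or_nonempty with h | h
    · exact ⟨1, one_pos, fun x h1 h2 => absurd (show x ∈ {x : En N | 1 / 2 ≤ ‖x‖ ∧ ‖x‖ ≤ 1} from
        ⟨h1, h2⟩) (by rw [h]; exact notMem_empty _)⟩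
    · obtain ⟨x, hx, hmin⟩ := hcpt.exists_isMinOn h hG.continuous.norm.continuousOn
      refine ⟨‖G x‖, norm_pos_iff.2 (hne x ?_), fun y h1 h2 => hmin
        (show y ∈ {x : En N | 1 / 2 ≤ ‖x‖ ∧ ‖x‖ ≤ 1} from ⟨h1, h2⟩)⟩
      rintro rfl
      have := hx.1
      norm_num at this
  obtain ⟨ε, hε, hdet⟩ : ∃ ε ∈ Ioo (0 : ℝ) b,
      LinearMap.det (algebraMap ℂ (Module.End ℂ (En N)) (ε : ℂ) -
        (-(fderiv ℂ G 0 : En N →ₗ[ℂ] En N))) ≠ 0 := by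
    by_contra! hall
    have hp := (LinearMap.charpoly_monic (-(fderiv ℂ G 0 : En N →ₗ[ℂ] En N))).ne_zero
    have hinf : ((fun ε : ℝ => (ε : ℂ)) '' Ioo 0 b).Infinite :=
      (Ioo_infinite hb).image (Complex.ofReal_injective.injOn)
    refine hp (Polynomial.eq_zero_of_infinite_isRoot _ (hinf.mono ?_))
    rintro _ ⟨ε, hε, rfl⟩
    simpa [LinearMap.eval_charpoly] using hall ε hε
  set G' : En N → En N := fun x => G x + (ε : ℂ) • x with hG'
  have hG'c : ContDiff ℂ 1 G' := hG.add (contDiff_id.const_smul (ε : ℂ))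
  have hG'd : Differentiable ℂ G' := hG'c.differentiable one_ne_zero
  have hG'r : ContDiff ℝ 1 G' := hG'c.restrict_scalars ℝ
  have hnz : ∀ x : En N, 1 / 2 ≤ ‖x‖ → ‖x‖ ≤ 1 → ∀ t ∈ Icc (0 : ℝ) 1,
      G x + t • ((ε : ℂ) • x) ≠ 0 := by
    intro x h1 h2 t ht h0
    have := congrArg norm (eq_neg_of_add_eq_zero_left h0)
    rw [norm_neg, norm_smul, norm_smul, Complex.norm_real, Real.norm_of_nonneg hε.1.le,
      Real.norm_of_nonneg ht.1] at this
    have h3 := hbb x h1 h2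
    have h4 : t * (ε * ‖x‖) ≤ ε := by
      calc t * (ε * ‖x‖) ≤ 1 * (ε * 1) := by
            gcongr
            · exact mul_nonneg hε.1.le (norm_nonneg _)
            · exact ht.2
            · exact hε.1.le
        _ = ε := by ring
    linarith [hε.2]
  have hS' : SphHom G' fun _ => v := by
    refine (SphHom.of_segment (f := G) hG.continuous.continuousOn hG'c.continuous.continuousOn
      fun x hx t ht => ?_).symm.trans hS
    have hx' : ‖x‖ = 1 := by simpa using hx
    have := hnz x (by linarith) hx'.le t ht
    simpa [hG'] using this
  obtain ⟨c, hc, hvol⟩ := hS'.integral_eq MeasureTheory.volume hG'r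
    (κ := fun _ => v) contDiff_const (fun _ _ => rfl) (fun _ _ => rfl)
    (fun x h1 h2 => by simpa [hG'] using hnz x h1 h2 1 ⟨zero_le_one, le_rfl⟩) (fun _ _ => hv)
  obtain ⟨θ, w, hθ, hwc, hdw, hw0, hwp, hws⟩ :=
    exists_contDiff_det_fderiv_eq_weight (0 : En N) (ball_mem_nhds 0 hc)
  have h := hvol θ w hθ hdw hws
  have hr : ∫ x in ball (0 : En N) 3, w v * (fderiv ℝ (fun _ : En N => v) x).det = 0 := by
    refine (MeasureTheory.setIntegral_congr_fun (g := fun _ => (0 : ℝ)) measurableSet_ball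
      fun x _ => ?_).trans (by simp)
    have : (0 : En N →L[ℝ] En N).det = 0 := by
      simp [ContinuousLinearMap.det]
    simp [this]
  rw [hr] at h
  refine absurd h (ne_of_gt (setIntegral_pos_of_continuous MeasureTheory.volume
    ((hwc.comp hG'c.continuous).mul (ContinuousLinearMap.continuous_det.comp
      (hG'r.continuous_fderiv one_ne_zero))) (fun x => ?_) (x := 0)
    (mem_ball_self (by norm_num)) ?_))
  · refine mul_nonneg (hw0 _) ?_
    show 0 ≤ (fderiv ℝ G' x).det
    rw [det_fderiv_real_eq hG'd]; exact Complex.normSq_nonneg _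
  · refine mul_pos (by simpa [hG', hG0] using hwp) ?_
    show 0 < (fderiv ℝ G' 0).det
    rw [det_fderiv_real_eq hG'd]
    refine Complex.normSq_pos.2 ?_
    have : fderiv ℂ G' 0 = fderiv ℂ G 0 + (ε : ℂ) • ContinuousLinearMap.id ℂ (En N) :=
      ((hG.differentiable one_ne_zero 0).hasFDerivAt.add
        ((hasFDerivAt_id (𝕜 := ℂ) (0 : En N)).const_smul (ε : ℂ))).fderiv
    rw [this]
    convert hdet using 1
    rw [ContinuousLinearMap.det]
    congr 1
    ext x
    simp [Algebra.algebraMap_eq_smul_one, add_comm]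

lemma fderiv_smul_of_homogeneous {G : En N → En N} (hG : Differentiable ℂ G) {e : ℕ}
    (hhom : ∀ (c : ℂ) x, G (c • x) = c ^ (e + 1) • G x) {c : ℂ} (hc : c ≠ 0) (x : En N) :
    fderiv ℂ G (c • x) = c ^ e • fderiv ℂ G x := by
  have h1 : HasFDerivAt (fun y => G (c • y))
      ((fderiv ℂ G (c • x)).comp (c • ContinuousLinearMap.id ℂ (En N))) x :=
    (hG (c • x)).hasFDerivAt.comp x ((hasFDerivAt_id (𝕜 := ℂ) x).const_smul c)
  have h2 : HasFDerivAt (fun y => G (c • y)) (c ^ (e + 1) • fderiv ℂ G x) x := by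
    simp_rw [hhom]
    exact (hG x).hasFDerivAt.const_smul (c ^ (e + 1))
  have h3 := h1.unique h2
  ext1 v
  have h4 : c • fderiv ℂ G (c • x) v = c ^ (e + 1) • fderiv ℂ G x v := by
    have := congrArg (fun A : En N →L[ℂ] En N => A v) h3
    simpa using this
  have h5 : c • fderiv ℂ G (c • x) v = c • (c ^ e • fderiv ℂ G x v) := by
    rw [h4, smul_smul, pow_succ']
  exact smul_right_injective _ hc h5

lemma fderiv_zero_of_homogeneous {G : En N → En N} (hG : ContDiff ℂ 1 G) {e : ℕ} (he : e ≠ 0)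
    (hhom : ∀ (c : ℂ) x, G (c • x) = c ^ (e + 1) • G x) : fderiv ℂ G 0 = 0 := by
  have h := fderiv_smul_of_homogeneous (hG.differentiable one_ne_zero) hhom two_ne_zero 0
  rw [smul_zero] at h
  have h2 : (1 - (2 : ℂ) ^ e) • fderiv ℂ G 0 = 0 := by
    have := sub_smul (1 : ℂ) ((2 : ℂ) ^ e) (fderiv ℂ G 0)
    rw [this, one_smul, ← h, sub_self]
  refine (smul_eq_zero.1 h2).resolve_left fun h3 => ?_
  have h4 : ((2 : ℕ) : ℂ) ^ e = ((1 : ℕ) : ℂ) := by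
    push_cast; linear_combination -h3
  have h5 : 2 ^ e = 1 := by exact_mod_cast h4
  exact he (by simpa using h5)

lemma exists_injOn_nhds {G : En N → En N} (hG : ContDiff ℂ 1 G) {x : En N}
    (hx : (fderiv ℂ G x).det ≠ 0) {W : Set (En N)} (hW : W ∈ 𝓝 x) :
    ∃ U ⊆ W, IsOpen U ∧ x ∈ U ∧ InjOn G U ∧ G '' U ∈ 𝓝 (G x) := by
  let A : En N ≃L[ℂ] En N := ContinuousLinearMap.toContinuousLinearEquivOfDetNeZero _ hx
  have hs : HasStrictFDerivAt G (A : En N →L[ℂ] En N) x := by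
    have : (A : En N →L[ℂ] En N) = fderiv ℂ G x := by ext1 v; rfl
    rw [this]
    exact (hG.contDiffAt).hasStrictFDerivAt one_ne_zero
  have hxs := hs.mem_toOpenPartialHomeomorph_source
  refine ⟨(hs.toOpenPartialHomeomorph G).source ∩ interior W, ?_, ?_, ⟨hxs,
    mem_interior_iff_mem_nhds.2 hW⟩, ?_, ?_⟩
  · exact inter_subset_right.trans interior_subset
  · exact (hs.toOpenPartialHomeomorph G).open_source.inter isOpen_interior
  · exact (hs.toOpenPartialHomeomorph G).injOn.mono inter_subset_left
  · have := hs.map_nhds_eq_of_equiv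
    rw [← this]
    exact image_mem_map (inter_mem ((hs.toOpenPartialHomeomorph G).open_source.mem_nhds hxs)
      (interior_mem_nhds.2 hW))

/-- A homogeneous holomorphic map of degree at least two vanishing only at the origin is not
homotopic on the unit sphere to a real-linear isomorphism. -/
lemma not_sphHom_linear [Nontrivial (En N)] {G : En N → En N} (hG : ContDiff ℂ 1 G) {e : ℕ}
    (he : e ≠ 0) (hhom : ∀ (c : ℂ) x, G (c • x) = c ^ (e + 1) • G x)
    (hne : ∀ x, x ≠ 0 → G x ≠ 0) (κ : En N ≃L[ℝ] En N) : ¬ SphHom G κ := by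
  intro hS
  have hGd := hG.differentiable one_ne_zero
  have hGr : ContDiff ℝ 1 G := hG.restrict_scalars ℝ
  set κ' : En N →L[ℝ] En N := (2 : ℝ)⁻¹ • (κ : En N →L[ℝ] En N) with hκ'
  have hκinj : Function.Injective κ' := by
    intro x y hxy
    have : (2 : ℝ)⁻¹ • κ x = (2 : ℝ)⁻¹ • κ y := hxy
    exact κ.injective (smul_right_injective _ (by norm_num : (2 : ℝ)⁻¹ ≠ 0) this)
  have hκdet : κ'.det ≠ 0 := by
    intro h0
    have hk := LinearMap.bot_lt_ker_of_det_eq_zero (f := (κ' : En N →ₗ[ℝ] En N)) h0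
    rw [LinearMap.ker_eq_bot.2 hκinj] at hk
    exact lt_irrefl _ hk
  have hfd : ∀ x, fderiv ℝ κ' x = κ' := fun x => κ'.fderiv
  obtain ⟨c, hc, hvol⟩ := hS.integral_eq MeasureTheory.volume hGr (κ := κ') κ'.contDiff
    (fun _ _ => rfl) (fun x _ => by simp [hκ', smul_smul])
    (fun x h1 _ => hne x (by rintro rfl; norm_num at h1))
    (fun x h1 h0 => by
      have : x = 0 := hκinj (by simpa using h0)
      subst this; norm_num at h1)
  simp only [hfd] at hvol
  by_cases hall : ∀ x ∈ ball (0 : En N) (1 / 2), (fderiv ℂ G x).det = 0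
  · obtain ⟨θ, w, hθ, hwc, hdw, hw0, hwp, hws⟩ :=
      exists_contDiff_det_fderiv_eq_weight (0 : En N) (ball_mem_nhds 0 hc)
    have h := hvol θ w hθ hdw hws
    have hl : ∫ x in ball (0 : En N) (1 / 2), w (G x) * (fderiv ℝ G x).det = 0 := by
      refine (MeasureTheory.setIntegral_congr_fun (g := fun _ => (0 : ℝ)) measurableSet_ball
        fun x hx => ?_).trans (by simp)
      simp [det_fderiv_real_eq hGd, hall x hx]
    rw [hl, MeasureTheory.integral_mul_const] at h
    have hpos := setIntegral_pos_of_continuous MeasureTheory.volume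
      (hwc.comp κ'.continuous) (fun x => hw0 _) (x := 0) (R := 3)
      (mem_ball_self (by norm_num)) (by simpa using hwp)
    exact (mul_ne_zero hpos.ne' hκdet) h.symm
  · push Not at hall
    obtain ⟨x₀, hx₀, hdet₀⟩ := hall
    have hx₀ne : x₀ ≠ 0 := by
      rintro rfl
      rw [fderiv_zero_of_homogeneous hG he hhom] at hdet₀
      exact hdet₀ (by simp [ContinuousLinearMap.det])
    have hdets : ∀ a : ℂ, a ≠ 0 → (fderiv ℂ G (a • x₀)).det ≠ 0 := by
      intro a ha
      rw [fderiv_smul_of_homogeneous hGd hhom ha, ContinuousLinearMap.det]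
      have := LinearMap.det_smul (a ^ e) (fderiv ℂ G x₀ : En N →ₗ[ℂ] En N)
      rw [ContinuousLinearMap.toLinearMap_smul, this]
      exact mul_ne_zero (pow_ne_zero _ (pow_ne_zero _ ha)) hdet₀
    have hG00 : G 0 = 0 := by simpa using hhom 0 0
    obtain ⟨t, ht⟩ : ∃ t : ℝ, t ∈ Ioo (0 : ℝ) 1 ∧ G ((t : ℂ) • x₀) ∈ ball (0 : En N) c := by
      have hcont : ContinuousAt (fun t : ℝ => G ((t : ℂ) • x₀)) 0 :=
        (hG.continuous.comp (by fun_prop)).continuousAt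
      have h1 : ∀ᶠ t : ℝ in 𝓝[>] (0 : ℝ), G ((t : ℂ) • x₀) ∈ ball (0 : En N) c :=
        (hcont.eventually (by
          simp only [Complex.ofReal_zero, zero_smul, hG00]; exact ball_mem_nhds (0 : En N) hc)).filter_mono
          nhdsWithin_le_nhds
      obtain ⟨t, h2, h3⟩ := (h1.and (Ioo_mem_nhdsGT one_pos)).exists
      exact ⟨t, h3, h2⟩
    obtain ⟨⟨ht0, ht1⟩, htc⟩ := ht
    have htne : (t : ℂ) ≠ 0 := by exact_mod_cast ht0.ne'
    set ω : ℂ := Complex.exp (2 * Real.pi * Complex.I / ((e + 1 : ℕ) : ℂ)) with hω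
    have hprim : IsPrimitiveRoot ω (e + 1) := Complex.isPrimitiveRoot_exp (e + 1) (by omega)
    have hω0 : ω ≠ 0 := Complex.exp_ne_zero _
    have hω1 : ω ≠ 1 := hprim.ne_one (by omega)
    have hωn : ‖ω‖ = 1 := hprim.norm'_eq_one (by omega)
    set x₁ := (t : ℂ) • x₀
    set x₂ := (ω * t) • x₀
    have hx12 : x₁ ≠ x₂ := by
      intro h
      have : (t : ℂ) = ω * t := smul_left_injective ℂ hx₀ne h
      exact hω1 (mul_right_cancel₀ htne (by rw [← this, one_mul]))
    have hx₀n : ‖x₀‖ < 1 / 2 := mem_ball_zero_iff.1 hx₀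
    have hn1 : x₁ ∈ ball (0 : En N) (1 / 2) := by
      rw [mem_ball_zero_iff, norm_smul, Complex.norm_real, Real.norm_of_nonneg ht0.le]
      nlinarith [norm_nonneg x₀]
    have hn2 : x₂ ∈ ball (0 : En N) (1 / 2) := by
      rw [mem_ball_zero_iff, norm_smul, norm_mul, hωn, one_mul, Complex.norm_real,
        Real.norm_of_nonneg ht0.le]
      nlinarith [norm_nonneg x₀]
    have hG12 : G x₂ = G x₁ := by
      have : x₂ = ω • x₁ := by simp only [x₁, x₂, smul_smul]
      rw [this, hhom, hprim.pow_eq_one, one_smul]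
    obtain ⟨O₁, O₂, ho1, ho2, hm1, hm2, hdisj⟩ := t2_separation hx12
    obtain ⟨U₁, hU1s, hU1o, hU1x, hU1i, hU1n⟩ := exists_injOn_nhds hG (hdets _ htne)
      (inter_mem (ho1.mem_nhds hm1) (isOpen_ball.mem_nhds hn1))
    obtain ⟨U₂, hU2s, hU2o, hU2x, hU2i, hU2n⟩ := exists_injOn_nhds hG
      (hdets _ (mul_ne_zero hω0 htne)) (inter_mem (ho2.mem_nhds hm2) (isOpen_ball.mem_nhds hn2))
    have hU2n' : G '' U₂ ∈ 𝓝 (G x₁) := by rw [← hG12]; exact hU2n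
    have hU12 : Disjoint U₁ U₂ :=
      hdisj.mono (hU1s.trans inter_subset_left) (hU2s.trans inter_subset_left)
    obtain ⟨θ, w, hθ, hwc, hdw, hw0, hwp, hws⟩ :=
      exists_contDiff_det_fderiv_eq_weight (G x₁)
        (inter_mem (inter_mem hU1n hU2n') (isOpen_ball.mem_nhds htc))
    have h := hvol θ w hθ hdw fun y hy => hws y fun hh => hy hh.2
    have hcs : HasCompactSupport w := by
      refine HasCompactSupport.intro (isCompact_closedBall (0 : En N) c) fun y hy => hws y ?_
      intro hh
      exact hy (ball_subset_closedBall hh.2)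
    have hwpos := hwc.integral_pos_of_hasCompactSupport_nonneg_nonzero
      (μ := MeasureTheory.volume) hcs hw0 hwp.ne'
    have hwint := hwc.integrable_of_hasCompactSupport hcs (μ := MeasureTheory.volume)
    have hcontL : Continuous fun x => w (G x) * (fderiv ℝ G x).det :=
      (hwc.comp hG.continuous).mul (ContinuousLinearMap.continuous_det.comp
        (hGr.continuous_fderiv one_ne_zero))
    have hdnn : ∀ x, 0 ≤ (fderiv ℝ G x).det := fun x => by
      rw [det_fderiv_real_eq hGd]; exact Complex.normSq_nonneg _
    have hnn : ∀ x, 0 ≤ w (G x) * (fderiv ℝ G x).det := fun x => mul_nonneg (hw0 _) (hdnn x)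
    have piece : ∀ U : Set (En N), IsOpen U → InjOn G U → (∀ y ∉ G '' U, w y = 0) →
        ∫ x in U, w (G x) * (fderiv ℝ G x).det = ∫ y, w y := by
      intro U hUo hUi hUw
      have h1 := MeasureTheory.integral_image_eq_integral_abs_det_fderiv_smul
        MeasureTheory.volume hUo.measurableSet (f := G) (f' := fun x => fderiv ℝ G x)
        (fun x _ => ((hGr.differentiable one_ne_zero) x).hasFDerivAt.hasFDerivWithinAt) hUi w
      rw [MeasureTheory.setIntegral_eq_integral_of_forall_compl_eq_zero hUw] at h1
      rw [h1]
      refine MeasureTheory.setIntegral_congr_fun hUo.measurableSet fun x _ => ?_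
      simp only [smul_eq_mul, abs_of_nonneg (hdnn x), mul_comm]
    have hsub : U₁ ∪ U₂ ⊆ ball (0 : En N) (1 / 2) :=
      union_subset (hU1s.trans inter_subset_right) (hU2s.trans inter_subset_right)
    have hintL := integrableOn_ball_of_continuous MeasureTheory.volume hcontL (1 / 2)
    have hge : 2 * ∫ y, w y ≤ ∫ x in ball (0 : En N) (1 / 2), w (G x) * (fderiv ℝ G x).det := by
      calc 2 * ∫ y, w y = ∫ x in U₁ ∪ U₂, w (G x) * (fderiv ℝ G x).det := by
            rw [MeasureTheory.setIntegral_union hU12 hU2o.measurableSet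
              (hintL.mono_set (subset_union_left.trans hsub))
              (hintL.mono_set (subset_union_right.trans hsub)),
              piece U₁ hU1o hU1i fun y hy => hws y fun hh => hy hh.1.1,
              piece U₂ hU2o hU2i fun y hy => hws y fun hh => hy hh.1.2]
            ring
        _ ≤ _ := MeasureTheory.setIntegral_mono_set hintL (Eventually.of_forall hnn)
            hsub.eventuallyLE
    have hle : ∫ x in ball (0 : En N) 3, w (κ' x) * κ'.det ≤ ∫ y, w y := by
      calc ∫ x in ball (0 : En N) 3, w (κ' x) * κ'.det
          ≤ ∫ x in ball (0 : En N) 3, |κ'.det| • w (κ' x) := by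
            refine MeasureTheory.setIntegral_mono_on
              (integrableOn_ball_of_continuous _ (by fun_prop) 3)
              (integrableOn_ball_of_continuous _ (by fun_prop) 3) measurableSet_ball fun x _ => ?_
            rw [smul_eq_mul, mul_comm]
            exact mul_le_mul_of_nonneg_right (le_abs_self _) (hw0 _)
        _ = ∫ y in κ' '' ball (0 : En N) 3, w y :=
            (MeasureTheory.integral_image_eq_integral_abs_det_fderiv_smul
              MeasureTheory.volume measurableSet_ball (f := κ') (f' := fun _ => κ')
              (fun x _ => κ'.hasFDerivAt.hasFDerivWithinAt) hκinj.injOn w).symm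
        _ ≤ ∫ y, w y := MeasureTheory.setIntegral_le_integral hwint (Eventually.of_forall hw0)
    linarith
end

section
variable {N : ℕ}

lemma fderiv_pev_apply (p : MvPolynomial (Fin N) ℂ) (x v : En N) :
    fderiv ℂ (pev p) x v = ∑ i, v i * pev (MvPolynomial.pderiv i p) x := by
  classical
  induction p using MvPolynomial.induction_on with
  | C a =>
    have : pev (MvPolynomial.C a : MvPolynomial (Fin N) ℂ) = fun _ => a := funext (pev_C (n := N) a)
    rw [this]
    simp [pev]
  | add p q hp hq =>
    have : pev (p + q) = fun x => pev p x + pev q x := funext (pev_add p q)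
    rw [this, fderiv_fun_add (differentiable_pev p x) (differentiable_pev q x)]
    simp [hp, hq, mul_add, Finset.sum_add_distrib]
  | mul_X p j hp =>
    have : pev (p * MvPolynomial.X j) = fun x : En N => pev p x * EuclideanSpace.proj (𝕜 := ℂ) j x := by
      ext x; simp
    rw [this, fderiv_fun_mul (differentiable_pev p x)
      ((EuclideanSpace.proj (𝕜 := ℂ) j).differentiableAt)]
    simp only [ContinuousLinearMap.fderiv, add_apply,
      smul_apply, hp, MvPolynomial.pderiv_mul, pev_add, pev_mul, mul_add,
      Finset.sum_add_distrib, smul_eq_mul]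
    rw [add_comm]
    congr 1
    · simp only [pev_X, Finset.mul_sum]
      refine Finset.sum_congr rfl fun i _ => ?_
      rw [show EuclideanSpace.proj (𝕜 := ℂ) j x = x j from rfl]
      ring
    · rw [Finset.sum_eq_single j]
      · simp [pev, mul_comm]
      · intro i _ hi
        rw [MvPolynomial.pderiv_X_of_ne hi.symm]
        simp [pev]
      · simp

lemma fderiv_pev_eq_zero_iff (p : MvPolynomial (Fin N) ℂ) (x : En N) :
    fderiv ℂ (pev p) x = 0 ↔ ∀ i, pev (MvPolynomial.pderiv i p) x = 0 := by
  constructor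
  · intro h i
    have := fderiv_pev_apply p x (EuclideanSpace.single i 1)
    rw [h] at this
    simpa [Finset.sum_ite_eq, PiLp.single_apply, eq_comm] using this
  · intro h
    ext1 v
    simp [fderiv_pev_apply, h]

lemma fderiv_pev_self {p : MvPolynomial (Fin N) ℂ} {d : ℕ} (hp : p.IsHomogeneous d) (x : En N) :
    fderiv ℂ (pev p) x x = d * pev p x := by
  rw [fderiv_pev_apply]
  have := congrArg (fun q => pev q x) hp.sum_X_mul_pderiv
  simpa [pev] using this

/-- Coordinatewise complex conjugation. -/
def conjE (N : ℕ) : En N ≃L[ℝ] En N :=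
  (LinearIsometryEquiv.piLpCongrRight 2 fun _ : Fin N => Complex.conjLIE).toContinuousLinearEquiv

lemma conjE_apply (x : En N) (i : Fin N) : conjE N x i = (starRingEnd ℂ) (x i) := rfl

lemma conjE_conjE (x : En N) : conjE N (conjE N x) = x := by
  ext i; simp [conjE_apply]

/-- The (holomorphic) gradient of a polynomial. -/
def pgrad (r : MvPolynomial (Fin N) ℂ) (x : En N) : En N :=
  WithLp.toLp 2 fun i => pev (MvPolynomial.pderiv i r) x

lemma contDiff_pgrad (r : MvPolynomial (Fin N) ℂ) : ContDiff ℂ 1 (pgrad r) :=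
  contDiff_piLp 2 |>.2 fun _ => contDiff_pev _

/-- The conjugate gradient of a polynomial. -/
def cgrad (r : MvPolynomial (Fin N) ℂ) (x : En N) : En N := conjE N (pgrad r x)

lemma continuous_cgrad (r : MvPolynomial (Fin N) ℂ) : Continuous (cgrad r) :=
  (conjE N).continuous.comp (contDiff_pgrad r).continuous

lemma fderiv_pev_cgrad (r : MvPolynomial (Fin N) ℂ) (x y : En N) :
    fderiv ℂ (pev r) x y = inner ℂ (cgrad r x) y := by
  rw [fderiv_pev_apply, PiLp.inner_apply]
  refine Finset.sum_congr rfl fun i _ => ?_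
  simp [cgrad, conjE_apply, pgrad]

lemma cgrad_eq_zero_iff (r : MvPolynomial (Fin N) ℂ) (x : En N) :
    cgrad r x = 0 ↔ fderiv ℂ (pev r) x = 0 := by
  constructor
  · intro h; ext1 v; simp [fderiv_pev_cgrad, h]
  · intro h
    have := fderiv_pev_cgrad r x (cgrad r x)
    rw [h] at this
    simpa using this.symm

lemma pgrad_smul {r : MvPolynomial (Fin N) ℂ} {e : ℕ} (hr : r.IsHomogeneous (e + 1)) (c : ℂ)
    (x : En N) : pgrad r (c • x) = c ^ e • pgrad r x := by
  ext i
  have := (hr.pderiv (i := i)).pev_smul c x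
  simpa [pgrad] using this

/-- Moving along the conjugate gradient increases the real part. -/
lemma eventually_re_lt_re_add_cgrad {r : MvPolynomial (Fin N) ℂ}
    (hs : ∀ x : En N, x ≠ 0 → fderiv ℂ (pev r) x ≠ 0) :
    ∀ᶠ ε : ℝ in 𝓝[>] 0, ∀ x ∈ sphere (0 : En N) 1,
      (pev r x).re < (pev r (x + (ε : ℂ) • cgrad r x)).re := by
  have key : ∀ᶠ ε : ℝ in 𝓝 0, ∀ x ∈ sphere (0 : En N) 1, 0 < ε →
      (pev r x).re < (pev r (x + (ε : ℂ) • cgrad r x)).re := by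
    refine (isCompact_sphere (0 : En N) 1).eventually_forall_of_forall_eventually
      (P := fun (ε : ℝ) (x : En N) => 0 < ε →
        (pev r x).re < (pev r (x + (ε : ℂ) • cgrad r x)).re) fun x₀ hx₀ => ?_
    have hx₀' : x₀ ≠ 0 := by rintro rfl; simp at hx₀
    have ha₀ : cgrad r x₀ ≠ 0 := fun h => hs x₀ hx₀' ((cgrad_eq_zero_iff r x₀).1 h)
    have hpos : 0 < ‖cgrad r x₀‖ := norm_pos_iff.2 ha₀
    have hst := (hasStrictFDerivAt_pev r x₀).isLittleO
    have h1 := hst.def (show 0 < ‖cgrad r x₀‖ / 4 by positivity)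
    have hcg := continuous_cgrad r
    have ht : Tendsto (fun z : ℝ × En N => (z.2 + (z.1 : ℂ) • cgrad r z.2, z.2)) (𝓝 (0, x₀))
        (𝓝 (x₀, x₀)) := by
      have : Continuous fun z : ℝ × En N => (z.2 + (z.1 : ℂ) • cgrad r z.2, z.2) := by fun_prop
      have h := this.tendsto (0, x₀)
      simpa using h
    have h2 : ∀ᶠ z : ℝ × En N in 𝓝 (0, x₀),
        ‖cgrad r x₀‖ ^ 2 / 2 < (fderiv ℂ (pev r) x₀ (cgrad r z.2)).re := by
      have hc : Continuous fun z : ℝ × En N => (fderiv ℂ (pev r) x₀ (cgrad r z.2)).re := by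
        fun_prop
      refine (hc.tendsto (0, x₀)).eventually (lt_mem_nhds ?_)
      show _ < (fderiv ℂ (pev r) x₀ (cgrad r x₀)).re
      rw [fderiv_pev_cgrad, inner_self_eq_norm_sq_to_K]
      norm_cast
      simp only [Complex.coe_algebraMap, Complex.ofReal_re]
      have : 0 < ‖cgrad r x₀‖ ^ 2 := by positivity
      linarith
    have h3 : ∀ᶠ z : ℝ × En N in 𝓝 (0, x₀), ‖cgrad r z.2‖ < 2 * ‖cgrad r x₀‖ := by
      have hc : Continuous fun z : ℝ × En N => ‖cgrad r z.2‖ := by fun_prop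
      exact (hc.tendsto (0, x₀)).eventually (gt_mem_nhds (by show ‖cgrad r x₀‖ < _; linarith))
    filter_upwards [ht.eventually h1, h2, h3] with z e1 e2 e3 hz
    simp only [add_sub_cancel_left, map_smul, norm_smul, Complex.norm_real,
      Real.norm_of_nonneg hz.le] at e1
    have e4 := (Complex.abs_re_le_norm _).trans e1
    rw [Complex.sub_re, Complex.sub_re, smul_eq_mul, Complex.re_ofReal_mul, abs_le] at e4
    have e5 : ‖cgrad r x₀‖ / 4 * (z.1 * ‖cgrad r z.2‖) ≤ z.1 * (‖cgrad r x₀‖ ^ 2 / 2) := by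
      have : ‖cgrad r x₀‖ * ‖cgrad r z.2‖ ≤ 2 * ‖cgrad r x₀‖ ^ 2 := by nlinarith
      nlinarith
    have e6 : z.1 * (‖cgrad r x₀‖ ^ 2 / 2) < z.1 * (fderiv ℂ (pev r) x₀ (cgrad r z.2)).re :=
      mul_lt_mul_of_pos_left e2 hz
    linarith [e4.1]
  filter_upwards [nhdsWithin_le_nhds key, self_mem_nhdsWithin] with ε h1 h2 x hx
  exact h1 x hx h2

lemma re_pev_eq_of_cgrad_eq {r : MvPolynomial (Fin N) ℂ} {d : ℕ} (hr : r.IsHomogeneous d)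
    {x : En N} (hx : x ∈ sphere (0 : En N) 1) {l : ℝ} (h : cgrad r x = (l : ℂ) • x) :
    d * (pev r x).re = l := by
  have h1 := fderiv_pev_self hr x
  rw [fderiv_pev_cgrad, h, inner_smul_left, inner_self_eq_norm_sq_to_K] at h1
  have hx' : ‖x‖ = 1 := by simpa using hx
  rw [hx'] at h1
  have h2 := congrArg Complex.re h1
  simpa using h2.symm

/-- The region where the real part of `r` is positive. -/
def posRe (r : MvPolynomial (Fin N) ℂ) : Set (En N) := {x | 0 < (pev r x).re}

/-- Deform the conjugate gradient along a homotopy of the region `posRe r`. -/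
lemma exists_deformation {r : MvPolynomial (Fin N) ℂ} {d : ℕ} (hr : r.IsHomogeneous d)
    (hd : d ≠ 0) (hs : ∀ x : En N, x ≠ 0 → fderiv ℂ (pev r) x ≠ 0) {Γ : ℝ × En N → En N}
    (hΓ : ContinuousOn Γ (Icc 0 1 ×ˢ posRe r)) (hΓm : ∀ z ∈ Icc (0 : ℝ) 1 ×ˢ posRe r, Γ z ∈ posRe r)
    (hΓ0 : ∀ x ∈ posRe r, Γ (0, x) = x) {δ₁ ε₁ : ℝ} (hδ₁ : 0 < δ₁) (hε₁ : 0 < ε₁) :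
    ∃ ε ∈ Ioo 0 ε₁, ∃ δ ∈ Ioo 0 δ₁, ∃ F : En N → En N, SphHom (cgrad r) F ∧
      ContinuousOn F (sphere 0 1) ∧
      (∀ x ∈ sphere (0 : En N) 1, (pev r x).re ≤ δ → ∀ c : ℝ, 0 ≤ c → F x ≠ (c : ℂ) • x) ∧
      (∀ x ∈ sphere (0 : En N) 1, δ ≤ (pev r x).re →
        x + (ε : ℂ) • cgrad r x ∈ posRe r ∧ F x = Γ (1, x + (ε : ℂ) • cgrad r x)) := by
  obtain ⟨ε, hεr, hε⟩ := ((eventually_re_lt_re_add_cgrad hs).and (Ioo_mem_nhdsGT hε₁)).exists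
  have hcg := continuous_cgrad r
  have hrc := continuous_pev r
  set ρ : En N → ℝ := fun x => (pev r x).re with hρ
  have hρc : Continuous ρ := by fun_prop
  set j : En N → En N := fun x => x + (ε : ℂ) • cgrad r x with hj
  have hjc : Continuous j := by fun_prop
  have hjm : ∀ x ∈ sphere (0 : En N) 1, 0 ≤ ρ x → j x ∈ posRe r := fun x hx h =>
    lt_of_le_of_lt h (hεr x hx)
  have hcg0 : ∀ x ∈ sphere (0 : En N) 1, cgrad r x ≠ 0 := by
    intro x hx h
    exact hs x (by rintro rfl; simp at hx) ((cgrad_eq_zero_iff r x).1 h)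
  -- the combined homotopy over the closed region `0 ≤ ρ`
  set T : Set (En N) := sphere 0 1 ∩ {x | 0 ≤ ρ x} with hT
  have hTc : IsCompact T :=
    (isCompact_sphere 0 1).inter_right (isClosed_le continuous_const hρc)
  set H : ℝ × En N → En N := fun z => if z.1 ≤ 1 / 2 then
    ((1 - 2 * z.1 : ℝ) : ℂ) • cgrad r z.2 + ((2 * z.1 : ℝ) : ℂ) • j z.2
    else Γ (2 * z.1 - 1, j z.2) with hH
  have H1 : EqOn H (fun z => ((1 - 2 * z.1 : ℝ) : ℂ) • cgrad r z.2 + ((2 * z.1 : ℝ) : ℂ) • j z.2)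
      (Icc (0 : ℝ) (1 / 2) ×ˢ T) := fun z hz => if_pos hz.1.2
  have H2 : EqOn H (fun z => Γ (2 * z.1 - 1, j z.2)) (Icc (1 / 2 : ℝ) 1 ×ˢ T) := by
    intro z hz
    rcases hz.1.1.lt_or_eq with h | h
    · exact if_neg (not_le.2 h)
    · rw [hH]
      simp only [← h, le_refl, if_true]
      norm_num
      rw [hΓ0 _ (hjm _ hz.2.1 hz.2.2)]
  have hm2 : MapsTo (fun z : ℝ × En N => (2 * z.1 - 1, j z.2)) (Icc (1 / 2 : ℝ) 1 ×ˢ T)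
      (Icc (0 : ℝ) 1 ×ˢ posRe r) := fun z hz =>
    ⟨⟨by linarith [hz.1.1], by linarith [hz.1.2]⟩, hjm _ hz.2.1 hz.2.2⟩
  have hu : Icc (0 : ℝ) 1 ×ˢ T = Icc (0 : ℝ) (1 / 2) ×ˢ T ∪ Icc (1 / 2 : ℝ) 1 ×ˢ T := by
    rw [← union_prod, Icc_union_Icc_eq_Icc (by norm_num) (by norm_num)]
  have hHc : ContinuousOn H (Icc (0 : ℝ) 1 ×ˢ T) := by
    rw [hu]
    refine ContinuousOn.union_of_isClosed (ContinuousOn.congr ?_ H1) (ContinuousOn.congr ?_ H2)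
      (isClosed_Icc.prod hTc.isClosed) (isClosed_Icc.prod hTc.isClosed)
    · exact Continuous.continuousOn (by fun_prop)
    · exact hΓ.comp (Continuous.continuousOn (by fun_prop)) hm2
  have hHcase : ∀ z ∈ Icc (0 : ℝ) 1 ×ˢ T, (∃ t ∈ Icc (0 : ℝ) 1,
      H z = ((1 - t + t * ε : ℝ) : ℂ) • cgrad r z.2 + (t : ℂ) • z.2) ∨ H z ∈ posRe r := by
    intro z hz
    rw [hu] at hz
    rcases hz with hz | hz
    · left
      refine ⟨2 * z.1, ⟨by linarith [hz.1.1], by linarith [hz.1.2]⟩, ?_⟩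
      rw [H1 hz]
      simp only [hj]
      push_cast
      module
    · right
      rw [H2 hz]
      exact hΓm _ (hm2 hz)
  have hpos : ∀ t ∈ Icc (0 : ℝ) 1, 0 < 1 - t + t * ε := by
    intro t ht
    rcases ht.2.lt_or_eq with h | h
    · nlinarith [ht.1, hε.1]
    · rw [h]; linarith [hε.1]
  have hsolve : ∀ x ∈ sphere (0 : En N) 1, ∀ t ∈ Icc (0 : ℝ) 1, ∀ c : ℝ,
      ((1 - t + t * ε : ℝ) : ℂ) • cgrad r x + (t : ℂ) • x = (c : ℂ) • x →
      cgrad r x = (((c - t) / (1 - t + t * ε) : ℝ) : ℂ) • x := by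
    intro x _ t ht c h
    have hne : ((1 - t + t * ε : ℝ) : ℂ) ≠ 0 := by exact_mod_cast (hpos t ht).ne'
    have h2 : ((1 - t + t * ε : ℝ) : ℂ) • cgrad r x = ((c - t : ℝ) : ℂ) • x := by
      rw [eq_sub_of_add_eq h, ← sub_smul]; push_cast; rfl
    rw [Complex.ofReal_div, div_eq_inv_mul, ← smul_smul, ← h2, smul_smul, inv_mul_cancel₀ hne,
      one_smul]
  have hdpos : (0 : ℝ) < d := by exact_mod_cast Nat.pos_of_ne_zero hd
  have hHne : ∀ z ∈ Icc (0 : ℝ) 1 ×ˢ T, H z ≠ 0 := by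
    intro z hz h0
    rcases hHcase z hz with ⟨t, ht, he⟩ | h
    · have h1 := hsolve z.2 hz.2.1 t ht 0 (by rw [← he, h0]; simp)
      have h2 := re_pev_eq_of_cgrad_eq hr hz.2.1 h1
      have h3 : 0 ≤ (d : ℝ) * (pev r z.2).re := mul_nonneg hdpos.le hz.2.2
      rw [h2] at h3
      have h4 : (0 - t) / (1 - t + t * ε) ≤ 0 :=
        div_nonpos_of_nonpos_of_nonneg (by linarith [ht.1]) (hpos t ht).le
      rw [le_antisymm h4 h3, Complex.ofReal_zero, zero_smul] at h1
      exact hcg0 _ hz.2.1 h1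
    · rw [h0] at h
      have : pev r (0 : En N) = 0 := by
        have := hr.pev_smul 0 (0 : En N)
        simpa [hd] using this
      simp [posRe, this] at h
  have hbd : ∀ z ∈ Icc (0 : ℝ) 1 ×ˢ T, ρ z.2 = 0 → ∀ c : ℝ, 0 ≤ c → H z ≠ (c : ℂ) • z.2 := by
    intro z hz hz0 c hc h
    rcases hHcase z hz with ⟨t, ht, he⟩ | h'
    · have h1 := hsolve z.2 hz.2.1 t ht c (by rw [← he, h])
      have h2 := re_pev_eq_of_cgrad_eq hr hz.2.1 h1
      rw [show (pev r z.2).re = 0 from hz0, mul_zero] at h2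
      rw [← h2, Complex.ofReal_zero, zero_smul] at h1
      exact hcg0 _ hz.2.1 h1
    · rw [h] at h'
      have : (pev r ((c : ℂ) • z.2)).re = c ^ d * (pev r z.2).re := by
        rw [hr.pev_smul, ← Complex.ofReal_pow, Complex.re_ofReal_mul]
      simp only [posRe, mem_ofPred_eq, this] at h'
      rw [show (pev r z.2).re = 0 from hz0, mul_zero] at h'
      exact lt_irrefl _ h'
  -- uniform collar
  obtain ⟨δ, hδ, hcollar⟩ : ∃ δ ∈ Ioo 0 δ₁, ∀ z ∈ Icc (0 : ℝ) 1 ×ˢ T, ρ z.2 ≤ δ →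
      ∀ c : ℝ, 0 ≤ c → H z ≠ (c : ℂ) • z.2 := by
    set B : Set (ℝ × En N) := {z ∈ Icc (0 : ℝ) 1 ×ˢ T | H z = ((‖H z‖ : ℝ) : ℂ) • z.2} with hB
    have hBc : IsCompact B := by
      have hcl : IsClosed B := by
        have h1 : ContinuousOn (fun z => H z - ((‖H z‖ : ℝ) : ℂ) • z.2) (Icc (0 : ℝ) 1 ×ˢ T) :=
          hHc.sub ((Complex.continuous_ofReal.comp_continuousOn hHc.norm).smul continuousOn_snd)
        have h2 := h1.preimage_isClosed_of_isClosed (isClosed_Icc.prod hTc.isClosed)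
          (isClosed_singleton (x := (0 : En N)))
        convert h2 using 1
        ext z
        simp [hB, sub_eq_zero]
      exact (isCompact_Icc.prod hTc).of_isClosed_subset hcl fun z hz => hz.1
    have hmem : ∀ z ∈ Icc (0 : ℝ) 1 ×ˢ T, ∀ c : ℝ, 0 ≤ c → H z = (c : ℂ) • z.2 → z ∈ B := by
      intro z hz c hc h
      refine ⟨hz, ?_⟩
      have hz1 : ‖z.2‖ = 1 := by simpa using hz.2.1
      have : ‖H z‖ = c := by
        rw [h, norm_smul, Complex.norm_real, Real.norm_of_nonneg hc, hz1, mul_one]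
      rw [this]; exact h
    have hBpos : ∀ z ∈ B, 0 < ρ z.2 := fun z hz =>
      lt_of_le_of_ne hz.1.2.2 fun h => hbd z hz.1 h.symm _ (norm_nonneg _) hz.2
    rcases B.eq_empty_or_nonempty with h | h
    · refine ⟨δ₁ / 2, ⟨by linarith, by linarith⟩, fun z hz _ c hc he => ?_⟩
      have := hmem z hz c hc he
      rw [h] at this
      exact this
    · obtain ⟨z₀, hz₀, hmin⟩ := hBc.exists_isMinOn h (f := fun z => ρ z.2)
        (hρc.comp continuous_snd).continuousOn
      have hp := hBpos z₀ hz₀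
      refine ⟨min (δ₁ / 2) (ρ z₀.2 / 2), ⟨by positivity, ?_⟩, fun z hz hz' c hc he => ?_⟩
      · exact lt_of_le_of_lt (min_le_left _ _) (by linarith)
      · have h1 : ρ z₀.2 ≤ ρ z.2 := hmin (hmem z hz c hc he)
        have h2 := hz'.trans (min_le_right _ _)
        linarith
  set σ : En N → ℝ := fun x => min 1 (max 0 (ρ x / δ)) with hσ
  have hσc : Continuous σ := by fun_prop
  have hσI : ∀ x, σ x ∈ Icc (0 : ℝ) 1 := fun x =>
    ⟨le_min zero_le_one (le_max_left _ _), min_le_left _ _⟩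
  set K : ℝ × En N → En N := fun z => if 0 ≤ ρ z.2 then H (z.1 * σ z.2, z.2) else cgrad r z.2 with hK
  have hH0 : ∀ x ∈ T, H (0, x) = cgrad r x := by
    intro x hx
    have := H1 (x := (0, x)) ⟨⟨le_rfl, by norm_num⟩, hx⟩
    simpa using this
  have K1 : EqOn K (fun z => H (z.1 * σ z.2, z.2)) (Icc (0 : ℝ) 1 ×ˢ T) :=
    fun z hz => if_pos hz.2.2
  have K2 : EqOn K (fun z => cgrad r z.2)
      (Icc (0 : ℝ) 1 ×ˢ (sphere (0 : En N) 1 ∩ {x | ρ x ≤ 0})) := by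
    intro z hz
    have hz0 : ρ z.2 ≤ 0 := hz.2.2
    rcases hz0.lt_or_eq with h | h
    · exact if_neg (not_le.2 h)
    · have hm : z.2 ∈ T := ⟨hz.2.1, h.ge⟩
      have hs0 : σ z.2 = 0 := by simp [hσ, h]
      rw [K1 (x := z) ⟨hz.1, hm⟩]
      simp only [hs0, mul_zero]
      exact hH0 _ hm
  have hmK : MapsTo (fun z : ℝ × En N => (z.1 * σ z.2, z.2)) (Icc (0 : ℝ) 1 ×ˢ T)
      (Icc (0 : ℝ) 1 ×ˢ T) := fun z hz =>
    ⟨⟨mul_nonneg hz.1.1 (hσI _).1, mul_le_one₀ hz.1.2 (hσI _).1 (hσI _).2⟩, hz.2⟩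
  have huS : sphere (0 : En N) 1 = T ∪ (sphere (0 : En N) 1 ∩ {x | ρ x ≤ 0}) := by
    rw [hT, ← inter_union_distrib_left]
    refine (inter_eq_left.2 fun x _ => ?_).symm
    exact le_total 0 (ρ x)
  have hKc : ContinuousOn K (Icc (0 : ℝ) 1 ×ˢ sphere (0 : En N) 1) := by
    rw [huS, prod_union]
    refine ContinuousOn.union_of_isClosed (ContinuousOn.congr ?_ K1) (ContinuousOn.congr ?_ K2)
      (isClosed_Icc.prod hTc.isClosed)
      (isClosed_Icc.prod (isClosed_sphere.inter (isClosed_le hρc continuous_const)))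
    · exact hHc.comp (Continuous.continuousOn (by fun_prop)) hmK
    · exact Continuous.continuousOn (by fun_prop)
  refine ⟨ε, hε, δ, hδ, fun x => K (1, x), ⟨K, hKc, ?_, ?_, fun _ _ => rfl⟩, ?_, ?_, ?_⟩
  · rintro z ⟨hz1, hz2⟩
    rw [huS] at hz2
    rcases hz2 with hz2 | hz2
    · rw [K1 ⟨hz1, hz2⟩]; exact hHne _ (hmK ⟨hz1, hz2⟩)
    · rw [K2 ⟨hz1, hz2⟩]; exact hcg0 _ hz2.1
  · intro x hx
    rw [huS] at hx
    rcases hx with hx | hx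
    · rw [K1 (x := (0, x)) ⟨⟨le_rfl, zero_le_one⟩, hx⟩]; simpa using hH0 x hx
    · rw [K2 (x := (0, x)) ⟨⟨le_rfl, zero_le_one⟩, hx⟩]
  · exact hKc.comp (Continuous.continuousOn (by fun_prop)) fun x hx =>
      ⟨⟨zero_le_one, le_rfl⟩, hx⟩
  · intro x hx hxδ c hc
    rw [huS] at hx
    have h11 : (1 : ℝ) ∈ Icc (0 : ℝ) 1 := ⟨zero_le_one, le_rfl⟩
    rcases hx with hx | hx
    · show K (1, x) ≠ _
      rw [K1 (x := (1, x)) ⟨h11, hx⟩]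
      exact hcollar _ (hmK (x := (1, x)) ⟨h11, hx⟩) hxδ c hc
    · show K (1, x) ≠ _
      rw [K2 (x := (1, x)) ⟨h11, hx⟩]
      intro h
      have h2 := re_pev_eq_of_cgrad_eq hr hx.1 h
      have h3 : (pev r x).re ≤ 0 := hx.2
      have h4 : c ≤ 0 := by rw [← h2]; exact mul_nonpos_of_nonneg_of_nonpos hdpos.le h3
      rw [le_antisymm h4 hc] at h
      exact hcg0 x hx.1 (by simpa using h)
  · intro x hx hxδ
    have h0 : 0 ≤ ρ x := hδ.1.le.trans hxδ
    have hxT : x ∈ T := ⟨hx, h0⟩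
    have h1 : σ x = 1 := by
      refine min_eq_left (le_max_of_le_right ?_)
      rw [le_div_iff₀ hδ.1, one_mul]; exact hxδ
    refine ⟨hjm x hx h0, ?_⟩
    show K (1, x) = _
    rw [K1 (x := (1, x)) ⟨⟨zero_le_one, le_rfl⟩, hxT⟩]
    simp only [h1, mul_one]
    rw [H2 (x := (1, x)) ⟨⟨by norm_num, le_rfl⟩, hxT⟩]
    simp only [hj]
    norm_num

lemma not_rotation [Nontrivial (En N)] {r : MvPolynomial (Fin N) ℂ} {d : ℕ}
    (hr : r.IsHomogeneous d) (hd : 3 ≤ d) (hs : ∀ x : En N, x ≠ 0 → fderiv ℂ (pev r) x ≠ 0)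
    {Γ : ℝ × En N → En N} (hΓ : ContinuousOn Γ (Icc 0 1 ×ˢ posRe r))
    (hΓm : ∀ z ∈ Icc (0 : ℝ) 1 ×ˢ posRe r, Γ z ∈ posRe r)
    (hΓ0 : ∀ x ∈ posRe r, Γ (0, x) = x) {ζ : ℂ} (hζ : ∀ c : ℝ, 0 ≤ c → ζ ≠ c)
    (hΓ1 : ∀ x ∈ posRe r, ∃ τ : ℝ, 0 < τ ∧ Γ (1, x) = ((τ : ℂ) * ζ) • x) : False := by
  obtain ⟨η, hη, hηb⟩ : ∃ η > 0, ∀ c : ℝ, 0 ≤ c → η ≤ ‖(c : ℂ) - ζ‖ := by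
    have hcl : IsClosed ((fun c : ℝ => (c : ℂ)) '' Ici 0) :=
      Complex.isometry_ofReal.isClosedEmbedding.isClosedMap _ isClosed_Ici
    have hnm : ζ ∉ (fun c : ℝ => (c : ℂ)) '' Ici 0 := by
      rintro ⟨c, hc, h⟩; exact hζ c hc h.symm
    obtain ⟨η, hη, hb⟩ := Metric.mem_nhds_iff.1 (hcl.isOpen_compl.mem_nhds hnm)
    refine ⟨η, hη, fun c hc => ?_⟩
    by_contra! hlt
    have : (c : ℂ) ∈ ball ζ η := by rwa [mem_ball, dist_eq_norm]
    exact hb this ⟨c, hc, rfl⟩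
  obtain ⟨A, hA⟩ := (isCompact_sphere (0 : En N) 1).exists_bound_of_continuousOn
    (continuous_cgrad r).continuousOn
  have hden : 0 < ‖ζ‖ * (|A| + 1) + 1 := by positivity
  obtain ⟨ε, hε, δ, hδ, F, hSF, hFc, hF1, hF2⟩ := exists_deformation hr (by omega) hs hΓ hΓm hΓ0
    one_pos (show 0 < η / (‖ζ‖ * (|A| + 1) + 1) by positivity)
  have hnf : ∀ x ∈ sphere (0 : En N) 1, ∀ c : ℝ, 0 ≤ c → F x ≠ (c : ℂ) • x := by
    intro x hx c hc h
    rcases le_total (pev r x).re δ with hxδ | hxδ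
    · exact hF1 x hx hxδ c hc h
    · obtain ⟨hm, he⟩ := hF2 x hx hxδ
      obtain ⟨τ, hτ, h1⟩ := hΓ1 _ hm
      rw [he, h1] at h
      have hτ' : (τ : ℂ) ≠ 0 := by exact_mod_cast hτ.ne'
      have h2 : ζ • (x + (ε : ℂ) • cgrad r x) = ((c / τ : ℝ) : ℂ) • x := by
        have := congrArg (fun v => (τ : ℂ)⁻¹ • v) h
        simp only [smul_smul, ← mul_assoc, inv_mul_cancel₀ hτ', one_mul] at this
        rw [this]; push_cast; rw [div_eq_inv_mul]
      have h3 : (((c / τ : ℝ) : ℂ) - ζ) • x = (ζ * ε) • cgrad r x := by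
        rw [sub_smul, ← h2]; module
      have hx' : ‖x‖ = 1 := by simpa using hx
      have h4 := congrArg norm h3
      rw [norm_smul, norm_smul, hx', mul_one, norm_mul, Complex.norm_real,
        Real.norm_of_nonneg hε.1.le] at h4
      have h5 := hηb (c / τ) (by positivity)
      rw [h4] at h5
      have h6 : ‖cgrad r x‖ ≤ |A| + 1 := (hA x hx).trans (by linarith [le_abs_self A])
      have h7 : ε * (‖ζ‖ * (|A| + 1) + 1) < η := (lt_div_iff₀ hden).1 hε.2
      have h8 : ‖ζ‖ * ε * ‖cgrad r x‖ ≤ ‖ζ‖ * ε * (|A| + 1) := by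
        have := hε.1.le
        gcongr
      nlinarith [hε.1]
  have h1 : SphHom F fun x => -x := by
    refine SphHom.of_segment hFc (by fun_prop) fun x hx t ht h => ?_
    have hx0 : x ≠ 0 := by rintro rfl; simp at hx
    have e : (1 - t) • F x = t • x := by
      have : (1 - t) • F x - t • x = 0 := by rw [← h]; module
      exact sub_eq_zero.1 this
    rcases ht.2.lt_or_eq with h' | h'
    · have hp : 0 < 1 - t := by linarith
      refine hnf x hx (t / (1 - t)) (div_nonneg ht.1 hp.le) ?_
      rw [Complex.coe_smul, div_eq_inv_mul, ← smul_smul, ← e, smul_smul, inv_mul_cancel₀ hp.ne',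
        one_smul]
    · subst h'
      simp at e
      exact hx0 e.symm
  have h2 : SphHom (fun x : En N => -x) fun x => x := by
    refine ⟨fun z => Complex.exp (Real.pi * (1 - z.1) * Complex.I) • z.2, ?_, ?_, ?_, ?_⟩
    · exact Continuous.continuousOn (by fun_prop)
    · intro z hz
      refine smul_ne_zero (Complex.exp_ne_zero _) ?_
      intro h
      have := hz.2
      rw [h] at this
      simp at this
    · intro x _
      simp [Complex.exp_pi_mul_I]
    · intro x _
      simp
  have h3 := ((hSF.trans h1).trans h2).map (conjE N)
  have h4 : SphHom (pgrad r) (conjE N) :=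
    h3.congr (fun x _ => conjE_conjE _) (fun x _ => rfl)
  obtain ⟨e, rfl⟩ : ∃ e, d = e + 1 + 1 := ⟨d - 2, by omega⟩
  refine not_sphHom_linear (contDiff_pgrad r) (show e ≠ 0 by omega) (fun c x => pgrad_smul hr c x)
    (fun x hx h => hs x hx ?_) (conjE N) h4
  rw [← cgrad_eq_zero_iff, cgrad, h, map_zero]

lemma not_contraction {r : MvPolynomial (Fin N) ℂ} {d : ℕ}
    (hr : r.IsHomogeneous d) (hd : 2 ≤ d) (hs : ∀ x : En N, x ≠ 0 → fderiv ℂ (pev r) x ≠ 0)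
    {Γ : ℝ × En N → En N} (hΓ : ContinuousOn Γ (Icc 0 1 ×ˢ posRe r))
    (hΓm : ∀ z ∈ Icc (0 : ℝ) 1 ×ˢ posRe r, Γ z ∈ posRe r)
    (hΓ0 : ∀ x ∈ posRe r, Γ (0, x) = x) {x₀ : En N} (hx₀ : x₀ ∈ posRe r)
    (hΓ1 : ∀ x ∈ posRe r, Γ (1, x) = x₀) : False := by
  have hr0 : pev r (0 : En N) = 0 := by
    have := hr.pev_smul 0 (0 : En N)
    simpa [show d ≠ 0 by omega] using this
  have hx₀ne : x₀ ≠ 0 := by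
    rintro rfl
    simp [posRe, hr0] at hx₀
  have hn : 0 < ‖x₀‖ := norm_pos_iff.2 hx₀ne
  set v : En N := ‖x₀‖⁻¹ • x₀ with hv
  have hvx : ‖x₀‖ • v = x₀ := by rw [hv, smul_smul, mul_inv_cancel₀ hn.ne', one_smul]
  have hvn : ‖v‖ = 1 := by rw [hv, norm_smul, norm_inv, norm_norm, inv_mul_cancel₀ hn.ne']
  set ρ : En N → ℝ := fun x => (pev r x).re with hρ
  have hρc : Continuous ρ := Complex.continuous_re.comp (continuous_pev r)
  have hρv : 0 < ρ v := by
    have : ρ v = ‖x₀‖⁻¹ ^ d * ρ x₀ := by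
      simp only [hρ, hv]
      rw [← Complex.coe_smul, hr.pev_smul, ← Complex.ofReal_pow, Complex.re_ofReal_mul]
    rw [this]
    have : 0 < ρ x₀ := hx₀
    positivity
  obtain ⟨ε, -, δ, hδ, F, hSF, hFc, hF1, hF2⟩ := exists_deformation hr (by omega) hs hΓ hΓm hΓ0
    hρv one_pos
  have hFe : ∀ x ∈ sphere (0 : En N) 1, δ ≤ ρ x → F x = x₀ := by
    intro x hx hxδ
    obtain ⟨hm, he⟩ := hF2 x hx hxδ
    rw [he, hΓ1 _ hm]
  obtain ⟨B, hB⟩ := (isCompact_sphere (0 : En N) 1).exists_bound_of_continuousOn hFc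
  obtain ⟨κ, hκ, hκb⟩ : ∃ κ > 0, ∀ x, ‖x - v‖ < κ → δ < ρ x := by
    have := hρc.continuousAt.eventually (lt_mem_nhds hδ.2 : ∀ᶠ y in 𝓝 (ρ v), δ < y)
    obtain ⟨κ, hκ, h⟩ := Metric.eventually_nhds_iff.1 this
    exact ⟨κ, hκ, fun x hx => h (by rwa [dist_eq_norm])⟩
  set M : ℝ := (2 * |B| + 1) / κ with hM
  have hMp : 0 < M := by positivity
  set ψ : En N → ℝ := fun x => max 0 (min 1 ((ρ v - ρ x) / (ρ v - δ))) with hψ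
  have hgap : 0 < ρ v - δ := sub_pos.2 hδ.2
  have hψc : Continuous ψ := by fun_prop
  have hψ0 : ∀ x, 0 ≤ ψ x := fun x => le_max_left _ _
  have hψv : ψ v = 0 := by simp [hψ]
  have hψ1 : ∀ x, ρ x ≤ δ → ψ x = 1 := by
    intro x hx
    have : 1 ≤ (ρ v - ρ x) / (ρ v - δ) := by rw [le_div_iff₀ hgap]; linarith
    simp [hψ, min_eq_left this]
  have hray : ∀ x ∈ sphere (0 : En N) 1, ∀ c : ℝ, 0 ≤ c → c • x = x₀ → x = v := by
    intro x hx c hc h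
    have hx' : ‖x‖ = 1 := by simpa using hx
    have : c = ‖x₀‖ := by rw [← h, norm_smul, hx', mul_one, Real.norm_of_nonneg hc]
    rw [hv, ← this, ← h, smul_smul, inv_mul_cancel₀ (by rw [this]; exact hn.ne'), one_smul]
  have hgood : ∀ x ∈ sphere (0 : En N) 1, δ ≤ ρ x → ∀ c : ℝ, 0 ≤ c → x₀ - (c * ψ x) • x ≠ 0 := by
    intro x hx hxδ c hc h
    have h1 := hray x hx (c * ψ x) (mul_nonneg hc (hψ0 x)) (sub_eq_zero.1 h).symm
    rw [h1, hψv, mul_zero, zero_smul, sub_zero] at h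
    exact hx₀ne h
  have s1 : SphHom F fun x => F x - (M * ψ x) • x := by
    refine SphHom.of_segment hFc (hFc.sub (by fun_prop)) fun x hx t ht h => ?_
    have e : F x - (t * M * ψ x) • x = 0 := by rw [← h]; module
    rcases le_total (ρ x) δ with hxδ | hxδ
    · refine hF1 x hx hxδ (t * M * ψ x) (mul_nonneg (mul_nonneg ht.1 hMp.le) (hψ0 x)) ?_
      rw [Complex.coe_smul]; exact sub_eq_zero.1 e
    · rw [hFe x hx hxδ] at e
      exact hgood x hx hxδ _ (mul_nonneg ht.1 hMp.le) e
  have s2 : SphHom (fun x => F x - (M * ψ x) • x) fun _ => x₀ := by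
    refine SphHom.of_segment (hFc.sub (by fun_prop)) continuousOn_const fun x hx t ht h => ?_
    rcases le_total (ρ x) δ with hxδ | hxδ
    · rw [hψ1 x hxδ, mul_one] at h
      rcases ht.2.lt_or_eq with h' | h'
      · have hp : 0 < 1 - t := by linarith
        have hx' : ‖x‖ = 1 := by simpa using hx
        set k := t / (1 - t) * ‖x₀‖ with hk
        have hk0 : 0 ≤ k := mul_nonneg (div_nonneg ht.1 hp.le) hn.le
        have e : M • x = F x + k • v := by
          have h1 : (1 - t) • (M • x) = (1 - t) • (F x + k • v) := by
            have h2 : (1 - t) • k • v = t • x₀ := by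
              rw [smul_smul, hk, ← mul_assoc, mul_div_cancel₀ _ hp.ne', ← smul_smul, hvx]
            rw [smul_add, h2, ← sub_eq_zero]
            rw [← neg_eq_zero, ← h]
            module
          exact smul_right_injective _ hp.ne' h1
        have hFB : ‖F x‖ ≤ |B| := (hB x hx).trans (le_abs_self B)
        have e1 : |M - k| ≤ |B| := by
          have h1 := abs_norm_sub_norm_le (M • x) (k • v)
          rw [norm_smul, norm_smul, hx', hvn, mul_one, mul_one, Real.norm_of_nonneg hMp.le,
            Real.norm_of_nonneg hk0, e, add_sub_cancel_right] at h1
          exact h1.trans hFB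
        have e2 : M • (x - v) = F x + (k - M) • v := by
          rw [smul_sub, e]; module
        have e3 : M * ‖x - v‖ ≤ 2 * |B| := by
          have h1 := congrArg norm e2
          rw [norm_smul, Real.norm_of_nonneg hMp.le] at h1
          rw [h1]
          refine (norm_add_le _ _).trans ?_
          rw [norm_smul, hvn, mul_one, Real.norm_eq_abs, abs_sub_comm]
          linarith
        have e4 : ‖x - v‖ < κ := by
          have h1 : M * κ = 2 * |B| + 1 := by rw [hM, div_mul_cancel₀ _ hκ.ne']
          by_contra! hge
          have := mul_le_mul_of_nonneg_left hge hMp.le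
          linarith
        exact absurd (hκb x e4) (not_lt.2 hxδ)
      · subst h'
        simp at h
        exact hx₀ne h
    · rw [hFe x hx hxδ] at h
      refine hgood x hx hxδ ((1 - t) * M) (mul_nonneg (by linarith [ht.2]) hMp.le) ?_
      rw [← h]; module
  have h3 := ((hSF.trans s1).trans s2).map (conjE N)
  have h4 : SphHom (pgrad r) fun _ => conjE N x₀ :=
    h3.congr (fun x _ => conjE_conjE _) (fun x _ => rfl)
  obtain ⟨e, rfl⟩ : ∃ e, d = e + 1 + 1 := ⟨d - 2, by omega⟩
  refine not_sphHom_const (contDiff_pgrad r) ?_ (fun x hx h => hs x hx ?_)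
    (fun h => hx₀ne (by simpa using h)) h4
  · have := pgrad_smul hr 0 (0 : En N)
    simpa using this
  · rw [← cgrad_eq_zero_iff, cgrad, h, map_zero]
end

section
variable {n : ℕ}

lemma natDegree_coeff_prod_linear {A ι : Type*} [CommRing A] (w b : ι → A) (m : ι → ℕ)
    (s : Finset ι) :
    (∏ i ∈ s, (Polynomial.C (w i) + Polynomial.C (b i) * Polynomial.X) ^ m i).natDegree ≤
        ∑ i ∈ s, m i ∧
      (∏ i ∈ s, (Polynomial.C (w i) + Polynomial.C (b i) * Polynomial.X) ^ m i).coeff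
        (∑ i ∈ s, m i) = ∏ i ∈ s, b i ^ m i := by
  classical
  induction s using Finset.induction_on with
  | empty => simp
  | insert i s hi ih =>
    rw [Finset.prod_insert hi, Finset.sum_insert hi, Finset.prod_insert hi]
    have h1 : (Polynomial.C (w i) + Polynomial.C (b i) * Polynomial.X).natDegree ≤ 1 := by
      compute_degree
    have h2 := Polynomial.natDegree_pow_le_of_le (m i) h1
    have h3 := Polynomial.coeff_pow_of_natDegree_le (m := m i) h1
    rw [mul_one] at h2 h3
    refine ⟨Polynomial.natDegree_mul_le_of_le h2 ih.1, ?_⟩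
    rw [Polynomial.coeff_mul_add_eq_of_natDegree_le h2 ih.1, h3, ih.2]
    simp

/-- The restriction of a homogeneous polynomial to a line has the expected leading term. -/
lemma natDegree_coeff_aeval_line {A : Type*} [CommRing A] [Algebra ℂ A] (w b : Fin n → A)
    {p : MvPolynomial (Fin n) ℂ} {d : ℕ} (hp : p.IsHomogeneous d) :
    (MvPolynomial.aeval (fun i => Polynomial.C (w i) + Polynomial.C (b i) * Polynomial.X)
        p).natDegree ≤ d ∧
      (MvPolynomial.aeval (fun i => Polynomial.C (w i) + Polynomial.C (b i) * Polynomial.X)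
        p).coeff d = MvPolynomial.aeval b p := by
  have hdeg : ∀ m ∈ p.support, ∑ i ∈ m.support, m i = d := by
    intro m hm
    by_contra h
    exact (MvPolynomial.mem_support_iff.1 hm) (hp.coeff_eq_zero h)
  simp only [MvPolynomial.aeval_def, MvPolynomial.eval₂_eq]
  constructor
  · refine Polynomial.natDegree_sum_le_of_forall_le _ _ fun m hm => ?_
    have h := (natDegree_coeff_prod_linear w b m m.support).1
    rw [hdeg m hm] at h
    exact (Polynomial.natDegree_C_mul_le _ _).trans h
  · rw [Polynomial.finsetSum_coeff]
    refine Finset.sum_congr rfl fun m hm => ?_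
    have h := (natDegree_coeff_prod_linear w b m m.support).2
    rw [hdeg m hm] at h
    rw [show algebraMap ℂ (Polynomial A) (p.coeff m) = Polynomial.C (algebraMap ℂ A (p.coeff m))
      from rfl, Polynomial.coeff_C_mul, h]

/-- The polynomial `λ ↦ p (w + λ b)`. -/
def lineP (p : MvPolynomial (Fin n) ℂ) (b w : En n) : Polynomial ℂ :=
  MvPolynomial.aeval (fun i => Polynomial.C (w i) + Polynomial.C (b i) * Polynomial.X) p

lemma eval_lineP (p : MvPolynomial (Fin n) ℂ) (b w : En n) (l : ℂ) :
    (lineP p b w).eval l = pev p (w + l • b) := by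
  have h : ((Polynomial.aeval l).comp (MvPolynomial.aeval
      (fun i => Polynomial.C (w i) + Polynomial.C (b i) * Polynomial.X)) :
        MvPolynomial (Fin n) ℂ →ₐ[ℂ] ℂ) = MvPolynomial.aeval fun i => (w + l • b) i := by
    ext i
    simp only [AlgHom.comp_apply, MvPolynomial.aeval_X, map_add, map_mul, Polynomial.aeval_C,
      Polynomial.aeval_X, PiLp.add_apply, PiLp.smul_apply, smul_eq_mul, Algebra.algebraMap_self,
      RingHom.id_apply]
    ring
  have := congrArg (fun F : MvPolynomial (Fin n) ℂ →ₐ[ℂ] ℂ => F p) h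
  simp only [AlgHom.comp_apply] at this
  rw [lineP, ← Polynomial.coe_aeval_eq_eval, this]
  rfl

lemma lineP_leading {p : MvPolynomial (Fin n) ℂ} {d : ℕ} (hp : p.IsHomogeneous d) {b : En n}
    (hb : pev p b ≠ 0) (w : En n) :
    (lineP p b w).natDegree = d ∧ (lineP p b w).leadingCoeff = pev p b := by
  obtain ⟨h1, h2⟩ := natDegree_coeff_aeval_line (w : Fin n → ℂ) (b : Fin n → ℂ) hp
  have h3 : (lineP p b w).coeff d = pev p b := h2
  have h4 : (lineP p b w).natDegree = d :=
    le_antisymm h1 (Polynomial.le_natDegree_of_ne_zero (by rw [h3]; exact hb))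
  exact ⟨h4, by rw [Polynomial.leadingCoeff, h4, h3]⟩

lemma pev_line_eq_prod {p : MvPolynomial (Fin n) ℂ} {d : ℕ} (hp : p.IsHomogeneous d) {b : En n}
    (hb : pev p b ≠ 0) (w : En n) (l : ℂ) :
    pev p (w + l • b) = pev p b * ((lineP p b w).roots.map fun z => l - z).prod := by
  rw [← eval_lineP, (IsAlgClosed.splits (lineP p b w)).eval_eq_prod_roots,
    (lineP_leading hp hb w).2]

lemma card_roots_lineP {p : MvPolynomial (Fin n) ℂ} {d : ℕ} (hp : p.IsHomogeneous d) {b : En n}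
    (hb : pev p b ≠ 0) (w : En n) : (lineP p b w).roots.card = d := by
  rw [← (lineP_leading hp hb w).1]
  exact ((IsAlgClosed.splits (lineP p b w)).natDegree_eq_card_roots).symm

lemma lineP_ne_zero {p : MvPolynomial (Fin n) ℂ} {d : ℕ} (hp : p.IsHomogeneous d) {b : En n}
    (hb : pev p b ≠ 0) (w : En n) : lineP p b w ≠ 0 := by
  intro h
  have := (lineP_leading hp hb w).2
  rw [h, Polynomial.leadingCoeff_zero] at this
  exact hb this.symm

lemma mem_roots_lineP {p : MvPolynomial (Fin n) ℂ} {d : ℕ} (hp : p.IsHomogeneous d) {b : En n}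
    (hb : pev p b ≠ 0) {w : En n} {l : ℂ} :
    l ∈ (lineP p b w).roots ↔ pev p (w + l • b) = 0 := by
  rw [Polynomial.mem_roots (lineP_ne_zero hp hb w), Polynomial.IsRoot.def, eval_lineP]

/-- The homomorphism `X_i ↦ x_i - b_i T` expressing base points through points on lines. -/
def lineBack {A : Type*} [CommRing A] [Algebra ℂ A] (mk : MvPolynomial (Fin n) ℂ →ₐ[ℂ] A)
    (b : En n) : MvPolynomial (Fin n) ℂ →ₐ[ℂ] Polynomial A :=
  MvPolynomial.aeval fun i =>
    Polynomial.C (mk (MvPolynomial.X i)) - Polynomial.C (algebraMap ℂ A (b i)) * Polynomial.X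

lemma exists_lineBack_mem_span {A : Type*} [CommRing A] [IsDomain A] [Algebra ℂ A]
    (mk : MvPolynomial (Fin n) ℂ →ₐ[ℂ] A) {p D : MvPolynomial (Fin n) ℂ} {d : ℕ}
    (hp : p.IsHomogeneous d) {b : En n} (hb : pev p b ≠ 0) (hmk : mk p = 0) (hD : mk D ≠ 0) :
    ∃ ρ : MvPolynomial (Fin n) ℂ, ρ ≠ 0 ∧
      lineBack mk b ρ ∈ Ideal.span {(Polynomial.C (mk D) : Polynomial A)} := by
  set f := lineBack mk b with hf
  let : Algebra (MvPolynomial (Fin n) ℂ) (Polynomial A) := f.toRingHom.toAlgebra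
  have halg : ∀ q, algebraMap (MvPolynomial (Fin n) ℂ) (Polynomial A) q = f q := fun q => rfl
  -- the parameter of the line is integral
  have hX : IsIntegral (MvPolynomial (Fin n) ℂ) (Polynomial.X : Polynomial A) := by
    let bb : Fin n → MvPolynomial (Fin n) ℂ := fun i => MvPolynomial.C (b i)
    obtain ⟨h1, h2⟩ := natDegree_coeff_aeval_line MvPolynomial.X bb hp
    set Pl := MvPolynomial.aeval (fun i => Polynomial.C (MvPolynomial.X i) +
      Polynomial.C (bb i) * Polynomial.X) p with hPl
    have hc : MvPolynomial.aeval bb p = MvPolynomial.C (pev p b) := by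
      have : (MvPolynomial.aeval bb : MvPolynomial (Fin n) ℂ →ₐ[ℂ] _) =
          (Algebra.ofId ℂ (MvPolynomial (Fin n) ℂ)).comp (MvPolynomial.aeval fun i => b i) := by
        ext i
        simp [bb, Algebra.ofId_apply, MvPolynomial.algebraMap_eq]
      rw [this]; rfl
    rw [hc] at h2
    refine ⟨Polynomial.C (MvPolynomial.C (pev p b)⁻¹) * Pl, ?_, ?_⟩
    · refine Polynomial.monic_of_natDegree_le_of_coeff_eq_one d
        ((Polynomial.natDegree_C_mul_le _ _).trans h1) ?_
      rw [Polynomial.coeff_C_mul, h2, ← map_mul, inv_mul_cancel₀ hb, map_one]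
    · rw [Polynomial.eval₂_mul]
      refine mul_eq_zero_of_right _ ?_
      have h3 : (Polynomial.eval₂RingHom f.toRingHom (Polynomial.X : Polynomial A)).comp
          (MvPolynomial.aeval (R := ℂ) (fun i => Polynomial.C (MvPolynomial.X i) +
            Polynomial.C (bb i) * Polynomial.X)).toRingHom =
          (Polynomial.C : A →+* Polynomial A).comp mk.toRingHom := by
        refine MvPolynomial.ringHom_ext (fun a => ?_) fun i => ?_
        · simp [Polynomial.algebraMap_apply, MvPolynomial.algebraMap_eq, MvPolynomial.algHom_C]
        · simp [hf, lineBack, bb, MvPolynomial.algHom_C, Polynomial.algebraMap_apply]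
      have h4 := congrArg (fun F : MvPolynomial (Fin n) ℂ →+* Polynomial A => F p) h3
      simp only [RingHom.comp_apply, AlgHom.toRingHom_eq_coe, RingHom.coe_coe] at h4
      rw [hmk, map_zero] at h4
      exact h4
  have hCx : ∀ q, IsIntegral (MvPolynomial (Fin n) ℂ) (Polynomial.C (mk q) : Polynomial A) := by
    intro q
    induction q using MvPolynomial.induction_on with
    | C a =>
      have : (Polynomial.C (mk (MvPolynomial.C a)) : Polynomial A) =
          algebraMap (MvPolynomial (Fin n) ℂ) (Polynomial A) (MvPolynomial.C a) := by
        rw [halg, MvPolynomial.algHom_C, MvPolynomial.algHom_C]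
        rfl
      rw [this]; exact isIntegral_algebraMap
    | add p q hp hq => rw [map_add, Polynomial.C_add]; exact hp.add hq
    | mul_X p i hp =>
      rw [map_mul, Polynomial.C_mul]
      refine hp.mul ?_
      have h1 : (Polynomial.C (mk (MvPolynomial.X i)) : Polynomial A) =
          algebraMap (MvPolynomial (Fin n) ℂ) (Polynomial A) (MvPolynomial.X i) +
          algebraMap (MvPolynomial (Fin n) ℂ) (Polynomial A) (MvPolynomial.C (b i)) * Polynomial.X := by
        rw [halg, halg, MvPolynomial.algHom_C]
        simp [hf, lineBack, Polynomial.algebraMap_apply]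
      rw [h1]
      exact isIntegral_algebraMap.add (isIntegral_algebraMap.mul hX)
  have hDne : (Polynomial.C (mk D) : Polynomial A) ≠ 0 := by
    intro h
    rw [Polynomial.C_eq_zero] at h
    exact hD h
  have hcomap := Ideal.comap_ne_bot_of_integral_mem hDne
    (Ideal.mem_span_singleton_self (Polynomial.C (mk D) : Polynomial A)) (hCx D)
  obtain ⟨ρ, hρ, hρ0⟩ := (Submodule.ne_bot_iff _).1 hcomap
  exact ⟨ρ, hρ0, hρ⟩

/-- Elimination along the direction `b`. -/
lemma exists_elimination {p : MvPolynomial (Fin n) ℂ} {d : ℕ} (hp : p.IsHomogeneous d)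
    (hpi : Irreducible p) {b : En n} (hb : pev p b ≠ 0) {D : MvPolynomial (Fin n) ℂ}
    (hD : ¬ p ∣ D) : ∃ ρ : MvPolynomial (Fin n) ℂ, ρ ≠ 0 ∧
      ∀ (w : En n) (l : ℂ), pev ρ w ≠ 0 → pev p (w + l • b) = 0 → pev D (w + l • b) ≠ 0 := by
  have hI : (Ideal.span {p}).IsPrime := (Ideal.span_singleton_prime hpi.ne_zero).2 hpi.prime
  obtain ⟨ρ, hρ0, hρ'⟩ := exists_lineBack_mem_span (Ideal.Quotient.mkₐ ℂ (Ideal.span {p})) hp hb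
    (Ideal.Quotient.eq_zero_iff_mem.2 (Ideal.mem_span_singleton_self p)) (D := D)
    (fun h => hD (Ideal.mem_span_singleton.1 (Ideal.Quotient.eq_zero_iff_mem.1 h)))
  set mk := Ideal.Quotient.mkₐ ℂ (Ideal.span {p}) with hmk
  refine ⟨ρ, hρ0, fun w l hw hpz hDz => hw ?_⟩
  obtain ⟨V, hV⟩ := Ideal.mem_span_singleton.1 hρ'
  -- evaluate at the point `w + l b` of the hypersurface
  let ev : (MvPolynomial (Fin n) ℂ ⧸ Ideal.span {p}) →ₐ[ℂ] ℂ := Ideal.Quotient.liftₐ (Ideal.span {p}) (MvPolynomial.aeval fun i => (w + l • b) i) (by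
    intro a ha
    obtain ⟨c, rfl⟩ := Ideal.mem_span_singleton.1 ha
    rw [map_mul]
    exact mul_eq_zero_of_left hpz _)
  have hevmk : ∀ q, ev (mk q) = pev q (w + l • b) := fun q => rfl
  let E := Polynomial.eval₂RingHom ev.toRingHom l
  have hE : E.comp (lineBack mk b).toRingHom = (MvPolynomial.aeval (R := ℂ) fun i => w i).toRingHom := by
    refine MvPolynomial.ringHom_ext (fun a => ?_) fun i => ?_
    · simp [E, MvPolynomial.algHom_C, Polynomial.algebraMap_apply]
    · have : ev (mk (MvPolynomial.X i)) = w i + l * b i := by rw [hevmk]; simp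
      simp only [E, lineBack, RingHom.comp_apply, AlgHom.toRingHom_eq_coe, RingHom.coe_coe,
        MvPolynomial.aeval_X, Polynomial.coe_eval₂RingHom, Polynomial.eval₂_sub,
        Polynomial.eval₂_mul, Polynomial.eval₂_C, Polynomial.eval₂_X, this, AlgHom.commutes]
      simp only [Algebra.algebraMap_self, RingHom.id_apply]
      ring
  have h1 := congrArg (fun F : MvPolynomial (Fin n) ℂ →+* ℂ => F ρ) hE
  simp only [RingHom.comp_apply, AlgHom.toRingHom_eq_coe, RingHom.coe_coe] at h1
  rw [hV, map_mul] at h1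
  have h2 : E (Polynomial.C (mk D)) = 0 := by
    have : E (Polynomial.C (mk D)) = ev (mk D) := by simp [E]
    rw [this, hevmk, hDz]
  rw [h2, zero_mul] at h1
  exact h1.symm

lemma dense_pev_ne_zero {ρ : MvPolynomial (Fin n) ℂ} (hρ : ρ ≠ 0) :
    Dense {w : En n | pev ρ w ≠ 0} := by
  rw [dense_iff_inter_open]
  intro U hU hne
  by_contra hemp
  obtain ⟨x, hx⟩ := hne
  have hz : ∀ᶠ y in 𝓝 x, pev ρ y = 0 := by
    filter_upwards [hU.mem_nhds hx] with y hy
    by_contra h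
    exact hemp ⟨y, hy, h⟩
  have han : AnalyticOnNhd ℂ (pev ρ) univ := fun y _ => analyticAt_pev ρ y
  obtain ⟨y, hy⟩ := exists_pev_ne_zero hρ
  exact hy (han.eqOn_zero_of_preconnected_of_eventuallyEq_zero isPreconnected_univ trivial hz
    trivial)

lemma eventually_exists_small_root {p : MvPolynomial (Fin n) ℂ} {d : ℕ} (hp : p.IsHomogeneous d)
    {b x : En n} (hb : pev p b ≠ 0) (hx : pev p x = 0) {η : ℝ} (hη : 0 < η) :
    ∀ᶠ w in 𝓝 x, ∃ l : ℂ, ‖l‖ < η ∧ pev p (w + l • b) = 0 := by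
  have hpos : 0 < ‖pev p b‖ * η ^ d := by
    have := norm_pos_iff.2 hb
    positivity
  have h1 : ∀ᶠ w in 𝓝 x, ‖pev p w‖ < ‖pev p b‖ * η ^ d := by
    refine (continuous_pev p).norm.continuousAt.eventually (gt_mem_nhds ?_)
    show ‖pev p x‖ < _
    rw [hx, norm_zero]; exact hpos
  filter_upwards [h1] with w hw
  by_contra! hall
  have h2 := pev_line_eq_prod hp hb w 0
  rw [zero_smul, add_zero] at h2
  have h3 : ∀ s : Multiset ℂ, (∀ z ∈ s, η ≤ ‖z‖) →
      η ^ s.card ≤ ‖(s.map fun z => 0 - z).prod‖ := by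
    intro s
    induction s using Multiset.induction_on with
    | empty => simp
    | cons z s ih =>
      intro h
      rw [Multiset.card_cons, Multiset.map_cons, Multiset.prod_cons, norm_mul, pow_succ', zero_sub,
        norm_neg]
      have e1 := h z (Multiset.mem_cons_self z s)
      have e2 := ih fun y hy => h y (Multiset.mem_cons_of_mem hy)
      have : 0 ≤ ‖z‖ := norm_nonneg z
      gcongr
  have h4 := h3 (lineP p b w).roots fun z hz => by
    by_contra! hlt
    exact hall z hlt ((mem_roots_lineP hp hb).1 hz)
  rw [card_roots_lineP hp hb] at h4
  rw [h2, norm_mul] at hw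
  have := norm_pos_iff.2 hb
  nlinarith

/-- Proper subvarieties of an irreducible hypersurface have dense complement. -/
lemma subset_closure_sdiff {p : MvPolynomial (Fin n) ℂ} {d : ℕ} (hp : p.IsHomogeneous d)
    (hpi : Irreducible p) {D : MvPolynomial (Fin n) ℂ} (hD : ¬ p ∣ D) {x : En n}
    (hx : pev p x = 0) : x ∈ closure {y : En n | pev p y = 0 ∧ pev D y ≠ 0} := by
  obtain ⟨b, hb⟩ := exists_pev_ne_zero hpi.ne_zero
  obtain ⟨ρ, hρ, hel⟩ := exists_elimination hp hpi hb hD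
  rw [Metric.mem_closure_iff]
  intro ε hε
  have hη : 0 < ε / (2 * (‖b‖ + 1)) := by positivity
  have h1 := (eventually_exists_small_root hp hb hx hη).and (ball_mem_nhds x (half_pos hε))
  obtain ⟨w, ⟨⟨l, hl, hpl⟩, hwx⟩, hw⟩ := (dense_pev_ne_zero hρ).inter_nhds_nonempty h1 |>.imp
    fun w hw => (⟨hw.2, hw.1⟩ : _ ∧ _)
  refine ⟨w + l • b, ⟨hpl, hel w l hw hpl⟩, ?_⟩
  have hwx' : ‖w - x‖ < ε / 2 := by rw [← dist_eq_norm]; exact hwx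
  rw [dist_comm, dist_eq_norm]
  have h2 : ‖l • b‖ < ε / 2 := by
    rw [norm_smul]
    calc ‖l‖ * ‖b‖ ≤ ‖l‖ * (‖b‖ + 1) := by gcongr; linarith
      _ < ε / (2 * (‖b‖ + 1)) * (‖b‖ + 1) := by gcongr
      _ = ε / 2 := by field_simp
  calc ‖w + l • b - x‖ = ‖(w - x) + l • b‖ := by congr 1; abel
    _ ≤ ‖w - x‖ + ‖l • b‖ := norm_add_le _ _
    _ < ε := by linarith
end

section
variable {n : ℕ}

/-- The derivative of a polynomial in the direction `b`. -/
def dirD (b : En n) (p : MvPolynomial (Fin n) ℂ) : MvPolynomial (Fin n) ℂ :=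
  ∑ i, MvPolynomial.C (b i) * MvPolynomial.pderiv i p

lemma pev_dirD (b : En n) (p : MvPolynomial (Fin n) ℂ) (x : En n) :
    pev (dirD b p) x = fderiv ℂ (pev p) x b := by
  rw [fderiv_pev_apply]
  simp [dirD, pev]

lemma one_le_of_irreducible {p : MvPolynomial (Fin n) ℂ} {d : ℕ} (hp : p.IsHomogeneous d)
    (hpi : Irreducible p) : 1 ≤ d := by
  by_contra h
  obtain rfl : d = 0 := by omega
  have h1 := hp.totalDegree hpi.ne_zero
  rw [MvPolynomial.totalDegree_eq_zero_iff_eq_C] at h1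
  have h2 : p.coeff 0 ≠ 0 := by
    intro h0
    rw [h0, map_zero] at h1
    exact hpi.ne_zero h1
  apply hpi.not_isUnit
  rw [h1]
  exact (isUnit_iff_ne_zero.2 h2).map MvPolynomial.C

lemma not_dvd_dirD {p : MvPolynomial (Fin n) ℂ} {d : ℕ} (hp : p.IsHomogeneous d) (hd : 1 ≤ d)
    {b : En n} (hb : pev p b ≠ 0) : ¬ p ∣ dirD b p := by
  rintro ⟨c, hc⟩
  have hp0 : p ≠ 0 := by
    rintro rfl
    exact hb (by simp [pev])
  have h1 : (dirD b p).IsHomogeneous (d - 1) := by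
    refine MvPolynomial.IsHomogeneous.sum _ _ _ fun i _ => ?_
    have := (MvPolynomial.isHomogeneous_C (Fin n) (b i)).mul (hp.pderiv (i := i))
    simpa using this
  have h2 : dirD b p ≠ 0 := by
    intro h
    have h3 := pev_dirD b p b
    rw [h, fderiv_pev_self hp] at h3
    have : (d : ℂ) * pev p b ≠ 0 := mul_ne_zero (by exact_mod_cast (by omega : d ≠ 0)) hb
    exact this (by rw [← h3]; simp [pev])
  have hc0 : c ≠ 0 := by rintro rfl; exact h2 (by rw [hc, mul_zero])
  have h4 := h1.totalDegree h2
  rw [hc, MvPolynomial.totalDegree_mul_of_isDomain hp0 hc0, hp.totalDegree hp0] at h4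
  omega

/-- The substitution `X_i ↦ T X_i`. -/
def scaleT : MvPolynomial (Fin n) ℂ →ₐ[ℂ] Polynomial (MvPolynomial (Fin n) ℂ) :=
  MvPolynomial.aeval fun i => Polynomial.C (MvPolynomial.X i) * Polynomial.X

lemma scaleT_monomial (m : Fin n →₀ ℕ) (a : ℂ) :
    scaleT (MvPolynomial.monomial m a) =
      Polynomial.C (MvPolynomial.monomial m a) * Polynomial.X ^ (Finsupp.degree m) := by
  have e1 : (Polynomial.C (MvPolynomial.monomial m a) : Polynomial (MvPolynomial (Fin n) ℂ)) =
      algebraMap ℂ (Polynomial (MvPolynomial (Fin n) ℂ)) a *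
        ∏ i ∈ m.support, Polynomial.C (MvPolynomial.X i) ^ m i := by
    rw [MvPolynomial.monomial_eq, map_mul, Finsupp.prod, map_prod]
    simp only [map_pow]
    rfl
  rw [scaleT, MvPolynomial.aeval_monomial, e1, Finsupp.prod]
  simp only [mul_pow, Finset.prod_mul_distrib]
  rw [Finset.prod_pow_eq_pow_sum, mul_assoc]
  rfl

lemma coeff_scaleT (p : MvPolynomial (Fin n) ℂ) (k : ℕ) :
    (scaleT p).coeff k = MvPolynomial.homogeneousComponent k p := by
  induction p using MvPolynomial.induction_on' with
  | monomial m a =>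
    rw [scaleT_monomial, Polynomial.coeff_C_mul_X_pow]
    ext m'
    rw [MvPolynomial.coeff_homogeneousComponent]
    by_cases h : k = Finsupp.degree m
    · by_cases h' : m = m'
      · subst h'; simp [h]
      · simp [h, h', MvPolynomial.coeff_monomial]
    · by_cases h' : m = m'
      · subst h'; simp [h, Ne.symm h]
      · simp [h, h', MvPolynomial.coeff_monomial]
  | add p q hp hq => rw [map_add, Polynomial.coeff_add, hp, hq, map_add]

lemma scaleT_ne_zero {p : MvPolynomial (Fin n) ℂ} (hp : p ≠ 0) : scaleT p ≠ 0 := by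
  intro h
  apply hp
  rw [← MvPolynomial.sum_homogeneousComponent p]
  exact Finset.sum_eq_zero fun k _ => by rw [← coeff_scaleT, h, Polynomial.coeff_zero]

lemma isHomogeneous_of_dvd {p P : MvPolynomial (Fin n) ℂ} {m : ℕ} (hP : P.IsHomogeneous m)
    (hP0 : P ≠ 0) (h : p ∣ P) : p.IsHomogeneous p.totalDegree := by
  obtain ⟨q, rfl⟩ := h
  have hp0 := left_ne_zero_of_mul hP0
  have hq0 := right_ne_zero_of_mul hP0
  have h1 : scaleT (p * q) = Polynomial.C (p * q) * Polynomial.X ^ m := by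
    ext1 k
    rw [coeff_scaleT, Polynomial.coeff_C_mul_X_pow]
    ext m'
    rw [MvPolynomial.coeff_homogeneousComponent]
    by_cases hk : k = m
    · by_cases hm : Finsupp.degree m' = m
      · simp [hk, hm]
      · simp [hk, hm, hP.coeff_eq_zero hm]
    · by_cases hm : Finsupp.degree m' = k
      · simp [hk, hm, hP.coeff_eq_zero (show Finsupp.degree m' ≠ m by omega)]
      · simp [hk, hm]
  have h2 : (scaleT (p * q)).natDegree = (scaleT (p * q)).natTrailingDegree := by
    rw [h1, Polynomial.natDegree_C_mul_X_pow _ _ hP0, Polynomial.C_mul_X_pow_eq_monomial,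
      Polynomial.natTrailingDegree_monomial hP0]
  rw [map_mul, Polynomial.natDegree_mul (scaleT_ne_zero hp0) (scaleT_ne_zero hq0),
    Polynomial.natTrailingDegree_mul (scaleT_ne_zero hp0) (scaleT_ne_zero hq0)] at h2
  have h3 := Polynomial.natTrailingDegree_le_natDegree (scaleT p)
  have h4 := Polynomial.natTrailingDegree_le_natDegree (scaleT q)
  have h5 : (scaleT p).natDegree = (scaleT p).natTrailingDegree := by omega
  set k := (scaleT p).natDegree with hk
  have h6 : ∀ j, j ≠ k → MvPolynomial.homogeneousComponent j p = 0 := by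
    intro j hj
    rw [← coeff_scaleT]
    rcases lt_or_gt_of_ne hj with h | h
    · exact Polynomial.coeff_eq_zero_of_lt_natTrailingDegree (by omega)
    · exact Polynomial.coeff_eq_zero_of_natDegree_lt h
  have h7 : p = MvPolynomial.homogeneousComponent k p := by
    ext m'
    rw [MvPolynomial.coeff_homogeneousComponent]
    split_ifs with hm
    · rfl
    · have := congrArg (MvPolynomial.coeff m') (h6 _ hm)
      rw [MvPolynomial.coeff_homogeneousComponent] at this
      simpa using this
  have h8 : p.IsHomogeneous k := by
    rw [h7]; exact MvPolynomial.homogeneousComponent_isHomogeneous k p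
  rw [h8.totalDegree hp0]
  exact h8

lemma exists_irreducible_dvd_pev_eq_zero {P : MvPolynomial (Fin n) ℂ} (hP : P ≠ 0) {x : En n}
    (hx : pev P x = 0) : ∃ p, Irreducible p ∧ p ∣ P ∧ pev p x = 0 := by
  obtain ⟨s, hs, u, hu⟩ := UniqueFactorizationMonoid.exists_prime_factors P hP
  have h1 : pev s.prod x = 0 := by
    have h2 : pev (s.prod * (u : MvPolynomial (Fin n) ℂ)) x = 0 := by rw [hu]; exact hx
    rw [pev_mul] at h2
    refine (mul_eq_zero.1 h2).resolve_right ?_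
    have : IsUnit (pev (u : MvPolynomial (Fin n) ℂ) x) :=
      u.isUnit.map (MvPolynomial.eval (x : Fin n → ℂ))
    exact this.ne_zero
  have h2 : (s.map fun p => pev p x).prod = 0 := by
    rw [← h1]
    exact (map_multiset_prod (MvPolynomial.eval (x : Fin n → ℂ)) s).symm
  rw [Multiset.prod_eq_zero_iff, Multiset.mem_map] at h2
  obtain ⟨p, hps, hpx⟩ := h2
  exact ⟨p, (hs p hps).irreducible, (Multiset.dvd_prod hps).trans ⟨u, hu.symm⟩, hpx⟩

lemma fderiv_pev_mul (p q : MvPolynomial (Fin n) ℂ) (x v : En n) :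
    fderiv ℂ (pev (p * q)) x v = pev p x * fderiv ℂ (pev q) x v + pev q x * fderiv ℂ (pev p) x v := by
  have : pev (p * q) = fun x => pev p x * pev q x := funext (pev_mul p q)
  rw [this, fderiv_fun_mul (differentiable_pev p x) (differentiable_pev q x)]
  simp

/-- Smooth points of a reduced hypersurface are dense in each of its components. -/
lemma subset_closure_regular {P p : MvPolynomial (Fin n) ℂ} (hP : Squarefree P) {d : ℕ}
    (hp : p.IsHomogeneous d) (hpi : Irreducible p) (hpP : p ∣ P) {D : MvPolynomial (Fin n) ℂ}
    (hD : ¬ p ∣ D) {x : En n} (hx : pev p x = 0) :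
    x ∈ closure {y : En n | pev p y = 0 ∧ fderiv ℂ (pev P) y ≠ 0 ∧ pev D y ≠ 0} := by
  obtain ⟨c, rfl⟩ := hpP
  obtain ⟨b, hb⟩ := exists_pev_ne_zero hpi.ne_zero
  have hc : ¬ p ∣ c := fun h => hpi.not_isUnit (hP p (mul_dvd_mul_left p h))
  have hD' : ¬ p ∣ dirD b p * c * D := by
    intro h
    rcases hpi.prime.dvd_or_dvd h with h | h
    · rcases hpi.prime.dvd_or_dvd h with h | h
      · exact not_dvd_dirD hp (one_le_of_irreducible hp hpi) hb h
      · exact hc h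
    · exact hD h
  refine closure_mono ?_ (subset_closure_sdiff hp hpi hD' hx)
  rintro y ⟨hy, hy'⟩
  rw [pev_mul, pev_mul, pev_dirD] at hy'
  refine ⟨hy, fun h => hy' ?_, right_ne_zero_of_mul hy'⟩
  have := fderiv_pev_mul p c y b
  rw [h, hy, zero_mul, zero_add] at this
  rw [mul_comm (fderiv ℂ (pev p) y b), ← this]
  simp

lemma not_dvd_one {p : MvPolynomial (Fin n) ℂ} (hpi : Irreducible p) : ¬ p ∣ 1 :=
  fun h => hpi.not_isUnit (isUnit_of_dvd_one h)

lemma dvd_of_subset {p D : MvPolynomial (Fin n) ℂ} {d : ℕ} (hp : p.IsHomogeneous d)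
    (hpi : Irreducible p) (h : ∀ x, pev p x = 0 → pev D x = 0) : p ∣ D := by
  by_contra hD
  have h0 : pev p 0 = 0 := by
    have := hp.pev_smul 0 (0 : En n)
    have hd := one_le_of_irreducible hp hpi
    simpa [show d ≠ 0 by omega] using this
  have := subset_closure_sdiff hp hpi hD h0
  have he : {y : En n | pev p y = 0 ∧ pev D y ≠ 0} = ∅ := by
    ext y; simpa using h y
  rw [he, closure_empty] at this
  exact this

lemma fderiv_comp_const_add (f : En n → ℂ) (y z : En n) :
    fderiv ℂ (fun z => f (y + z)) z = fderiv ℂ f (y + z) := by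
  have : (fun z => f (y + z)) = fun z => f (z + y) := by ext z; rw [add_comm]
  rw [this, fderiv_comp_add_right, add_comm]

lemma redAt_pev {P : MvPolynomial (Fin n) ℂ} {m : ℕ} (hP : Squarefree P) (hPh : P.IsHomogeneous m)
    (y : En n) : RedAt fun z => pev P (y + z) := by
  refine Eventually.of_forall fun z hz => ?_
  have hP0 : P ≠ 0 := hP.ne_zero
  obtain ⟨p, hpi, hpP, hpz⟩ := exists_irreducible_dvd_pev_eq_zero hP0 hz
  have h1 := subset_closure_regular hP (isHomogeneous_of_dvd hPh hP0 hpP) hpi hpP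
    (not_dvd_one hpi) hpz
  have h2 : z ∈ (fun z => y + z) ⁻¹' closure {x : En n | pev P x = 0 ∧ fderiv ℂ (pev P) x ≠ 0} := by
    refine closure_mono ?_ h1
    rintro x ⟨hx1, hx2, -⟩
    obtain ⟨c, rfl⟩ := hpP
    exact ⟨by rw [pev_mul, hx1, zero_mul], hx2⟩
  rw [← Homeomorph.coe_addLeft, (Homeomorph.addLeft y).preimage_closure] at h2
  refine closure_mono ?_ h2
  rintro x ⟨h3, h4⟩
  exact ⟨h3, by rw [fderiv_comp_const_add]; exact h4⟩

lemma MvPolynomial.IsHomogeneous.norm_pev_le {p : MvPolynomial (Fin n) ℂ} {k : ℕ}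
    (hp : p.IsHomogeneous k) : ∃ C ≥ 0, ∀ z : En n, ‖pev p z‖ ≤ C * ‖z‖ ^ k := by
  obtain ⟨C, hC⟩ := (isCompact_closedBall (0 : En n) 1).exists_bound_of_continuousOn
    (continuous_pev p).continuousOn
  refine ⟨max C 0, le_max_right _ _, fun z => ?_⟩
  by_cases hz : z = 0
  · subst hz
    by_cases hk : k = 0
    · subst hk
      have := hC 0 (by simp)
      simpa using Or.inl this
    · have := hp.pev_smul 0 (0 : En n)
      rw [smul_zero, zero_pow hk, zero_mul] at this
      simp [this, hk]
  · have hz' : 0 < ‖z‖ := norm_pos_iff.2 hz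
    have h1 : z = ((‖z‖ : ℝ) : ℂ) • (((‖z‖ : ℝ) : ℂ)⁻¹ • z) := by
      rw [smul_smul, mul_inv_cancel₀ (by exact_mod_cast hz'.ne'), one_smul]
    have h2 : ‖((‖z‖ : ℝ) : ℂ)⁻¹ • z‖ = 1 := by
      rw [norm_smul, norm_inv, Complex.norm_real, norm_norm, inv_mul_cancel₀ hz'.ne']
    have h3 := hC (((‖z‖ : ℝ) : ℂ)⁻¹ • z) (by simp [h2])
    rw [h1, hp.pev_smul, norm_mul, norm_pow, ← h1, Complex.norm_real, norm_norm, mul_comm]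
    gcongr
    exact h3.trans (le_max_left _ _)

lemma exists_isInit_pev {F : MvPolynomial (Fin n) ℂ} (hF : F ≠ 0) :
    ∃ e S, IsInit (pev F) e S := by
  have hex : ∃ k, MvPolynomial.homogeneousComponent k F ≠ 0 := by
    by_contra! h
    apply hF
    rw [← MvPolynomial.sum_homogeneousComponent F]
    exact Finset.sum_eq_zero fun k _ => h k
  classical
  set e := Nat.find hex with he
  have he0 : MvPolynomial.homogeneousComponent e F ≠ 0 := Nat.find_spec hex
  have hlt : ∀ k < e, MvPolynomial.homogeneousComponent k F = 0 := fun k hk => by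
    have := Nat.find_min hex hk
    simpa using this
  refine ⟨e, MvPolynomial.homogeneousComponent e F,
    MvPolynomial.homogeneousComponent_isHomogeneous e F, he0, ?_⟩
  choose C hC0 hC using fun k => (MvPolynomial.homogeneousComponent_isHomogeneous k F).norm_pev_le
  refine ⟨∑ k ∈ Finset.range (F.totalDegree + 1), C k, Finset.sum_nonneg fun k _ => hC0 k, 1,
    one_pos, fun z hz => ?_⟩
  have hmem : e ∈ Finset.range (F.totalDegree + 1) := by
    rw [Finset.mem_range]
    by_contra h
    exact he0 (MvPolynomial.homogeneousComponent_eq_zero _ _ (by omega))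
  have h1 : pev F z = ∑ k ∈ Finset.range (F.totalDegree + 1),
      pev (MvPolynomial.homogeneousComponent k F) z := by
    conv_lhs => rw [← MvPolynomial.sum_homogeneousComponent F]
    simp [pev]
  rw [h1, ← Finset.add_sum_erase _ _ hmem, add_sub_cancel_left]
  refine (norm_sum_le _ _).trans ?_
  rw [Finset.sum_mul]
  refine (Finset.sum_le_sum fun k hk => ?_).trans (Finset.sum_le_sum_of_subset_of_nonneg
    (Finset.erase_subset e _) fun k _ _ => mul_nonneg (hC0 k) (by positivity))
  have hke : k ≠ e := (Finset.mem_erase.1 hk).1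
  rcases lt_or_gt_of_ne hke with h | h
  · rw [hlt k h]
    simpa [pev] using mul_nonneg (hC0 k) (by positivity)
  · refine (hC k z).trans ?_
    exact mul_le_mul_of_nonneg_left (pow_le_pow_of_le_one (norm_nonneg z) hz.le h) (hC0 k)

/-- The polynomial `z ↦ R (y + z)`. -/
def translateP (y : En n) (R : MvPolynomial (Fin n) ℂ) : MvPolynomial (Fin n) ℂ :=
  MvPolynomial.aeval (fun i => MvPolynomial.C (y i) + MvPolynomial.X i) R

lemma pev_translateP (y : En n) (R : MvPolynomial (Fin n) ℂ) (z : En n) :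
    pev (translateP y R) z = pev R (y + z) := by
  have h : (MvPolynomial.aeval (fun i => z i) : MvPolynomial (Fin n) ℂ →ₐ[ℂ] ℂ).comp
      (MvPolynomial.aeval fun i => MvPolynomial.C (y i) + MvPolynomial.X i) =
      MvPolynomial.aeval fun i => (y + z) i := by
    ext i
    simp
  exact congrArg (fun F : MvPolynomial (Fin n) ℂ →ₐ[ℂ] ℂ => F R) h

lemma exists_isInit_translate {R : MvPolynomial (Fin n) ℂ} (hR : R ≠ 0) (y : En n) :
    ∃ e S, IsInit (fun z => pev R (y + z)) e S := by
  have h : translateP y R ≠ 0 := by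
    intro h
    obtain ⟨x, hx⟩ := exists_pev_ne_zero hR
    apply hx
    have := pev_translateP y R (x - y)
    rw [h, add_sub_cancel] at this
    rw [← this]; simp [pev]
  obtain ⟨e, S, hS⟩ := exists_isInit_pev h
  refine ⟨e, S, ?_⟩
  have : (fun z => pev R (y + z)) = pev (translateP y R) := funext fun z => (pev_translateP y R z).symm
  rw [this]; exact hS

lemma IsInit.tendsto {f : En n → ℂ} {m : ℕ} {P : MvPolynomial (Fin n) ℂ} (h : IsInit f m P)
    {z : ℝ → En n} {z₀ : En n} (hz : Tendsto z (𝓝[>] 0) (𝓝 z₀)) :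
    Tendsto (fun t : ℝ => f ((t : ℂ) • z t) / (t : ℂ) ^ m) (𝓝[>] 0) (𝓝 (pev P z₀)) := by
  have h1 : Tendsto (fun t => pev P (z t)) (𝓝[>] 0) (𝓝 (pev P z₀)) :=
    ((continuous_pev P).tendsto z₀).comp hz
  have h2 : Tendsto (fun t : ℝ => f ((t : ℂ) • z t) / (t : ℂ) ^ m - pev P (z t)) (𝓝[>] 0)
      (𝓝 0) := by
    rw [Metric.tendsto_nhds]
    intro ε hε
    have hb : ∀ᶠ t : ℝ in 𝓝[>] 0, ‖z t‖ ≤ ‖z₀‖ + 1 :=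
      (hz.norm.eventually (gt_mem_nhds (lt_add_one _))).mono fun t ht => ht.le
    filter_upwards [h.rescale (‖z₀‖ + 1) (half_pos hε), hb, self_mem_nhdsWithin] with t e1 e2 e3
    have ht : (0 : ℝ) < t := e3
    have htp : 0 < t ^ m := by positivity
    have hne : (t : ℂ) ^ m ≠ 0 := pow_ne_zero _ (by exact_mod_cast ht.ne')
    have e4 := e1 _ e2
    have e5 : f ((t : ℂ) • z t) / (t : ℂ) ^ m - pev P (z t) =
        (f ((t : ℂ) • z t) - (t : ℂ) ^ m * pev P (z t)) / (t : ℂ) ^ m := by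
      field_simp
    rw [dist_zero_right, e5, norm_div, norm_pow, Complex.norm_real, Real.norm_of_nonneg ht.le,
      div_lt_iff₀ htp]
    nlinarith
  have := h2.add h1
  simpa using this

lemma IsInit.one_le {f : En n → ℂ} {m : ℕ} {P : MvPolynomial (Fin n) ℂ} (h : IsInit f m P)
    (h0 : f 0 = 0) : 1 ≤ m := by
  by_contra hm
  obtain rfl : m = 0 := by omega
  have h1 := h.tendsto (z := fun _ => (0 : En n)) tendsto_const_nhds
  simp only [smul_zero, h0, pow_zero, zero_div] at h1
  have h2 := tendsto_nhds_unique h1 tendsto_const_nhds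
  obtain ⟨x, hx⟩ := exists_pev_ne_zero h.ne
  have h3 := h.hom.pev_smul 0 x
  rw [zero_smul, h2, pow_zero, one_mul] at h3
  exact hx h3.symm

lemma IsInit.pev_eq_fderiv {f : En n → ℂ} {P : MvPolynomial (Fin n) ℂ} (h : IsInit f 1 P)
    (hf : DifferentiableAt ℂ f 0) (h0 : f 0 = 0) (z : En n) : pev P z = fderiv ℂ f 0 z := by
  have h1 := h.tendsto (z := fun _ => z) tendsto_const_nhds
  have h2 : HasDerivAt (fun t : ℝ => f ((t : ℂ) • z)) (fderiv ℂ f 0 z) 0 := by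
    have e1 : HasDerivAt (fun t : ℝ => (t : ℂ) • z) z 0 := by
      have := (Complex.ofRealCLM.hasDerivAt (x := 0)).smul_const z
      simpa using this
    have e2 : HasFDerivAt f ((fderiv ℂ f 0).restrictScalars ℝ) ((fun t : ℝ => (t : ℂ) • z) 0) := by
      simp only [Complex.ofReal_zero, zero_smul]
      exact hf.hasFDerivAt.restrictScalars ℝ
    exact e2.comp_hasDerivAt 0 e1
  have h3 := h2.hasDerivWithinAt (s := Ioi 0)
  rw [hasDerivWithinAt_iff_tendsto_slope' (by simp)] at h3
  refine tendsto_nhds_unique h1 (h3.congr' ?_)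
  filter_upwards [self_mem_nhdsWithin] with t ht
  simp [slope, h0, div_eq_inv_mul]

lemma IsInit.eq_one {f : En n → ℂ} {m : ℕ} {P : MvPolynomial (Fin n) ℂ} (h : IsInit f m P)
    (hf : DifferentiableAt ℂ f 0) (h0 : f 0 = 0) (hd : fderiv ℂ f 0 ≠ 0) : m = 1 := by
  have hm := h.one_le h0
  by_contra hne
  apply hd
  ext1 z
  have h1 := h.tendsto (z := fun _ => z) tendsto_const_nhds
  have h4 : Tendsto (fun t : ℝ => (t : ℂ) ^ (m - 1)) (𝓝[>] 0) (𝓝 0) := by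
    have : Continuous fun t : ℝ => (t : ℂ) ^ (m - 1) := by fun_prop
    have := this.tendsto 0
    rw [Complex.ofReal_zero, zero_pow (by omega)] at this
    exact this.mono_left nhdsWithin_le_nhds
  have h5 := h4.mul h1
  rw [zero_mul] at h5
  have h2 : HasDerivAt (fun t : ℝ => f ((t : ℂ) • z)) (fderiv ℂ f 0 z) 0 := by
    have e1 : HasDerivAt (fun t : ℝ => (t : ℂ) • z) z 0 := by
      have := (Complex.ofRealCLM.hasDerivAt (x := 0)).smul_const z
      simpa using this
    have e2 : HasFDerivAt f ((fderiv ℂ f 0).restrictScalars ℝ) ((fun t : ℝ => (t : ℂ) • z) 0) := by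
      simp only [Complex.ofReal_zero, zero_smul]
      exact hf.hasFDerivAt.restrictScalars ℝ
    exact e2.comp_hasDerivAt 0 e1
  have h3 := h2.hasDerivWithinAt (s := Ioi 0)
  rw [hasDerivWithinAt_iff_tendsto_slope' (by simp)] at h3
  refine tendsto_nhds_unique h3 (h5.congr' ?_)
  filter_upwards [self_mem_nhdsWithin] with t ht
  have ht' : (t : ℂ) ≠ 0 := by exact_mod_cast (ne_of_gt ht)
  have : (t : ℂ) ^ m = (t : ℂ) ^ (m - 1) * t := by rw [← pow_succ]; congr 1; omega
  simp only [slope, h0, this, vsub_eq_sub, sub_zero, Complex.ofReal_zero, zero_smul,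
    Complex.real_smul, Complex.ofReal_inv]
  field_simp
end

section
variable {n : ℕ}

lemma exists_entire_extension (Z : Finset ℂ) (φ : ℂ → ℂ) (hd : ∀ z ∉ Z, DifferentiableAt ℂ φ z)
    (hb : ∀ z, ∃ C, ∀ᶠ w in 𝓝[≠] z, ‖φ w‖ ≤ C) :
    ∃ ψ : ℂ → ℂ, Differentiable ℂ ψ ∧ ∀ z ∉ Z, ψ z = φ z := by
  classical
  induction Z using Finset.induction_on generalizing φ with
  | empty => exact ⟨φ, fun z => hd z (by simp), fun z _ => rfl⟩
  | insert c Z hc ih =>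
    obtain ⟨ψ, h1, h2⟩ := ih (Function.update φ c (limUnder (𝓝[≠] c) φ)) (by
      intro z hz
      by_cases hzc : z = c
      · subst hzc
        obtain ⟨C, hC⟩ := hb z
        have h3 : ∀ᶠ w in 𝓝[≠] z, w ∉ Z :=
          nhdsWithin_le_nhds (Z.finite_toSet.isClosed.isOpen_compl.mem_nhds hz)
        obtain ⟨s, hs, hs'⟩ := mem_nhdsWithin_iff_exists_mem_nhds_inter.1 (hC.and h3)
        have h4 := Complex.differentiableOn_update_limUnder_of_bddAbove (f := φ) hs
          (fun w hw => (hd w (by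
            simp only [Finset.mem_insert, not_or]
            exact ⟨hw.2, (hs' hw).2⟩)).differentiableWithinAt)
          ⟨C, by rintro _ ⟨w, hw, rfl⟩; exact (hs' hw).1⟩
        exact h4.differentiableAt hs
      · refine (hd z (by simp [hzc, hz])).congr_of_eventuallyEq ?_
        filter_upwards [isOpen_ne.mem_nhds hzc] with w hw
        exact Function.update_of_ne hw _ _) (by
      intro z
      obtain ⟨C, hC⟩ := hb z
      refine ⟨max C ‖limUnder (𝓝[≠] c) φ‖, ?_⟩
      filter_upwards [hC] with w hw
      by_cases hwc : w = c
      · subst hwc; simp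
      · rw [Function.update_of_ne hwc]; exact hw.trans (le_max_left _ _))
    refine ⟨ψ, h1, fun z hz => ?_⟩
    simp only [Finset.mem_insert, not_or] at hz
    rw [h2 z hz.2, Function.update_of_ne hz.1]

/-- An entire function of polynomial growth is its Taylor polynomial. -/
lemma entire_eq_sum_of_growth {ψ : ℂ → ℂ} (hψ : Differentiable ℂ ψ) {A B : ℝ} (hA : 0 ≤ A)
    (hB : 0 ≤ B) {d : ℕ} (hg : ∀ z, ‖ψ z‖ ≤ (A + B * ‖z‖) ^ d) (z : ℂ) :
    ψ z = ∑ j ∈ Finset.range (d + 1), (j.factorial : ℂ)⁻¹ * iteratedDeriv j ψ 0 * z ^ j := by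
  have hz : ∀ j, j ∉ Finset.range (d + 1) → iteratedDeriv j ψ 0 = 0 := by
    intro j hj
    have hdj : d + 1 ≤ j := by simpa using hj
    have hle : ∀ R : ℝ, 1 ≤ R → ‖iteratedDeriv j ψ 0‖ ≤ j.factorial * (A + B) ^ d * R⁻¹ := by
      intro R hR
      have hR0 : 0 < R := by linarith
      have h := Complex.norm_iteratedDeriv_le_of_forall_mem_sphere_norm_le j hR0
        hψ.diffContOnCl (c := 0) (C := (A + B) ^ d * R ^ d) (by
          intro w hw
          refine (hg w).trans ?_
          rw [← mul_pow, mem_sphere_zero_iff_norm.1 hw]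
          gcongr
          nlinarith)
      refine h.trans ?_
      rw [div_le_iff₀ (by positivity), mul_assoc (_ * _)]
      have h5 : R ^ d ≤ R⁻¹ * R ^ j := by
        obtain ⟨k, rfl⟩ := Nat.exists_eq_add_of_le hdj
        rw [show R⁻¹ * R ^ (d + 1 + k) = R ^ d * R ^ k by field_simp; ring]
        exact le_mul_of_one_le_right (by positivity) (one_le_pow₀ hR)
      rw [mul_assoc]
      gcongr
    have hlim : Tendsto (fun R : ℝ => j.factorial * (A + B) ^ d * R⁻¹) atTop (𝓝 0) := by
      simpa using tendsto_inv_atTop_zero.const_mul ((j.factorial : ℝ) * (A + B) ^ d)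
    have := ge_of_tendsto hlim (eventually_atTop.2 ⟨1, hle⟩)
    exact norm_le_zero_iff.1 this
  rw [← Complex.taylorSeries_eq_of_entire' 0 z hψ, tsum_eq_sum (s := Finset.range (d + 1))]
  · simp
  · intro j hj
    simp [hz j hj]

lemma exists_pev_eq_diag {j : ℕ} (q : ContinuousMultilinearMap ℂ (fun _ : Fin j => En n) ℂ) :
    ∃ Φ : MvPolynomial (Fin n) ℂ, ∀ v, pev Φ v = q fun _ => v := by
  classical
  refine ⟨∑ r : Fin j → Fin n, MvPolynomial.C (q fun i => EuclideanSpace.single (r i) 1) *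
    ∏ i, MvPolynomial.X (r i), fun v => ?_⟩
  have hv : v = ∑ i, v i • EuclideanSpace.single i (1 : ℂ) := by
    ext k
    simp [Finset.sum_apply, Pi.single_apply]
  have h1 : (q fun _ => v) = q fun _ => ∑ i, v i • EuclideanSpace.single i (1 : ℂ) := by
    rw [← hv]
  have h2 := q.toMultilinearMap.map_sum
    (g := fun (_ : Fin j) (i : Fin n) => v i • (EuclideanSpace.single i (1 : ℂ) : En n))
  rw [h1]
  refine Eq.trans ?_ h2.symm
  simp only [pev, map_sum, map_mul, map_prod, MvPolynomial.eval_C, MvPolynomial.eval_X]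
  refine Finset.sum_congr rfl fun r _ => ?_
  rw [MultilinearMap.map_smul_univ, smul_eq_mul, mul_comm]
  rfl

/-- A function holomorphic off a hypersurface and of polynomial growth is a polynomial. -/
lemma exists_pev_eq_of_growth {F : En n → ℂ} {ρ : MvPolynomial (Fin n) ℂ} (hρ : ρ ≠ 0)
    (hF : ∀ w, pev ρ w ≠ 0 → AnalyticAt ℂ F w) {K : ℝ} (hK : 0 ≤ K) {d : ℕ}
    (hg : ∀ w, pev ρ w ≠ 0 → ‖F w‖ ≤ (1 + K * ‖w‖) ^ d) :
    ∃ Φ : MvPolynomial (Fin n) ℂ, ∀ w, pev ρ w ≠ 0 → F w = pev Φ w := by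
  classical
  obtain ⟨w₀, hw₀⟩ := exists_pev_ne_zero hρ
  obtain ⟨q, r, hq⟩ := hF w₀ hw₀
  choose Φ hΦ using fun j => exists_pev_eq_diag (q j)
  refine ⟨translateP (-w₀) (∑ j ∈ Finset.range (d + 1), Φ j), fun w hw => ?_⟩
  set v := -w₀ + w with hv
  have hsum : pev (∑ j ∈ Finset.range (d + 1), Φ j) v =
      ∑ j ∈ Finset.range (d + 1), q j fun _ => v := by
    rw [pev, map_sum]
    exact Finset.sum_congr rfl fun j _ => hΦ j v
  rw [pev_translateP, hsum]
  have hl0 : lineP ρ v w₀ ≠ 0 := by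
    intro h
    apply hw₀
    have := eval_lineP ρ v w₀ 0
    rw [h] at this
    simpa using this.symm
  have hZ : ∀ t, t ∉ (lineP ρ v w₀).roots.toFinset ↔ pev ρ (w₀ + t • v) ≠ 0 := by
    intro t
    rw [Multiset.mem_toFinset, Polynomial.mem_roots hl0, Polynomial.IsRoot.def, eval_lineP]
  set Z := (lineP ρ v w₀).roots.toFinset with hZdef
  have hZe : ∀ z : ℂ, ∀ᶠ w in 𝓝[≠] z, w ∉ Z := by
    intro z
    have h1 : ((Z.erase z : Finset ℂ) : Set ℂ)ᶜ ∈ 𝓝 z :=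
      (Z.erase z).finite_toSet.isClosed.isOpen_compl.mem_nhds (by simp)
    filter_upwards [nhdsWithin_le_nhds h1, self_mem_nhdsWithin] with t ht ht' htZ
    exact ht (by simpa using ⟨htZ, ht'⟩)
  have hline : ∀ t : ℂ, AnalyticAt ℂ (fun t : ℂ => w₀ + t • v) t := fun t =>
    analyticAt_const.add (analyticAt_id.smul analyticAt_const)
  have hbd : ∀ t, t ∉ Z → ‖F (w₀ + t • v)‖ ≤ ((1 + K * ‖w₀‖) + K * ‖v‖ * ‖t‖) ^ d := by
    intro t ht
    refine (hg _ ((hZ t).1 ht)).trans ?_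
    have : ‖w₀ + t • v‖ ≤ ‖w₀‖ + ‖t‖ * ‖v‖ := (norm_add_le _ _).trans (by rw [norm_smul])
    exact pow_le_pow_left₀ (by positivity) (by nlinarith) _
  obtain ⟨ψ, hψd, hψe⟩ := exists_entire_extension Z (fun t => F (w₀ + t • v))
    (fun t ht => ((hF _ ((hZ t).1 ht)).comp_of_eq (hline t) rfl).differentiableAt)
    (fun z => ⟨((1 + K * ‖w₀‖) + K * ‖v‖ * (‖z‖ + 1)) ^ d, by
      filter_upwards [hZe z, nhdsWithin_le_nhds (ball_mem_nhds z one_pos)] with t ht ht1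
      refine (hbd t ht).trans ?_
      have : ‖t‖ ≤ ‖z‖ + 1 := by
        have h1 := norm_sub_norm_le t z
        rw [mem_ball, dist_eq_norm] at ht1
        linarith
      gcongr⟩)
  have hψg : ∀ t, ‖ψ t‖ ≤ ((1 + K * ‖w₀‖) + K * ‖v‖ * ‖t‖) ^ d := by
    intro z
    have h1 : Tendsto (fun t => ‖ψ t‖) (𝓝[≠] z) (𝓝 ‖ψ z‖) :=
      (hψd.continuous.norm.tendsto z).mono_left nhdsWithin_le_nhds
    have h2 : Tendsto (fun t : ℂ => ((1 + K * ‖w₀‖) + K * ‖v‖ * ‖t‖) ^ d) (𝓝[≠] z)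
        (𝓝 (((1 + K * ‖w₀‖) + K * ‖v‖ * ‖z‖) ^ d)) := by
      refine Tendsto.mono_left (Continuous.tendsto ?_ z) nhdsWithin_le_nhds
      fun_prop
    refine le_of_tendsto_of_tendsto h1 h2 ?_
    filter_upwards [hZe z] with t ht
    rw [hψe t ht]
    exact hbd t ht
  have h0Z : (0 : ℂ) ∉ Z := (hZ 0).2 (by simpa using hw₀)
  have h1Z : (1 : ℂ) ∉ Z := (hZ 1).2 (by simpa [hv] using hw)
  have h1 := entire_eq_sum_of_growth hψd (by positivity) (by positivity) hψg 1
  rw [hψe 1 h1Z] at h1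
  simp only [one_smul, one_pow, mul_one] at h1
  rw [show w₀ + v = w by simp [hv]] at h1
  rw [h1]
  refine Finset.sum_congr rfl fun j _ => ?_
  have hev : ψ =ᶠ[𝓝 0] fun t => F (w₀ + t • v) := by
    filter_upwards [Z.finite_toSet.isClosed.isOpen_compl.mem_nhds h0Z] with t ht
    exact hψe t ht
  rw [hev.iteratedDeriv_eq, iteratedDeriv_eq_iteratedFDeriv]
  have hq' : HasFPowerSeriesAt (fun z => F (w₀ + z)) q ((ContinuousLinearMap.toSpanSingleton ℂ v) 0) := by
    rw [map_zero]
    have := HasFPowerSeriesOnBall.hasFPowerSeriesAt (hq.comp_sub (-w₀))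
    simpa [sub_neg_eq_add, add_comm] using this
  obtain ⟨r', h5⟩ := hq'.compContinuousLinearMap
  have h6 := h5.factorial_smul (1 : ℂ) j
  have h7 : ((fun z => F (w₀ + z)) ∘ (ContinuousLinearMap.toSpanSingleton ℂ v : ℂ →L[ℂ] En n)) =
      fun t : ℂ => F (w₀ + t • v) := by
    ext t; simp
  rw [h7] at h6
  rw [← h6, nsmul_eq_mul, inv_mul_cancel_left₀ (by exact_mod_cast j.factorial_ne_zero)]
  rw [FormalMultilinearSeries.compContinuousLinearMap_apply]
  congr 1
  ext i
  simp

lemma exists_root_function {p : MvPolynomial (Fin n) ℂ} {b w₀ : En n} {l : ℂ}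
    (h : pev p (w₀ + l • b) = 0) (hd : fderiv ℂ (pev p) (w₀ + l • b) b ≠ 0) :
    ∃ g : En n → ℂ, AnalyticAt ℂ g w₀ ∧ g w₀ = l ∧ ∀ᶠ w in 𝓝 w₀, pev p (w + g w • b) = 0 := by
  set f : En n × ℂ → ℂ := fun u => pev p (u.1 + u.2 • b) with hf
  have hc : ContDiff ℂ ⊤ f := by
    refine (contDiff_pev p).comp ?_
    fun_prop
  have hcd : ContDiffAt ℂ ⊤ f (w₀, l) := hc.contDiffAt
  have hfd : HasFDerivAt f ((fderiv ℂ (pev p) (w₀ + l • b)) ∘L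
      (ContinuousLinearMap.fst ℂ (En n) ℂ +
        (ContinuousLinearMap.snd ℂ (En n) ℂ).smulRight b)) (w₀, l) := by
    refine HasFDerivAt.comp (g := pev p) (f := fun u : En n × ℂ => u.1 + u.2 • b) (w₀, l)
      (differentiable_pev p _).hasFDerivAt ?_
    exact hasFDerivAt_fst.add (hasFDerivAt_snd.smul_const b)
  have hinv : (fderiv ℂ f (w₀, l) ∘L .inr ℂ (En n) ℂ).IsInvertible := by
    rw [hfd.fderiv]
    refine ⟨ContinuousLinearEquiv.unitsEquivAut ℂ (Units.mk0 _ hd), ?_⟩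
    ext
    simp
  refine ⟨hcd.implicitFunction (by simp) hinv,
    (hcd.contDiffAt_implicitFunction (by simp) hinv).analyticAt,
    hcd.implicitFunction_apply_self (by simp) hinv, ?_⟩
  filter_upwards [hcd.eventually_apply_implicitFunction (by simp) hinv] with w hw
  rw [← h]
  exact hw

lemma exists_root_bound {p : MvPolynomial (Fin n) ℂ} {d : ℕ} (hp : p.IsHomogeneous d) {b : En n}
    (hb : pev p b ≠ 0) : ∃ K ≥ 0, ∀ (w : En n) (l : ℂ), pev p (w + l • b) = 0 → ‖l‖ ≤ K * ‖w‖ := by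
  obtain ⟨κ, hκ, hball⟩ := Metric.eventually_nhds_iff.1
    ((continuous_pev p).continuousAt.eventually_ne hb)
  refine ⟨κ⁻¹, by positivity, fun w l h => ?_⟩
  by_cases hl : l = 0
  · simp [hl]; positivity
  by_contra hlt
  push Not at hlt
  have h1 : pev p (l⁻¹ • w + b) ≠ 0 := by
    apply hball
    rw [dist_eq_norm, add_sub_cancel_right, norm_smul, norm_inv]
    have := norm_pos_iff.2 hl
    rw [inv_mul_lt_iff₀ this]
    rw [inv_mul_lt_iff₀ hκ] at hlt
    linarith
  apply h1
  have h2 : w + l • b = l • (l⁻¹ • w + b) := by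
    rw [smul_add, smul_inv_smul₀ hl]
  rw [h2, hp.pev_smul] at h
  exact (mul_eq_zero.1 h).resolve_left (pow_ne_zero _ hl)

/-- The product of the negatives of the roots `λ` of `p (w + λ b)` with `w + λ b ∈ u`. -/
def partProd (p : MvPolynomial (Fin n) ℂ) (b : En n) (u : Set (En n)) (w : En n) : ℂ :=
  open Classical in
  ∏ l ∈ (lineP p b w).roots.toFinset, if w + l • b ∈ u then -l else 1

lemma mem_rootsFinset {p : MvPolynomial (Fin n) ℂ} {d : ℕ} (hp : p.IsHomogeneous d) {b : En n}
    (hb : pev p b ≠ 0) {w : En n} {l : ℂ} :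
    l ∈ (lineP p b w).roots.toFinset ↔ pev p (w + l • b) = 0 := by
  rw [Multiset.mem_toFinset, mem_roots_lineP hp hb]

lemma roots_nodup {p : MvPolynomial (Fin n) ℂ} {d : ℕ} (hp : p.IsHomogeneous d) {b : En n}
    (hb : pev p b ≠ 0) {w : En n}
    (hw : ∀ l : ℂ, pev p (w + l • b) = 0 → fderiv ℂ (pev p) (w + l • b) b ≠ 0) :
    (lineP p b w).roots.Nodup := by
  classical
  rw [Multiset.nodup_iff_count_le_one]
  intro l
  rw [Polynomial.count_roots]
  by_contra hlt
  push Not at hlt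
  rw [Polynomial.one_lt_rootMultiplicity_iff_isRoot (lineP_ne_zero hp hb w)] at hlt
  have h1 : pev p (w + l • b) = 0 := by
    rw [← eval_lineP]; exact hlt.1
  apply hw l h1
  have h2 : HasDerivAt (fun t : ℂ => pev p (w + t • b)) (fderiv ℂ (pev p) (w + l • b) b) l := by
    refine HasFDerivAt.comp_hasDerivAt (l := pev p) (f := fun t : ℂ => w + t • b) l
      (differentiable_pev p _).hasFDerivAt ?_
    simpa using ((hasDerivAt_id l).smul_const b).const_add w
  have h3 : (fun t : ℂ => pev p (w + t • b)) = fun t => (lineP p b w).eval t := by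
    ext t; rw [eval_lineP]
  rw [h3] at h2
  rw [h2.unique ((lineP p b w).hasDerivAt l)]
  exact hlt.2

section partProd
variable {p : MvPolynomial (Fin n) ℂ} {d : ℕ} {b w : En n} {u v : Set (En n)}

lemma norm_partProd_le (hp : p.IsHomogeneous d) (hb : pev p b ≠ 0) {K : ℝ} (hK : 0 ≤ K)
    (hroot : ∀ (w : En n) (l : ℂ), pev p (w + l • b) = 0 → ‖l‖ ≤ K * ‖w‖)
    {s : Finset ℂ} (hs : s ⊆ (lineP p b w).roots.toFinset) [DecidablePred fun l : ℂ => w + l • b ∈ u] :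
    ‖∏ l ∈ s, if w + l • b ∈ u then -l else 1‖ ≤ (1 + K * ‖w‖) ^ d := by
  have h0 : 0 ≤ K * ‖w‖ := by positivity
  have h1 : ‖∏ l ∈ s, if w + l • b ∈ u then -l else 1‖ ≤
      ∏ _l ∈ s, (1 + K * ‖w‖) := by
    rw [norm_prod]
    refine Finset.prod_le_prod (fun _ _ => norm_nonneg _) fun l hl => ?_
    have h2 := hroot w l ((mem_rootsFinset hp hb).1 (hs hl))
    split_ifs
    · rw [norm_neg]; linarith
    · rw [norm_one]; linarith
  refine h1.trans ?_
  rw [Finset.prod_const]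
  refine pow_le_pow_right₀ (by linarith) ?_
  rw [← card_roots_lineP hp hb w]
  exact (Finset.card_le_card hs).trans (Multiset.toFinset_card_le _)

lemma pev_eq_partProd_mul (hp : p.IsHomogeneous d) (hb : pev p b ≠ 0)
    (hw : ∀ l : ℂ, pev p (w + l • b) = 0 → fderiv ℂ (pev p) (w + l • b) b ≠ 0)
    (huv : ∀ l : ℂ, pev p (w + l • b) = 0 → (w + l • b ∈ u ↔ w + l • b ∉ v)) :
    pev p w = pev p b * (partProd p b u w * partProd p b v w) := by
  classical
  have h1 := pev_line_eq_prod hp hb w 0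
  rw [zero_smul, add_zero] at h1
  have h3 : ((lineP p b w).roots.map fun z => 0 - z).prod =
      ∏ l ∈ (lineP p b w).roots.toFinset, -l := by
    rw [Finset.prod, Multiset.toFinset_val, (roots_nodup hp hb hw).dedup]
    simp
  rw [h1, h3, partProd, partProd, ← Finset.prod_mul_distrib]
  congr 1
  refine Finset.prod_congr rfl fun l hl => ?_
  have h2 := huv l ((mem_rootsFinset hp hb).1 hl)
  by_cases hu : w + l • b ∈ u
  · simp [hu, h2.1 hu]
  · have : w + l • b ∈ v := by
      by_contra hv
      exact hu (h2.2 hv)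
    simp [hu, this]

lemma analyticAt_partProd (hp : p.IsHomogeneous d) (hb : pev p b ≠ 0)
    (hu : IsOpen u) (hv : IsOpen v)
    (hw : ∀ᶠ w in 𝓝 w, ∀ l : ℂ, pev p (w + l • b) = 0 → fderiv ℂ (pev p) (w + l • b) b ≠ 0)
    (huv : ∀ᶠ w in 𝓝 w, ∀ l : ℂ, pev p (w + l • b) = 0 → (w + l • b ∈ u ↔ w + l • b ∉ v)) :
    AnalyticAt ℂ (partProd p b u) w := by
  classical
  set S := (lineP p b w).roots.toFinset with hS
  have hex : ∀ l ∈ S, ∃ g : En n → ℂ, AnalyticAt ℂ g w ∧ g w = l ∧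
      ∀ᶠ w in 𝓝 w, pev p (w + g w • b) = 0 := fun l hl =>
    exists_root_function ((mem_rootsFinset hp hb).1 hl)
      (hw.self_of_nhds l ((mem_rootsFinset hp hb).1 hl))
  choose! g hg using hex
  have hcont : ∀ l ∈ S, ContinuousAt (fun w => w + g l w • b) w := fun l hl =>
    continuousAt_id.add ((hg l hl).1.continuousAt.smul continuousAt_const)
  have hcard : ∀ w, (∀ l : ℂ, pev p (w + l • b) = 0 → fderiv ℂ (pev p) (w + l • b) b ≠ 0) →
      (lineP p b w).roots.toFinset.card = d := by
    intro w hw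
    rw [Multiset.toFinset_card_of_nodup (roots_nodup hp hb hw), card_roots_lineP hp hb]
  have e1 : ∀ᶠ y in 𝓝 w, ∀ l ∈ S, pev p (y + g l y • b) = 0 :=
    (Filter.eventually_all_finset S).2 fun l hl => (hg l hl).2.2
  have e2 : ∀ᶠ y in 𝓝 w, ∀ l ∈ S, ∀ l' ∈ S, l ≠ l' → g l y ≠ g l' y := by
    refine (Filter.eventually_all_finset S).2 fun l hl =>
      (Filter.eventually_all_finset S).2 fun l' hl' => ?_
    by_cases hll : l = l'
    · simp [hll]
    · have := (hg l hl).1.continuousAt.ne_iff_eventually_ne (hg l' hl').1.continuousAt |>.1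
        (by rw [(hg l hl).2.1, (hg l' hl').2.1]; exact hll)
      filter_upwards [this] with y hy _ using hy
  have e3 : ∀ᶠ y in 𝓝 w, ∀ l ∈ S, w + l • b ∈ u → y + g l y • b ∈ u := by
    refine (Filter.eventually_all_finset S).2 fun l hl => ?_
    by_cases h : w + l • b ∈ u
    · filter_upwards [(hcont l hl).preimage_mem_nhds (hu.mem_nhds (by
        rw [(hg l hl).2.1]; exact h))] with y hy _ using hy
    · simp [h]
  have e4 : ∀ᶠ y in 𝓝 w, ∀ l ∈ S, w + l • b ∈ v → y + g l y • b ∈ v := by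
    refine (Filter.eventually_all_finset S).2 fun l hl => ?_
    by_cases h : w + l • b ∈ v
    · filter_upwards [(hcont l hl).preimage_mem_nhds (hv.mem_nhds (by
        rw [(hg l hl).2.1]; exact h))] with y hy _ using hy
    · simp [h]
  have hev : partProd p b u =ᶠ[𝓝 w] fun y => ∏ l ∈ S, if w + l • b ∈ u then -g l y else 1 := by
    filter_upwards [e1, e2, e3, e4, hw, huv] with y h1 h2 h3 h4 h5 h6
    have hinj : Set.InjOn (fun l => g l y) S := by
      intro l hl l' hl' h
      by_contra hne
      exact h2 l hl l' hl' hne h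
    have himg : S.image (fun l => g l y) = (lineP p b y).roots.toFinset := by
      refine Finset.eq_of_subset_of_card_le ?_ ?_
      · intro x hx
        obtain ⟨l, hl, rfl⟩ := Finset.mem_image.1 hx
        exact (mem_rootsFinset hp hb).2 (h1 l hl)
      · rw [Finset.card_image_of_injOn hinj, hcard y h5, hcard w hw.self_of_nhds]
    rw [partProd, ← himg, Finset.prod_image hinj]
    refine Finset.prod_congr rfl fun l hl => ?_
    by_cases h : w + l • b ∈ u
    · rw [if_pos h, if_pos (h3 l hl h)]
    · have hlv : w + l • b ∈ v := by
        by_contra hv'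
        exact h ((huv.self_of_nhds l ((mem_rootsFinset hp hb).1 hl)).2 hv')
      have : y + g l y • b ∉ u := fun hh => (h6 _ (h1 l hl)).1 hh (h4 l hl hlv)
      rw [if_neg h, if_neg this]
  refine AnalyticAt.congr ?_ hev.symm
  refine Finset.analyticAt_fun_prod _ fun l hl => ?_
  split_ifs
  · exact (hg l hl).1.neg
  · exact analyticAt_const

end partProd

lemma pev_eq_zero_of_partProd {p Φ ρ : MvPolynomial (Fin n) ℂ} {d : ℕ} {b x : En n}
    {u : Set (En n)} (hp : p.IsHomogeneous d) (hb : pev p b ≠ 0) (hρ : ρ ≠ 0)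
    (hΦ : ∀ w, pev ρ w ≠ 0 → partProd p b u w = pev Φ w) (hu : IsOpen u) (hx : pev p x = 0)
    (hxu : x ∈ u) : pev Φ x = 0 := by
  classical
  obtain ⟨K, hK, hroot⟩ := exists_root_bound hp hb
  by_contra hne
  have hc : 0 < ‖pev Φ x‖ / 2 := by have := norm_pos_iff.2 hne; positivity
  obtain ⟨δ, hδ, hball⟩ := Metric.isOpen_iff.1 hu x hxu
  set M := (1 + K * (‖x‖ + 1)) ^ d with hM
  have hM0 : 0 < M := by positivity
  obtain ⟨η, hη, hη1, hη2⟩ : ∃ η : ℝ, 0 < η ∧ η * M ≤ ‖pev Φ x‖ / 2 ∧ η * ‖b‖ ≤ δ / 2 := by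
    refine ⟨min (‖pev Φ x‖ / 2 / M) (δ / 2 / (‖b‖ + 1)), by positivity, ?_, ?_⟩
    · rw [← le_div_iff₀ hM0]; exact min_le_left _ _
    · calc _ ≤ δ / 2 / (‖b‖ + 1) * (‖b‖ + 1) := by
            gcongr
            · exact min_le_right _ _
            · linarith
        _ = δ / 2 := by field_simp
  have hev : ∀ᶠ w in 𝓝 x, ‖pev Φ x‖ / 2 < ‖pev Φ w‖ :=
    (continuous_pev Φ).norm.continuousAt.eventually_const_lt (by linarith)
  obtain ⟨w, hw, h1, ⟨l, hl, hl'⟩, h3, h4⟩ := ((mem_closure_iff_frequently.1 (dense_pev_ne_zero hρ x)).and_eventually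
    (hev.and ((eventually_exists_small_root hp hb hx hη).and ((eventually_mem_set.2 (ball_mem_nhds x one_pos)).and
      (eventually_mem_set.2 (ball_mem_nhds x (half_pos hδ))))))).exists
  have hlu : w + l • b ∈ u := by
    apply hball
    rw [mem_ball, dist_eq_norm] at h4 ⊢
    calc ‖w + l • b - x‖ = ‖(w - x) + l • b‖ := by congr 1; abel
      _ ≤ ‖w - x‖ + ‖l‖ * ‖b‖ := (norm_add_le _ _).trans (by rw [norm_smul])
      _ ≤ ‖w - x‖ + η * ‖b‖ := by gcongr
      _ < δ := by linarith
  have hmem := (mem_rootsFinset hp hb).2 hl'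
  rw [← hΦ w hw, partProd, ← Finset.mul_prod_erase _ _ hmem, if_pos hlu, norm_mul, norm_neg] at h1
  have h5 := norm_partProd_le (u := u) hp hb hK hroot
    (Finset.erase_subset l (lineP p b w).roots.toFinset)
  have h6 : (1 + K * ‖w‖) ^ d ≤ M := by
    have : ‖w‖ ≤ ‖x‖ + 1 := by
      have h7 := norm_sub_norm_le w x
      rw [mem_ball, dist_eq_norm] at h3
      linarith
    rw [hM]
    gcongr
  have h8 : ‖l‖ * ‖∏ l ∈ (lineP p b w).roots.toFinset.erase l, if w + l • b ∈ u then -l else 1‖ ≤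
      η * M := by
    gcongr
    exact h5.trans h6
  linarith

/-- The complement of a proper closed subset in an irreducible hypersurface is connected. -/
theorem isPreconnected_sdiff {p D : MvPolynomial (Fin n) ℂ} {d : ℕ} (hp : p.IsHomogeneous d)
    (hpi : Irreducible p) (hD : ¬ p ∣ D) : IsPreconnected {y : En n | pev p y = 0 ∧ pev D y ≠ 0} := by
  classical
  obtain ⟨b, hb⟩ := exists_pev_ne_zero hpi.ne_zero
  have hD' : ¬ p ∣ D * dirD b p := fun h => (hpi.prime.dvd_or_dvd h).elim hD
    (not_dvd_dirD hp (one_le_of_irreducible hp hpi) hb)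
  obtain ⟨ρ, hρ, hel⟩ := exists_elimination hp hpi hb hD'
  obtain ⟨K, hK, hroot⟩ := exists_root_bound hp hb
  suffices hA : IsPreconnected {y : En n | pev p y = 0 ∧ pev (D * dirD b p) y ≠ 0} by
    refine hA.subset_closure ?_ ?_
    · rintro y ⟨h1, h2⟩
      refine ⟨h1, fun h => h2 ?_⟩
      rw [pev_mul, h, zero_mul]
    · rintro y ⟨h1, -⟩
      exact subset_closure_sdiff hp hpi hD' h1
  rw [isPreconnected_iff_subset_of_disjoint]
  intro u v hu hv hcov hdis
  have hopen : IsOpen {w : En n | pev ρ w ≠ 0} := isOpen_ne_fun (continuous_pev ρ) continuous_const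
  have hw : ∀ w, pev ρ w ≠ 0 → ∀ l : ℂ, pev p (w + l • b) = 0 →
      fderiv ℂ (pev p) (w + l • b) b ≠ 0 := by
    intro w hw l hl h
    apply hel w l hw hl
    rw [pev_mul, pev_dirD, h, mul_zero]
  have huv : ∀ w, pev ρ w ≠ 0 → ∀ l : ℂ, pev p (w + l • b) = 0 →
      (w + l • b ∈ u ↔ w + l • b ∉ v) := by
    intro w hw l hl
    have hmem : w + l • b ∈ {y : En n | pev p y = 0 ∧ pev (D * dirD b p) y ≠ 0} :=
      ⟨hl, hel w l hw hl⟩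
    constructor
    · intro h1 h2
      exact (hdis.le ⟨hmem, h1, h2⟩ : _)
    · intro h
      exact (hcov hmem).resolve_right h
  have hvu : ∀ w, pev ρ w ≠ 0 → ∀ l : ℂ, pev p (w + l • b) = 0 →
      (w + l • b ∈ v ↔ w + l • b ∉ u) := fun w hw l hl => by
    rw [huv w hw l hl, not_not]
  obtain ⟨Φ, hΦ⟩ := exists_pev_eq_of_growth (F := partProd p b u) hρ (fun w hwρ =>
    analyticAt_partProd hp hb hu hv
      (by filter_upwards [hopen.mem_nhds hwρ] with y hy using hw y hy)
      (by filter_upwards [hopen.mem_nhds hwρ] with y hy using huv y hy)) hK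
    (fun w _ => norm_partProd_le hp hb hK hroot subset_rfl)
  obtain ⟨Ψ, hΨ⟩ := exists_pev_eq_of_growth (F := partProd p b v) hρ (fun w hwρ =>
    analyticAt_partProd hp hb hv hu
      (by filter_upwards [hopen.mem_nhds hwρ] with y hy using hw y hy)
      (by filter_upwards [hopen.mem_nhds hwρ] with y hy using hvu y hy)) hK
    (fun w _ => norm_partProd_le hp hb hK hroot subset_rfl)
  have hfac : p = (MvPolynomial.C (pev p b) * Φ) * Ψ := by
    apply pev_ext
    intro x
    have : Set.EqOn (pev p) (pev ((MvPolynomial.C (pev p b) * Φ) * Ψ)) {w | pev ρ w ≠ 0} := by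
      intro w hwρ
      rw [pev_eq_partProd_mul hp hb (hw w hwρ) (huv w hwρ), hΦ w hwρ, hΨ w hwρ]
      simp only [pev_mul, pev_C]
      ring
    exact congrFun (Continuous.ext_on (dense_pev_ne_zero hρ) (continuous_pev _)
      (continuous_pev _) this) x
  have hunit : ∀ {G : MvPolynomial (Fin n) ℂ}, IsUnit G → ∀ x, pev G x ≠ 0 := fun hG x =>
    (hG.map (MvPolynomial.eval (x : Fin n → ℂ))).ne_zero
  rcases hpi.isUnit_or_isUnit hfac with h | h
  · right
    rintro x ⟨hx, hx'⟩
    refine (hcov ⟨hx, hx'⟩).resolve_left fun hxu => ?_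
    have := pev_eq_zero_of_partProd hp hb hρ hΦ hu hx hxu
    exact hunit h x (by rw [pev_mul, this, mul_zero])
  · left
    rintro x ⟨hx, hx'⟩
    refine (hcov ⟨hx, hx'⟩).resolve_right fun hxv => ?_
    exact hunit h x (pev_eq_zero_of_partProd hp hb hρ hΨ hv hx hxv)

end

section
variable {n : ℕ}

lemma isInit_self {P : MvPolynomial (Fin n) ℂ} {m : ℕ} (hP : P.IsHomogeneous m) (h0 : P ≠ 0) :
    IsInit (pev P) m P :=
  ⟨hP, h0, 0, le_rfl, 1, one_pos, fun x _ => by simp⟩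

lemma MvPolynomial.IsHomogeneous.pev_zero_right {P : MvPolynomial (Fin n) ℂ} {m : ℕ}
    (hP : P.IsHomogeneous m) (hm : m ≠ 0) : pev P (0 : En n) = 0 := by
  have := hP.pev_smul 0 (0 : En n)
  simpa [hm] using this

lemma exists_clm_of_linear {ℓ : MvPolynomial (Fin n) ℂ} (hℓ : ℓ.IsHomogeneous 1) (h0 : ℓ ≠ 0) :
    ∃ Λ : En n →L[ℂ] ℂ, Λ ≠ 0 ∧ pev ℓ = Λ := by
  have h1 : pev ℓ = fderiv ℂ (pev ℓ) 0 := by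
    ext z
    exact (isInit_self hℓ h0).pev_eq_fderiv (differentiable_pev ℓ 0)
      (hℓ.pev_zero_right one_ne_zero) z
  refine ⟨fderiv ℂ (pev ℓ) 0, fun h => h0 (pev_ext fun x => ?_), h1⟩
  rw [h1, h]
  simp

lemma fderiv_pev_ne_zero_of_linear {ℓ : MvPolynomial (Fin n) ℂ} (hℓ : ℓ.IsHomogeneous 1)
    (h0 : ℓ ≠ 0) (x : En n) : fderiv ℂ (pev ℓ) x ≠ 0 := by
  obtain ⟨Λ, hΛ, h⟩ := exists_clm_of_linear hℓ h0
  rw [h, Λ.fderiv]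
  exact hΛ

lemma isUnit_of_totalDegree_eq_zero {p : MvPolynomial (Fin n) ℂ} (h : p.totalDegree = 0)
    (h0 : p ≠ 0) : IsUnit p := by
  rw [MvPolynomial.totalDegree_eq_zero_iff_eq_C] at h
  rw [h] at h0 ⊢
  refine IsUnit.map MvPolynomial.C (isUnit_iff_ne_zero.2 fun h' => h0 ?_)
  rw [h', map_zero]

lemma squarefree_of_linear {ℓ : MvPolynomial (Fin n) ℂ} (hℓ : ℓ.IsHomogeneous 1) (h0 : ℓ ≠ 0) :
    Squarefree ℓ := by
  rintro x ⟨c, rfl⟩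
  have hx : x ≠ 0 := by rintro rfl; simp at h0
  have hc : c ≠ 0 := by rintro rfl; simp at h0
  have h1 := hℓ.totalDegree h0
  rw [MvPolynomial.totalDegree_mul_of_isDomain (mul_ne_zero hx hx) hc,
    MvPolynomial.totalDegree_mul_of_isDomain hx hx] at h1
  exact isUnit_of_totalDegree_eq_zero (by omega) hx

lemma LipPair.mono {h h' : En n → En n} {K K' : ℝ} (L : LipPair h h' K) (hK : K ≤ K') :
    LipPair h h' K' :=
  ⟨L.zero, L.zero', fun x y => (L.lip x y).trans (by gcongr),
    fun x y => (L.lip' x y).trans (by gcongr), L.left, L.right⟩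

lemma LipPair.lipGerm_translate {f g : En n → ℂ} {h h' : En n → En n} {K : ℝ}
    (L : LipPair h h' K) (hK : 1 ≤ K) (hfg : ∀ x, g (h x) = 0 ↔ f x = 0) (x : En n) :
    LipGerm (fun z => f (x + z)) (fun z => g (h x + z)) (fun z => h (x + z) - h x)
      (fun z => h' (h x + z) - x) K 1 where
  hK := hK
  hr := one_pos
  φ0 := by simp
  ψ0 := by simp [L.left]
  lipφ y _ z _ := by simpa using L.lip (x + y) (x + z)
  lipψ y _ z _ := by simpa using L.lip' (h x + y) (h x + z)
  left y _ := by simp [L.left]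
  right y _ := by simp [L.right]
  memφ y _ := by simp [hfg]
  memψ y _ := by simp [← hfg, L.right]

lemma squarefree_of_rel_mult {S : MvPolynomial (Fin n) ℂ} {e : ℕ} (hS : S.IsHomogeneous e)
    (hS0 : S ≠ 0) (h : ∀ (q v : MvPolynomial (Fin n) ℂ) (l : ℕ) (y : En n), 1 ≤ l → S = q ^ l * v →
      pev q y = 0 → fderiv ℂ (pev q) y ≠ 0 → pev v y ≠ 0 → l ≤ 1) : Squarefree S := by
  rw [squarefree_iff_irreducible_sq_not_dvd_of_ne_zero hS0]
  intro q hq hqq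
  obtain ⟨v, hv, hqv⟩ :=
    (FiniteMultiplicity.of_prime_left hq.prime hS0).exists_eq_pow_mul_and_not_dvd
  have hl : 2 ≤ multiplicity q S := by
    apply (FiniteMultiplicity.of_prime_left hq.prime hS0).le_multiplicity_of_pow_dvd
    rwa [pow_two]
  have hqh := isHomogeneous_of_dvd hS hS0 (dvd_of_mul_left_dvd hqq)
  have hq1 := one_le_of_irreducible hqh hq
  obtain ⟨y, h1, h2, h3⟩ := closure_nonempty_iff.1 ⟨_, subset_closure_regular hq.squarefree hqh hq
    dvd_rfl hqv (hqh.pev_zero_right (by omega))⟩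
  have := h q v _ y (by omega) hv h1 h2 h3
  omega

/-- Blowing up at a smooth point of the source gives a squarefree cone over a hyperplane. -/
lemma exists_blowup_linear {P R : MvPolynomial (Fin n) ℂ} {d e : ℕ} (hP : P.IsHomogeneous d)
    (hPs : Squarefree P) (hR : R.IsHomogeneous e) (hRs : Squarefree R) {h h' : En n → En n} {K : ℝ}
    (L : LipPair h h' K) (hPR : ∀ x, pev R (h x) = 0 ↔ pev P x = 0) {x : En n}
    (hx : pev P x = 0) (hx' : fderiv ℂ (pev P) x ≠ 0) :
    ∃ (k : ℕ) (S ℓ : MvPolynomial (Fin n) ℂ) (h₁ h₁' : En n → En n) (K₁ : ℝ),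
      IsInit (fun z => pev R (h x + z)) k S ∧ Squarefree S ∧ ℓ.IsHomogeneous 1 ∧ ℓ ≠ 0 ∧
      LipPair h₁ h₁' K₁ ∧ ∀ z, pev S (h₁ z) = 0 ↔ pev ℓ z = 0 := by
  obtain ⟨k, S, hS⟩ := exists_isInit_translate hRs.ne_zero (h x)
  obtain ⟨k', ℓ, hℓ⟩ := exists_isInit_translate hPs.ne_zero x
  have hPa : AnalyticAt ℂ (fun z => pev P (x + z)) 0 :=
    (analyticAt_pev P _).comp_of_eq (analyticAt_const.add analyticAt_id) rfl
  have hRa : AnalyticAt ℂ (fun z => pev R (h x + z)) 0 :=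
    (analyticAt_pev R _).comp_of_eq (analyticAt_const.add analyticAt_id) rfl
  have hk' : k' = 1 := hℓ.eq_one hPa.differentiableAt (by simpa using hx)
    (by rw [fderiv_comp_const_add]; simpa using hx')
  subst hk'
  have H := (L.mono (le_max_left K 1)).lipGerm_translate (le_max_right K 1) hPR x
  obtain ⟨𝒰, h₁, h₁', B, L₁⟩ := H.exists_blowup
  have hiff := B.pev_eq_zero_iff H L₁ hPa hRa hℓ hS
  refine ⟨k, S, ℓ, h₁, h₁', _, hS, ?_, hℓ.hom, hℓ.ne, L₁, hiff⟩
  refine squarefree_of_rel_mult hS.hom hS.ne fun q v l y hl hSq hqy hq' hvy => ?_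
  have hℓy : pev ℓ (h₁' y) = 0 := by
    rw [← hiff, L₁.right, hSq, pev_mul, pev_pow, hqy, zero_pow (by omega), zero_mul]
  refine rel_mult_le H B L₁ hPa hRa (redAt_pev hPs hP x) (redAt_pev hRs hR (h x)) hℓ hS le_rfl hl
    (p := ℓ) (u := 1) (by simp) hSq (x := h₁' y) hℓy (fderiv_pev_ne_zero_of_linear hℓ.hom hℓ.ne _)
    (by simp [pev]) ?_ ?_ ?_
  all_goals rw [L₁.right]; assumption

lemma fderiv_ne_zero_of_isInit_one {R S : MvPolynomial (Fin n) ℂ} {y : En n}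
    (h : IsInit (fun z => pev R (y + z)) 1 S) (hy : pev R y = 0) : fderiv ℂ (pev R) y ≠ 0 := by
  intro h0
  have hd : DifferentiableAt ℂ (fun z => pev R (y + z)) 0 :=
    (differentiable_pev R _).comp _ (by fun_prop)
  apply h.ne
  apply pev_ext
  intro z
  rw [h.pev_eq_fderiv hd (by simpa using hy), fderiv_comp_const_add, add_zero, h0]
  simp

/-- The space of translations leaving `R` invariant. -/
def invSub (R : MvPolynomial (Fin n) ℂ) : Submodule ℂ (En n) where
  carrier := {v | ∀ (c : ℂ) (x : En n), pev R (x + c • v) = pev R x}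
  zero_mem' := by simp
  add_mem' := by
    intro v w hv hw c x
    rw [smul_add, ← add_assoc, hw, hv]
  smul_mem' := by
    intro a v hv c x
    rw [smul_smul, hv]

lemma mem_invSub {R : MvPolynomial (Fin n) ℂ} {v : En n} :
    v ∈ invSub R ↔ ∀ (c : ℂ) (x : En n), pev R (x + c • v) = pev R x := Iff.rfl

lemma invSub_le_of_isInit {R S : MvPolynomial (Fin n) ℂ} {y : En n} {k : ℕ}
    (hS : IsInit (fun z => pev R (y + z)) k S) : invSub R ≤ invSub S := by
  intro v hv c z
  refine tendsto_nhds_unique (hS.tendsto (z := fun _ => z + c • v) tendsto_const_nhds) ?_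
  refine (hS.tendsto (z := fun _ => z) tendsto_const_nhds).congr fun t => ?_
  rw [smul_add, smul_smul, ← add_assoc, mem_invSub.1 hv]

lemma mem_invSub_of_isInit {R S : MvPolynomial (Fin n) ℂ} {e : ℕ} (hR : R.IsHomogeneous e)
    {y : En n} {k : ℕ} (hS : IsInit (fun z => pev R (y + z)) k S) : y ∈ invSub S := by
  intro c z
  refine tendsto_nhds_unique (hS.tendsto (z := fun _ => z + c • y) tendsto_const_nhds) ?_
  have hc : Tendsto (fun t : ℝ => 1 + (t : ℂ) * c) (𝓝[>] 0) (𝓝 1) := by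
    have : Continuous fun t : ℝ => 1 + (t : ℂ) * c := by fun_prop
    have := (this.tendsto 0).mono_left (nhdsWithin_le_nhds (s := Ioi 0))
    simpa using this
  have h1 : Tendsto (fun t : ℝ => (1 + (t : ℂ) * c)⁻¹ • z) (𝓝[>] 0) (𝓝 z) := by
    simpa using (hc.inv₀ one_ne_zero).smul_const z
  have h2 := (hc.pow e).mul (hS.tendsto h1)
  rw [one_pow, one_mul] at h2
  refine h2.congr' ?_
  filter_upwards [hc.eventually_ne one_ne_zero] with t ht
  have : y + (t : ℂ) • (z + c • y) =
      (1 + (t : ℂ) * c) • (y + (t : ℂ) • (1 + (t : ℂ) * c)⁻¹ • z) := by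
    rw [smul_add (1 + (t : ℂ) * c), smul_comm (1 + (t : ℂ) * c) (t : ℂ), smul_inv_smul₀ ht,
      add_smul, one_smul, smul_add, smul_smul]
    abel
  rw [this, hR.pev_smul, mul_div_assoc]

/-- Splitting off the translations leaving `R` invariant. -/
lemma exists_reduction (R : MvPolynomial (Fin n) ℂ) {e : ℕ} (hR : R.IsHomogeneous e) :
    ∃ (N : ℕ) (A : En N →L[ℂ] En n) (B : En n →L[ℂ] En N) (r : MvPolynomial (Fin N) ℂ),
      r.IsHomogeneous e ∧ (∀ z, B (A z) = z) ∧ (∀ z, pev r z = pev R (A z)) ∧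
      (∀ x, x - A (B x) ∈ invSub R) ∧ ∀ z, A z ∈ invSub R → z = 0 := by
  set M := (invSub R)ᗮ with hM
  set b := stdOrthonormalBasis ℂ M
  refine ⟨Module.finrank ℂ M, M.subtypeL ∘L (b.repr.symm.toContinuousLinearEquiv : _ →L[ℂ] M),
    (b.repr.toContinuousLinearEquiv : M →L[ℂ] _) ∘L M.orthogonalProjectionOnto,
    MvPolynomial.aeval (fun i => ∑ j, MvPolynomial.C ((b j : En n) i) * MvPolynomial.X j) R,
    ?_, ?_, ?_, ?_, ?_⟩
  · rw [← one_mul e]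
    refine hR.aeval _ fun i => MvPolynomial.IsHomogeneous.sum _ _ _ fun j _ => ?_
    simpa using (MvPolynomial.isHomogeneous_C (Fin _) ((b j : En n) i)).mul
      (MvPolynomial.isHomogeneous_X ℂ j)
  · intro z
    simp
  · intro z
    have hz : ((b.repr.symm z : M) : En n) = ∑ j, z j • (b j : En n) := by
      rw [← b.sum_repr_symm z]
      simp
    have h1 : ∀ i, ((b.repr.symm z : M) : En n) i = ∑ j, (b j : En n) i * z j := by
      intro i
      rw [hz]
      simp [mul_comm]
    have h2 := MvPolynomial.comp_aeval_apply (R := ℂ) (p := R)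
      (fun i => ∑ j, MvPolynomial.C ((b j : En n) i) * MvPolynomial.X j)
      (MvPolynomial.aeval (z : Fin _ → ℂ))
    rw [MvPolynomial.aeval_eq_eval, MvPolynomial.aeval_eq_eval] at h2
    refine h2.trans ?_
    rw [pev]
    congr 2
    ext i
    simp only [map_sum, map_mul, MvPolynomial.eval_C, MvPolynomial.eval_X]
    exact (h1 i).symm
  · intro x
    have : x - M.starProjection x ∈ Mᗮ := Submodule.sub_starProjection_mem_orthogonal x
    have h2 : Mᗮ = invSub R := by rw [hM, Submodule.orthogonal_orthogonal]
    rw [h2] at this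
    simpa using this
  · intro z hz
    have h1 : ((b.repr.symm z : M) : En n) ∈ invSub R ⊓ (invSub R)ᗮ := ⟨hz, (b.repr.symm z).2⟩
    rw [Submodule.inf_orthogonal_eq_bot, Submodule.mem_bot] at h1
    simpa using h1


/-- If a hyperplane is mapped onto the cone of `R`, then `posRe R` is contractible. -/
lemma exists_contraction {R ℓ : MvPolynomial (Fin n) ℂ} {e : ℕ} (hR : R.IsHomogeneous e)
    (he : 1 ≤ e) (hRs : Squarefree R) (hℓ : ℓ.IsHomogeneous 1) (hℓ0 : ℓ ≠ 0)
    {h h' : En n → En n} {K : ℝ} (L : LipPair h h' K)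
    (hiff : ∀ x, pev R (h x) = 0 ↔ pev ℓ x = 0) :
    ∃ (Γ : ℝ × En n → En n) (x₀ : En n), ContinuousOn Γ (Icc 0 1 ×ˢ posRe R) ∧
      (∀ z ∈ Icc (0 : ℝ) 1 ×ˢ posRe R, Γ z ∈ posRe R) ∧ (∀ x ∈ posRe R, Γ (0, x) = x) ∧
      x₀ ∈ posRe R ∧ ∀ x ∈ posRe R, Γ (1, x) = x₀ := by
  have he0 : (e : ℂ) ≠ 0 := by exact_mod_cast (by omega : e ≠ 0)
  obtain ⟨Λ, hΛ, hpev⟩ := exists_clm_of_linear hℓ hℓ0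
  obtain ⟨b, hb⟩ : ∃ b, Λ b = 1 := by
    obtain ⟨v, hv⟩ : ∃ v, Λ v ≠ 0 := by
      by_contra hcon
      push Not at hcon
      exact hΛ (ContinuousLinearMap.ext hcon)
    exact ⟨(Λ v)⁻¹ • v, by rw [map_smul, smul_eq_mul, inv_mul_cancel₀ hv]⟩
  rw [hpev] at hiff
  set W : Set ℂ := {0}ᶜ with hW
  set B : Set (En n) := {w | Λ w = 0} with hB
  have hBc : Convex ℝ B := by
    intro x hx y hy s t _ _ _
    rw [hB, mem_ofPred_eq] at *
    rw [map_add, ← Complex.coe_smul, ← Complex.coe_smul, map_smul, map_smul, hx, hy]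
    simp
  have hΛzw : ∀ z : ℂ, ∀ w ∈ B, Λ (z • b + w) = z := by
    intro z w hw
    rw [map_add, map_smul, hb, show Λ w = 0 from hw]
    simp
  obtain ⟨a, u, hu, hau⟩ := exists_zpow_mul_exp (W := W) (B := B)
    (F := fun z => pev R (h (z.1 • b + z.2))) (by simp [hW])
    (by
      have : Complex.exp ⁻¹' W = univ := by
        ext z; simp [hW, Complex.exp_ne_zero]
      rw [this]; exact convex_univ) hBc
    (by
      have h1 := (continuous_pev R).comp L.continuous
      exact (h1.comp (by fun_prop : Continuous fun z : ℂ × En n => z.1 • b + z.2)).continuousOn)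
    (by
      rintro ⟨z, w⟩ ⟨hz, hw⟩ h0
      rw [hiff, hΛzw z w hw] at h0
      exact hz h0)
  set w : En n → En n := fun x => x - Λ x • b with hw
  have hwB : ∀ x, w x ∈ B := by
    intro x
    show Λ (x - Λ x • b) = 0
    rw [map_sub, map_smul, hb]; simp
  have hwc : Continuous w := by fun_prop
  have hdec : ∀ x, Λ x • b + w x = x := by intro x; simp [hw]
  have hRh : ∀ x, Λ x ≠ 0 → pev R (h x) = Λ x ^ a * Complex.exp (u (Λ x, w x)) := by
    intro x hx
    have := hau (Λ x, w x) ⟨hx, hwB x⟩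
    simp only [hdec] at this
    exact this
  have ha : a = 1 ∨ a = -1 := by
    obtain ⟨p, hp, hpR, hp0⟩ := exists_irreducible_dvd_pev_eq_zero hRs.ne_zero
      (hR.pev_zero_right (by omega))
    obtain ⟨y, hy1, hy2, -⟩ := closure_nonempty_iff.1 ⟨_, subset_closure_regular hRs
      (isHomogeneous_of_dvd hR hRs.ne_zero hpR) hp hpR (not_dvd_one hp) hp0⟩
    have hRy : pev R y = 0 := by
      obtain ⟨c, rfl⟩ := hpR
      rw [pev_mul, hy1, zero_mul]
    have hyy : h (h' y) = y := L.right y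
    obtain ⟨Ω, hΩ, -, a', ha', u', hu', hau'⟩ := local_pair (p := Λ) (q := pev R) (φ := h) (ψ := h')
      (x := h' y) Λ.hasStrictFDerivAt ((hiff _).1 (by rw [hyy, hRy])) hΛ
      (hasStrictFDerivAt_pev R _) (by rw [hyy, hRy]) (by rw [hyy]; exact hy2)
      (Eventually.of_forall fun z => L.continuous.continuousAt)
      (Eventually.of_forall fun z => L.symm.continuous.continuousAt)
      (Eventually.of_forall L.left) (Eventually.of_forall hiff)
      (Eventually.of_forall fun z => by rw [← hiff, L.right])
    have h3 : a - a' = 0 := by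
      refine zpow_eq_exp_imp (p := Λ) (x := h' y) Λ.hasStrictFDerivAt
        ((hiff _).1 (by rw [hyy, hRy])) hΛ hΩ
        (u := fun x => u' x - u (Λ x, w x)) ?_ ?_
      · refine hu'.sub (hu.comp (by fun_prop) ?_)
        rintro x ⟨-, hx⟩
        exact ⟨hx, hwB x⟩
      · rintro x ⟨hx, hx'⟩
        have hx0 : Λ x ≠ 0 := hx'
        have h4 := hau' x ⟨hx, hx'⟩
        rw [hRh x hx0] at h4
        rw [zpow_sub₀ hx0, Complex.exp_sub, div_eq_div_iff (zpow_ne_zero _ hx0)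
          (Complex.exp_ne_zero _), h4, mul_comm]
    rwa [show a = a' by omega]
  have haa : (a : ℂ) * a = 1 := by rcases ha with rfl | rfl <;> norm_num
  set s : En n → ℂ := fun x => a * (Complex.log (pev R x) - u (Λ (h' x), w (h' x))) with hs
  have hne : ∀ x ∈ posRe R, Λ (h' x) ≠ 0 := by
    intro x hx h0
    rw [← hiff, L.right] at h0
    simp [posRe, h0] at hx
  have hRne : ∀ x ∈ posRe R, pev R x ≠ 0 := by
    intro x hx h0
    simp [posRe, h0] at hx
  have hexps : ∀ x ∈ posRe R, Complex.exp (s x) = Λ (h' x) := by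
    intro x hx
    have h1 := hRh (h' x) (hne x hx)
    rw [L.right] at h1
    have h2 : Complex.exp (Complex.log (pev R x) - u (Λ (h' x), w (h' x))) = Λ (h' x) ^ a := by
      rw [Complex.exp_sub, Complex.exp_log (hRne x hx), h1, mul_div_assoc,
        div_self (Complex.exp_ne_zero _), mul_one]
    rw [hs]
    simp only
    rw [Complex.exp_int_mul, h2, ← zpow_mul]
    rcases ha with rfl | rfl <;> simp
  have hsc : ContinuousOn s (posRe R) := by
    refine continuousOn_const.mul (ContinuousOn.sub ?_ ?_)
    · exact (continuous_pev R).continuousOn.clog fun x hx => Or.inl hx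
    · refine hu.comp ?_ fun x hx => ⟨hne x hx, hwB _⟩
      have := L.symm.continuous
      exact ((Λ.continuous.comp this).prodMk (hwc.comp this)).continuousOn
  set ρ : ℂ → En n → ℂ := fun σ v => a * σ + u (Complex.exp σ, v) with hρ
  have hexpρ : ∀ σ, ∀ v ∈ B, pev R (h (Complex.exp σ • b + v)) = Complex.exp (ρ σ v) := by
    intro σ v hv
    have := hau (Complex.exp σ, v) ⟨Complex.exp_ne_zero _, hv⟩
    simp only at this
    rw [this, hρ]
    simp only
    rw [Complex.exp_add, Complex.exp_int_mul]
  have hsB : ∀ (c : ℂ) (v : En n), v ∈ B → c • v ∈ B := by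
    intro c v hv
    show Λ (c • v) = 0
    rw [map_smul, show Λ v = 0 from hv, smul_zero]
  set G : ℂ → ℂ → En n → En n := fun lam σ v =>
    Complex.exp ((lam - ρ σ v) / e) • h (Complex.exp σ • b + v) with hG
  have hRG : ∀ lam σ, ∀ v ∈ B, pev R (G lam σ v) = Complex.exp lam := by
    intro lam σ v hv
    rw [hG]
    simp only
    rw [hR.pev_smul, hexpρ σ v hv, ← Complex.exp_nat_mul, ← Complex.exp_add,
      mul_div_cancel₀ _ he0, sub_add_cancel]
  refine ⟨fun z => G ((1 - z.1 : ℝ) * Complex.log (pev R z.2)) ((1 - z.1 : ℝ) * s z.2)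
    (((1 - z.1 : ℝ) : ℂ) • w (h' z.2)), G 0 0 0, ?_, ?_, ?_, ?_, ?_⟩
  · have c1 : ContinuousOn (fun z : ℝ × En n => ((1 - z.1 : ℝ) : ℂ)) (Icc 0 1 ×ˢ posRe R) := by
      fun_prop
    have c2 : ContinuousOn (fun z : ℝ × En n => ((1 - z.1 : ℝ) : ℂ) * s z.2) (Icc 0 1 ×ˢ posRe R) :=
      c1.mul (hsc.comp continuousOn_snd fun z hz => hz.2)
    have c3 : ContinuousOn (fun z : ℝ × En n => ((1 - z.1 : ℝ) : ℂ) • w (h' z.2))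
        (Icc 0 1 ×ˢ posRe R) :=
      c1.smul ((hwc.comp L.symm.continuous).comp continuous_snd).continuousOn
    have c4 : ContinuousOn (fun z : ℝ × En n => ((1 - z.1 : ℝ) : ℂ) * Complex.log (pev R z.2))
        (Icc 0 1 ×ˢ posRe R) :=
      c1.mul (ContinuousOn.clog ((continuous_pev R).comp continuous_snd).continuousOn
        fun z hz => Or.inl hz.2)
    have c5 : ContinuousOn (fun z : ℝ × En n => u (Complex.exp (((1 - z.1 : ℝ) : ℂ) * s z.2),
        ((1 - z.1 : ℝ) : ℂ) • w (h' z.2))) (Icc 0 1 ×ˢ posRe R) :=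
      hu.comp (c2.cexp.prodMk c3) fun z _ => ⟨Complex.exp_ne_zero _, hsB _ _ (hwB _)⟩
    have c6 := L.continuous.comp_continuousOn ((c2.cexp.smul (continuousOn_const (c := b))).add c3)
    exact ((c4.sub ((continuousOn_const.mul c2).add c5)).div_const (e : ℂ)).cexp.smul c6
  · rintro ⟨t, x⟩ ⟨ht, hx⟩
    simp only [posRe, mem_ofPred_eq]
    rw [hRG _ _ _ (hsB _ _ (hwB _)), Complex.exp_re]
    refine mul_pos (Real.exp_pos _) (Real.cos_pos_of_mem_Ioo ?_)
    have h1 : |Complex.arg (pev R x)| < Real.pi / 2 := by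
      rw [Complex.abs_arg_lt_pi_div_two_iff]
      exact Or.inl hx
    rw [Complex.im_ofReal_mul, Complex.log_im]
    have h2 : |(1 - t) * Complex.arg (pev R x)| < Real.pi / 2 := by
      rw [abs_mul, abs_of_nonneg (by linarith [ht.2])]
      have := abs_nonneg (Complex.arg (pev R x))
      nlinarith [ht.1, ht.2]
    exact abs_lt.1 h2
  · intro x hx
    simp only [hG, sub_zero, Complex.ofReal_one, one_mul, one_smul]
    rw [hexps x hx, hdec, L.right]
    have : ρ (s x) (w (h' x)) = Complex.log (pev R x) := by
      rw [hρ]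
      simp only
      rw [hexps x hx, hs]
      simp only
      rw [← mul_assoc, haa]
      ring
    rw [this]
    simp
  · simp only [posRe, mem_ofPred_eq]
    rw [hRG 0 0 0 (by simp [hB])]
    simp
  · intro x hx
    simp

/-- A squarefree cone which is the bi-Lipschitz image of a hyperplane is a hyperplane. -/
theorem degree_eq_one_of_hyperplane (k : ℕ) {R ℓ : MvPolynomial (Fin n) ℂ} {e : ℕ}
    (hk : n - Module.finrank ℂ (invSub R) ≤ k)
    (hR : R.IsHomogeneous e) (hRs : Squarefree R) (hℓ : ℓ.IsHomogeneous 1) (hℓ0 : ℓ ≠ 0)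
    {h h' : En n → En n} {K : ℝ} (L : LipPair h h' K)
    (hiff : ∀ x, pev R (h x) = 0 ↔ pev ℓ x = 0) : e = 1 := by
  induction k generalizing R ℓ e h h' K with
  | zero =>
    exfalso
    have h1 : Module.finrank ℂ (invSub R) ≤ Module.finrank ℂ (En n) := Submodule.finrank_le _
    have h2 : Module.finrank ℂ (En n) = n := by simp
    have h3 : invSub R = ⊤ := Submodule.eq_top_of_finrank_eq (by omega)
    have h0 : pev R (0 : En n) = 0 := by
      have := (hiff 0).2 (hℓ.pev_zero_right one_ne_zero)
      rwa [L.zero] at this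
    apply hRs.ne_zero
    apply pev_ext
    intro x
    have hx : x ∈ invSub R := by rw [h3]; trivial
    have := mem_invSub.1 hx 1 0
    rw [zero_add, one_smul, h0] at this
    simp [this]
  | succ k ih =>
    have h0 : pev R (0 : En n) = 0 := by
      have := (hiff 0).2 (hℓ.pev_zero_right one_ne_zero)
      rwa [L.zero] at this
    have he : 1 ≤ e := (isInit_self hR hRs.ne_zero).one_le h0
    by_contra hne
    have hreg : ∀ y ∉ invSub R, fderiv ℂ (pev R) y ≠ 0 := by
      intro y hy
      by_cases hRy : pev R y = 0
      · have hx : pev ℓ (h' y) = 0 := by rw [← hiff, L.right, hRy]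
        obtain ⟨k', S, ℓ₁, h₁, h₁', K₁, hS, hSs, hℓ₁, hℓ₁0, L₁, hiff₁⟩ := exists_blowup_linear hℓ
          (squarefree_of_linear hℓ hℓ0) hR hRs L hiff hx (fderiv_pev_ne_zero_of_linear hℓ hℓ0 _)
        rw [L.right] at hS
        have hlt : invSub R < invSub S := by
          refine lt_of_le_of_ne (invSub_le_of_isInit hS) fun heq => hy ?_
          rw [heq]
          exact mem_invSub_of_isInit hR hS
        have hlt' := Submodule.finrank_lt_finrank_of_lt hlt
        have hk' : k' = 1 := ih (by omega) hS.hom hSs hℓ₁ hℓ₁0 L₁ hiff₁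
        subst hk'
        exact fderiv_ne_zero_of_isInit_one hS hRy
      · intro h1
        have h2 := fderiv_pev_self hR y
        rw [h1] at h2
        have : (e : ℂ) ≠ 0 := by exact_mod_cast (by omega : e ≠ 0)
        exact (mul_ne_zero this hRy) h2.symm
    obtain ⟨N, A, B, r, hr, hBA, hrR, hAB, hA⟩ := exists_reduction R hR
    have hRAB : ∀ x, pev R (A (B x)) = pev R x := by
      intro x
      have := mem_invSub.1 (hAB x) 1 (A (B x))
      rw [one_smul, add_sub_cancel] at this
      exact this.symm
    have hrs : ∀ z, z ≠ 0 → fderiv ℂ (pev r) z ≠ 0 := by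
      intro z hz hz'
      apply hreg (A z) fun hm => hz (hA z hm)
      have hfun : pev r = fun z => pev R (A z) := funext hrR
      have hfun' : pev R = fun x => pev r (B x) := by
        ext x; rw [hrR, hRAB]
      have hd : HasFDerivAt (fun x => pev r (B x)) ((fderiv ℂ (pev r) (B (A z))) ∘L B) (A z) :=
        HasFDerivAt.comp (g := pev r) (A z) (differentiable_pev r _).hasFDerivAt B.hasFDerivAt
      rw [hfun', hd.fderiv, hBA, hz']
      simp
    obtain ⟨Γ, x₀, c1, c2, c3, c4, c5⟩ := exists_contraction hR he hRs hℓ hℓ0 L hiff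
    have hposA : ∀ z ∈ posRe r, A z ∈ posRe R := by
      intro z hz
      simpa [posRe, hrR] using hz
    have hposB : ∀ x ∈ posRe R, B x ∈ posRe r := by
      intro x hx
      simpa [posRe, hrR, hRAB] using hx
    refine not_contraction hr (by omega) hrs (Γ := fun z => B (Γ (z.1, A z.2))) ?_ ?_ ?_
      (hposB x₀ c4) ?_
    · refine B.continuous.comp_continuousOn (c1.comp (by fun_prop) ?_)
      rintro ⟨t, z⟩ ⟨ht, hz⟩
      exact ⟨ht, hposA z hz⟩
    · rintro ⟨t, z⟩ ⟨ht, hz⟩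
      exact hposB _ (c2 (t, A z) ⟨ht, hposA z hz⟩)
    · intro z hz
      show B (Γ (0, A z)) = z
      rw [c3 _ (hposA z hz), hBA]
    · intro z hz
      show B (Γ (1, A z)) = B x₀
      rw [c5 _ (hposA z hz)]

/-- Bi-Lipschitz maps between squarefree cones preserve smooth points. -/
theorem fderiv_ne_zero_of_lipPair {P R : MvPolynomial (Fin n) ℂ} {d e : ℕ} (hP : P.IsHomogeneous d)
    (hPs : Squarefree P) (hR : R.IsHomogeneous e) (hRs : Squarefree R) {h h' : En n → En n} {K : ℝ}
    (L : LipPair h h' K) (hPR : ∀ x, pev R (h x) = 0 ↔ pev P x = 0) {x : En n}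
    (hx : pev P x = 0) (hx' : fderiv ℂ (pev P) x ≠ 0) : fderiv ℂ (pev R) (h x) ≠ 0 := by
  obtain ⟨k, S, ℓ, h₁, h₁', K₁, hS, hSs, hℓ, hℓ0, L₁, hiff⟩ :=
    exists_blowup_linear hP hPs hR hRs L hPR hx hx'
  have hk : k = 1 := degree_eq_one_of_hyperplane n (by omega) hS.hom hSs hℓ hℓ0 L₁ hiff
  subst hk
  exact fderiv_ne_zero_of_isInit_one hS ((hPR x).2 hx)

end

section
variable {n : ℕ}

lemma not_dvd_of_squarefree_mul {p c : MvPolynomial (Fin n) ℂ} (h : Squarefree (p * c))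
    (hp : Irreducible p) : ¬ p ∣ c := fun hc => hp.not_isUnit (h p (mul_dvd_mul_left p hc))

/-- The smooth part of a hypersurface lying on an irreducible component is connected. -/
lemma isPreconnected_regular {P p : MvPolynomial (Fin n) ℂ} (hP : Squarefree P) {d : ℕ}
    (hp : p.IsHomogeneous d) (hpi : Irreducible p) (hpP : p ∣ P) :
    IsPreconnected {y : En n | pev p y = 0 ∧ fderiv ℂ (pev P) y ≠ 0} := by
  obtain ⟨c, rfl⟩ := hpP
  obtain ⟨b, hb⟩ := exists_pev_ne_zero hpi.ne_zero
  have hD : ¬ p ∣ c * dirD b p := fun h => (hpi.prime.dvd_or_dvd h).elim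
    (not_dvd_of_squarefree_mul hP hpi) (not_dvd_dirD hp (one_le_of_irreducible hp hpi) hb)
  refine (isPreconnected_sdiff hp hpi hD).subset_closure ?_ ?_
  · rintro y ⟨h1, h2⟩
    refine ⟨h1, fun h0 => h2 ?_⟩
    have h3 := fderiv_pev_mul p c y b
    rw [h0, h1, zero_mul, zero_add] at h3
    rw [pev_mul, pev_dirD]
    exact h3.symm
  · rintro y ⟨h1, -⟩
    exact subset_closure_sdiff hp hpi hD h1

lemma fderiv_mul_eq_zero {p c : MvPolynomial (Fin n) ℂ} {y : En n} (h1 : pev p y = 0)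
    (h2 : pev c y = 0) : fderiv ℂ (pev (p * c)) y = 0 := by
  ext v
  rw [fderiv_pev_mul, h1, h2]
  simp

/-- Irreducible components are mapped into irreducible components. -/
lemma exists_component {P Q : MvPolynomial (Fin n) ℂ} {m m' : ℕ} (hP : P.IsHomogeneous m)
    (hPs : Squarefree P) (hQ : Q.IsHomogeneous m') (hQs : Squarefree Q) {h h' : En n → En n} {K : ℝ}
    (L : LipPair h h' K) (hPQ : ∀ x, pev Q (h x) = 0 ↔ pev P x = 0)
    {p : MvPolynomial (Fin n) ℂ} (hpi : Irreducible p) (hpP : p ∣ P) :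
    ∃ q, Irreducible q ∧ q ∣ Q ∧ ∀ x, pev p x = 0 → pev q (h x) = 0 := by
  have hp := isHomogeneous_of_dvd hP hPs.ne_zero hpP
  have hp0 := hp.pev_zero_right (n := n) (by have := one_le_of_irreducible hp hpi; omega)
  have hpz : ∀ x, pev p x = 0 → pev P x = 0 := by
    intro x hx
    obtain ⟨c, rfl⟩ := hpP
    rw [pev_mul, hx, zero_mul]
  have hcl : ∀ x, pev p x = 0 → x ∈ closure {y : En n | pev p y = 0 ∧ fderiv ℂ (pev P) y ≠ 0} := by
    intro x hx
    refine closure_mono ?_ (subset_closure_regular hPs hp hpi hpP (not_dvd_one hpi) hx)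
    rintro y ⟨h1, h2, -⟩
    exact ⟨h1, h2⟩
  obtain ⟨x₀, hx₀, hx₀'⟩ := closure_nonempty_iff.1 ⟨_, hcl 0 hp0⟩
  obtain ⟨q, hqi, hqQ, hqx₀⟩ := exists_irreducible_dvd_pev_eq_zero hQs.ne_zero
    ((hPQ x₀).2 (hpz x₀ hx₀))
  refine ⟨q, hqi, hqQ, ?_⟩
  obtain ⟨v, rfl⟩ := hqQ
  have hpre := (isPreconnected_regular hPs hp hpi hpP).image h L.continuous.continuousOn
  have hreg : ∀ x, pev p x = 0 → fderiv ℂ (pev P) x ≠ 0 → fderiv ℂ (pev (q * v)) (h x) ≠ 0 :=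
    fun x h1 h2 => fderiv_ne_zero_of_lipPair hP hPs hQ hQs L hPQ (hpz x h1) h2
  have hsub : h '' {y : En n | pev p y = 0 ∧ fderiv ℂ (pev P) y ≠ 0} ⊆ {y | pev q y = 0} := by
    have h1 := isPreconnected_iff_subset_of_disjoint_closed.1 hpre {y | pev q y = 0}
      {y | pev v y = 0} (isClosed_eq (continuous_pev q) continuous_const)
      (isClosed_eq (continuous_pev v) continuous_const)
      (by
        rintro _ ⟨x, ⟨hx, -⟩, rfl⟩
        have := (hPQ x).2 (hpz x hx)
        rw [pev_mul] at this
        exact mul_eq_zero.1 this)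
      (by
        rw [eq_empty_iff_forall_notMem]
        rintro _ ⟨⟨x, ⟨hx, hx'⟩, rfl⟩, h2, h3⟩
        exact hreg x hx hx' (fderiv_mul_eq_zero h2 h3))
    refine h1.resolve_right fun h2 => ?_
    exact hreg x₀ hx₀ hx₀' (fderiv_mul_eq_zero hqx₀ (h2 ⟨x₀, ⟨hx₀, hx₀'⟩, rfl⟩))
  intro x hx
  have h2 : IsClosed {x | pev q (h x) = 0} :=
    isClosed_eq ((continuous_pev q).comp L.continuous) continuous_const
  have h3 : {y : En n | pev p y = 0 ∧ fderiv ℂ (pev P) y ≠ 0} ⊆ {x | pev q (h x) = 0} :=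
    fun y hy => hsub ⟨y, hy, rfl⟩
  exact closure_minimal h3 h2 (hcl x hx)

/-- Irreducible components correspond to irreducible components. -/
lemma exists_component_iff {P Q : MvPolynomial (Fin n) ℂ} {m m' : ℕ} (hP : P.IsHomogeneous m)
    (hPs : Squarefree P) (hQ : Q.IsHomogeneous m') (hQs : Squarefree Q) {h h' : En n → En n} {K : ℝ}
    (L : LipPair h h' K) (hPQ : ∀ x, pev Q (h x) = 0 ↔ pev P x = 0)
    {p : MvPolynomial (Fin n) ℂ} (hpi : Irreducible p) (hpP : p ∣ P) :
    ∃ q, Irreducible q ∧ q ∣ Q ∧ ∀ x, pev q (h x) = 0 ↔ pev p x = 0 := by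
  have hp := isHomogeneous_of_dvd hP hPs.ne_zero hpP
  obtain ⟨q, hqi, hqQ, hpq⟩ := exists_component hP hPs hQ hQs L hPQ hpi hpP
  obtain ⟨p₁, hp₁i, hp₁P, hqp₁⟩ := exists_component hQ hQs hP hPs L.symm
    (fun y => by rw [← hPQ, L.right]) hqi hqQ
  have hdvd : p ∣ p₁ := dvd_of_subset hp hpi fun x hx => by
    have := hqp₁ _ (hpq x hx)
    rwa [L.left] at this
  have hdvd' : p₁ ∣ p := (hpi.associated_of_dvd hp₁i hdvd).symm.dvd
  refine ⟨q, hqi, hqQ, fun x => ⟨fun hx => ?_, hpq x⟩⟩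
  have h1 := hqp₁ _ hx
  rw [L.left] at h1
  obtain ⟨c, rfl⟩ := hdvd'
  rw [pev_mul, h1, zero_mul]

/-- `F` behaves near `y` like the `a`-th power of `q`. -/
def HasSign (q F : En n → ℂ) (a : ℤ) (Ω : Set (En n)) : Prop :=
  IsOpen Ω ∧ ∃ u : En n → ℂ, ContinuousOn u (Ω \ {z | q z = 0}) ∧
    ∀ z ∈ Ω \ {z | q z = 0}, F z = q z ^ a * Complex.exp (u z)

lemma HasSign.unique {q : MvPolynomial (Fin n) ℂ} {F : En n → ℂ} {a a' : ℤ} {Ω Ω' : Set (En n)}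
    (h : HasSign (pev q) F a Ω) (h' : HasSign (pev q) F a' Ω') {y : En n} (hy : y ∈ Ω)
    (hy' : y ∈ Ω') (hq : pev q y = 0) (hq' : fderiv ℂ (pev q) y ≠ 0) : a = a' := by
  obtain ⟨hΩ, u, hu, hF⟩ := h
  obtain ⟨hΩ', u', hu', hF'⟩ := h'
  have h3 : a - a' = 0 := by
    refine zpow_eq_exp_imp (hasStrictFDerivAt_pev q y) hq hq'
      (Ω := Ω ∩ Ω') ((hΩ.inter hΩ').mem_nhds ⟨hy, hy'⟩) (u := fun x => u' x - u x) ?_ ?_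
    · exact (hu'.mono (sdiff_subset_sdiff_left inter_subset_right)).sub
        (hu.mono (sdiff_subset_sdiff_left inter_subset_left))
    · rintro x ⟨hx, hx'⟩
      have hx0 : pev q x ≠ 0 := hx'
      have h4 := hF x ⟨hx.1, hx'⟩
      rw [hF' x ⟨hx.2, hx'⟩] at h4
      rw [zpow_sub₀ hx0, Complex.exp_sub, div_eq_div_iff (zpow_ne_zero _ hx0)
        (Complex.exp_ne_zero _), ← h4, mul_comm]
  omega

/-- The orientation sign of a bi-Lipschitz map along an irreducible hypersurface is constant. -/
lemma exists_sign {p q : MvPolynomial (Fin n) ℂ} {d d' : ℕ} (hp : p.IsHomogeneous d)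
    (hpi : Irreducible p) (hq : q.IsHomogeneous d') (hqi : Irreducible q) {h h' : En n → En n}
    {K : ℝ} (L : LipPair h h' K) (hqp : ∀ y, pev p (h y) = 0 ↔ pev q y = 0) :
    ∃ a : ℤ, (a = 1 ∨ a = -1) ∧ ∀ y, pev q y = 0 → fderiv ℂ (pev q) y ≠ 0 →
      ∃ Ω, y ∈ Ω ∧ HasSign (pev q) (fun z => pev p (h z)) a Ω := by
  have hex : ∀ y, pev q y = 0 → fderiv ℂ (pev q) y ≠ 0 →
      ∃ a : ℤ, (a = 1 ∨ a = -1) ∧ ∃ Ω, y ∈ Ω ∧ HasSign (pev q) (fun z => pev p (h z)) a Ω := by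
    intro y hy hy'
    obtain ⟨Ω, hΩ, hΩo, a, ha, u, hu, hau⟩ := local_pair (p := pev q) (q := pev p) (φ := h)
      (ψ := h') (hasStrictFDerivAt_pev q y) hy hy' (hasStrictFDerivAt_pev p _) ((hqp y).2 hy)
      (fderiv_ne_zero_of_lipPair hq hqi.squarefree hp hpi.squarefree L hqp hy hy')
      (Eventually.of_forall fun z => L.continuous.continuousAt)
      (Eventually.of_forall fun z => L.symm.continuous.continuousAt)
      (Eventually.of_forall L.left) (Eventually.of_forall hqp)
      (Eventually.of_forall fun z => by rw [← hqp, L.right])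
    exact ⟨a, ha, Ω, mem_of_mem_nhds hΩ, hΩo, u, hu, hau⟩
  have hpre := isPreconnected_regular hqi.squarefree hq hqi dvd_rfl
  set u : ℤ → Set (En n) := fun a => ⋃₀ {Ω | HasSign (pev q) (fun z => pev p (h z)) a Ω} with hu
  have huo : ∀ a, IsOpen (u a) := fun a => isOpen_sUnion fun Ω hΩ => hΩ.1
  rcases isPreconnected_iff_subset_of_disjoint.1 hpre (u 1) (u (-1)) (huo _) (huo _)
    (by
      rintro y ⟨h1, h2⟩
      obtain ⟨a, rfl | rfl, Ω, hy, hΩ⟩ := hex y h1 h2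
      · exact Or.inl ⟨Ω, hΩ, hy⟩
      · exact Or.inr ⟨Ω, hΩ, hy⟩)
    (by
      rw [eq_empty_iff_forall_notMem]
      rintro y ⟨⟨h1, h2⟩, ⟨Ω, hΩ, hy⟩, ⟨Ω', hΩ', hy'⟩⟩
      have := hΩ.unique hΩ' hy hy' h1 h2
      omega) with hsub | hsub
  · refine ⟨1, Or.inl rfl, fun y h1 h2 => ?_⟩
    obtain ⟨Ω, hΩ, hy⟩ := hsub ⟨h1, h2⟩
    exact ⟨Ω, hy, hΩ⟩
  · refine ⟨-1, Or.inr rfl, fun y h1 h2 => ?_⟩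
    obtain ⟨Ω, hΩ, hy⟩ := hsub ⟨h1, h2⟩
    exact ⟨Ω, hy, hΩ⟩


/-- The winding number of `p ∘ h` on a complex line through the origin. -/
lemma hasIdx_comp_line {p q : MvPolynomial (Fin n) ℂ} {d' : ℕ} (hq : q.IsHomogeneous d')
    (hqi : Irreducible q) {h h' : En n → En n} {K : ℝ} (L : LipPair h h' K)
    (hqp : ∀ y, pev p (h y) = 0 ↔ pev q y = 0) {a : ℤ}
    (ha : ∀ y, pev q y = 0 → fderiv ℂ (pev q) y ≠ 0 →
      ∃ Ω, y ∈ Ω ∧ HasSign (pev q) (fun z => pev p (h z)) a Ω) {y : En n} (hy : pev q y ≠ 0) :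
    HasIdx (fun l => pev p (h (l • y))) 0 1 (a * d') := by
  classical
  obtain ⟨ρ, hρ, hel⟩ := exists_elimination hq hqi hy
    (not_dvd_dirD hq (one_le_of_irreducible hq hqi) hy)
  obtain ⟨C, hC, hroot⟩ := exists_root_bound hq hy
  obtain ⟨v, hvρ, hv⟩ : ∃ v : En n, pev ρ v ≠ 0 ∧ C * ‖v‖ < 1 := by
    have h1 : ∀ᶠ v : En n in 𝓝 0, C * ‖v‖ < 1 := by
      have : Continuous fun v : En n => C * ‖v‖ := by fun_prop
      exact this.continuousAt.eventually_lt_const (by simp)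
    exact ((mem_closure_iff_frequently.1 (dense_pev_ne_zero hρ 0)).and_eventually h1).exists
  have hne : ∀ t ∈ Icc (0 : ℝ) 1, ∀ z ∈ sphere (0 : ℂ) 1,
      pev q (((1 - t : ℝ) : ℂ) • v + z • y) ≠ 0 := by
    intro t ht z hz h0
    have h1 := hroot _ _ h0
    rw [mem_sphere_zero_iff_norm.1 hz, norm_smul, Complex.norm_real,
      Real.norm_of_nonneg (by linarith [ht.2])] at h1
    have : (1 - t) * ‖v‖ ≤ ‖v‖ := by
      have := norm_nonneg v
      nlinarith [ht.1]
    nlinarith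
  set Z := (lineP q y v).roots.toFinset with hZ
  have hZmem : ∀ l, l ∈ Z ↔ pev q (v + l • y) = 0 := fun l => mem_rootsFinset hq hy
  have hZball : ∀ l ∈ Z, l ∈ ball (0 : ℂ) 1 := by
    intro l hl
    rw [mem_ball_zero_iff]
    exact (hroot v l ((hZmem l).1 hl)).trans_lt hv
  have hcl : Continuous fun l : ℂ => v + l • y := by fun_prop
  have hloc : ∀ l ∈ Z, ∃ m : ℕ, LocIdx (fun l : ℂ => pev q (v + l • y)) l m := by
    intro l hl
    have h1 : AnalyticAt ℂ (fun l : ℂ => pev q (v + l • y)) l :=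
      (analyticAt_pev q _).comp_of_eq (analyticAt_const.add (analyticAt_id.smul analyticAt_const))
        rfl
    obtain ⟨m, hm, -⟩ := locIdx_of_analyticAt h1 (by
      intro h2
      have h3 : (Z : Set ℂ) ∈ 𝓝 l := by
        filter_upwards [h2] with l' hl'
        exact (hZmem l').2 hl'
      exact (infinite_of_mem_nhds l h3) Z.finite_toSet)
    exact ⟨m, hm⟩
  choose! m hm using hloc
  have hI1 : HasIdx (fun l : ℂ => pev q (v + l • y)) 0 1 (∑ l ∈ Z, (m l : ℤ)) :=
    hasIdx_sum_locIdx one_pos (fun l => (m l : ℤ)) Z _ hZball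
      ((continuous_pev q).comp hcl).continuousOn
      (fun l hl h0 => hl.2 ((hZmem l).2 h0)) hm
  have hI2 : HasIdx (fun l : ℂ => pev p (h (v + l • y))) 0 1 (∑ l ∈ Z, a * (m l : ℤ)) := by
    refine hasIdx_sum_locIdx one_pos (fun l => a * (m l : ℤ)) Z _ hZball
      ((continuous_pev p).comp (L.continuous.comp hcl)).continuousOn
      (fun l hl h0 => hl.2 ((hZmem l).2 ((hqp _).1 h0))) fun l hl => ?_
    have hql := (hZmem l).1 hl
    have hd := hel v l hvρ hql
    rw [pev_dirD] at hd
    obtain ⟨Ω, hΩ, hΩo, u, hu, hau⟩ := ha _ hql fun h0 => hd (by rw [h0]; simp)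
    exact locIdx_of_local_pair (hm l hl) (hΩo.mem_nhds hΩ) hu hau
  have hI3 : HasIdx (fun l : ℂ => pev q (l • y)) 0 1 (∑ l ∈ Z, (m l : ℤ)) := by
    have := HasIdx.of_homotopy (c := 0) (r := 1) (a := ∑ l ∈ Z, (m l : ℤ))
      (fun t l => pev q (((1 - t : ℝ) : ℂ) • v + l • y))
      ((continuous_pev q).comp (by fun_prop)).continuousOn hne (by simpa using hI1)
    simpa using this
  have hI4 : HasIdx (fun l : ℂ => pev p (h (l • y))) 0 1 (∑ l ∈ Z, a * (m l : ℤ)) := by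
    have := HasIdx.of_homotopy (c := 0) (r := 1) (a := ∑ l ∈ Z, a * (m l : ℤ))
      (fun t l => pev p (h (((1 - t : ℝ) : ℂ) • v + l • y)))
      ((continuous_pev p).comp (L.continuous.comp (by fun_prop))).continuousOn
      (fun t ht z hz h0 => hne t ht z hz ((hqp _).1 h0)) (by simpa using hI2)
    simpa using this
  have hI5 : HasIdx (fun l : ℂ => pev q (l • y)) 0 1 d' := by
    refine ⟨fun _ => Complex.log (pev q y), continuousOn_const, fun z _ => ?_⟩
    simp only [Complex.exp_log hy, sub_zero, hq.pev_smul, zpow_natCast]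
  rw [hI5.unique one_pos hI3, Finset.mul_sum]
  exact hI4

/-- A closed lift of a loop to the logarithm picks up the winding number. -/
lemma HasIdx.log_sub_eq {F : ℂ → ℂ} {a : ℤ} (h : HasIdx F 0 1 a) {U : ℝ → ℂ}
    (hU : ContinuousOn U (Icc 0 1))
    (hFU : ∀ s ∈ Icc (0 : ℝ) 1, F (Complex.exp (2 * Real.pi * s * Complex.I)) = Complex.exp (U s)) :
    U 1 - U 0 = a * (2 * Real.pi * Complex.I) := by
  obtain ⟨u, hu, hF⟩ := h
  have hγ : ∀ s : ℝ, Complex.exp (2 * Real.pi * s * Complex.I) ∈ sphere (0 : ℂ) 1 := by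
    intro s
    rw [mem_sphere_zero_iff_norm]
    exact_mod_cast Complex.norm_exp_ofReal_mul_I (2 * Real.pi * s)
  have hγc : Continuous fun s : ℝ => Complex.exp (2 * Real.pi * s * Complex.I) := by fun_prop
  obtain ⟨k, hk⟩ := log_sub_log_const (isPreconnected_Icc (a := (0 : ℝ)) (b := 1)) hU
    (v := fun s => a * (2 * Real.pi * s * Complex.I) +
      u (Complex.exp (2 * Real.pi * s * Complex.I)))
    (by
      have := hu.comp_continuous hγc hγ
      exact ((by fun_prop : Continuous fun s : ℝ =>
        (a : ℂ) * (2 * Real.pi * s * Complex.I)).add this).continuousOn)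
    (by
      intro s hs
      rw [← hFU s hs, hF _ (hγ s), sub_zero, ← Complex.exp_int_mul, ← Complex.exp_add])
  have h0 := hk 0 (by simp)
  have h1 := hk 1 (by simp)
  simp only [Complex.ofReal_zero, Complex.ofReal_one, mul_zero, zero_mul, mul_one,
    Complex.exp_zero, Complex.exp_two_pi_mul_I] at h0 h1
  rw [h0, h1]
  ring

/-- The degree of an irreducible cone with isolated singularity does not exceed that of a
bi-Lipschitz equivalent irreducible cone. -/
theorem degree_le_of_lipPair {p q : MvPolynomial (Fin n) ℂ} {d d' : ℕ} (hp : p.IsHomogeneous d)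
    (hpi : Irreducible p) (hq : q.IsHomogeneous d') (hqi : Irreducible q) {h h' : En n → En n}
    {K : ℝ} (L : LipPair h h' K) (hpq : ∀ x, pev q (h x) = 0 ↔ pev p x = 0)
    (hs : ∀ x : En n, x ≠ 0 → fderiv ℂ (pev p) x ≠ 0) : d ≤ d' := by
  have hqp : ∀ y, pev p (h' y) = 0 ↔ pev q y = 0 := fun y => by rw [← hpq, L.right]
  by_contra hlt
  push Not at hlt
  have hd'1 := one_le_of_irreducible hq hqi
  rcases hd'1.eq_or_lt with rfl | hd'2
  · have := degree_eq_one_of_hyperplane n (by omega) hp hpi.squarefree hq hqi.ne_zero L.symm hqp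
    omega
  have hd3 : 3 ≤ d := by omega
  have hd0 : (d : ℂ) ≠ 0 := by exact_mod_cast (by omega : d ≠ 0)
  have hnt : Nontrivial (En n) := by
    obtain ⟨b, hb⟩ := exists_pev_ne_zero hpi.ne_zero
    exact ⟨b, 0, fun h0 => hb (by rw [h0]; exact hp.pev_zero_right (by omega))⟩
  obtain ⟨a, ha, hsign⟩ := exists_sign hp hpi hq hqi L.symm hqp
  have hRne : ∀ x ∈ posRe p, pev p x ≠ 0 := by
    intro x hx h0
    simp [posRe, h0] at hx
  set β : ℝ × En n → En n := fun z => h' (Complex.exp (2 * Real.pi * z.1 * Complex.I) • h z.2)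
    with hβ
  have hβc : Continuous β := by
    have h1 : Continuous fun z : ℝ × En n =>
        Complex.exp (2 * Real.pi * z.1 * Complex.I) • h z.2 :=
      (by fun_prop : Continuous fun z : ℝ × En n =>
        Complex.exp (2 * Real.pi * z.1 * Complex.I)).smul (L.continuous.comp continuous_snd)
    exact L.symm.continuous.comp h1
  have hβne : ∀ s, ∀ x ∈ posRe p, pev p (β (s, x)) ≠ 0 := by
    intro s x hx h0
    rw [hβ] at h0
    simp only at h0
    rw [hqp, hq.pev_smul, mul_eq_zero] at h0
    rcases h0 with h0 | h0
    · exact pow_ne_zero _ (Complex.exp_ne_zero _) h0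
    · exact hRne x hx ((hpq x).1 h0)
  have hA : Continuous fun z : unitInterval × posRe p => ((z.1 : ℝ), (z.2 : En n)) := by fun_prop
  obtain ⟨U, hU, hU0⟩ := exists_log_homotopy (A := posRe p)
    ⟨fun z => pev p (β ((z.1 : ℝ), (z.2 : En n))), (continuous_pev p).comp (hβc.comp hA)⟩
    (fun z => hβne _ _ z.2.2)
    ⟨fun x => Complex.log (pev p x), by
      have := ((continuous_pev p).continuousOn (s := posRe p)).clog fun x hx => Or.inl hx
      exact this.domRestrict⟩
    (fun x => by
      have : β (0, (x : En n)) = x := by simp [hβ, L.left]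
      simp only [ContinuousMap.coe_mk, Set.Icc.coe_zero, this]
      exact (Complex.exp_log (hRne x x.2)).symm)
  obtain ⟨V, hV, hVU⟩ := exists_continuousOn_extension (s := Icc (0 : ℝ) 1 ×ˢ posRe p)
    (U := fun z => U (⟨z.1.1, z.2.1⟩, ⟨z.1.2, z.2.2⟩)) (by fun_prop)
  have hexp : ∀ z ∈ Icc (0 : ℝ) 1 ×ˢ posRe p, pev p (β z) = Complex.exp (V z) := by
    intro z hz
    rw [hVU z hz, ← hU]
    rfl
  have hV0 : ∀ x ∈ posRe p, V (0, x) = Complex.log (pev p x) := by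
    intro x hx
    rw [hVU (0, x) ⟨by simp, hx⟩]
    exact hU0 ⟨x, hx⟩
  have hV1 : ∀ x ∈ posRe p,
      V (1, x) - V (0, x) = (a * d' : ℤ) * (2 * Real.pi * Complex.I) := by
    intro x hx
    have hqx : pev q (h x) ≠ 0 := fun h0 => hRne x hx ((hpq x).1 h0)
    refine (hasIdx_comp_line hq hqi L.symm hqp hsign hqx).log_sub_eq (U := fun s => V (s, x)) ?_ ?_
    · exact hV.comp (by fun_prop) fun s hs => ⟨hs, hx⟩
    · intro s hs
      exact hexp (s, x) ⟨hs, hx⟩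
  set ζ : ℂ := Complex.exp (-((a * d' : ℤ) * (2 * Real.pi * Complex.I)) / d) with hζ
  have hζne : ∀ c : ℝ, 0 ≤ c → ζ ≠ c := by
    intro c hc h0
    have hnorm : ‖ζ‖ = 1 := by
      rw [hζ, show (-((a * d' : ℤ) * (2 * Real.pi * Complex.I)) / d : ℂ) =
        ((-((a * d' : ℤ) * (2 * Real.pi)) / d : ℝ) : ℂ) * Complex.I by push_cast; ring]
      exact Complex.norm_exp_ofReal_mul_I _
    rw [h0, Complex.norm_real, Real.norm_of_nonneg hc] at hnorm
    rw [hnorm, hζ, Complex.ofReal_one, Complex.exp_eq_one_iff] at h0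
    obtain ⟨k, hk⟩ := h0
    have h2 : (-(a * d' : ℤ) : ℂ) = k * d := by
      rw [div_eq_iff hd0] at hk
      apply mul_right_cancel₀ Complex.two_pi_I_ne_zero
      linear_combination hk
    have h3 : -(a * d' : ℤ) = k * d := by exact_mod_cast h2
    have h4 : (d : ℤ) ∣ d' := by
      rcases ha with rfl | rfl
      · exact ⟨-k, by linarith⟩
      · exact ⟨k, by linarith⟩
    have := Nat.le_of_dvd (by omega) (Int.natCast_dvd_natCast.1 h4)
    omega
  refine not_rotation hp hd3 hs
    (Γ := fun z => Complex.exp (-(V z - Complex.log (pev p z.2)) / d) • β z) ?_ ?_ ?_ hζne ?_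
  · refine ContinuousOn.smul (ContinuousOn.cexp ?_) hβc.continuousOn
    refine ((hV.sub ?_).neg).div_const _
    exact ContinuousOn.clog ((continuous_pev p).comp continuous_snd).continuousOn
      fun z hz => Or.inl hz.2
  · rintro ⟨s, x⟩ hz
    have h1 : pev p (Complex.exp (-(V (s, x) - Complex.log (pev p x)) / d) • β (s, x)) =
        pev p x := by
      rw [hp.pev_smul, hexp _ hz, ← Complex.exp_nat_mul, ← Complex.exp_add, mul_div_cancel₀ _ hd0,
        neg_sub, sub_add_cancel, Complex.exp_log (hRne x hz.2)]
    simp only [posRe, mem_ofPred_eq]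
    rw [h1]
    exact hz.2
  · intro x hx
    simp [hV0 x hx, hβ, L.left]
  · intro x hx
    refine ⟨1, one_pos, ?_⟩
    have h1 := hV1 x hx
    rw [hV0 x hx] at h1
    have h2 : β (1, x) = x := by
      simp only [hβ, Complex.ofReal_one, mul_one, Complex.exp_two_pi_mul_I, one_smul, L.left]
    simp only
    rw [h1, h2, Complex.ofReal_one, one_mul]

end

section
variable {n : ℕ}

lemma fderiv_pev_eq_zero_imp {p : MvPolynomial (Fin n) ℂ} {d : ℕ} (hp : p.IsHomogeneous d)
    (hd : 1 ≤ d) {x : En n} (hx : fderiv ℂ (pev p) x = 0) : pev p x = 0 := by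
  have h1 := fderiv_pev_self hp x
  rw [hx] at h1
  have : (d : ℂ) ≠ 0 := by exact_mod_cast (by omega : d ≠ 0)
  exact (mul_eq_zero.1 h1.symm).resolve_left this

lemma continuous_fderiv_pev (p : MvPolynomial (Fin n) ℂ) : Continuous (fderiv ℂ (pev p)) :=
  (contDiff_pev p (k := 1)).continuous_fderiv one_ne_zero

/-- Multiplicities of corresponding components of the tangent cones do not decrease. -/
lemma rel_mult_le_of_component {f g : En n → ℂ} {φ ψ h h' : En n → En n} {K r : ℝ}
    {𝒰 : Ultrafilter ℝ} (H : LipGerm f g φ ψ K r) (B : IsBlowup φ ψ 𝒰 h h') (L : LipPair h h' K)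
    (hf : AnalyticAt ℂ f 0) (hg : AnalyticAt ℂ g 0) (hfr : RedAt f) (hgr : RedAt g)
    {m m' : ℕ} {P Q : MvPolynomial (Fin n) ℂ} (hP : IsInit f m P) (hQ : IsInit g m' Q)
    {p q : MvPolynomial (Fin n) ℂ} (hpi : Irreducible p) (hpP : p ∣ P) (hqi : Irreducible q)
    (hqQ : q ∣ Q) (hpq : ∀ x, pev q (h x) = 0 ↔ pev p x = 0) {k : ℕ} (hk : p ^ k ∣ P) :
    q ^ k ∣ Q := by
  have hp := isHomogeneous_of_dvd hP.hom hP.ne hpP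
  have hq := isHomogeneous_of_dvd hQ.hom hQ.ne hqQ
  have hpf := FiniteMultiplicity.of_prime_left hpi.prime hP.ne
  have hqf := FiniteMultiplicity.of_prime_left hqi.prime hQ.ne
  obtain ⟨u, hPu, hpu⟩ := hpf.exists_eq_pow_mul_and_not_dvd
  obtain ⟨v, hQv, hqv⟩ := hqf.exists_eq_pow_mul_and_not_dvd
  have hk1 : 1 ≤ multiplicity p P := hpf.le_multiplicity_of_pow_dvd (by simpa using hpP)
  have hl1 : 1 ≤ multiplicity q Q := hqf.le_multiplicity_of_pow_dvd (by simpa using hqQ)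
  obtain ⟨x₀, h1, h2, h3⟩ := closure_nonempty_iff.1 ⟨_, subset_closure_regular hpi.squarefree hp hpi
    dvd_rfl hpu (hp.pev_zero_right (by have := one_le_of_irreducible hp hpi; omega))⟩
  have hh' : Tendsto h' (𝓝 (h x₀)) (𝓝 x₀) := by
    have := L.symm.continuous.tendsto (h x₀)
    rwa [L.left] at this
  have e1 : ∀ᶠ y in 𝓝 (h x₀), fderiv ℂ (pev p) (h' y) ≠ 0 :=
    hh'.eventually ((continuous_fderiv_pev p).continuousAt.eventually_ne h2)
  have e2 : ∀ᶠ y in 𝓝 (h x₀), pev u (h' y) ≠ 0 :=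
    hh'.eventually ((continuous_pev u).continuousAt.eventually_ne h3)
  obtain ⟨y, ⟨hy1, hy2⟩, hy3, hy4⟩ := ((mem_closure_iff_frequently.1 (subset_closure_sdiff hq hqi hqv
    ((hpq x₀).2 h1))).and_eventually (e1.and e2)).exists
  have hpy : pev p (h' y) = 0 := by rw [← hpq, L.right, hy1]
  have hqy : fderiv ℂ (pev q) y ≠ 0 := by
    have := fderiv_ne_zero_of_lipPair hp hpi.squarefree hq hqi.squarefree L hpq hpy hy3
    rwa [L.right] at this
  have hle := rel_mult_le H.symm B.symm L.symm hg hf hgr hfr hQ hP hl1 hk1 hQv hPu hy1 hqy hy2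
    hpy hy3 hy4
  have hk' := hpf.le_multiplicity_of_pow_dvd hk
  exact (pow_dvd_pow q (hk'.trans hle)).trans (pow_multiplicity_dvd q Q)

lemma exists_squarefree_dvd {P : MvPolynomial (Fin n) ℂ} (hP : P ≠ 0) :
    ∃ P', Squarefree P' ∧ P' ∣ P ∧ (∀ p, Irreducible p → p ∣ P → p ∣ P') ∧
      ∀ x : En n, pev P' x = 0 ↔ pev P x = 0 := by
  classical
  let := UniqueFactorizationMonoid.strongNormalizationMonoid (α := MvPolynomial (Fin n) ℂ)
  have h1 : ∀ p, Irreducible p → p ∣ P → p ∣ UniqueFactorizationMonoid.radical P :=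
    fun p hp h => (UniqueFactorizationMonoid.dvd_radical_iff_of_irreducible hp hP).2 h
  refine ⟨UniqueFactorizationMonoid.radical P, UniqueFactorizationMonoid.squarefree_radical,
    UniqueFactorizationMonoid.radical_dvd_self, h1, fun x => ⟨fun hx => ?_, fun hx => ?_⟩⟩
  · obtain ⟨c, hc⟩ := UniqueFactorizationMonoid.radical_dvd_self (a := P)
    rw [hc, pev_mul, hx, zero_mul]
  · obtain ⟨p, hp, hpP, hpx⟩ := exists_irreducible_dvd_pev_eq_zero hP hx
    obtain ⟨c, hc⟩ := h1 p hp hpP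
    rw [hc, pev_mul, hpx, zero_mul]

lemma totalDegree_pow_eq {p : MvPolynomial (Fin n) ℂ} (hp : p ≠ 0) (k : ℕ) :
    (p ^ k).totalDegree = k * p.totalDegree := by
  induction k with
  | zero => simp
  | succ k ih =>
    rw [pow_succ, MvPolynomial.totalDegree_mul_of_isDomain (pow_ne_zero k hp) hp, ih]
    ring

/-- Comparison of degrees through a matching of irreducible factors. -/
lemma totalDegree_le_of_matching {P₀ Q : MvPolynomial (Fin n) ℂ} {m : ℕ} (hP₀ : P₀.IsHomogeneous m)
    (hP₀0 : P₀ ≠ 0) (hQ0 : Q ≠ 0) {h : En n → En n}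
    (hmatch : ∀ p, Irreducible p → p ∣ P₀ → ∃ q, Irreducible q ∧
      (∀ x, pev q (h x) = 0 ↔ pev p x = 0) ∧ p.totalDegree ≤ q.totalDegree ∧
      ∀ k, p ^ k ∣ P₀ → q ^ k ∣ Q) : P₀.totalDegree ≤ Q.totalDegree := by
  suffices hs : P₀ ∣ P₀ → ∃ Q₁, Q₁ ∣ Q ∧ P₀.totalDegree ≤ Q₁.totalDegree ∧
      ∀ q, Irreducible q → q ∣ Q₁ → ∃ p, Irreducible p ∧ p ∣ P₀ ∧
        ∀ x, pev q (h x) = 0 ↔ pev p x = 0 by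
    obtain ⟨Q₁, ⟨c, rfl⟩, h2, -⟩ := hs dvd_rfl
    have hQ₁ : Q₁ ≠ 0 := left_ne_zero_of_mul hQ0
    have hc : c ≠ 0 := right_ne_zero_of_mul hQ0
    rw [MvPolynomial.totalDegree_mul_of_isDomain hQ₁ hc]
    omega
  have key : ∀ P : MvPolynomial (Fin n) ℂ, P ∣ P₀ → ∃ Q₁, Q₁ ∣ Q ∧
      P.totalDegree ≤ Q₁.totalDegree ∧ ∀ q, Irreducible q → q ∣ Q₁ → ∃ p, Irreducible p ∧ p ∣ P ∧
        ∀ x, pev q (h x) = 0 ↔ pev p x = 0 := by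
    intro P
    induction P using UniqueFactorizationMonoid.induction_on_coprime with
    | h0 => intro h0; exact absurd (zero_dvd_iff.1 h0) hP₀0
    | h1 hu =>
      rename_i P
      intro _
      refine ⟨1, one_dvd _, ?_, fun q hq hq1 => absurd (isUnit_of_dvd_one hq1) hq.not_isUnit⟩
      obtain ⟨c, hc⟩ := hu.exists_right_inv
      have hP : P ≠ 0 := hu.ne_zero
      have hc0 : c ≠ 0 := by rintro rfl; simp at hc
      have h1 := MvPolynomial.totalDegree_mul_of_isDomain hP hc0
      rw [hc, MvPolynomial.totalDegree_one] at h1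
      omega
    | hpr i hp =>
      rename_i p
      intro hpi
      rcases Nat.eq_zero_or_pos i with rfl | hi
      · exact ⟨1, one_dvd _, by simp, fun q hq hq1 => absurd (isUnit_of_dvd_one hq1) hq.not_isUnit⟩
      obtain ⟨q, hq, hpq, hdeg, hmul⟩ := hmatch p hp.irreducible
        ((dvd_pow_self p hi.ne').trans hpi)
      refine ⟨q ^ i, hmul i hpi, ?_, fun q₁ hq₁ hdvd => ?_⟩
      · rw [totalDegree_pow_eq hp.ne_zero, totalDegree_pow_eq hq.ne_zero]
        gcongr
      · refine ⟨p, hp.irreducible, dvd_pow_self p hi.ne', fun x => ?_⟩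
        have h1 : q₁ ∣ q := hq₁.prime.dvd_of_dvd_pow hdvd
        have h2 : q ∣ q₁ := (hq₁.associated_of_dvd hq h1).symm.dvd
        rw [← hpq]
        obtain ⟨c, hc⟩ := h1
        obtain ⟨c', hc'⟩ := h2
        constructor
        · intro h3; rw [hc, pev_mul, h3, zero_mul]
        · intro h3; rw [hc', pev_mul, h3, zero_mul]
    | hcp hxy ihx ihy =>
      rename_i x y
      intro hdvd
      obtain ⟨Q₁, a1, a2, a3⟩ := ihx ((dvd_mul_right x y).trans hdvd)
      obtain ⟨Q₂, b1, b2, b3⟩ := ihy ((dvd_mul_left y x).trans hdvd)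
      have hQ₁ : Q₁ ≠ 0 := ne_zero_of_dvd_ne_zero hQ0 a1
      have hQ₂ : Q₂ ≠ 0 := ne_zero_of_dvd_ne_zero hQ0 b1
      have hx0 : x ≠ 0 := ne_zero_of_dvd_ne_zero hP₀0 ((dvd_mul_right x y).trans hdvd)
      have hy0 : y ≠ 0 := ne_zero_of_dvd_ne_zero hP₀0 ((dvd_mul_left y x).trans hdvd)
      have hrel : IsRelPrime Q₁ Q₂ := by
        refine (UniqueFactorizationMonoid.isRelPrime_iff_no_prime_factors hQ₁).2 ?_
        intro q h1 h2 hq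
        obtain ⟨p₁, hp₁, hp₁x, e1⟩ := a3 q hq.irreducible h1
        obtain ⟨p₂, hp₂, hp₂y, e2⟩ := b3 q hq.irreducible h2
        have hp₁h := isHomogeneous_of_dvd hP₀ hP₀0
          (hp₁x.trans ((dvd_mul_right x y).trans hdvd))
        have h12 : p₁ ∣ p₂ := dvd_of_subset hp₁h hp₁ fun z hz => (e2 z).1 ((e1 z).2 hz)
        exact hp₁.not_isUnit (hxy hp₁x (h12.trans hp₂y))
      refine ⟨Q₁ * Q₂, hrel.mul_dvd a1 b1, ?_, fun q hq hqd => ?_⟩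
      · rw [MvPolynomial.totalDegree_mul_of_isDomain hQ₁ hQ₂,
          MvPolynomial.totalDegree_mul_of_isDomain hx0 hy0]
        omega
      · rcases hq.prime.dvd_or_dvd hqd with h1 | h1
        · obtain ⟨p, c1, c2, c3⟩ := a3 q hq h1
          exact ⟨p, c1, c2.trans (dvd_mul_right x y), c3⟩
        · obtain ⟨p, c1, c2, c3⟩ := b3 q hq h1
          exact ⟨p, c1, c2.trans (dvd_mul_left y x), c3⟩
  exact fun hd => key P₀ hd

/-- Isolated singularities of the tangent cone components are transported, and the order of
vanishing does not decrease. -/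
theorem LipGerm.isolated_and_order_le {f g : En n → ℂ} {φ ψ : En n → En n} {K r : ℝ}
    (H : LipGerm f g φ ψ K r) (hf : AnalyticAt ℂ f 0) (hg : AnalyticAt ℂ g 0) (hfr : RedAt f)
    (hgr : RedAt g) {m m' : ℕ} {P Q : MvPolynomial (Fin n) ℂ} (hP : IsInit f m P)
    (hQ : IsInit g m' Q)
    (hs : ∀ p, Irreducible p → p ∣ P → ∀ x : En n, x ≠ 0 → fderiv ℂ (pev p) x ≠ 0) :
    (∀ q, Irreducible q → q ∣ Q → ∀ x : En n, x ≠ 0 → fderiv ℂ (pev q) x ≠ 0) ∧ m ≤ m' := by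
  obtain ⟨𝒰, h, h', B, L⟩ := H.exists_blowup
  obtain ⟨P', hP's, hP'P, hP', hPz⟩ := exists_squarefree_dvd hP.ne
  obtain ⟨Q', hQ's, hQ'Q, hQ', hQz⟩ := exists_squarefree_dvd hQ.ne
  have hP'h := isHomogeneous_of_dvd hP.hom hP.ne hP'P
  have hQ'h := isHomogeneous_of_dvd hQ.hom hQ.ne hQ'Q
  have hiff : ∀ x, pev Q' (h x) = 0 ↔ pev P' x = 0 := by
    intro x
    rw [hPz, hQz, B.pev_eq_zero_iff H L hf hg hP hQ]
  have hiff' : ∀ y, pev P' (h' y) = 0 ↔ pev Q' y = 0 := fun y => by rw [← hiff, L.right]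
  constructor
  · intro q hqi hqQ y hy hy0
    have hq := isHomogeneous_of_dvd hQ.hom hQ.ne hqQ
    obtain ⟨p, hpi, hpP', hqp⟩ := exists_component_iff hQ'h hQ's hP'h hP's L.symm hiff' hqi
      (hQ' q hqi hqQ)
    have hpP := hpP'.trans hP'P
    have hp := isHomogeneous_of_dvd hP.hom hP.ne hpP
    have hqy := fderiv_pev_eq_zero_imp hq (one_le_of_irreducible hq hqi) hy0
    have hne : h' y ≠ 0 := by
      intro h0
      apply hy
      rw [← L.right y, h0, L.zero]
    have := fderiv_ne_zero_of_lipPair hp hpi.squarefree hq hqi.squarefree L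
      (fun x => by rw [← hqp, L.left]) ((hqp y).2 hqy) (hs p hpi hpP _ hne)
    rw [L.right] at this
    exact this hy0
  · rw [← hP.hom.totalDegree hP.ne, ← hQ.hom.totalDegree hQ.ne]
    refine totalDegree_le_of_matching hP.hom hP.ne hQ.ne (h := h) fun p hpi hpP => ?_
    obtain ⟨q, hqi, hqQ', hpq⟩ := exists_component_iff hP'h hP's hQ'h hQ's L hiff hpi
      (hP' p hpi hpP)
    have hqQ := hqQ'.trans hQ'Q
    exact ⟨q, hqi, hpq, degree_le_of_lipPair (isHomogeneous_of_dvd hP.hom hP.ne hpP) hpi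
      (isHomogeneous_of_dvd hQ.hom hQ.ne hqQ) hqi L hpq (hs p hpi hpP), fun k hk =>
      rel_mult_le_of_component H B L hf hg hfr hgr hP hQ hpi hpP hqi hqQ hpq hk⟩

lemma BiLipGermHomeo.exists_lipGerm {f g : En n → ℂ} {W W' : Set (En n)} (hW : IsOpen W)
    (hW0 : (0 : En n) ∈ W) (hW' : IsOpen W') (hW'0 : (0 : En n) ∈ W')
    (hφ : BiLipGermHomeo {x ∈ W | f x = 0} {x ∈ W' | g x = 0}) :
    ∃ φ ψ K r, LipGerm f g φ ψ K r := by
  obtain ⟨U, U', φ, ψ, K, hU, hU', h0U, h0U', hφ0, hφm, hψm, hl, hr, hφl, hψl, himg⟩ := hφ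
  have hψ0 : ψ 0 = 0 := by
    have := hl h0U
    rwa [hφ0] at this
  obtain ⟨r, hr0, hball⟩ := Metric.isOpen_iff.1 ((hU.inter hU').inter (hW.inter hW')) 0
    ⟨⟨h0U, h0U'⟩, hW0, hW'0⟩
  set K' : ℝ := max K 1 with hK'
  have hK1 : 1 ≤ K' := le_max_right _ _
  have hsub : ball (0 : En n) (r / K') ⊆ ball 0 r :=
    ball_subset_ball (div_le_self hr0.le hK1)
  have lφ : ∀ x ∈ ball (0 : En n) r, ∀ y ∈ ball (0 : En n) r, ‖φ x - φ y‖ ≤ K' * ‖x - y‖ := by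
    intro x hx y hy
    refine (hφl.norm_sub_le (hball hx).1.1 (hball hy).1.1).trans ?_
    gcongr
    exact le_max_left _ _
  have lψ : ∀ x ∈ ball (0 : En n) r, ∀ y ∈ ball (0 : En n) r, ‖ψ x - ψ y‖ ≤ K' * ‖x - y‖ := by
    intro x hx y hy
    refine (hψl.norm_sub_le (hball hx).1.2 (hball hy).1.2).trans ?_
    gcongr
    exact le_max_left _ _
  have mball : ∀ F : En n → En n, F 0 = 0 →
      (∀ x ∈ ball (0 : En n) r, ∀ y ∈ ball (0 : En n) r, ‖F x - F y‖ ≤ K' * ‖x - y‖) →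
      ∀ x ∈ ball (0 : En n) (r / K'), F x ∈ ball (0 : En n) r := by
    intro F hF hFl x hx
    have h1 := hFl x (hsub hx) 0 (mem_ball_self hr0)
    rw [hF, sub_zero, sub_zero] at h1
    rw [mem_ball_zero_iff] at hx ⊢
    rw [lt_div_iff₀ (by linarith)] at hx
    linarith
  refine ⟨φ, ψ, K', r / K', hK1, by positivity, hφ0, hψ0,
    fun x hx y hy => lφ x (hsub hx) y (hsub hy), fun x hx y hy => lψ x (hsub hx) y (hsub hy),
    fun x hx => hl (hball (hsub hx)).1.1, fun y hy => hr (hball (hsub hy)).1.2, ?_, ?_⟩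
  · intro x hx
    have hxU := (hball (hsub hx)).1.1
    constructor
    · intro h1
      have h2 : φ x ∈ {x ∈ W' | g x = 0} ∩ U' :=
        ⟨⟨(hball (mball φ hφ0 lφ x hx)).2.2, h1⟩, hφm hxU⟩
      rw [← himg] at h2
      obtain ⟨x', ⟨hx', hx'U⟩, he⟩ := h2
      have : x' = x := by rw [← hl hx'U, he, hl hxU]
      rw [← this]
      exact hx'.2
    · intro h1
      have h2 : φ x ∈ {x ∈ W' | g x = 0} ∩ U' := by
        rw [← himg]
        exact ⟨x, ⟨⟨(hball (hsub hx)).2.1, h1⟩, hxU⟩, rfl⟩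
      exact h2.1.2
  · intro y hy
    have hyU := (hball (hsub hy)).1.2
    constructor
    · intro h1
      have h2 : φ (ψ y) ∈ {x ∈ W' | g x = 0} ∩ U' := by
        rw [← himg]
        exact ⟨ψ y, ⟨⟨(hball (mball ψ hψ0 lψ y hy)).2.1, h1⟩, hψm hyU⟩, rfl⟩
      rw [hr hyU] at h2
      exact h2.1.2
    · intro h1
      have h2 : y ∈ {x ∈ W' | g x = 0} ∩ U' := ⟨⟨(hball (hsub hy)).2.2, h1⟩, hyU⟩
      rw [← himg] at h2
      obtain ⟨x', ⟨hx', hx'U⟩, he⟩ := h2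
      rw [← he, hl hx'U]
      exact hx'.2

lemma redAt_of_subset_closure {f : En n → ℂ} {W : Set (En n)} (hW : IsOpen W)
    (hW0 : (0 : En n) ∈ W) (h : ∃ V ∈ 𝓝 (0 : En n), {x ∈ W | f x = 0} ∩ V ⊆
      closure {x | x ∈ W ∧ f x = 0 ∧ fderiv ℂ f x ≠ 0}) : RedAt f := by
  obtain ⟨V, hV, hsub⟩ := h
  filter_upwards [hV, hW.mem_nhds hW0] with x hx hxW hfx
  exact closure_mono (fun z hz => hz.2) (hsub ⟨⟨hxW, hfx⟩, hx⟩)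

/-- The lowest-degree term of the Taylor expansion is the initial form. -/
lemma isInit_of_vanishingOrder {f : En n → ℂ} (hf : AnalyticAt ℂ f 0)
    (hne : ¬ ∀ᶠ x in 𝓝 (0 : En n), f x = 0) {P : MvPolynomial (Fin n) ℂ}
    (hP : P.IsHomogeneous (vanishingOrder f))
    (hPf : ∀ x : En n, MvPolynomial.eval (x : Fin n → ℂ) P =
      (iteratedFDeriv ℂ (vanishingOrder f) f 0 (fun _ => x)) /
        ((vanishingOrder f).factorial : ℂ)) : IsInit f (vanishingOrder f) P := by
  obtain ⟨q, r, hq⟩ := hf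
  have hfac : ∀ k : ℕ, (k.factorial : ℂ) ≠ 0 := fun k => by exact_mod_cast k.factorial_ne_zero
  have hdiag : ∀ k x, q k (fun _ => x) = (iteratedFDeriv ℂ k f 0 fun _ => x) / k.factorial := by
    intro k x
    rw [← hq.factorial_smul x k, nsmul_eq_mul, mul_div_cancel_left₀ _ (hfac k)]
  have hnon : {k | iteratedFDeriv ℂ k f 0 ≠ 0}.Nonempty := by
    by_contra hemp
    rw [not_nonempty_iff_eq_empty, eq_empty_iff_forall_notMem] at hemp
    apply hne
    have h1 := hq.hasFPowerSeriesAt.eventually_hasSum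
    filter_upwards [h1] with x hx
    have h2 : (fun k => q k fun _ => x) = fun _ => 0 := by
      ext k
      have h3 : iteratedFDeriv ℂ k f 0 = 0 := by
        by_contra h3
        exact hemp k h3
      rw [hdiag, h3]
      simp
    rw [h2, zero_add] at hx
    exact hx.unique hasSum_zero
  have hm : iteratedFDeriv ℂ (vanishingOrder f) f 0 ≠ 0 := Nat.sInf_mem hnon
  have hlt : ∀ k < vanishingOrder f, iteratedFDeriv ℂ k f 0 = 0 := by
    intro k hk
    by_contra h3
    exact Nat.notMem_of_lt_sInf hk h3
  have hPq : ∀ x, pev P x = q (vanishingOrder f) fun _ => x := by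
    intro x
    rw [hdiag]
    exact hPf x
  refine ⟨hP, ?_, ?_⟩
  · rintro rfl
    apply hm
    ext v
    rw [hq.iteratedFDeriv_eq_sum_of_completeSpace,
      ← ContinuousMultilinearMap.iteratedFDeriv_comp_diagonal _ 0]
    have : (fun x : En n => q (vanishingOrder f) fun _ => x) = fun _ => 0 := by
      ext x
      rw [← hPq]
      simp
    rw [this]
    simp
  · obtain ⟨C, hC⟩ := (hq.hasFPowerSeriesAt.isBigO_sub_partialSum_pow (vanishingOrder f + 1)).bound
    obtain ⟨ρ, hρ, hb⟩ := Metric.eventually_nhds_iff.1 hC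
    refine ⟨max C 0, le_max_right _ _, ρ, hρ, fun x hx => ?_⟩
    have h1 := hb (by simpa using hx)
    rw [zero_add, Real.norm_of_nonneg (by positivity), FormalMultilinearSeries.partialSum,
      Finset.sum_range_succ, Finset.sum_eq_zero, zero_add, ← hPq] at h1
    · exact h1.trans (by gcongr; exact le_max_left _ _)
    · intro k hk
      rw [hdiag, hlt k (Finset.mem_range.1 hk)]
      simp

lemma fderiv_ne_zero_of_singV {P p : MvPolynomial (Fin n) ℂ} {m : ℕ} (hP : P.IsHomogeneous m)
    (hP0 : P ≠ 0) (hpi : Irreducible p) (hpP : p ∣ P) (hs : SingV p ⊆ {0}) {x : En n} (hx : x ≠ 0) :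
    fderiv ℂ (pev p) x ≠ 0 := by
  intro h0
  have hp := isHomogeneous_of_dvd hP hP0 hpP
  exact hx (hs ⟨fderiv_pev_eq_zero_imp hp (one_le_of_irreducible hp hpi) h0,
    (fderiv_pev_eq_zero_iff p x).1 h0⟩)

end

/-- Theorem: if the tangent cone of `V(f)` has all irreducible components with
isolated singularities at `0` and there is a bi-Lipschitz homeomorphism of germs
`(ℂⁿ, V(f), 0) → (ℂⁿ, V(g), 0)`, then the same holds for the tangent cone of `V(g)`,
and the multiplicities coincide. Here `P`, `Q` are the initial (lowest-degree
homogeneous) terms of the Taylor expansions of `f` and `g`, so the tangent cones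
are `V(P)` and `V(Q)`. -/
theorem bilip_invariance_of_multiplicity_isolated_tangent_cone_sing
    (n : ℕ) (f g : En n → ℂ) (W W' : Set (En n))
    (hWopen : IsOpen W) (hW0 : (0 : En n) ∈ W)
    (hW'open : IsOpen W') (hW'0 : (0 : En n) ∈ W')
    (hf : AnalyticOnNhd ℂ f W) (hg : AnalyticOnNhd ℂ g W')
    (hf0 : f 0 = 0) (hg0 : g 0 = 0)
    (hfne : ¬ (∀ᶠ x in 𝓝 (0 : En n), f x = 0))
    (hgne : ¬ (∀ᶠ x in 𝓝 (0 : En n), g x = 0))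
    -- f and g are reduced at 0
    (hfred : ∃ Wf ∈ 𝓝 (0 : En n), {x ∈ W | f x = 0} ∩ Wf ⊆
        closure {x | x ∈ W ∧ f x = 0 ∧ fderiv ℂ f x ≠ 0})
    (hgred : ∃ Wg ∈ 𝓝 (0 : En n), {x ∈ W' | g x = 0} ∩ Wg ⊆
        closure {x | x ∈ W' ∧ g x = 0 ∧ fderiv ℂ g x ≠ 0})
    (P Q : MvPolynomial (Fin n) ℂ)
    -- P is homogeneous of degree m = vanishingOrder f and its evaluation is the
    -- lowest-degree homogeneous term f_m of the Taylor expansion of f at 0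
    (hP : P.IsHomogeneous (vanishingOrder f))
    (hPf : ∀ x : En n, MvPolynomial.eval (x : Fin n → ℂ) P =
        (iteratedFDeriv ℂ (vanishingOrder f) f 0 (fun _ => x)) / ((vanishingOrder f).factorial : ℂ))
    (hQ : Q.IsHomogeneous (vanishingOrder g))
    (hQg : ∀ x : En n, MvPolynomial.eval (x : Fin n → ℂ) Q =
        (iteratedFDeriv ℂ (vanishingOrder g) g 0 (fun _ => x)) / ((vanishingOrder g).factorial : ℂ))
    -- every irreducible factor p of P has Sing V(p) ⊆ {0}
    (hPsing : ∀ p : MvPolynomial (Fin n) ℂ, Irreducible p → p ∣ P → SingV p ⊆ {0})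
    (hφ : BiLipGermHomeo {x ∈ W | f x = 0} {x ∈ W' | g x = 0}) :
    (∀ q : MvPolynomial (Fin n) ℂ, Irreducible q → q ∣ Q → SingV q ⊆ {0}) ∧
      vanishingOrder f = vanishingOrder g := by
  obtain ⟨φ, ψ, K, r, H⟩ := BiLipGermHomeo.exists_lipGerm hWopen hW0 hW'open hW'0 hφ
  have hfa := hf 0 hW0
  have hga := hg 0 hW'0
  have hfr := redAt_of_subset_closure hWopen hW0 hfred
  have hgr := redAt_of_subset_closure hW'open hW'0 hgred
  have hPi := isInit_of_vanishingOrder hfa hfne hP hPf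
  have hQi := isInit_of_vanishingOrder hga hgne hQ hQg
  obtain ⟨h1, h2⟩ := H.isolated_and_order_le hfa hga hfr hgr hPi hQi fun p hp hpP x hx =>
    fderiv_ne_zero_of_singV hP hPi.ne hp hpP (hPsing p hp hpP) hx
  obtain ⟨-, h3⟩ := H.symm.isolated_and_order_le hga hfa hgr hfr hQi hPi h1
  refine ⟨fun q hq hqQ x hx => ?_, le_antisymm h2 h3⟩
  by_contra hne
  exact h1 q hq hqQ x hne ((fderiv_pev_eq_zero_iff q x).2 hx.2)
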